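/- Let α ∈ (0,2) and let c ∈ ℂ be nonzero with |arg c| ∈ [t₀(α), min(π, πα)) and ρ_α(|arg c|) < 0. Then the system of eigenfunctions of 𝓛_{c,α} is complete in L²((0,∞), ℂ). -/

import Mathlib

open MeasureTheory Set

/-- `t₀(α) = 2πα/(α+2)`. -/
noncomputable def t0 (α : ℝ) : ℝ := 2 * Real.pi * α / (α + 2)

/-- `Z₀(θ) = (sin t₀(α) / sin θ)^(1/α)`. -/
noncomputable def Z0 (α θ : ℝ) : ℝ := (Real.sin (t0 α) / Real.sin θ) ^ (1 / α)

/-- `y` is an eigenfunction of the Dirichlet operator `𝓛_{c,α} = −d²/dx² + c·x^α` on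
`L²(0,∞)` with eigenvalue `lam`. -/
def IsEigenfunction (α : ℝ) (c lam : ℂ) (y : ℝ → ℂ) : Prop :=
  ContinuousOn y (Set.Ici 0) ∧
  y 0 = 0 ∧
  (∃ x ≥ (0 : ℝ), y x ≠ 0) ∧
  (∃ y' : ℝ → ℂ,
    (∀ x ∈ Set.Ioi (0 : ℝ), HasDerivAt y (y' x) x) ∧
    (∀ x ∈ Set.Ioi (0 : ℝ), HasDerivAt y' ((c * ((x ^ α : ℝ) : ℂ) - lam) * y x) x)) ∧
  MeasureTheory.IntegrableOn (fun x => ‖y x‖ ^ 2) (Set.Ioi 0)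

/-- The system of eigenfunctions of `𝓛_{c,α}` is complete in `L²((0,∞),ℂ)`. -/
def EigenfunctionsComplete (α : ℝ) (c : ℂ) : Prop :=
  closure ((Submodule.span ℂ
      {F : MeasureTheory.Lp ℂ 2 (MeasureTheory.volume.restrict (Set.Ioi (0 : ℝ))) |
        ∃ lam : ℂ, ∃ y : ℝ → ℂ, IsEigenfunction α c lam y ∧
          ∀ᵐ x ∂(MeasureTheory.volume.restrict (Set.Ioi (0 : ℝ))), F x = y x} :
      Submodule ℂ (MeasureTheory.Lp ℂ 2 (MeasureTheory.volume.restrict (Set.Ioi (0 : ℝ))))) :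
    Set (MeasureTheory.Lp ℂ 2 (MeasureTheory.volume.restrict (Set.Ioi (0 : ℝ))))) = Set.univ

namespace Anharmonic

/-! ### Fundamental solutions of `u'' = (z^α - μ) u` -/

noncomputable def expo (α σ : ℝ) (n k : ℕ) : ℝ := σ + 2 * n + α * k

noncomputable def coef (α σ : ℝ) : ℕ → ℕ → ℝ
  | 0, 0 => 1
  | 0, _ + 1 => 0
  | n + 1, 0 => coef α σ n 0 / (expo α σ (n + 1) 0 * (expo α σ (n + 1) 0 - 1))
  | n + 1, k + 1 => (coef α σ n k + coef α σ n (k + 1)) /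
      (expo α σ (n + 1) (k + 1) * (expo α σ (n + 1) (k + 1) - 1))

section coef
variable {α σ : ℝ} (hα : 0 < α) (hα2 : α < 2) (hσ : 0 ≤ σ) (hσ1 : σ ≤ 1)
include hα hσ

lemma expo_ge (n k : ℕ) : 2 * (n : ℝ) ≤ expo α σ n k := by
  unfold expo; have : 0 ≤ α * k := by positivity
  linarith

lemma expo_prod_ge (n k : ℕ) :
    ((n : ℝ) + 1) ^ 2 ≤ expo α σ (n + 1) k * (expo α σ (n + 1) k - 1) := by
  have h := expo_ge hα hσ (n + 1) k
  push_cast at h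
  have hn : (0 : ℝ) ≤ n := n.cast_nonneg
  nlinarith

lemma coef_nonneg : ∀ n k, 0 ≤ coef α σ n k := by
  intro n
  induction n with
  | zero => intro k; cases k <;> simp [coef]
  | succ n ih =>
    intro k
    cases k with
    | zero =>
      exact div_nonneg (ih 0) (le_trans (by positivity) (expo_prod_ge hα hσ n 0))
    | succ k =>
      exact div_nonneg (add_nonneg (ih k) (ih (k + 1)))
        (le_trans (by positivity) (expo_prod_ge hα hσ n (k + 1)))

omit hα hσ in
lemma coef_eq_zero : ∀ n k, n < k → coef α σ n k = 0 := by
  intro n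
  induction n with
  | zero => intro k hk; cases k with
    | zero => omega
    | succ k => rfl
  | succ n ih => intro k hk; cases k with
    | zero => omega
    | succ k => simp [coef, ih k (by omega), ih (k + 1) (by omega)]

lemma coef_le : ∀ n k, coef α σ n k ≤ (n.choose k : ℝ) / (n.factorial : ℝ) ^ 2 := by
  intro n
  induction n with
  | zero => intro k; cases k <;> simp [coef]
  | succ n ih =>
    intro k
    have hf : (((n + 1).factorial : ℕ) : ℝ) ^ 2 = ((n : ℝ) + 1) ^ 2 * (n.factorial : ℝ) ^ 2 := by
      rw [Nat.factorial_succ]; push_cast; ring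
    have key : ∀ A B : ℝ, 0 ≤ A → A ≤ B / (n.factorial : ℝ) ^ 2 →
        ∀ E : ℝ, ((n : ℝ) + 1) ^ 2 ≤ E → A / E ≤ B / (((n + 1).factorial : ℕ) : ℝ) ^ 2 := by
      intro A B hA hAB E hE
      have h1 : (0 : ℝ) < ((n : ℝ) + 1) ^ 2 := by positivity
      calc A / E ≤ A / ((n : ℝ) + 1) ^ 2 := div_le_div_of_nonneg_left hA h1 hE
        _ ≤ (B / (n.factorial : ℝ) ^ 2) / ((n : ℝ) + 1) ^ 2 := by gcongr
        _ = _ := by rw [hf, div_div, mul_comm]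
    cases k with
    | zero =>
      refine key _ _ (coef_nonneg hα hσ n 0) ?_ _ (expo_prod_ge hα hσ n 0)
      simpa using ih 0
    | succ k =>
      refine key _ _ (add_nonneg (coef_nonneg hα hσ n k) (coef_nonneg hα hσ n (k + 1))) ?_ _
        (expo_prod_ge hα hσ n (k + 1))
      rw [Nat.choose_succ_succ]; push_cast; rw [add_div]
      exact add_le_add (ih k) (ih (k + 1))

end coef

noncomputable def term (α σ : ℝ) (μ : ℂ) (n : ℕ) (z : ℂ) : ℂ :=
  ∑ k ∈ Finset.range (n + 1), (coef α σ n k : ℂ) * (-μ) ^ (n - k) * z ^ ((expo α σ n k : ℝ) : ℂ)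

noncomputable def term1 (α σ : ℝ) (μ : ℂ) (n : ℕ) (z : ℂ) : ℂ :=
  ∑ k ∈ Finset.range (n + 1), (coef α σ n k : ℂ) * (-μ) ^ (n - k) *
    ((expo α σ n k : ℝ) * z ^ ((expo α σ n k - 1 : ℝ) : ℂ))

/-- The size parameter `√(5 R² (R^α + M))` in the bounds for the fundamental solutions. -/
noncomputable def growth (α R M : ℝ) : ℝ := √(5 * (R ^ 2 * (R ^ α + M)))

lemma growth_sq {α R M : ℝ} (hR : 0 ≤ R) (hM : 0 ≤ M) :
    growth α R M ^ 2 = 5 * (R ^ 2 * (R ^ α + M)) := by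
  unfold growth
  exact Real.sq_sqrt (by have := Real.rpow_nonneg hR α; positivity)

section bounds
variable {α σ : ℝ} (hα : 0 < α) (hα2 : α < 2) (hσ : 0 ≤ σ) (hσ1 : σ ≤ 1)
include hα hα2 hσ hσ1

lemma sum_bound {R M : ℝ} (hR : 1 ≤ R) (hM : 0 ≤ M) (n : ℕ) :
    ∑ k ∈ Finset.range (n + 1), (5 : ℝ) ^ n * coef α σ n k * M ^ (n - k) * R ^ (expo α σ n k)
      ≤ R * (growth α R M ^ n / n.factorial) ^ 2 := by
  have hR0 : 0 ≤ R := by linarith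
  have hRp : 0 < R := by linarith
  have h2 : (growth α R M ^ n / n.factorial) ^ 2
      = 5 ^ n * R ^ (2 * n) * (R ^ α + M) ^ n / (n.factorial : ℝ) ^ 2 := by
    rw [div_pow, ← pow_mul, mul_comm n 2, pow_mul, growth_sq hR0 hM, mul_pow, mul_pow, pow_mul]
    ring
  rw [h2, add_pow, Finset.mul_sum, Finset.sum_div, Finset.mul_sum]
  refine Finset.sum_le_sum fun k hk => ?_
  have h3 : R ^ (expo α σ n k) ≤ R * R ^ (2 * n) * (R ^ α) ^ k := by
    unfold expo
    rw [Real.rpow_add hRp, Real.rpow_add hRp, Real.rpow_mul hR0 α, Real.rpow_natCast,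
      show (2 * (n : ℝ)) = ((2 * n : ℕ) : ℝ) by push_cast; ring, Real.rpow_natCast]
    have : R ^ σ ≤ R := by
      conv_rhs => rw [← Real.rpow_one R]
      exact Real.rpow_le_rpow_of_exponent_le hR hσ1
    have := Real.rpow_nonneg hR0 α
    gcongr
  have h4 := coef_le hα hσ n k
  have h5 := coef_nonneg hα hσ n k
  have h6 := Real.rpow_nonneg hR0 α
  calc (5 : ℝ) ^ n * coef α σ n k * M ^ (n - k) * R ^ (expo α σ n k)
      ≤ (5 : ℝ) ^ n * ((n.choose k : ℝ) / (n.factorial : ℝ) ^ 2) * M ^ (n - k) *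
        (R * R ^ (2 * n) * (R ^ α) ^ k) := by gcongr
    _ = _ := by ring

omit hα hα2 hσ hσ1 in
lemma four_mul_add_one_le (n : ℕ) : 4 * (n : ℝ) + 1 ≤ 5 ^ n := by
  have := one_add_mul_le_pow (show (-2 : ℝ) ≤ 4 by norm_num) n
  norm_num at this; linarith

lemma norm_term_le {R M : ℝ} (hR : 1 ≤ R) {z μ : ℂ} (hz : ‖z‖ ≤ R) (hμ : ‖μ‖ ≤ M) (n : ℕ) :
    ‖term α σ μ n z‖ ≤ R * (growth α R M ^ n / n.factorial) ^ 2 := by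
  have hM : 0 ≤ M := le_trans (norm_nonneg _) hμ
  refine le_trans (norm_sum_le _ _) (le_trans (Finset.sum_le_sum fun k hk => ?_)
    (sum_bound hα hα2 hσ hσ1 hR hM n))
  have h5 := coef_nonneg hα hσ n k
  have he : 0 ≤ expo α σ n k := le_trans (by positivity) (expo_ge hα hσ n k)
  rw [norm_mul, norm_mul, norm_pow, norm_neg, Complex.norm_real, Real.norm_of_nonneg h5,
    Complex.norm_cpow_real]
  have h1 : (1 : ℝ) ≤ 5 ^ n := one_le_pow₀ (by norm_num)
  have h2 : ‖z‖ ^ expo α σ n k ≤ R ^ expo α σ n k := Real.rpow_le_rpow (norm_nonneg _) hz he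
  calc _ ≤ coef α σ n k * M ^ (n - k) * R ^ expo α σ n k := by gcongr
    _ ≤ 5 ^ n * (coef α σ n k * M ^ (n - k) * R ^ expo α σ n k) :=
        le_mul_of_one_le_left (by have := Real.rpow_nonneg (zero_le_one.trans hR) (expo α σ n k); positivity) h1
    _ = _ := by ring

end bounds

section bounds1
variable {α σ : ℝ} (hα : 0 < α) (hα2 : α < 2) (hσ : σ = 0 ∨ σ = 1)
include hα hα2 hσ

omit hα2 in
lemma expo_zero_or_ge (n k : ℕ) (hk : k ≤ n) : expo α σ n k = 0 ∨ 1 ≤ expo α σ n k := by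
  rcases n with _ | n
  · have : k = 0 := by omega
    subst this
    unfold expo
    rcases hσ with h | h <;> simp [h]
  · right
    have := expo_ge hα (σ := σ) (by rcases hσ with h | h <;> simp [h]) (n + 1) k
    push_cast at this
    have hn : (0 : ℝ) ≤ n := n.cast_nonneg
    linarith

lemma norm_term1_le {R M : ℝ} (hR : 1 ≤ R) {z μ : ℂ} (hz : ‖z‖ ≤ R) (hμ : ‖μ‖ ≤ M) (n : ℕ) :
    ‖term1 α σ μ n z‖ ≤ R * (growth α R M ^ n / n.factorial) ^ 2 := by
  have hσ0 : 0 ≤ σ := by rcases hσ with h | h <;> simp [h]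
  have hσ1 : σ ≤ 1 := by rcases hσ with h | h <;> simp [h]
  have hM : 0 ≤ M := le_trans (norm_nonneg _) hμ
  refine le_trans (norm_sum_le _ _) (le_trans (Finset.sum_le_sum fun k hk => ?_)
    (sum_bound hα hα2 hσ0 hσ1 hR hM n))
  have hkn : k ≤ n := by simpa [Nat.lt_succ_iff] using hk
  have h5 := coef_nonneg hα hσ0 n k
  have hRe := Real.rpow_nonneg (zero_le_one.trans hR) (expo α σ n k)
  rcases expo_zero_or_ge hα hσ n k hkn with h0 | h1
  · rw [h0]; simp; positivity
  have he : 0 ≤ expo α σ n k := by linarith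
  rw [norm_mul, norm_mul, norm_mul, norm_pow, norm_neg, Complex.norm_real, Complex.norm_real,
    Real.norm_of_nonneg h5, Real.norm_of_nonneg he, Complex.norm_cpow_real]
  have h2 : ‖z‖ ^ (expo α σ n k - 1) ≤ R ^ expo α σ n k :=
    (Real.rpow_le_rpow (norm_nonneg _) hz (by linarith)).trans
      (Real.rpow_le_rpow_of_exponent_le hR (by linarith))
  have h6 : expo α σ n k ≤ 5 ^ n := by
    refine le_trans ?_ (four_mul_add_one_le n)
    unfold expo
    have : (k : ℝ) ≤ n := by exact_mod_cast hkn
    have hk0 : (0 : ℝ) ≤ k := k.cast_nonneg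
    nlinarith
  calc _ ≤ coef α σ n k * M ^ (n - k) * (5 ^ n * R ^ expo α σ n k) := by gcongr
    _ = _ := by ring

end bounds1

lemma summable_sq_bound (Y : ℝ) (hY : 0 ≤ Y) : Summable fun n : ℕ => (Y ^ n / n.factorial) ^ 2 := by
  have h := Real.summable_pow_div_factorial Y
  refine Summable.of_nonneg_of_le (fun n => sq_nonneg _) (fun n => ?_) (h.mul_left (Real.exp Y))
  rw [sq]
  gcongr
  exact Real.pow_div_factorial_le_exp Y hY n

lemma tsum_sq_bound (Y : ℝ) (hY : 0 ≤ Y) :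
    ∑' n : ℕ, (Y ^ n / n.factorial) ^ 2 ≤ Real.exp (2 * Y) := by
  have h := Real.summable_pow_div_factorial Y
  have h2 : ∑' n : ℕ, Real.exp Y * (Y ^ n / n.factorial) = Real.exp (2 * Y) := by
    rw [tsum_mul_left, two_mul, Real.exp_add]
    congr 1
    rw [Real.exp_eq_exp_ℝ, NormedSpace.exp_eq_tsum_div]
  rw [← h2]
  refine (summable_sq_bound Y hY).tsum_le_tsum (fun n => ?_) (h.mul_left (Real.exp Y))
  rw [sq]
  gcongr
  exact Real.pow_div_factorial_le_exp Y hY n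

end Anharmonic

namespace Anharmonic

noncomputable def fund (α σ : ℝ) (μ z : ℂ) : ℂ := ∑' n, term α σ μ n z
noncomputable def fund1 (α σ : ℝ) (μ z : ℂ) : ℂ := ∑' n, term1 α σ μ n z

section fund
variable {α σ : ℝ} (hα : 0 < α) (hα2 : α < 2) (hσ : σ = 0 ∨ σ = 1)
include hα hα2 hσ

lemma norm_term_le' {R M : ℝ} (hR : 1 ≤ R) {z μ : ℂ} (hz : ‖z‖ ≤ R) (hμ : ‖μ‖ ≤ M) (n : ℕ) :
    ‖term α σ μ n z‖ ≤ R * (growth α R M ^ n / n.factorial) ^ 2 :=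
  norm_term_le hα hα2 (by rcases hσ with h | h <;> simp [h]) (by rcases hσ with h | h <;> simp [h])
    hR hz hμ n

omit hα hα2 hσ in
lemma summable_growth (R M : ℝ) :
    Summable fun n : ℕ => R * (growth α R M ^ n / n.factorial) ^ 2 :=
  (summable_sq_bound _ (Real.sqrt_nonneg _)).mul_left R

lemma summable_term (μ z : ℂ) : Summable fun n => term α σ μ n z :=
  Summable.of_norm_bounded (summable_growth (‖z‖ + 1) ‖μ‖) fun n =>
    norm_term_le' hα hα2 hσ (by linarith [norm_nonneg z]) (by linarith) le_rfl n

lemma summable_term1 (μ z : ℂ) : Summable fun n => term1 α σ μ n z :=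
  Summable.of_norm_bounded (summable_growth (‖z‖ + 1) ‖μ‖) fun n =>
    norm_term1_le hα hα2 hσ (by linarith [norm_nonneg z]) (by linarith) le_rfl n

lemma norm_fund_le {R M : ℝ} (hR : 1 ≤ R) {z μ : ℂ} (hz : ‖z‖ ≤ R) (hμ : ‖μ‖ ≤ M) :
    ‖fund α σ μ z‖ ≤ R * Real.exp (2 * growth α R M) := by
  refine le_trans (tsum_of_norm_bounded (summable_growth (α := α) R M).hasSum
    (norm_term_le' hα hα2 hσ hR hz hμ)) ?_
  rw [tsum_mul_left]
  exact mul_le_mul_of_nonneg_left (tsum_sq_bound _ (Real.sqrt_nonneg _)) (by linarith)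

lemma norm_fund1_le {R M : ℝ} (hR : 1 ≤ R) {z μ : ℂ} (hz : ‖z‖ ≤ R) (hμ : ‖μ‖ ≤ M) :
    ‖fund1 α σ μ z‖ ≤ R * Real.exp (2 * growth α R M) := by
  refine le_trans (tsum_of_norm_bounded (summable_growth (α := α) R M).hasSum
    (norm_term1_le hα hα2 hσ hR hz hμ)) ?_
  rw [tsum_mul_left]
  exact mul_le_mul_of_nonneg_left (tsum_sq_bound _ (Real.sqrt_nonneg _)) (by linarith)

lemma differentiable_fund (z : ℂ) : Differentiable ℂ fun μ => fund α σ μ z := by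
  intro μ
  refine ((Complex.differentiableOn_tsum_of_summable_norm
    (summable_growth (α := α) (‖z‖ + 1) (‖μ‖ + 1)) (fun n => ?_)
    (Metric.isOpen_ball (x := (0 : ℂ)) (ε := ‖μ‖ + 1))
    fun n w hw => norm_term_le' hα hα2 hσ (by linarith [norm_nonneg z])
      (by linarith) (by simpa using (mem_ball_zero_iff.1 hw).le) n)).differentiableAt
    (Metric.isOpen_ball.mem_nhds (by simp))
  unfold term
  fun_prop

lemma differentiable_fund1 (z : ℂ) : Differentiable ℂ fun μ => fund1 α σ μ z := by
  intro μ
  refine ((Complex.differentiableOn_tsum_of_summable_norm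
    (summable_growth (α := α) (‖z‖ + 1) (‖μ‖ + 1)) (fun n => ?_)
    (Metric.isOpen_ball (x := (0 : ℂ)) (ε := ‖μ‖ + 1))
    fun n w hw => norm_term1_le hα hα2 hσ (by linarith [norm_nonneg z])
      (by linarith) (by simpa using (mem_ball_zero_iff.1 hw).le) n)).differentiableAt
    (Metric.isOpen_ball.mem_nhds (by simp))
  unfold term1
  fun_prop

lemma continuousOn_fund (μ : ℂ) : ContinuousOn (fund α σ μ) {z | 0 ≤ z.re} := by
  have hσ0 : 0 ≤ σ := by rcases hσ with h | h <;> simp [h]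
  intro z hz
  have : ContinuousOn (fund α σ μ) ({z | 0 ≤ z.re} ∩ Metric.ball 0 (‖z‖ + 1)) := by
    refine continuousOn_tsum (fun n => ?_) (summable_growth (α := α) (‖z‖ + 1) ‖μ‖)
      fun n w hw => norm_term_le' hα hα2 hσ (by linarith [norm_nonneg z])
        (by simpa using (mem_ball_zero_iff.1 hw.2).le) le_rfl n
    refine continuousOn_finsetSum _ fun k hk => continuousOn_const.mul fun w hw => ?_
    refine ContinuousAt.continuousWithinAt ?_
    rcases expo_zero_or_ge hα hσ n k (by simpa [Nat.lt_succ_iff] using hk) with h | h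
    · simp only [h, Complex.ofReal_zero, Complex.cpow_zero]; exact continuousAt_const
    · exact Complex.continuousAt_cpow_const_of_re_pos (Or.inl hw.1)
        (by rw [Complex.ofReal_re]; linarith)
  have h2 := this z ⟨hz, by simp⟩
  exact (continuousWithinAt_inter (Metric.isOpen_ball.mem_nhds (by simp))).1 h2

lemma continuousOn_fund1 (μ : ℂ) : ContinuousOn (fund1 α σ μ) {z | 0 ≤ z.re} := by
  have hσ0 : 0 ≤ σ := by rcases hσ with h | h <;> simp [h]
  intro z hz
  have : ContinuousOn (fund1 α σ μ) ({z | 0 ≤ z.re} ∩ Metric.ball 0 (‖z‖ + 1)) := by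
    refine continuousOn_tsum (fun n => ?_) (summable_growth (α := α) (‖z‖ + 1) ‖μ‖)
      fun n w hw => norm_term1_le hα hα2 hσ (by linarith [norm_nonneg z])
        (by simpa using (mem_ball_zero_iff.1 hw.2).le) le_rfl n
    refine continuousOn_finsetSum _ fun k hk => continuousOn_const.mul fun w hw => ?_
    refine ContinuousAt.continuousWithinAt ?_
    rcases expo_zero_or_ge hα hσ n k (by simpa [Nat.lt_succ_iff] using hk) with h | h
    · simp only [h, Complex.ofReal_zero, zero_mul]; exact continuousAt_const
    · rcases h.eq_or_lt with h | h
      · simp only [← h, sub_self, Complex.ofReal_zero, Complex.cpow_zero]; exact continuousAt_const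
      · exact continuousAt_const.mul (Complex.continuousAt_cpow_const_of_re_pos (Or.inl hw.1)
          (by rw [Complex.ofReal_re]; linarith))
  have h2 := this z ⟨hz, by simp⟩
  exact (continuousWithinAt_inter (Metric.isOpen_ball.mem_nhds (by simp))).1 h2

omit hα hα2 hσ in
lemma hasDerivAt_term (μ : ℂ) (n : ℕ) {z : ℂ} (hz : z ∈ Complex.slitPlane) :
    HasDerivAt (term α σ μ n) (term1 α σ μ n z) z := by
  unfold term term1
  refine HasDerivAt.fun_sum fun k _ => HasDerivAt.const_mul _ ?_
  have := (hasDerivAt_id z).cpow_const (c := ((expo α σ n k : ℝ) : ℂ)) hz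
  simpa using this

omit hα hα2 hσ in
lemma hasDerivAt_term1 (μ : ℂ) (n : ℕ) {z : ℂ} (hz : z ∈ Complex.slitPlane) :
    HasDerivAt (term1 α σ μ n) (∑ k ∈ Finset.range (n + 1), (coef α σ n k : ℂ) * (-μ) ^ (n - k) *
      ((expo α σ n k * (expo α σ n k - 1) : ℝ) * z ^ ((expo α σ n k - 2 : ℝ) : ℂ))) z := by
  unfold term1
  refine HasDerivAt.fun_sum fun k _ => HasDerivAt.const_mul _ ?_
  have := ((hasDerivAt_id z).cpow_const (c := ((expo α σ n k - 1 : ℝ) : ℂ)) hz).const_mul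
    ((expo α σ n k : ℝ) : ℂ)
  convert! this using 1
  push_cast
  simp only [id]
  rw [show (expo α σ n k : ℂ) - 1 - 1 = expo α σ n k - 2 by ring]
  ring

omit hα2 in
lemma second_deriv_term (μ : ℂ) (n : ℕ) {z : ℂ} (hz : z ≠ 0) :
    ∑ k ∈ Finset.range (n + 1 + 1), (coef α σ (n + 1) k : ℂ) * (-μ) ^ (n + 1 - k) *
      ((expo α σ (n + 1) k * (expo α σ (n + 1) k - 1) : ℝ) *
        z ^ ((expo α σ (n + 1) k - 2 : ℝ) : ℂ))
      = (z ^ (α : ℂ) - μ) * term α σ μ n z := by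
  have hσ0 : 0 ≤ σ := by rcases hσ with h | h <;> simp [h]
  have hE : ∀ k, expo α σ (n + 1) k * (expo α σ (n + 1) k - 1) ≠ 0 := fun k =>
    ne_of_gt (lt_of_lt_of_le (by positivity) (expo_prod_ge hα hσ0 n k))
  have h0 : ∀ k, expo α σ (n + 1) k - 2 = expo α σ n k := fun k => by
    unfold expo; push_cast; ring
  have h1 : ∀ k, expo α σ n (k + 1) = expo α σ n k + α := fun k => by
    unfold expo; push_cast; ring
  have hc0 : coef α σ (n + 1) 0 * (expo α σ (n + 1) 0 * (expo α σ (n + 1) 0 - 1)) = coef α σ n 0 :=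
    div_mul_cancel₀ _ (hE 0)
  have hc1 : ∀ k, coef α σ (n + 1) (k + 1) *
      (expo α σ (n + 1) (k + 1) * (expo α σ (n + 1) (k + 1) - 1)) =
      coef α σ n k + coef α σ n (k + 1) := fun k => div_mul_cancel₀ _ (hE (k + 1))
  rw [Finset.sum_range_succ']
  have hz0 : ((-μ) ^ (n + 1 - 0) : ℂ) = -μ * (-μ) ^ (n - 0) := by
    rw [Nat.sub_zero, Nat.sub_zero, pow_succ]; ring
  have hA : ∀ k ∈ Finset.range (n + 1), (coef α σ (n + 1) (k + 1) : ℂ) * (-μ) ^ (n + 1 - (k + 1)) *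
      ((expo α σ (n + 1) (k + 1) * (expo α σ (n + 1) (k + 1) - 1) : ℝ) *
        z ^ ((expo α σ (n + 1) (k + 1) - 2 : ℝ) : ℂ))
      = z ^ (α : ℂ) * ((coef α σ n k : ℂ) * (-μ) ^ (n - k) * z ^ ((expo α σ n k : ℝ) : ℂ))
        + (coef α σ n (k + 1) : ℂ) * (-μ) ^ (n - k) * z ^ ((expo α σ n (k + 1) : ℝ) : ℂ) := by
    intro k _
    have := congrArg (fun x : ℝ => (x : ℂ)) (hc1 k)
    simp only [Complex.ofReal_mul, Complex.ofReal_add] at this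
    rw [h0, Nat.add_sub_add_right, Complex.ofReal_mul]
    rw [show ∀ a b c d e : ℂ, a * b * (c * d * e) = (a * (c * d)) * b * e by intros; ring, this]
    conv_rhs => rw [h1]
    conv_lhs => rw [h1]
    rw [Complex.ofReal_add, Complex.cpow_add _ _ hz]
    ring
  rw [Finset.sum_congr rfl hA, Finset.sum_add_distrib, ← Finset.mul_sum]
  rw [hz0, h0]
  have hB : ∑ k ∈ Finset.range (n + 1), (coef α σ n (k + 1) : ℂ) * (-μ) ^ (n - k) *
      z ^ ((expo α σ n (k + 1) : ℝ) : ℂ) + -μ * ((coef α σ n 0 : ℂ) * (-μ) ^ (n - 0) *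
        z ^ ((expo α σ n 0 : ℝ) : ℂ)) = -μ * term α σ μ n z := by
    unfold term
    rw [Finset.sum_range_succ, coef_eq_zero n (n + 1) (by omega), Finset.sum_range_succ', mul_add,
      Finset.mul_sum]
    congr 1
    simp only [Complex.ofReal_zero, zero_mul, add_zero]
    refine Finset.sum_congr rfl fun k hk => ?_
    have hk' : k < n := by simpa using hk
    rw [show n - k = (n - (k + 1)) + 1 by omega, pow_succ]
    ring
  have hc0' := congrArg (fun x : ℝ => (x : ℂ)) hc0
  simp only [Complex.ofReal_mul] at hc0'
  rw [Complex.ofReal_mul, show ∀ a b c d e f : ℂ, a * (f * b) * (c * d * e) = f * ((a * (c * d)) * b * e) by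
    intros; ring, hc0', add_assoc, hB]
  unfold term
  ring

omit hα hα2 in
lemma second_deriv_term_zero (μ : ℂ) (z : ℂ) :
    ∑ k ∈ Finset.range (0 + 1), (coef α σ 0 k : ℂ) * (-μ) ^ (0 - k) *
      ((expo α σ 0 k * (expo α σ 0 k - 1) : ℝ) *
        z ^ ((expo α σ 0 k - 2 : ℝ) : ℂ)) = 0 := by
  rcases hσ with h | h <;> simp [expo, h]

lemma hasDerivAt_fund (μ : ℂ) {z : ℂ} (hz : z ∈ Complex.slitPlane) :
    HasDerivAt (fund α σ μ) (fund1 α σ μ z) z := by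
  obtain ⟨r, hr, hrz⟩ := Metric.isOpen_iff.1 Complex.isOpen_slitPlane z hz
  have hR : ∀ w ∈ Metric.ball z r, ‖w‖ ≤ ‖z‖ + r + 1 := by
    intro w hw
    have := norm_add_le z (w - z)
    rw [add_sub_cancel] at this
    rw [Metric.mem_ball, dist_eq_norm] at hw
    linarith
  exact hasDerivAt_tsum_of_isPreconnected (summable_growth (α := α) (‖z‖ + r + 1) ‖μ‖)
    Metric.isOpen_ball (convex_ball z r).isPreconnected
    (fun n y hy => hasDerivAt_term μ n (hrz hy))
    (fun n y hy => norm_term1_le hα hα2 hσ (by linarith [norm_nonneg z]) (hR y hy) le_rfl n)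
    (Metric.mem_ball_self hr) (summable_term hα hα2 hσ μ z) (Metric.mem_ball_self hr)

lemma hasDerivAt_fund1 (μ : ℂ) {z : ℂ} (hz : z ∈ Complex.slitPlane) :
    HasDerivAt (fund1 α σ μ) ((z ^ (α : ℂ) - μ) * fund α σ μ z) z := by
  obtain ⟨r, hr, hrz⟩ := Metric.isOpen_iff.1 Complex.isOpen_slitPlane z hz
  set R := ‖z‖ + r + 1 with hRdef
  have hR1 : 1 ≤ R := by linarith [norm_nonneg z]
  have hR : ∀ w ∈ Metric.ball z r, ‖w‖ ≤ R := by
    intro w hw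
    have := norm_add_le z (w - z)
    rw [add_sub_cancel] at this
    rw [Metric.mem_ball, dist_eq_norm] at hw
    linarith
  have hrz' : ∀ w ∈ Metric.ball z r, w ≠ 0 := fun w hw => Complex.slitPlane_ne_zero (hrz hw)
  set B := R ^ α + ‖μ‖ with hB
  have hB0 : 0 ≤ B := by have := Real.rpow_nonneg (zero_le_one.trans hR1) α; positivity
  let u : ℕ → ℝ := fun n => B * match n with
    | 0 => 0
    | n + 1 => R * (growth α R ‖μ‖ ^ n / n.factorial) ^ 2
  have hu : Summable u := by
    refine Summable.mul_left _ ?_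
    rw [← summable_nat_add_iff 1]
    exact summable_growth R ‖μ‖
  let d : ℕ → ℂ → ℂ := fun n z => match n with
    | 0 => 0
    | n + 1 => (z ^ (α : ℂ) - μ) * term α σ μ n z
  have key := hasDerivAt_tsum_of_isPreconnected (g := fun n => term1 α σ μ n) (g' := d)
    (y := z) (y₀ := z) hu
    Metric.isOpen_ball (convex_ball z r).isPreconnected
    (fun n y hy => by
      have := hasDerivAt_term1 (α := α) (σ := σ) μ n (hrz hy)
      rcases n with _ | n
      · rwa [second_deriv_term_zero hσ] at this
      · rwa [second_deriv_term hα hσ _ _ (hrz' y hy)] at this)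
    (fun n y hy => by
      rcases n with _ | n
      · simp [d, u]
      · simp only [d, u, norm_mul]
        gcongr
        · refine (norm_sub_le _ _).trans ?_
          rw [Complex.norm_cpow_real, hB]
          exact add_le_add (Real.rpow_le_rpow (norm_nonneg _) (hR y hy) hα.le) le_rfl
        · exact norm_term_le' hα hα2 hσ hR1 (hR y hy) le_rfl n)
    (Metric.mem_ball_self hr) (summable_term1 hα hα2 hσ μ z) (Metric.mem_ball_self hr)
  have hd : ∑' n, d n z = (z ^ (α : ℂ) - μ) * fund α σ μ z := by
    rw [Summable.tsum_eq_zero_add]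
    · simp only [d, zero_add]
      rw [tsum_mul_left]; rfl
    · rw [← summable_nat_add_iff 1]
      exact (summable_term hα hα2 hσ μ z).mul_left _
  rw [hd] at key
  exact key

omit hα hα2 hσ in
lemma term_at_zero (hα : 0 < α) (hσ : 0 ≤ σ) (μ : ℂ) (n : ℕ) : term α σ μ (n + 1) 0 = 0 := by
  unfold term
  refine Finset.sum_eq_zero fun k _ => ?_
  have := expo_ge hα hσ (n + 1) k
  push_cast at this
  have hn : (0 : ℝ) ≤ n := n.cast_nonneg
  rw [Complex.zero_cpow (by norm_cast; linarith), mul_zero]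

omit hα hα2 hσ in
lemma term1_at_zero (hα : 0 < α) (hσ : 0 ≤ σ) (μ : ℂ) (n : ℕ) : term1 α σ μ (n + 1) 0 = 0 := by
  unfold term1
  refine Finset.sum_eq_zero fun k _ => ?_
  have := expo_ge hα hσ (n + 1) k
  push_cast at this
  have hn : (0 : ℝ) ≤ n := n.cast_nonneg
  rw [Complex.zero_cpow (by norm_cast; linarith), mul_zero, mul_zero]

end fund

section values
variable {α : ℝ} (hα : 0 < α)
include hα

lemma fund_zero_zero (μ : ℂ) : fund α 0 μ 0 = 1 := by
  unfold fund
  rw [tsum_eq_single 0]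
  · simp [term, coef, expo]
  · intro n hn; obtain ⟨m, rfl⟩ := Nat.exists_eq_succ_of_ne_zero hn
    exact term_at_zero hα le_rfl μ m

lemma fund_one_zero (μ : ℂ) : fund α 1 μ 0 = 0 := by
  unfold fund
  rw [tsum_eq_single 0]
  · simp [term, coef, expo]
  · intro n hn; obtain ⟨m, rfl⟩ := Nat.exists_eq_succ_of_ne_zero hn
    exact term_at_zero hα zero_le_one μ m

lemma fund1_zero_zero (μ : ℂ) : fund1 α 0 μ 0 = 0 := by
  unfold fund1
  rw [tsum_eq_single 0]
  · simp [term1, coef, expo]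
  · intro n hn; obtain ⟨m, rfl⟩ := Nat.exists_eq_succ_of_ne_zero hn
    exact term1_at_zero hα le_rfl μ m

lemma fund1_one_zero (μ : ℂ) : fund1 α 1 μ 0 = 1 := by
  unfold fund1
  rw [tsum_eq_single 0]
  · simp [term1, coef, expo]
  · intro n hn; obtain ⟨m, rfl⟩ := Nat.exists_eq_succ_of_ne_zero hn
    exact term1_at_zero hα zero_le_one μ m

end values

/-- The solution of `u'' = (z^α - μ) u` with `u(0) = a`, `u'(0) = b`. -/
noncomputable def sol (α : ℝ) (a b μ z : ℂ) : ℂ := a * fund α 0 μ z + b * fund α 1 μ z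
noncomputable def sol1 (α : ℝ) (a b μ z : ℂ) : ℂ := a * fund1 α 0 μ z + b * fund1 α 1 μ z

section sol
variable {α : ℝ} (hα : 0 < α) (hα2 : α < 2) (a b μ : ℂ)
include hα

lemma sol_zero : sol α a b μ 0 = a := by
  simp [sol, fund_zero_zero hα, fund_one_zero hα]

lemma sol1_zero : sol1 α a b μ 0 = b := by
  simp [sol1, fund1_zero_zero hα, fund1_one_zero hα]

include hα2

lemma hasDerivAt_sol {z : ℂ} (hz : z ∈ Complex.slitPlane) :
    HasDerivAt (sol α a b μ) (sol1 α a b μ z) z :=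
  ((hasDerivAt_fund hα hα2 (Or.inl rfl) μ hz).const_mul a).add
    ((hasDerivAt_fund hα hα2 (Or.inr rfl) μ hz).const_mul b)

lemma hasDerivAt_sol1 {z : ℂ} (hz : z ∈ Complex.slitPlane) :
    HasDerivAt (sol1 α a b μ) ((z ^ (α : ℂ) - μ) * sol α a b μ z) z := by
  convert! ((hasDerivAt_fund1 hα hα2 (Or.inl rfl) μ hz).const_mul a).add
    ((hasDerivAt_fund1 hα hα2 (Or.inr rfl) μ hz).const_mul b) using 1
  unfold sol; ring

lemma continuousOn_sol : ContinuousOn (sol α a b μ) {z | 0 ≤ z.re} :=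
  (continuousOn_const.mul (continuousOn_fund hα hα2 (Or.inl rfl) μ)).add
    (continuousOn_const.mul (continuousOn_fund hα hα2 (Or.inr rfl) μ))

lemma continuousOn_sol1 : ContinuousOn (sol1 α a b μ) {z | 0 ≤ z.re} :=
  (continuousOn_const.mul (continuousOn_fund1 hα hα2 (Or.inl rfl) μ)).add
    (continuousOn_const.mul (continuousOn_fund1 hα hα2 (Or.inr rfl) μ))

lemma norm_sol_le {R M : ℝ} (hR : 1 ≤ R) {z : ℂ} (hz : ‖z‖ ≤ R) (hμ : ‖μ‖ ≤ M) :
    ‖sol α a b μ z‖ ≤ (‖a‖ + ‖b‖) * (R * Real.exp (2 * growth α R M)) := by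
  refine (norm_add_le _ _).trans ?_
  rw [norm_mul, norm_mul, add_mul]
  have h0 := norm_fund_le hα hα2 (Or.inl rfl) hR hz hμ
  have h1 := norm_fund_le hα hα2 (Or.inr rfl) hR hz hμ
  gcongr

lemma norm_sol1_le {R M : ℝ} (hR : 1 ≤ R) {z : ℂ} (hz : ‖z‖ ≤ R) (hμ : ‖μ‖ ≤ M) :
    ‖sol1 α a b μ z‖ ≤ (‖a‖ + ‖b‖) * (R * Real.exp (2 * growth α R M)) := by
  refine (norm_add_le _ _).trans ?_
  rw [norm_mul, norm_mul, add_mul]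
  have h0 := norm_fund1_le hα hα2 (Or.inl rfl) hR hz hμ
  have h1 := norm_fund1_le hα hα2 (Or.inr rfl) hR hz hμ
  gcongr

end sol
end Anharmonic

open ComplexConjugate

namespace Anharmonic

/-! ### Second order linear equations on a half-line -/

lemma hasDerivAt_re {f : ℝ → ℂ} {f' : ℂ} {x : ℝ} (h : HasDerivAt f f' x) :
    HasDerivAt (fun s => (f s).re) f'.re x :=
  Complex.reCLM.hasFDerivAt.comp_hasDerivAt x h

lemma hasDerivAt_conj {f : ℝ → ℂ} {f' : ℂ} {x : ℝ} (h : HasDerivAt f f' x) :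
    HasDerivAt (fun s => conj (f s)) (conj f') x :=
  Complex.conjCLE.toContinuousLinearMap.hasFDerivAt.comp_hasDerivAt x h

lemma hasDerivAt_norm_sq {f : ℝ → ℂ} {f' : ℂ} {x : ℝ} (h : HasDerivAt f f' x) :
    HasDerivAt (fun s => ‖f s‖ ^ 2) (2 * (f' * conj (f x)).re) x := by
  have h1 := hasDerivAt_re (h.mul (hasDerivAt_conj h))
  have h2 : (fun s => ‖f s‖ ^ 2) = fun s => ((f * fun s => conj (f s)) s).re := by
    funext s
    simp only [Pi.mul_apply, Complex.mul_conj, Complex.normSq_eq_norm_sq, Complex.ofReal_re]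
  rw [h2]
  convert! h1 using 1
  simp only [Complex.add_re, Complex.mul_re, Complex.conj_re, Complex.conj_im]
  ring

/-- `U` solves `U'' = q U` on `[0, ∞)`, with derivative `U1`. -/
structure IsSol (q U U1 : ℝ → ℂ) : Prop where
  contq : ContinuousOn q (Ici 0)
  cont : ContinuousOn U (Ici 0)
  cont1 : ContinuousOn U1 (Ici 0)
  deriv : ∀ x, 0 < x → HasDerivAt U (U1 x) x
  deriv1 : ∀ x, 0 < x → HasDerivAt U1 (q x * U x) x

noncomputable def flux (e : ℂ) (U U1 : ℝ → ℂ) (s : ℝ) : ℝ := -(e * (U1 s * conj (U s))).re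

lemma flux_le {e : ℂ} (he : ‖e‖ ≤ 1) (U U1 : ℝ → ℂ) (s : ℝ) :
    |flux e U U1 s| ≤ ‖U1 s‖ * ‖U s‖ := by
  unfold flux
  rw [abs_neg]
  refine (Complex.abs_re_le_norm _).trans ?_
  rw [norm_mul, norm_mul, RCLike.norm_conj]
  exact mul_le_of_le_one_left (by positivity) he

namespace IsSol
variable {q U U1 : ℝ → ℂ} (h : IsSol q U U1)
include h

lemma shift {t : ℝ} (ht : 0 ≤ t) :
    IsSol (fun s => q (t + s)) (fun s => U (t + s)) (fun s => U1 (t + s)) where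
  contq := h.contq.comp (by fun_prop) fun s hs => by simp only [mem_Ici] at *; linarith
  cont := h.cont.comp (by fun_prop) fun s hs => by simp only [mem_Ici] at *; linarith
  cont1 := h.cont1.comp (by fun_prop) fun s hs => by simp only [mem_Ici] at *; linarith
  deriv x hx := (h.deriv (t + x) (by linarith)).comp_const_add t x
  deriv1 x hx := (h.deriv1 (t + x) (by linarith)).comp_const_add t x

lemma hasDerivAt_flux (e : ℂ) {x : ℝ} (hx : 0 < x) :
    HasDerivAt (flux e U U1) (-(e.re * ‖U1 x‖ ^ 2 + (e * q x).re * ‖U x‖ ^ 2)) x := by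
  have h1 := (hasDerivAt_re (((h.deriv1 x hx).mul (hasDerivAt_conj (h.deriv x hx))).const_mul e)).neg
  convert! h1 using 1
  rw [← Complex.normSq_eq_norm_sq, ← Complex.normSq_eq_norm_sq, Complex.normSq_apply,
    Complex.normSq_apply]
  simp only [Complex.add_re, Complex.mul_re, Complex.conj_re, Complex.conj_im, Complex.add_im,
    Complex.mul_im]
  ring

lemma continuousOn_flux (e : ℂ) : ContinuousOn (flux e U U1) (Ici 0) := by
  unfold flux
  refine (Complex.continuous_re.comp_continuousOn (continuousOn_const.mul (h.cont1.mul ?_))).neg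
  exact Complex.continuous_conj.comp_continuousOn h.cont

lemma flux_energy (e : ℂ) {T : ℝ} (hT : 0 ≤ T) :
    ∫ s in (0 : ℝ)..T, (e.re * ‖U1 s‖ ^ 2 + (e * q s).re * ‖U s‖ ^ 2)
      = flux e U U1 0 - flux e U U1 T := by
  have hsub : Icc 0 T ⊆ Ici (0 : ℝ) := fun s hs => hs.1
  have hc : ContinuousOn (fun s => -(e.re * ‖U1 s‖ ^ 2 + (e * q s).re * ‖U s‖ ^ 2)) (Icc 0 T) := by
    have h1 := h.cont1.mono hsub
    have h2 := h.cont.mono hsub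
    have h3 := Complex.continuous_re.comp_continuousOn
      ((continuousOn_const (c := e)).mul (h.contq.mono hsub))
    exact (((continuousOn_const (c := e.re)).mul (h1.norm.pow 2)).add (h3.mul (h2.norm.pow 2))).neg
  have := intervalIntegral.integral_eq_sub_of_hasDerivAt_of_le hT
    ((h.continuousOn_flux e).mono hsub) (fun x hx => h.hasDerivAt_flux e hx.1)
    (hc.intervalIntegrable_of_Icc hT)
  rw [intervalIntegral.integral_neg] at this
  linarith

lemma antitoneOn_flux {e : ℂ} (he : 0 ≤ e.re) (hq : ∀ s, 0 < s → 0 ≤ (e * q s).re) :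
    AntitoneOn (flux e U U1) (Ici 0) := by
  refine antitoneOn_of_deriv_nonpos (convex_Ici 0) (h.continuousOn_flux e) ?_ ?_
  · intro x hx
    rw [interior_Ici] at hx
    exact (h.hasDerivAt_flux e hx).differentiableAt.differentiableWithinAt
  · intro x hx
    rw [interior_Ici] at hx
    rw [(h.hasDerivAt_flux e hx).deriv]
    have := hq x hx
    have : 0 ≤ e.re * ‖U1 x‖ ^ 2 + (e * q x).re * ‖U x‖ ^ 2 := by positivity
    linarith

lemma flux_nonneg {e : ℂ} (he : 0 < e.re) (he1 : ‖e‖ ≤ 1) (hq : ∀ s, 0 < s → 0 ≤ (e * q s).re)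
    {B : ℝ} (hB : ∀ s, 0 ≤ s → ‖U s‖ ≤ B) {s : ℝ} (hs : 0 ≤ s) : 0 ≤ flux e U U1 s := by
  by_contra! hneg
  have hanti := h.antitoneOn_flux he.le hq
  have hB' : ∀ s, 0 ≤ s → ‖U s‖ ≤ |B| + 1 := fun s hs => by
    linarith [hB s hs, le_abs_self B]
  set K := |B| + 1 with hK
  have hKp : 0 < K := by positivity
  have hlt : ∀ t, s ≤ t → flux e U U1 t < 0 := fun t ht =>
    lt_of_le_of_lt (hanti hs (hs.trans ht) ht) hneg
  set k := e.re / K ^ 2 with hk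
  have hkp : 0 < k := by positivity
  have hmono : MonotoneOn (fun t => (flux e U U1 t)⁻¹ - k * t) (Ici s) := by
    have hd : ∀ t, s < t → HasDerivAt (fun t => (flux e U U1 t)⁻¹ - k * t)
        (-(-(e.re * ‖U1 t‖ ^ 2 + (e * q t).re * ‖U t‖ ^ 2)) / flux e U U1 t ^ 2 - k * 1) t := by
      intro t ht
      exact ((h.hasDerivAt_flux e (hs.trans_lt ht)).inv (hlt t ht.le).ne).sub
        ((hasDerivAt_id t).const_mul k)
    refine monotoneOn_of_deriv_nonneg (convex_Ici s) ?_ ?_ ?_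
    · refine ContinuousOn.sub (ContinuousOn.inv₀ ((h.continuousOn_flux e).mono
        (Ici_subset_Ici.2 hs)) fun t ht => (hlt t ht).ne) (by fun_prop)
    · intro t ht
      rw [interior_Ici] at ht
      exact (hd t ht).differentiableAt.differentiableWithinAt
    · intro t ht
      rw [interior_Ici] at ht
      rw [(hd t ht).deriv, neg_neg, mul_one, sub_nonneg, hk, div_le_div_iff₀ (by positivity)
        (sq_pos_of_neg (hlt t (le_of_lt ht)))]
      have h1 : flux e U U1 t ^ 2 ≤ (‖U1 t‖ * K) ^ 2 := by
        rw [← sq_abs]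
        have := flux_le he1 U U1 t
        have := hB' t (hs.trans (le_of_lt ht))
        have : ‖U1 t‖ * ‖U t‖ ≤ ‖U1 t‖ * K := by gcongr
        gcongr; linarith
      have h2 := hq t (hs.trans_lt ht)
      have h3 : 0 ≤ (e * q t).re * ‖U t‖ ^ 2 * K ^ 2 := by positivity
      nlinarith [mul_le_mul_of_nonneg_left h1 he.le]
  set t := s - (flux e U U1 s)⁻¹ / k + 1 with htdef
  have hinv : (flux e U U1 s)⁻¹ < 0 := inv_lt_zero.2 hneg
  have hst : s ≤ t := by
    have : (flux e U U1 s)⁻¹ / k < 0 := div_neg_of_neg_of_pos hinv hkp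
    linarith
  have h1 := hmono self_mem_Ici hst hst
  simp only at h1
  have h2 : (flux e U U1 t)⁻¹ < 0 := inv_lt_zero.2 (hlt t hst)
  have h3 : k * t = k * s - (flux e U U1 s)⁻¹ + k := by rw [htdef]; field_simp
  linarith

end IsSol

/-- A bounded solution for which the energy method applies with multiplier `e`. -/
structure IsDecaying (q U U1 : ℝ → ℂ) (e : ℂ) (d : ℝ) : Prop extends IsSol q U U1 where
  e_pos : 0 < e.re
  e_le : ‖e‖ ≤ 1
  d_nonneg : 0 ≤ d
  q_ge : ∀ s, 0 < s → d ≤ (e * q s).re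
  bdd : ∃ B : ℝ, ∀ s, 0 ≤ s → ‖U s‖ ≤ B

namespace IsDecaying
variable {q U U1 : ℝ → ℂ} {e : ℂ} {d : ℝ} (h : IsDecaying q U U1 e d)
include h

lemma shift {t : ℝ} (ht : 0 ≤ t) :
    IsDecaying (fun s => q (t + s)) (fun s => U (t + s)) (fun s => U1 (t + s)) e d where
  toIsSol := h.toIsSol.shift ht
  e_pos := h.e_pos
  e_le := h.e_le
  d_nonneg := h.d_nonneg
  q_ge s hs := h.q_ge _ (by linarith)
  bdd := h.bdd.imp fun B hB s hs => hB _ (by linarith)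

lemma flux_nonneg {s : ℝ} (hs : 0 ≤ s) : 0 ≤ flux e U U1 s := by
  obtain ⟨B, hB⟩ := h.bdd
  exact h.toIsSol.flux_nonneg h.e_pos h.e_le (fun s hs => h.d_nonneg.trans (h.q_ge s hs)) hB hs

lemma flux_zero_le : flux e U U1 0 ≤ ‖U1 0‖ * ‖U 0‖ :=
  (le_abs_self _).trans (flux_le h.e_le U U1 0)

lemma flux_pos (hd : 0 < d) {s : ℝ} (hs : 0 ≤ s) (hU : ∃ t, s < t ∧ U t ≠ 0) :
    0 < flux e U U1 s := by
  obtain ⟨t, hst, hUt⟩ := hU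
  refine lt_of_le_of_ne (h.flux_nonneg hs) fun h0 => ?_
  have hanti := h.antitoneOn_flux h.e_pos.le fun s hs => h.d_nonneg.trans (h.q_ge s hs)
  have hz : ∀ x, s ≤ x → flux e U U1 x = 0 := fun x hx =>
    le_antisymm (h0 ▸ hanti hs (hs.trans hx) hx) (h.flux_nonneg (hs.trans hx))
  have ht0 : 0 < t := hs.trans_lt hst
  have h1 := h.hasDerivAt_flux e ht0
  have h2 : HasDerivAt (flux e U U1) 0 t := by
    refine (hasDerivAt_const t (0 : ℝ)).congr_of_eventuallyEq ?_
    filter_upwards [Ioi_mem_nhds hst] with x hx using hz x (le_of_lt hx)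
  have h3 := h1.unique h2
  have h4 := h.q_ge t ht0
  have h5 : 0 < ‖U t‖ ^ 2 := by positivity
  have h6 := mul_le_mul_of_nonneg_right h4 h5.le
  have h7 : 0 < d * ‖U t‖ ^ 2 := by positivity
  have h8 : 0 ≤ e.re * ‖U1 t‖ ^ 2 := mul_nonneg h.e_pos.le (sq_nonneg _)
  linarith

lemma energy_le {T : ℝ} (hT : 0 ≤ T) :
    ∫ s in (0 : ℝ)..T, (e.re * ‖U1 s‖ ^ 2 + d * ‖U s‖ ^ 2) ≤ flux e U U1 0 := by
  have hsub : Icc 0 T ⊆ Ici (0 : ℝ) := fun s hs => hs.1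
  have h1 := h.cont1.mono hsub
  have h2 := h.cont.mono hsub
  have h3 := Complex.continuous_re.comp_continuousOn
    ((continuousOn_const (c := e)).mul (h.contq.mono hsub))
  have h4 := h.flux_energy e hT
  have h5 := h.flux_nonneg hT
  refine le_trans (intervalIntegral.integral_mono_on_of_le_Ioo hT
    (g := fun s => e.re * ‖U1 s‖ ^ 2 + (e * q s).re * ‖U s‖ ^ 2) ?_ ?_ ?_) (by linarith)
  · exact (((continuousOn_const (c := e.re)).mul (h1.norm.pow 2)).add
      ((continuousOn_const (c := d)).mul (h2.norm.pow 2))).intervalIntegrable_of_Icc hT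
  · exact (((continuousOn_const (c := e.re)).mul (h1.norm.pow 2)).add
      (h3.mul (h2.norm.pow 2))).intervalIntegrable_of_Icc hT
  · intro s hs
    have := h.q_ge s hs.1
    gcongr

lemma intervalIntegrable_sq {T : ℝ} (hT : 0 ≤ T) :
    IntervalIntegrable (fun s => ‖U s‖ ^ 2) volume 0 T :=
  ((h.cont.mono fun _ hs => hs.1).norm.pow 2).intervalIntegrable_of_Icc hT

lemma intervalIntegrable_sq1 {T : ℝ} (hT : 0 ≤ T) :
    IntervalIntegrable (fun s => ‖U1 s‖ ^ 2) volume 0 T :=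
  ((h.cont1.mono fun _ hs => hs.1).norm.pow 2).intervalIntegrable_of_Icc hT

lemma energy_add {T : ℝ} (hT : 0 ≤ T) :
    e.re * (∫ s in (0 : ℝ)..T, ‖U1 s‖ ^ 2) + d * (∫ s in (0 : ℝ)..T, ‖U s‖ ^ 2)
      ≤ flux e U U1 0 := by
  rw [← intervalIntegral.integral_const_mul, ← intervalIntegral.integral_const_mul,
    ← intervalIntegral.integral_add ((h.intervalIntegrable_sq1 hT).const_mul _)
      ((h.intervalIntegrable_sq hT).const_mul _)]
  exact h.energy_le hT

lemma integral_sq_le {T : ℝ} (hT : 0 ≤ T) :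
    d * (∫ s in (0 : ℝ)..T, ‖U s‖ ^ 2) ≤ flux e U U1 0 := by
  have h1 : 0 ≤ ∫ s in (0 : ℝ)..T, ‖U1 s‖ ^ 2 :=
    intervalIntegral.integral_nonneg hT fun _ _ => sq_nonneg _
  have := h.energy_add hT
  have := mul_nonneg h.e_pos.le h1
  linarith

lemma integral_sq1_le {T : ℝ} (hT : 0 ≤ T) :
    e.re * (∫ s in (0 : ℝ)..T, ‖U1 s‖ ^ 2) ≤ flux e U U1 0 := by
  have h1 : 0 ≤ ∫ s in (0 : ℝ)..T, ‖U s‖ ^ 2 :=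
    intervalIntegral.integral_nonneg hT fun _ _ => sq_nonneg _
  have := h.energy_add hT
  have := mul_nonneg h.d_nonneg h1
  linarith

lemma integrableOn_sq (hd : 0 < d) : IntegrableOn (fun s => ‖U s‖ ^ 2) (Ioi 0) := by
  refine integrableOn_Ioi_of_intervalIntegral_norm_bounded (flux e U U1 0 / d) 0
    (l := Filter.atTop) (b := id) (fun T => ?_) Filter.tendsto_id ?_
  · rcases le_total 0 T with hT | hT
    · exact (intervalIntegrable_iff_integrableOn_Ioc_of_le hT).1 (h.intervalIntegrable_sq hT)
    · simp only [id, Ioc_eq_empty (not_lt.2 hT), integrableOn_empty]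
  · filter_upwards [Filter.eventually_ge_atTop 0] with T hT
    rw [le_div_iff₀ hd, mul_comm]
    simpa using h.integral_sq_le hT

lemma integral_Ioi_sq_le (hd : 0 < d) : d * ∫ s in Ioi (0 : ℝ), ‖U s‖ ^ 2 ≤ flux e U U1 0 := by
  refine le_of_tendsto ((intervalIntegral_tendsto_integral_Ioi 0 (h.integrableOn_sq hd)
    Filter.tendsto_id).const_mul d) ?_
  filter_upwards [Filter.eventually_ge_atTop 0] with T hT using h.integral_sq_le hT

lemma flux_exp_decay {s : ℝ} (hs : 0 ≤ s) :
    flux e U U1 s ≤ flux e U U1 0 * Real.exp (-(2 * √(e.re * d)) * s) := by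
  set k := 2 * √(e.re * d) with hk
  have hed : 0 ≤ e.re * d := mul_nonneg h.e_pos.le h.d_nonneg
  have hd : ∀ t, 0 < t → HasDerivAt (fun t => flux e U U1 t * Real.exp (k * t))
      (-(e.re * ‖U1 t‖ ^ 2 + (e * q t).re * ‖U t‖ ^ 2) * Real.exp (k * t) +
        flux e U U1 t * (Real.exp (k * t) * (k * 1))) t := fun t ht =>
    (h.hasDerivAt_flux e ht).mul (((hasDerivAt_id t).const_mul k).exp)
  have hanti : AntitoneOn (fun t => flux e U U1 t * Real.exp (k * t)) (Ici 0) := by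
    refine antitoneOn_of_deriv_nonpos (convex_Ici 0)
      ((h.continuousOn_flux e).mul (by fun_prop)) ?_ ?_
    · intro x hx
      rw [interior_Ici] at hx
      exact (hd x hx).differentiableAt.differentiableWithinAt
    · intro x hx
      rw [interior_Ici] at hx
      rw [(hd x hx).deriv]
      have h1 : k * flux e U U1 x ≤ e.re * ‖U1 x‖ ^ 2 + (e * q x).re * ‖U x‖ ^ 2 := by
        have hq := h.q_ge x hx
        have hf := (le_abs_self _).trans (flux_le h.e_le U U1 x)
        have hk0 : 0 ≤ k := by positivity
        have h2 : k * flux e U U1 x ≤ k * (‖U1 x‖ * ‖U x‖) := by gcongr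
        have h3 : k * (‖U1 x‖ * ‖U x‖) ≤ e.re * ‖U1 x‖ ^ 2 + d * ‖U x‖ ^ 2 := by
          have := sq_nonneg (√e.re * ‖U1 x‖ - √d * ‖U x‖)
          rw [hk, Real.sqrt_mul h.e_pos.le]
          have e1 := Real.sq_sqrt h.e_pos.le
          have e2 := Real.sq_sqrt h.d_nonneg
          nlinarith
        have h4 : d * ‖U x‖ ^ 2 ≤ (e * q x).re * ‖U x‖ ^ 2 := by gcongr
        linarith
      have := Real.exp_pos (k * x)
      nlinarith
  have := hanti self_mem_Ici hs hs
  simp only [mul_zero, Real.exp_zero, mul_one] at this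
  rw [neg_mul, Real.exp_neg, ← div_eq_mul_inv, le_div_iff₀ (Real.exp_pos _)]
  exact this

/-- Bound for the initial slope of a decaying solution. -/
lemma norm_deriv_zero_le (hd : 0 < d) {ℓ B k : ℝ} (hℓ : 0 < ℓ) (hk : 0 < k)
    (hB : ∀ s ∈ Ioo 0 ℓ, ‖q s‖ ≤ B) :
    ‖U1 0‖ ≤ (1 / (ℓ * e.re) + B * k / d + B / (k * e.re)) * ‖U 0‖ := by
  have hB0 : 0 ≤ B := (norm_nonneg _).trans (hB (ℓ / 2) ⟨by linarith, by linarith⟩)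
  have hsub : Icc 0 ℓ ⊆ Ici (0 : ℝ) := fun s hs => hs.1
  have hc1 := h.cont1.mono hsub
  have hc := h.cont.mono hsub
  have hcq := h.contq.mono hsub
  have hder : ∀ s ∈ Ioo 0 ℓ, HasDerivAt (fun s => (s / ℓ - 1) * ‖U1 s‖ ^ 2)
      (1 / ℓ * ‖U1 s‖ ^ 2 + (s / ℓ - 1) * (2 * ((q s * U s) * conj (U1 s)).re)) s := fun s hs =>
    (((hasDerivAt_id s).div_const ℓ).sub_const 1).mul (hasDerivAt_norm_sq (h.deriv1 s hs.1))
  have hcc : ContinuousOn (fun s => 1 / ℓ * ‖U1 s‖ ^ 2 +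
      (s / ℓ - 1) * (2 * ((q s * U s) * conj (U1 s)).re)) (Icc 0 ℓ) := by
    have := Complex.continuous_re.comp_continuousOn
      ((hcq.mul hc).mul (Complex.continuous_conj.comp_continuousOn hc1))
    exact (continuousOn_const.mul (hc1.norm.pow 2)).add
      (ContinuousOn.mul (by fun_prop) (continuousOn_const.mul this))
  have hF := intervalIntegral.integral_eq_sub_of_hasDerivAt_of_le hℓ.le
    (ContinuousOn.mul (by fun_prop) (hc1.norm.pow 2)) hder
    (hcc.intervalIntegrable_of_Icc hℓ.le)
  have hF2 : ‖U1 0‖ ^ 2 = ∫ s in (0 : ℝ)..ℓ, (1 / ℓ * ‖U1 s‖ ^ 2 +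
      (s / ℓ - 1) * (2 * ((q s * U s) * conj (U1 s)).re)) := by
    rw [hF]; simp [hℓ.ne']
  have hinteg : ∫ s in (0 : ℝ)..ℓ, (1 / ℓ * ‖U1 s‖ ^ 2 +
      (s / ℓ - 1) * (2 * ((q s * U s) * conj (U1 s)).re))
      ≤ ∫ s in (0 : ℝ)..ℓ, ((1 / ℓ + B / k) * ‖U1 s‖ ^ 2 + B * k * ‖U s‖ ^ 2) := by
    refine intervalIntegral.integral_mono_on_of_le_Ioo hℓ.le (hcc.intervalIntegrable_of_Icc hℓ.le)
      (((h.intervalIntegrable_sq1 hℓ.le).const_mul _).add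
        ((h.intervalIntegrable_sq hℓ.le).const_mul _)) ?_
    intro s hs
    have h1 : |s / ℓ - 1| ≤ 1 := by
      rw [abs_le]
      have := div_pos hs.1 hℓ
      have := (div_lt_one hℓ).2 hs.2
      constructor <;> linarith
    have h2 : |((q s * U s) * conj (U1 s)).re| ≤ B * (‖U s‖ * ‖U1 s‖) := by
      refine (Complex.abs_re_le_norm _).trans ?_
      rw [norm_mul, norm_mul, RCLike.norm_conj, mul_assoc]
      have := hB s hs
      gcongr
    have h3 : (s / ℓ - 1) * (2 * ((q s * U s) * conj (U1 s)).re) ≤ 2 * (B * (‖U s‖ * ‖U1 s‖)) := by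
      refine (le_abs_self _).trans ?_
      rw [abs_mul, abs_mul, abs_two]
      calc _ ≤ 1 * (2 * (B * (‖U s‖ * ‖U1 s‖))) := by gcongr
        _ = _ := by ring
    have h4 : 2 * (‖U s‖ * ‖U1 s‖) ≤ 1 / k * ‖U1 s‖ ^ 2 + k * ‖U s‖ ^ 2 := by
      have : 0 ≤ (‖U1 s‖ - k * ‖U s‖) ^ 2 / k := by positivity
      have h5 : (‖U1 s‖ - k * ‖U s‖) ^ 2 / k =
          1 / k * ‖U1 s‖ ^ 2 + k * ‖U s‖ ^ 2 - 2 * (‖U s‖ * ‖U1 s‖) := by field_simp; ring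
      linarith
    have h6 := mul_le_mul_of_nonneg_left h4 hB0
    have h7 : B * (1 / k * ‖U1 s‖ ^ 2 + k * ‖U s‖ ^ 2) = B / k * ‖U1 s‖ ^ 2 + B * k * ‖U s‖ ^ 2 := by
      ring
    linarith
  rw [← hF2, intervalIntegral.integral_add ((h.intervalIntegrable_sq1 hℓ.le).const_mul _)
    ((h.intervalIntegrable_sq hℓ.le).const_mul _), intervalIntegral.integral_const_mul,
    intervalIntegral.integral_const_mul] at hinteg
  have he := h.e_pos
  have i1 : ∫ s in (0 : ℝ)..ℓ, ‖U1 s‖ ^ 2 ≤ ‖U1 0‖ * ‖U 0‖ / e.re := by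
    rw [le_div_iff₀ he, mul_comm]
    exact (h.integral_sq1_le hℓ.le).trans h.flux_zero_le
  have i2 : ∫ s in (0 : ℝ)..ℓ, ‖U s‖ ^ 2 ≤ ‖U1 0‖ * ‖U 0‖ / d := by
    rw [le_div_iff₀ hd, mul_comm]
    exact (h.integral_sq_le hℓ.le).trans h.flux_zero_le
  have h8 : ‖U1 0‖ ^ 2 ≤ (1 / ℓ + B / k) * (‖U1 0‖ * ‖U 0‖ / e.re)
      + B * k * (‖U1 0‖ * ‖U 0‖ / d) :=
    hinteg.trans (add_le_add (mul_le_mul_of_nonneg_left i1 (by positivity))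
      (mul_le_mul_of_nonneg_left i2 (by positivity)))
  rcases (norm_nonneg (U1 0)).eq_or_lt with h0 | h0
  · rw [← h0]; positivity
  · refine le_of_mul_le_mul_left ?_ h0
    calc ‖U1 0‖ * ‖U1 0‖ = ‖U1 0‖ ^ 2 := by ring
      _ ≤ _ := h8
      _ = _ := by field_simp; ring

end IsDecaying
end Anharmonic

namespace Anharmonic

namespace IsSol
variable {q U U1 V V1 : ℝ → ℂ} (h : IsSol q U U1)
include h

/-- Gronwall's inequality for the energy `K²|U|² + |U'|²`. -/
lemma gronwall {K T : ℝ} (hK : 0 < K) (hq : ∀ s ∈ Ioo 0 T, ‖q s‖ ≤ K ^ 2) {s t : ℝ}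
    (hs : s ∈ Icc 0 T) (ht : t ∈ Icc 0 T) :
    K ^ 2 * ‖U s‖ ^ 2 + ‖U1 s‖ ^ 2 ≤
      (K ^ 2 * ‖U t‖ ^ 2 + ‖U1 t‖ ^ 2) * Real.exp (2 * K * |s - t|) := by
  set E : ℝ → ℝ := fun s => K ^ 2 * ‖U s‖ ^ 2 + ‖U1 s‖ ^ 2 with hE
  have hsub : Icc 0 T ⊆ Ici (0 : ℝ) := fun s hs => hs.1
  have hEc : ContinuousOn E (Icc 0 T) :=
    (continuousOn_const.mul ((h.cont.mono hsub).norm.pow 2)).add ((h.cont1.mono hsub).norm.pow 2)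
  have hEd : ∀ x ∈ Ioo 0 T, ∃ D, HasDerivAt E D x ∧ |D| ≤ 2 * K * E x := by
    intro x hx
    refine ⟨_, ((hasDerivAt_norm_sq (h.deriv x hx.1)).const_mul (K ^ 2)).add
      (hasDerivAt_norm_sq (h.deriv1 x hx.1)), ?_⟩
    have h1 : |(U1 x * conj (U x)).re| ≤ ‖U1 x‖ * ‖U x‖ := by
      refine (Complex.abs_re_le_norm _).trans ?_
      rw [norm_mul, RCLike.norm_conj]
    have h2 : |(q x * U x * conj (U1 x)).re| ≤ K ^ 2 * (‖U1 x‖ * ‖U x‖) := by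
      refine (Complex.abs_re_le_norm _).trans ?_
      rw [norm_mul, norm_mul, RCLike.norm_conj, mul_assoc, mul_comm ‖U x‖]
      have := hq x hx
      gcongr
    refine (abs_add_le _ _).trans ?_
    rw [abs_mul, abs_mul, abs_mul, abs_two, abs_of_nonneg (sq_nonneg K)]
    have h3 := sq_nonneg (K * ‖U x‖ - ‖U1 x‖)
    have h4 : K ^ 2 * (2 * |(U1 x * conj (U x)).re|) ≤ K ^ 2 * (2 * (‖U1 x‖ * ‖U x‖)) := by gcongr
    simp only [hE]
    nlinarith [mul_nonneg hK.le h3]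
  have hEnn : ∀ x, 0 ≤ E x := fun x => by simp only [hE]; positivity
  have hm : MonotoneOn (fun s => E s * Real.exp (2 * K * s)) (Icc 0 T) := by
    refine monotoneOn_of_deriv_nonneg (convex_Icc 0 T) (hEc.mul (by fun_prop)) ?_ ?_ <;>
    intro x hx <;> rw [interior_Icc] at hx <;> obtain ⟨D, hD, hDb⟩ := hEd x hx <;>
    have hd := hD.mul (((hasDerivAt_id x).const_mul (2 * K)).exp)
    · exact hd.differentiableAt.differentiableWithinAt
    · have : 0 ≤ D * Real.exp (2 * K * x) + E x * (Real.exp (2 * K * x) * (2 * K * 1)) := by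
        have := neg_le_of_abs_le hDb
        have := Real.exp_pos (2 * K * x)
        nlinarith
      exact hd.deriv ▸ this
  have ha : AntitoneOn (fun s => E s * Real.exp (-(2 * K) * s)) (Icc 0 T) := by
    refine antitoneOn_of_deriv_nonpos (convex_Icc 0 T) (hEc.mul (by fun_prop)) ?_ ?_ <;>
    intro x hx <;> rw [interior_Icc] at hx <;> obtain ⟨D, hD, hDb⟩ := hEd x hx <;>
    have hd := hD.mul (((hasDerivAt_id x).const_mul (-(2 * K))).exp)
    · exact hd.differentiableAt.differentiableWithinAt
    · have : D * Real.exp (-(2 * K) * x) + E x * (Real.exp (-(2 * K) * x) * (-(2 * K) * 1)) ≤ 0 := by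
        have := le_of_abs_le hDb
        have := Real.exp_pos (-(2 * K) * x)
        nlinarith
      exact hd.deriv ▸ this
  change E s ≤ E t * _
  rcases le_total s t with hst | hst
  · have h1 := hm hs ht hst
    simp only at h1
    rw [abs_of_nonpos (by linarith), show 2 * K * -(s - t) = 2 * K * t - 2 * K * s by ring,
      Real.exp_sub, ← mul_div_assoc, le_div_iff₀ (Real.exp_pos _)]
    exact h1
  · have h1 := ha ht hs hst
    simp only at h1
    rw [abs_of_nonneg (by linarith), show 2 * K * (s - t) = -(2 * K) * t - -(2 * K) * s by ring,
      Real.exp_sub, ← mul_div_assoc, le_div_iff₀ (Real.exp_pos _)]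
    exact h1

lemma wronskian (h' : IsSol q V V1) {T : ℝ} (hT : 0 ≤ T) :
    U T * V1 T - U1 T * V T = U 0 * V1 0 - U1 0 * V 0 := by
  have hsub : Icc 0 T ⊆ Ici (0 : ℝ) := fun s hs => hs.1
  have := intervalIntegral.integral_eq_sub_of_hasDerivAt_of_le hT
    (f := fun s => U s * V1 s - U1 s * V s) (f' := fun _ => 0)
    (((h.cont.mul h'.cont1).sub (h.cont1.mul h'.cont)).mono hsub) (fun x hx => by
      have := ((h.deriv x hx.1).mul (h'.deriv1 x hx.1)).sub ((h.deriv1 x hx.1).mul (h'.deriv x hx.1))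
      convert! this using 1
      ring) (by simp)
  rw [intervalIntegral.integral_zero] at this
  exact (sub_eq_zero.1 this.symm)

end IsSol

lemma IsDecaying.norm_sq_le {q U U1 : ℝ → ℂ} {e : ℂ} {d : ℝ} (h : IsDecaying q U U1 e d)
    (hd : 0 < d) {T : ℝ} (hT : 0 ≤ T) :
    ‖U T‖ ^ 2 ≤ ‖U 0‖ ^ 2 + ‖U1 0‖ * ‖U 0‖ / √(e.re * d) := by
  have hp : 0 < √(e.re * d) := Real.sqrt_pos.2 (mul_pos h.e_pos hd)
  have hder : ∀ x, 0 < x → HasDerivAt (fun s => ‖U s‖ ^ 2 + flux e U U1 s / √(e.re * d))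
      (2 * (U1 x * conj (U x)).re +
        -(e.re * ‖U1 x‖ ^ 2 + (e * q x).re * ‖U x‖ ^ 2) / √(e.re * d)) x := fun x hx =>
    (hasDerivAt_norm_sq (h.deriv x hx)).add ((h.hasDerivAt_flux e hx).div_const _)
  have hanti : AntitoneOn (fun s => ‖U s‖ ^ 2 + flux e U U1 s / √(e.re * d)) (Ici 0) := by
    refine antitoneOn_of_deriv_nonpos (convex_Ici 0)
      ((h.cont.norm.pow 2).add ((h.continuousOn_flux e).div_const _)) ?_ ?_ <;>
    intro x hx <;> rw [interior_Ici] at hx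
    · exact (hder x hx).differentiableAt.differentiableWithinAt
    · rw [(hder x hx).deriv]
      have h1 : (U1 x * conj (U x)).re ≤ ‖U1 x‖ * ‖U x‖ := by
        refine (Complex.re_le_norm _).trans ?_
        rw [norm_mul, RCLike.norm_conj]
      have h2 : 2 * (‖U1 x‖ * ‖U x‖) * √(e.re * d) ≤ e.re * ‖U1 x‖ ^ 2 + d * ‖U x‖ ^ 2 := by
        have := sq_nonneg (√e.re * ‖U1 x‖ - √d * ‖U x‖)
        rw [Real.sqrt_mul h.e_pos.le]
        have e1 := Real.sq_sqrt h.e_pos.le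
        have e2 := Real.sq_sqrt h.d_nonneg
        nlinarith
      have h3 : d * ‖U x‖ ^ 2 ≤ (e * q x).re * ‖U x‖ ^ 2 := by
        have := h.q_ge x hx
        gcongr
      have h4 : 2 * (‖U1 x‖ * ‖U x‖) ≤ (e.re * ‖U1 x‖ ^ 2 + (e * q x).re * ‖U x‖ ^ 2) / √(e.re * d) := by
        rw [le_div_iff₀ hp]; linarith
      rw [neg_div]; linarith
  have h1 := hanti self_mem_Ici hT hT
  simp only at h1
  have h2 := div_nonneg (h.flux_nonneg hT) hp.le
  have h3 : flux e U U1 0 / √(e.re * d) ≤ ‖U1 0‖ * ‖U 0‖ / √(e.re * d) := by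
    have := h.flux_zero_le
    gcongr
  linarith

section lines
variable {α : ℝ} (hα : 0 < α) (hα2 : α < 2) (a b μ : ℂ)
include hα hα2

omit hα2 in
lemma continuousOn_cpow_re : ContinuousOn (fun z : ℂ => z ^ (α : ℂ)) {z | 0 ≤ z.re} :=
  fun z hz => (Complex.continuousAt_cpow_const_of_re_pos (Or.inl hz)
    (by simpa using hα)).continuousWithinAt

lemma isSol_line (z0 d : ℂ) (hz0 : 0 ≤ z0.re) (hd : ∀ s : ℝ, 0 < s → 0 < (z0 + s * d).re) :
    IsSol (fun s => d ^ 2 * ((z0 + s * d) ^ (α : ℂ) - μ)) (fun s => sol α a b μ (z0 + s * d))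
      (fun s => d * sol1 α a b μ (z0 + s * d)) := by
  have hmaps : MapsTo (fun s : ℝ => z0 + s * d) (Ici 0) {z | 0 ≤ z.re} := by
    intro s hs
    rcases (mem_Ici.1 hs).eq_or_lt with h | h
    · simpa [← h] using hz0
    · exact (hd s h).le
  have hc : ContinuousOn (fun s : ℝ => z0 + s * d) (Ici 0) := by fun_prop
  have hl : ∀ x : ℝ, HasDerivAt (fun s : ℝ => z0 + s * d) d x := fun x => by
    simpa using ((Complex.ofRealCLM.hasDerivAt (x := x)).mul_const d).const_add z0
  exact
  { contq := continuousOn_const.mul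
      (((continuousOn_cpow_re hα).comp hc hmaps).sub continuousOn_const)
    cont := (continuousOn_sol hα hα2 a b μ).comp hc hmaps
    cont1 := continuousOn_const.mul ((continuousOn_sol1 hα hα2 a b μ).comp hc hmaps)
    deriv := fun x hx => by
      have := (hasDerivAt_sol hα hα2 a b μ (Or.inl (hd x hx))).comp x (hl x)
      rwa [mul_comm] at this
    deriv1 := fun x hx => by
      have := ((hasDerivAt_sol1 hα hα2 a b μ (Or.inl (hd x hx))).comp x (hl x)).const_mul d
      convert! this using 1
      ring }

lemma isSol_real {X : ℝ} (hX : 0 ≤ X) :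
    IsSol (fun s => ((X + s : ℝ) : ℂ) ^ (α : ℂ) - μ) (fun s => sol α a b μ (X + s : ℝ))
      (fun s => sol1 α a b μ (X + s : ℝ)) := by
  have := isSol_line hα hα2 a b μ X 1 (by simpa using hX) (fun s hs => by simp; linarith)
  simpa using this

lemma sol_wronskian {X : ℝ} (hX : 0 ≤ X) (a' b' : ℂ) :
    sol α a b μ X * sol1 α a' b' μ X - sol1 α a b μ X * sol α a' b' μ X = a * b' - b * a' := by
  have := (isSol_real hα hα2 a b μ le_rfl).wronskian (isSol_real hα hα2 a' b' μ le_rfl) hX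
  simpa [sol_zero hα, sol1_zero hα] using this

omit hα hα2 in
lemma ofReal_cpow_eq {x : ℝ} (hx : 0 ≤ x) : ((x : ℝ) : ℂ) ^ (α : ℂ) = ((x ^ α : ℝ) : ℂ) := by
  rw [Complex.ofReal_cpow hx]

end lines

/-- Holomorphic dependence of an integral on a parameter. -/
lemma differentiableOn_integral {X : Type*} [MeasurableSpace X] {ν : Measure X} {D : Set ℂ}
    (hD : IsOpen D) {h : ℂ → X → ℂ} {bound : X → ℝ}
    (hm : ∀ μ ∈ D, AEStronglyMeasurable (h μ) ν)
    (hd : ∀ᵐ x ∂ν, DifferentiableOn ℂ (fun μ => h μ x) D)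
    (hb : ∀ᵐ x ∂ν, ∀ μ ∈ D, ‖h μ x‖ ≤ bound x) (hbi : Integrable bound ν) :
    DifferentiableOn ℂ (fun μ => ∫ x, h μ x ∂ν) D := by
  intro μ hμ
  obtain ⟨r, hr, hrD⟩ := Metric.isOpen_iff.1 hD μ hμ
  have hball : ∀ w ∈ Metric.ball μ (r / 2), Metric.ball w (r / 2) ⊆ D := fun w hw v hv =>
    hrD (by
      rw [Metric.mem_ball] at *
      linarith [dist_triangle v w μ])
  have hin : ∀ w ∈ Metric.ball μ (r / 2), w ∈ D := fun w hw =>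
    hball w hw (Metric.mem_ball_self (by linarith))
  refine DifferentiableAt.differentiableWithinAt (HasDerivAt.differentiableAt
    (hasDerivAt_integral_of_dominated_loc_of_deriv_le (F := h)
      (F' := fun w x => deriv (fun v => h v x) w) (bound := fun x => bound x / (r / 4))
      (s := Metric.ball μ (r / 2))
      (Metric.ball_mem_nhds μ (by linarith)) ?_ ?_ ?_ ?_ ?_ ?_).2)
  · filter_upwards [hD.mem_nhds hμ] with w hw using hm w hw
  · exact hbi.mono' (hm μ hμ) (hb.mono fun x hx => hx μ hμ)
  · -- measurability of the derivative as a limit of difference quotients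
    let ε : ℕ → ℂ := fun n => ((r / 2 / ((n : ℝ) + 2) : ℝ) : ℂ)
    have hε0 : ∀ n, ε n ≠ 0 := fun n => by
      simp only [ε, ne_eq, Complex.ofReal_eq_zero]; positivity
    have hεD : ∀ n, μ + ε n ∈ D := fun n => hrD (by
      simp only [ε, Metric.mem_ball, dist_self_add_left, Complex.norm_real, Real.norm_eq_abs]
      rw [abs_of_pos (by positivity), div_lt_iff₀ (by positivity)]
      have : (0 : ℝ) ≤ n := n.cast_nonneg
      nlinarith)
    have hεt : Filter.Tendsto ε Filter.atTop (nhds 0) := by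
      have : Filter.Tendsto (fun n : ℕ => r / 2 / ((n : ℝ) + 2)) Filter.atTop (nhds 0) :=
        tendsto_const_nhds.div_atTop
          (Filter.tendsto_atTop_add_const_right _ _ tendsto_natCast_atTop_atTop)
      have h2 := (Complex.continuous_ofReal.tendsto 0).comp this
      rwa [Complex.ofReal_zero] at h2
    refine aestronglyMeasurable_of_tendsto_ae Filter.atTop
      (f := fun n x => (ε n)⁻¹ • (h (μ + ε n) x - h μ x))
      (fun n => AEStronglyMeasurable.fun_const_smul ((hm _ (hεD n)).sub (hm μ hμ)) _) ?_
    filter_upwards [hd] with x hx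
    have h1 := (hx.differentiableAt (hD.mem_nhds hμ)).hasDerivAt
    exact h1.tendsto_slope_zero.comp (tendsto_nhdsWithin_iff.2 ⟨hεt, Filter.Eventually.of_forall hε0⟩)
  · filter_upwards [hb, hd] with x hx hdx w hw
    refine Complex.norm_deriv_le_of_forall_mem_sphere_norm_le (by linarith) ?_ ?_
    · refine (hdx.mono fun v hv => ?_).diffContOnCl
      refine hball w hw (Metric.closedBall_subset_ball (by linarith) (closure_minimal
        Metric.ball_subset_closedBall Metric.isClosed_closedBall hv))
    · intro v hv
      exact hx v (hball w hw (by rw [Metric.mem_sphere] at hv; rw [Metric.mem_ball]; linarith))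
  · exact hbi.div_const _
  · filter_upwards [hd] with x hx w hw
    exact (hx.differentiableAt (hD.mem_nhds (hin w hw))).hasDerivAt

end Anharmonic

namespace Anharmonic

/-- `a`, `b` are the Cauchy data at `0` of a nontrivial solution of `u'' = (z^α - μ) u` that is
bounded on the positive real axis. -/
def Sub (α : ℝ) (μ a b : ℂ) : Prop :=
  (a ≠ 0 ∨ b ≠ 0) ∧ ∃ B : ℝ, ∀ x : ℝ, 0 ≤ x → ‖sol α a b μ x‖ ≤ B

/-- Exponential growth of the solution with `U(0) = U'(0) = 1`. -/
lemma IsSol.growing {q U U1 : ℝ → ℂ} (h : IsSol q U U1) (h0 : U 0 = 1) (h1 : U1 0 = 1)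
    (hq : ∀ s, 0 < s → 1 ≤ (q s).re) {s t : ℝ} (hs : 0 ≤ s) (hst : s ≤ t) :
    ‖U s‖ ^ 2 * Real.exp (t - s) ≤ ‖U t‖ ^ 2 := by
  have hD : ∀ x, 0 ≤ x → 1 ≤ -2 * flux 1 U U1 x - ‖U x‖ ^ 2 := by
    have hder : ∀ x, 0 < x → HasDerivAt (fun x => -2 * flux 1 U U1 x - ‖U x‖ ^ 2)
      (-2 * -((1 : ℂ).re * ‖U1 x‖ ^ 2 + (1 * q x).re * ‖U x‖ ^ 2) - 2 * (U1 x * conj (U x)).re) x :=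
      fun x hx => ((h.hasDerivAt_flux 1 hx).const_mul (-2)).sub (hasDerivAt_norm_sq (h.deriv x hx))
    have hm : MonotoneOn (fun x => -2 * flux 1 U U1 x - ‖U x‖ ^ 2) (Ici 0) := by
      refine monotoneOn_of_deriv_nonneg (convex_Ici 0)
        ((continuousOn_const.mul (h.continuousOn_flux 1)).sub (h.cont.norm.pow 2)) ?_ ?_ <;>
      intro x hx <;> rw [interior_Ici] at hx
      · exact (hder x hx).differentiableAt.differentiableWithinAt
      · rw [(hder x hx).deriv]
        have h1 : (U1 x * conj (U x)).re ≤ ‖U1 x‖ * ‖U x‖ := by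
          refine (Complex.re_le_norm _).trans ?_
          rw [norm_mul, RCLike.norm_conj]
        have h2 : ‖U x‖ ^ 2 ≤ (q x).re * ‖U x‖ ^ 2 :=
          le_mul_of_one_le_left (sq_nonneg _) (hq x hx)
        simp only [Complex.one_re, one_mul]
        nlinarith [sq_nonneg (‖U1 x‖ - ‖U x‖), sq_nonneg (‖U1 x‖), sq_nonneg ‖U x‖]
    intro x hx
    have := hm self_mem_Ici hx hx
    have h2 : -2 * flux 1 U U1 0 - ‖U 0‖ ^ 2 = 1 := by simp [flux, h0, h1]; norm_num
    simp only at this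
    linarith
  have hder : ∀ x, 0 < x → HasDerivAt (fun x => ‖U x‖ ^ 2 * Real.exp (-1 * x))
      (2 * (U1 x * conj (U x)).re * Real.exp (-1 * x) +
        ‖U x‖ ^ 2 * (Real.exp (-1 * x) * (-1 * 1))) x := fun x hx =>
    (hasDerivAt_norm_sq (h.deriv x hx)).mul (((hasDerivAt_id x).const_mul (-1)).exp)
  have hm : MonotoneOn (fun x => ‖U x‖ ^ 2 * Real.exp (-1 * x)) (Ici 0) := by
    refine monotoneOn_of_deriv_nonneg (convex_Ici 0)
      ((h.cont.norm.pow 2).mul (by fun_prop)) ?_ ?_ <;>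
    intro x hx <;> rw [interior_Ici] at hx
    · exact (hder x hx).differentiableAt.differentiableWithinAt
    · rw [(hder x hx).deriv]
      have h1 := hD x (le_of_lt hx)
      simp only [flux, one_mul] at h1
      have := Real.exp_pos (-1 * x)
      nlinarith
  have h2 := hm hs (hs.trans hst) hst
  simp only [neg_one_mul] at h2
  rw [Real.exp_neg, Real.exp_neg, ← div_eq_mul_inv, ← div_eq_mul_inv,
    div_le_div_iff₀ (Real.exp_pos _) (Real.exp_pos _)] at h2
  rw [Real.exp_sub, ← mul_div_assoc, div_le_iff₀ (Real.exp_pos _)]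
  exact h2

section
variable {α : ℝ} (hα : 0 < α) (hα2 : α < 2)
include hα

lemma le_rpow_of_ge {M X x : ℝ} (hM : 0 ≤ M) (hX : M ^ (1 / α) ≤ X) (hx : X ≤ x) : M ≤ x ^ α := by
  have h0 : 0 ≤ M ^ (1 / α) := Real.rpow_nonneg hM _
  calc M = (M ^ (1 / α)) ^ α := by rw [← Real.rpow_mul hM]; field_simp; simp
    _ ≤ x ^ α := Real.rpow_le_rpow h0 (hX.trans hx) hα.le

lemma re_ge_real {M X : ℝ} {μ : ℂ} (hX : (M + 1) ^ (1 / α) ≤ X) (hμ : ‖μ‖ ≤ M) {s : ℝ}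
    (hs : 0 ≤ s) : 1 ≤ (((X + s : ℝ) : ℂ) ^ (α : ℂ) - μ).re := by
  have hM : 0 ≤ M := (norm_nonneg _).trans hμ
  have hX0 : 0 ≤ X := (Real.rpow_nonneg (by linarith) _).trans hX
  rw [ofReal_cpow_eq (by linarith), Complex.sub_re, Complex.ofReal_re]
  have := le_rpow_of_ge hα (by linarith) hX (show X ≤ X + s by linarith)
  have := Complex.re_le_norm μ
  linarith

include hα2

lemma exists_local_sub {M : ℝ} (hM : 0 < M) : ∃ a b : ℂ → ℂ,
    DifferentiableOn ℂ a (Metric.ball 0 M) ∧ DifferentiableOn ℂ b (Metric.ball 0 M) ∧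
    ∀ μ ∈ Metric.ball (0 : ℂ) M, Sub α μ (a μ) (b μ) := by
  set X := (M + 1) ^ (1 / α) with hX
  have hX0 : 0 ≤ X := Real.rpow_nonneg (by linarith) _
  set C : ℂ → ℂ := fun μ => fund α 0 μ X
  set S : ℂ → ℂ := fun μ => fund α 1 μ X
  set C1 : ℂ → ℂ := fun μ => fund1 α 0 μ X
  set S1 : ℂ → ℂ := fun μ => fund1 α 1 μ X
  have dC : Differentiable ℂ C := differentiable_fund hα hα2 (Or.inl rfl) _
  have dS : Differentiable ℂ S := differentiable_fund hα hα2 (Or.inr rfl) _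
  have dC1 : Differentiable ℂ C1 := differentiable_fund1 hα hα2 (Or.inl rfl) _
  have dS1 : Differentiable ℂ S1 := differentiable_fund1 hα hα2 (Or.inr rfl) _
  have hW : ∀ μ, C μ * S1 μ - C1 μ * S μ = 1 := fun μ => by
    have := sol_wronskian hα hα2 1 0 μ hX0 0 1
    simpa [sol, sol1] using this
  set a0 : ℂ → ℂ := fun μ => S1 μ - S μ
  set b0 : ℂ → ℂ := fun μ => C μ - C1 μ
  set G : ℂ → ℝ → ℂ := fun μ s => sol α (a0 μ) (b0 μ) μ (X + s : ℝ)
  set G1 : ℂ → ℝ → ℂ := fun μ s => sol1 α (a0 μ) (b0 μ) μ (X + s : ℝ)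
  set V : ℂ → ℝ → ℂ := fun μ s => sol α (-S μ) (C μ) μ (X + s : ℝ)
  set V1 : ℂ → ℝ → ℂ := fun μ s => sol1 α (-S μ) (C μ) μ (X + s : ℝ)
  have hG : ∀ μ, IsSol (fun s => ((X + s : ℝ) : ℂ) ^ (α : ℂ) - μ) (G μ) (G1 μ) := fun μ =>
    isSol_real hα hα2 _ _ μ hX0
  have hV : ∀ μ, IsSol (fun s => ((X + s : ℝ) : ℂ) ^ (α : ℂ) - μ) (V μ) (V1 μ) := fun μ =>
    isSol_real hα hα2 _ _ μ hX0
  have hG0 : ∀ μ, G μ 0 = 1 := fun μ => by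
    simp only [G, sol, add_zero, a0, b0]; linear_combination hW μ
  have hG10 : ∀ μ, G1 μ 0 = 1 := fun μ => by
    simp only [G1, sol1, add_zero, a0, b0]; linear_combination hW μ
  have hV0 : ∀ μ, V μ 0 = 0 := fun μ => by
    simp only [V, sol, add_zero]; ring
  have hV10 : ∀ μ, V1 μ 0 = 1 := fun μ => by
    simp only [V1, sol1, add_zero]; linear_combination hW μ
  have hgrow : ∀ μ ∈ Metric.ball (0 : ℂ) M, ∀ s t, 0 ≤ s → s ≤ t →
      ‖G μ s‖ ^ 2 * Real.exp (t - s) ≤ ‖G μ t‖ ^ 2 := fun μ hμ s t hs hst =>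
    (hG μ).growing (hG0 μ) (hG10 μ)
      (fun s hs => re_ge_real hα le_rfl (mem_ball_zero_iff.1 hμ).le hs.le) hs hst
  have hGexp : ∀ μ ∈ Metric.ball (0 : ℂ) M, ∀ t, 0 ≤ t → Real.exp t ≤ ‖G μ t‖ ^ 2 := by
    intro μ hμ t ht
    have := hgrow μ hμ 0 t le_rfl ht
    simpa [hG0] using this
  have hGne : ∀ μ ∈ Metric.ball (0 : ℂ) M, ∀ t, 0 ≤ t → G μ t ≠ 0 := by
    intro μ hμ t ht h0
    have := hGexp μ hμ t ht
    rw [h0] at this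
    simp at this
    exact absurd this (not_le.2 (Real.exp_pos t))
  set J : ℂ → ℂ := fun μ => ∫ s in Ioi (0 : ℝ), (G μ s ^ 2)⁻¹
  have hcont : ∀ μ ∈ Metric.ball (0 : ℂ) M, ContinuousOn (fun s => (G μ s ^ 2)⁻¹) (Ici 0) :=
    fun μ hμ => ((hG μ).cont.pow 2).inv₀ fun s hs => pow_ne_zero 2 (hGne μ hμ s hs)
  have hbd : ∀ μ ∈ Metric.ball (0 : ℂ) M, ∀ s, 0 ≤ s → ‖(G μ s ^ 2)⁻¹‖ ≤ Real.exp (-s) := by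
    intro μ hμ s hs
    rw [norm_inv, norm_pow, Real.exp_neg]
    exact inv_anti₀ (Real.exp_pos s) (hGexp μ hμ s hs)
  have hmeas : ∀ μ ∈ Metric.ball (0 : ℂ) M,
      AEStronglyMeasurable (fun s => (G μ s ^ 2)⁻¹) (volume.restrict (Ioi 0)) := fun μ hμ =>
    ((hcont μ hμ).mono Ioi_subset_Ici_self).aestronglyMeasurable measurableSet_Ioi
  have hdG : ∀ s, Differentiable ℂ fun μ => G μ s := fun s => by
    have h1 := differentiable_fund (α := α) (σ := 0) hα hα2 (Or.inl rfl) ((X + s : ℝ) : ℂ)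
    have h2 := differentiable_fund (α := α) (σ := 1) hα hα2 (Or.inr rfl) ((X + s : ℝ) : ℂ)
    exact ((dS1.sub dS).mul h1).add ((dC.sub dC1).mul h2)
  have hJ : DifferentiableOn ℂ J (Metric.ball 0 M) := by
    refine differentiableOn_integral Metric.isOpen_ball (bound := fun s => Real.exp (-s)) hmeas ?_ ?_
      (integrableOn_exp_neg_Ioi 0)
    · refine (ae_restrict_iff' measurableSet_Ioi).2 (Filter.Eventually.of_forall fun s hs => ?_)
      exact ((hdG s).pow 2).differentiableOn.inv fun μ hμ =>
        pow_ne_zero 2 (hGne μ hμ s (le_of_lt hs))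
    · exact (ae_restrict_iff' measurableSet_Ioi).2 (Filter.Eventually.of_forall fun s hs μ hμ =>
        hbd μ hμ s (le_of_lt hs))
  refine ⟨fun μ => J μ * a0 μ + S μ, fun μ => J μ * b0 μ - C μ,
    (hJ.mul (dS1.sub dS).differentiableOn).add dS.differentiableOn,
    (hJ.mul (dC.sub dC1).differentiableOn).sub dC.differentiableOn, fun μ hμ => ⟨?_, ?_⟩⟩
  · by_contra! hcon
    obtain ⟨h1, h2⟩ := hcon
    have hs : J μ * G μ 0 - V μ 0 = 0 := by
      have : J μ * G μ 0 - V μ 0 = (J μ * a0 μ + S μ) * C μ + (J μ * b0 μ - C μ) * S μ := by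
        simp only [G, V, sol, add_zero, C, S]; ring
      rw [this, h1, h2]; ring
    have hs1 : J μ * G1 μ 0 - V1 μ 0 = 0 := by
      have : J μ * G1 μ 0 - V1 μ 0 = (J μ * a0 μ + S μ) * C1 μ + (J μ * b0 μ - C μ) * S1 μ := by
        simp only [G1, V1, sol1, add_zero, C1, S1]; ring
      rw [this, h1, h2]; ring
    rw [hG0, hV0] at hs
    rw [hG10, hV10] at hs1
    have : (1 : ℂ) = 0 := by linear_combination hs - hs1
    exact one_ne_zero this
  · have hbig : ∀ s, 0 ≤ s →
        ‖sol α (J μ * a0 μ + S μ) (J μ * b0 μ - C μ) μ (X + s : ℝ)‖ ≤ 1 := by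
      intro s hs
      have e1 : sol α (J μ * a0 μ + S μ) (J μ * b0 μ - C μ) μ (X + s : ℝ) = J μ * G μ s - V μ s := by
        simp only [G, V, sol]; ring
      have hinteg : IntegrableOn (fun s => (G μ s ^ 2)⁻¹) (Ioi 0) :=
        (integrableOn_exp_neg_Ioi 0).mono' (hmeas μ hμ)
          ((ae_restrict_iff' measurableSet_Ioi).2 (Filter.Eventually.of_forall fun s hs =>
            hbd μ hμ s (le_of_lt hs)))
      have e2 : ∫ t in (0 : ℝ)..s, (G μ t ^ 2)⁻¹ = V μ s / G μ s := by
        have := intervalIntegral.integral_eq_sub_of_hasDerivAt_of_le hs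
          (f := fun t => V μ t / G μ t) (f' := fun t => (G μ t ^ 2)⁻¹)
          (((hV μ).cont.mono fun t ht => ht.1).div ((hG μ).cont.mono fun t ht => ht.1)
            fun t ht => hGne μ hμ t ht.1) (fun t ht => by
              have hd := ((hV μ).deriv t ht.1).div ((hG μ).deriv t ht.1) (hGne μ hμ t ht.1.le)
              have hw := (hG μ).wronskian (hV μ) ht.1.le
              rw [hG0, hG10, hV0, hV10] at hw
              convert! hd using 1
              rw [inv_eq_one_div]
              congr 1
              linear_combination -hw)
          (((hcont μ hμ).mono fun t ht => ht.1).intervalIntegrable_of_Icc hs)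
        rw [this, hV0]; simp
      have e3 : J μ = V μ s / G μ s + ∫ t in Ioi s, (G μ t ^ 2)⁻¹ := by
        rw [← e2, intervalIntegral.integral_of_le hs, ← setIntegral_union Ioc_disjoint_Ioi_same
          measurableSet_Ioi (hinteg.mono_set Ioc_subset_Ioi_self)
          (hinteg.mono_set (Ioi_subset_Ioi hs)), Ioc_union_Ioi_eq_Ioi hs]
      have hGs := hGne μ hμ s hs
      rw [e1, e3, add_mul, div_mul_cancel₀ _ hGs, add_sub_cancel_left, norm_mul]
      have hGp : 0 < ‖G μ s‖ := norm_pos_iff.2 hGs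
      have e4 : ‖∫ t in Ioi s, (G μ t ^ 2)⁻¹‖ ≤ ∫ t in Ioi s, Real.exp s / ‖G μ s‖ ^ 2 * Real.exp (-t) := by
        refine norm_integral_le_of_norm_le ((integrableOn_exp_neg_Ioi s).const_mul _) ?_
        refine (ae_restrict_iff' measurableSet_Ioi).2 (Filter.Eventually.of_forall fun t ht => ?_)
        have := hgrow μ hμ s t hs (le_of_lt ht)
        rw [norm_inv, norm_pow]
        refine (inv_anti₀ (by positivity) this).trans (le_of_eq ?_)
        rw [mul_inv, ← Real.exp_neg, neg_sub, Real.exp_sub, Real.exp_neg]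
        field_simp
      rw [integral_const_mul, integral_exp_neg_Ioi, Real.exp_neg] at e4
      have e5 : Real.exp s / ‖G μ s‖ ^ 2 * (Real.exp s)⁻¹ = (‖G μ s‖ ^ 2)⁻¹ := by
        have := Real.exp_ne_zero s
        field_simp
      rw [e5] at e4
      have h1 : 1 ≤ ‖G μ s‖ := by
        have := (Real.one_le_exp hs).trans (hGexp μ hμ s hs)
        nlinarith
      calc _ ≤ (‖G μ s‖ ^ 2)⁻¹ * ‖G μ s‖ := by gcongr
        _ = ‖G μ s‖⁻¹ := by field_simp
        _ ≤ 1 := inv_le_one_of_one_le₀ h1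
    have hsm : ∀ z : ℂ, ‖z‖ ≤ X + 1 → ‖sol α (J μ * a0 μ + S μ) (J μ * b0 μ - C μ) μ z‖ ≤
        (‖J μ * a0 μ + S μ‖ + ‖J μ * b0 μ - C μ‖) *
          ((X + 1) * Real.exp (2 * growth α (X + 1) ‖μ‖)) := fun z hz =>
      norm_sol_le hα hα2 _ _ μ (by linarith) hz le_rfl
    refine ⟨max 1 ((‖J μ * a0 μ + S μ‖ + ‖J μ * b0 μ - C μ‖) *
      ((X + 1) * Real.exp (2 * growth α (X + 1) ‖μ‖))), fun x hx => ?_⟩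
    rcases le_total x X with h | h
    · refine le_max_of_le_right (hsm _ ?_)
      rw [Complex.norm_real, Real.norm_of_nonneg hx]; linarith
    · refine le_max_of_le_left ?_
      have := hbig (x - X) (by linarith)
      rwa [add_sub_cancel] at this

lemma Sub.isDecaying_real {μ a b : ℂ} (h : Sub α μ a b) {X : ℝ}
    (hX : (‖μ‖ + 1) ^ (1 / α) ≤ X) :
    IsDecaying (fun s => ((X + s : ℝ) : ℂ) ^ (α : ℂ) - μ) (fun s => sol α a b μ (X + s : ℝ))
      (fun s => sol1 α a b μ (X + s : ℝ)) 1 1 where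
  toIsSol := isSol_real hα hα2 a b μ ((Real.rpow_nonneg (by positivity) _).trans hX)
  e_pos := by simp
  e_le := by simp
  d_nonneg := zero_le_one
  q_ge s hs := by rw [one_mul]; exact re_ge_real hα hX le_rfl hs.le
  bdd := by
    obtain ⟨B, hB⟩ := h.2
    exact ⟨B, fun s hs => hB _ (by
      have := (Real.rpow_nonneg (show 0 ≤ ‖μ‖ + 1 by positivity) (1 / α)).trans hX
      linarith)⟩

lemma sol_eq_zero_of_data {μ a b : ℂ} {x : ℝ} (hx : 0 ≤ x) (h0 : sol α a b μ x = 0)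
    (h1 : sol1 α a b μ x = 0) : a = 0 ∧ b = 0 := by
  have e1 := sol_wronskian hα hα2 a b μ hx 0 1
  have e2 := sol_wronskian hα hα2 a b μ hx 1 0
  rw [h0, h1] at e1 e2
  constructor
  · simpa using e1.symm
  · simpa using e2.symm

lemma exists_ne_zero {μ a b : ℂ} (h : a ≠ 0 ∨ b ≠ 0) {x : ℝ} (hx : 0 ≤ x) :
    ∃ t, x < t ∧ sol α a b μ t ≠ 0 := by
  by_contra! hcon
  have hx1 : 0 < x + 1 := by linarith
  have h0 := hcon (x + 1) (by linarith)
  have hd : HasDerivAt (fun s : ℝ => sol α a b μ s) (sol1 α a b μ (x + 1 : ℝ)) (x + 1) := by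
    have := (hasDerivAt_sol hα hα2 a b μ (z := ((x + 1 : ℝ) : ℂ))
      (Or.inl (by rw [Complex.ofReal_re]; exact hx1))).comp_ofReal
    exact this
  have hd0 : HasDerivAt (fun s : ℝ => sol α a b μ s) 0 (x + 1) := by
    refine (hasDerivAt_const (x + 1) (0 : ℂ)).congr_of_eventuallyEq ?_
    filter_upwards [Ioi_mem_nhds (show x < x + 1 by linarith)] with t ht using hcon t ht
  obtain ⟨h1, h2⟩ := sol_eq_zero_of_data hα hα2 hx1.le h0 (hd.unique hd0)
  rcases h with h | h <;> contradiction

lemma Sub.sol_ne_zero {μ a b : ℂ} (h : Sub α μ a b) {X : ℝ} (hX : (‖μ‖ + 1) ^ (1 / α) ≤ X) :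
    sol α a b μ X ≠ 0 := by
  intro h0
  have hX0 : 0 ≤ X := (Real.rpow_nonneg (by positivity) _).trans hX
  obtain ⟨t, ht, hne⟩ := exists_ne_zero hα hα2 (μ := μ) h.1 hX0
  have := (h.isDecaying_real hα hα2 hX).flux_pos one_pos le_rfl
    ⟨t - X, by linarith, by simpa using hne⟩
  simp [flux, h0] at this

lemma Sub.unique {μ a b a' b' : ℂ} (h : Sub α μ a b) (h' : Sub α μ a' b') :
    ∃ c : ℂ, c ≠ 0 ∧ a' = c * a ∧ b' = c * b := by
  set X := (‖μ‖ + 1) ^ (1 / α) with hX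
  have hn := h.sol_ne_zero hα hα2 (hX.ge)
  have hn' := h'.sol_ne_zero hα hα2 (hX.ge)
  set u := sol α a b μ X with hu
  set u' := sol α a' b' μ X with hu'
  have hlin : ∀ x : ℂ, sol α (u' * a - u * a') (u' * b - u * b') μ x
      = u' * sol α a b μ x - u * sol α a' b' μ x := fun x => by unfold sol; ring
  have hz : u' * a - u * a' = 0 ∧ u' * b - u * b' = 0 := by
    by_contra hcon
    have hs : Sub α μ (u' * a - u * a') (u' * b - u * b') := by
      refine ⟨by tauto, ?_⟩
      obtain ⟨B, hB⟩ := h.2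
      obtain ⟨B', hB'⟩ := h'.2
      refine ⟨‖u'‖ * B + ‖u‖ * B', fun x hx => ?_⟩
      rw [hlin]
      refine (norm_sub_le _ _).trans ?_
      rw [norm_mul, norm_mul]
      have := hB x hx
      have := hB' x hx
      gcongr
    refine hs.sol_ne_zero hα hα2 hX.ge ?_
    rw [hlin, ← hu, ← hu']; ring
  refine ⟨u' / u, div_ne_zero hn' hn, ?_, ?_⟩
  · field_simp; linear_combination -hz.1
  · field_simp; linear_combination -hz.2

lemma exists_sub (μ : ℂ) : ∃ a b, Sub α μ a b := by
  obtain ⟨a, b, -, -, h⟩ := exists_local_sub hα hα2 (M := ‖μ‖ + 1) (by positivity)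
  exact ⟨a μ, b μ, h μ (by simp)⟩

end
end Anharmonic

namespace Anharmonic

/-- A power of exponent less than `2` is eventually dominated by the square. -/
lemma eventually_rpow_le_sq {α : ℝ} (hα : 0 < α) (hα2 : α < 2) {A B E : ℝ} (hA : 0 ≤ A)
    (hE : 0 ≤ E) : ∀ᶠ x : ℝ in Filter.atTop, A * ((x + E) ^ α + B) ≤ x ^ 2 := by
  have h1 : Filter.Tendsto (fun x : ℝ => (2 : ℝ) ^ α * A * x ^ (-(2 - α)) + A * B * x ^ (-(2 : ℝ)))
      Filter.atTop (nhds ((2 : ℝ) ^ α * A * 0 + A * B * 0)) :=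
    ((tendsto_rpow_neg_atTop (by linarith)).const_mul _).add
      ((tendsto_rpow_neg_atTop (by norm_num)).const_mul _)
  simp only [mul_zero, add_zero] at h1
  filter_upwards [h1.eventually_le_const (show (0 : ℝ) < 1 by norm_num),
    Filter.eventually_gt_atTop 0, Filter.eventually_ge_atTop E] with x hx hx0 hxE
  have h2 : (x + E) ^ α ≤ (2 : ℝ) ^ α * x ^ α := by
    rw [← Real.mul_rpow (by norm_num) hx0.le]
    exact Real.rpow_le_rpow (by linarith) (by linarith) hα.le
  have e1 : x ^ (-(2 - α)) * x ^ 2 = x ^ α := by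
    rw [← Real.rpow_natCast x 2, ← Real.rpow_add hx0]; congr 1; push_cast; ring
  have e2 : x ^ (-(2 : ℝ)) * x ^ 2 = 1 := by
    rw [← Real.rpow_natCast x 2, ← Real.rpow_add hx0]; norm_num
  calc A * ((x + E) ^ α + B) ≤ A * ((2 : ℝ) ^ α * x ^ α + B) := by gcongr
    _ = ((2 : ℝ) ^ α * A * x ^ (-(2 - α)) + A * B * x ^ (-(2 : ℝ))) * x ^ 2 := by
        rw [← e1]; linear_combination (- A * B) * e2
    _ ≤ 1 * x ^ 2 := by gcongr
    _ = x ^ 2 := one_mul _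

section
variable {α : ℝ} (hα : 0 < α) (hα2 : α < 2)
include hα hα2

/-- Exponential decay of the subdominant solution along the positive axis. -/
lemma Sub.exp_decay {μ a b : ℂ} (h : Sub α μ a b) : ∃ C X : ℝ, 0 ≤ C ∧ ∀ x, X ≤ x →
    (‖μ‖ + 1) ^ (1 / α) ≤ x ∧ ‖sol α a b μ x‖ ^ 2 ≤ C * Real.exp (-2 * x) := by
  set X := (‖μ‖ + 1) ^ (1 / α) with hX
  have hd := h.isDecaying_real hα hα2 hX.ge
  set U : ℝ → ℂ := fun s => sol α a b μ (X + s : ℝ) with hU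
  set U1 : ℝ → ℂ := fun s => sol1 α a b μ (X + s : ℝ) with hU1
  have hanti : AntitoneOn (fun s => ‖U s‖ ^ 2) (Ici 0) := by
    refine antitoneOn_of_deriv_nonpos (convex_Ici 0) (hd.cont.norm.pow 2) ?_ ?_ <;>
    intro x hx <;> rw [interior_Ici] at hx
    · exact (hasDerivAt_norm_sq (hd.deriv x hx)).differentiableAt.differentiableWithinAt
    · rw [(hasDerivAt_norm_sq (hd.deriv x hx)).deriv]
      have := hd.flux_nonneg (le_of_lt hx)
      simp only [flux, one_mul] at this
      linarith
  have hF : 0 ≤ flux 1 U U1 0 := hd.flux_nonneg le_rfl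
  refine ⟨flux 1 U U1 0 * Real.exp (2 * (X + 1)), X + 1, by positivity, fun x hx => ⟨by linarith, ?_⟩⟩
  have hs : 0 ≤ x - X - 1 := by linarith
  have h1 := (hd.shift hs).integral_sq_le zero_le_one
  have h2 : flux 1 (fun s => U (x - X - 1 + s)) (fun s => U1 (x - X - 1 + s)) 0
      = flux 1 U U1 (x - X - 1) := by simp [flux]
  rw [h2, one_mul] at h1
  have h3 : ∫ s in (0 : ℝ)..1, ‖U (x - X)‖ ^ 2 ≤ ∫ s in (0 : ℝ)..1, ‖U (x - X - 1 + s)‖ ^ 2 := by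
    refine intervalIntegral.integral_mono_on zero_le_one (by simp)
      ((hd.shift hs).intervalIntegrable_sq zero_le_one) fun s hs' => ?_
    exact hanti (show 0 ≤ x - X - 1 + s by linarith [hs'.1]) (show 0 ≤ x - X by linarith)
      (by linarith [hs'.2])
  have h4 := hd.flux_exp_decay hs
  simp only [Complex.one_re, mul_one, Real.sqrt_one] at h4
  have h5 : U (x - X) = sol α a b μ x := by simp [hU]
  rw [h5] at h3
  simp only [intervalIntegral.integral_const, sub_zero, one_smul] at h3
  rw [mul_assoc, ← Real.exp_add]
  refine h3.trans (h1.trans (h4.trans (le_of_eq ?_)))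
  congr 2; ring

/-- The subdominant solution is bounded on every horizontal half-line. -/
lemma Sub.bdd_line {μ a b : ℂ} (h : Sub α μ a b) {z : ℂ} (hz : 0 ≤ z.re) :
    ∃ B : ℝ, ∀ s : ℝ, 0 ≤ s → ‖sol α a b μ (z + s)‖ ≤ B := by
  obtain ⟨C, X, hC, hdec⟩ := h.exp_decay hα hα2
  set y := z.im with hy
  set K : ℝ → ℝ := fun x => √((x + (1 + |y|)) ^ α + (‖μ‖ + 1)) with hK
  have hK2 : ∀ x, 0 ≤ x → K x ^ 2 = (x + (1 + |y|)) ^ α + (‖μ‖ + 1) := fun x hx =>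
    Real.sq_sqrt (by positivity)
  have hK1 : ∀ x, 0 ≤ x → 1 ≤ K x := fun x hx => by
    have := hK2 x hx
    have h0 : 0 ≤ (x + (1 + |y|)) ^ α := by positivity
    have h1 := norm_nonneg μ
    have h2 : 0 ≤ K x := Real.sqrt_nonneg _
    nlinarith
  have hev := eventually_rpow_le_sq hα hα2 (A := (1 + |y|) ^ 2) (B := ‖μ‖ + 1) (E := 1 + |y|)
    (by positivity) (by positivity)
  obtain ⟨Y, hY⟩ := Filter.eventually_atTop.1 hev
  set T := max (max X Y) 1 with hT
  have hbig : ∀ x, T ≤ x → ‖sol α a b μ (x + y * Complex.I)‖ ^ 2 ≤ 26 * C := by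
    intro x hx
    have hx1 : 1 ≤ x := (le_max_right _ _).trans hx
    have hxX : X ≤ x := ((le_max_left _ _).trans (le_max_left _ _)).trans hx
    have hxY : Y ≤ x := ((le_max_right _ _).trans (le_max_left _ _)).trans hx
    obtain ⟨hx2, hdx⟩ := hdec x hxX
    obtain ⟨σ, hσ, hσy⟩ : ∃ σ : ℝ, |σ| = 1 ∧ |y| * σ = y := by
      rcases le_total 0 y with h0 | h0
      · exact ⟨1, by simp, by rw [abs_of_nonneg h0]; ring⟩
      · exact ⟨-1, by simp, by rw [abs_of_nonpos h0]; ring⟩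
    have hnd : ‖(σ : ℂ) * Complex.I‖ = 1 := by simp [hσ]
    have hv := isSol_line hα hα2 a b μ (x : ℂ) (σ * Complex.I) (by simp; linarith)
      (fun s hs => by simp; linarith)
    have hKx := hK1 x (by linarith)
    have hg := hv.gronwall (K := K x) (T := |y|) (by linarith) (fun s hs => by
      rw [norm_mul, norm_pow, hnd, one_pow, one_mul, hK2 x (by linarith)]
      refine (norm_sub_le _ _).trans ?_
      have h1 : ‖((x : ℂ) + s * (σ * Complex.I))‖ ≤ x + (1 + |y|) := by
        refine (norm_add_le _ _).trans ?_
        rw [norm_mul, hnd, Complex.norm_real, Complex.norm_real, Real.norm_of_nonneg (by linarith),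
          Real.norm_of_nonneg hs.1.le]
        linarith [hs.2]
      have h2 : ‖((x : ℂ) + s * (σ * Complex.I)) ^ (α : ℂ)‖ ≤ (x + (1 + |y|)) ^ α := by
        rw [Complex.norm_cpow_real]
        exact Real.rpow_le_rpow (norm_nonneg _) h1 hα.le
      linarith) (s := |y|) (t := 0) (by simp) (by simp)
    have hU : (x : ℂ) + ((|y| : ℝ) : ℂ) * (σ * Complex.I) = x + y * Complex.I := by
      rw [← mul_assoc, ← Complex.ofReal_mul, hσy]
    rw [hU] at hg
    simp only [Complex.ofReal_zero, zero_mul, add_zero, norm_mul, hnd, one_mul, sub_zero,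
      abs_abs] at hg
    have hd := (h.isDecaying_real hα hα2 hx2).norm_deriv_zero_le one_pos (ℓ := 1) (k := 1)
      (B := K x ^ 2) one_pos one_pos (fun s hs => by
        rw [hK2 x (by linarith)]
        refine (norm_sub_le _ _).trans ?_
        rw [Complex.norm_cpow_real, Complex.norm_real, Real.norm_of_nonneg (by linarith [hs.1])]
        have := Real.rpow_le_rpow (by linarith [hs.1]) (show x + s ≤ x + (1 + |y|) by
          linarith [hs.2, abs_nonneg y]) hα.le
        linarith)
    simp only [Complex.one_re, mul_one, add_zero, div_one] at hd
    have hexp : 1 + 2 * K x ^ 2 ≤ 5 * Real.exp (K x) := by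
      have := Real.quadratic_le_exp_of_nonneg (show 0 ≤ K x by linarith)
      nlinarith
    have hKlin : K x * (1 + |y|) ≤ x := by
      have := hY x hxY
      refine abs_le_of_sq_le_sq' ?_ (by linarith) |>.2
      rw [mul_pow, hK2 x (by linarith)]; linarith
    have hu1 : ‖sol1 α a b μ x‖ ^ 2 ≤ 25 * Real.exp (2 * K x) * ‖sol α a b μ x‖ ^ 2 := by
      have e : Real.exp (2 * K x) = Real.exp (K x) ^ 2 := by rw [← Real.exp_nat_mul]; norm_num
      have : ‖sol1 α a b μ x‖ ≤ 5 * Real.exp (K x) * ‖sol α a b μ x‖ := by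
        refine hd.trans ?_
        gcongr
        linarith
      calc _ ≤ (5 * Real.exp (K x) * ‖sol α a b μ x‖) ^ 2 := by gcongr
        _ = _ := by rw [e]; ring
    have h3 : K x ^ 2 * ‖sol α a b μ (x + y * Complex.I)‖ ^ 2 ≤
        K x ^ 2 * (26 * C) := by
      have hK21 : 1 ≤ K x ^ 2 := one_le_pow₀ hKx
      have he1 : 1 ≤ Real.exp (2 * K x) := Real.one_le_exp (by linarith)
      calc _ ≤ (K x ^ 2 * ‖sol α a b μ x‖ ^ 2 + ‖sol1 α a b μ x‖ ^ 2) *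
            Real.exp (2 * K x * |y|) := by
              refine le_trans ?_ hg
              exact le_add_of_nonneg_right (sq_nonneg _)
        _ ≤ (K x ^ 2 * (Real.exp (2 * K x) * ‖sol α a b μ x‖ ^ 2) +
              K x ^ 2 * (25 * Real.exp (2 * K x) * ‖sol α a b μ x‖ ^ 2)) *
              Real.exp (2 * K x * |y|) := by
            gcongr
            · exact le_mul_of_one_le_left (sq_nonneg _) he1
            · exact hu1.trans (le_mul_of_one_le_left (by positivity) hK21)
        _ = K x ^ 2 * (26 * ‖sol α a b μ x‖ ^ 2) * Real.exp (2 * (K x * (1 + |y|))) := by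
            rw [show 2 * (K x * (1 + |y|)) = 2 * K x + 2 * K x * |y| by ring, Real.exp_add]; ring
        _ ≤ K x ^ 2 * (26 * (C * Real.exp (-2 * x))) * Real.exp (2 * x) := by gcongr
        _ = K x ^ 2 * (26 * C) * (Real.exp (-2 * x) * Real.exp (2 * x)) := by ring
        _ = _ := by rw [← Real.exp_add]; simp
    exact le_of_mul_le_mul_left h3 (by positivity)
  have hzs : ∀ s : ℝ, z + s = ((z.re + s : ℝ) : ℂ) + y * Complex.I := fun s => by
    apply Complex.ext <;> simp [hy]
  refine ⟨max (√(26 * C)) ((‖a‖ + ‖b‖) * ((T + |y| + 1) *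
    Real.exp (2 * growth α (T + |y| + 1) ‖μ‖))), fun s hs => ?_⟩
  have hT1 : 1 ≤ T := le_max_right _ _
  rcases le_total T (z.re + s) with hTs | hTs
  · refine le_max_of_le_left (Real.le_sqrt_of_sq_le ?_)
    rw [hzs]
    exact hbig _ hTs
  · refine le_max_of_le_right (norm_sol_le hα hα2 a b μ (by linarith [abs_nonneg y]) ?_ le_rfl)
    rw [hzs]
    refine (norm_add_le _ _).trans ?_
    rw [norm_mul, Complex.norm_I, Complex.norm_real, Complex.norm_real, Real.norm_eq_abs,
      Real.norm_eq_abs, abs_of_nonneg (by linarith)]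
    linarith

/-- Boundedness along a horizontal line upgraded to the decaying situation. -/
lemma Sub.isDecaying_line {μ a b : ℂ} (h : Sub α μ a b) {z e : ℂ} {d : ℝ} (hz : 0 ≤ z.re)
    (he : 0 < e.re) (he1 : ‖e‖ ≤ 1) (hd : 0 ≤ d)
    (hq : ∀ s : ℝ, 0 < s → d ≤ (e * ((z + s) ^ (α : ℂ) - μ)).re) :
    IsDecaying (fun s => (z + s) ^ (α : ℂ) - μ) (fun s => sol α a b μ (z + s))
      (fun s => sol1 α a b μ (z + s)) e d where
  toIsSol := by
    have := isSol_line hα hα2 a b μ z 1 hz (fun s hs => by simp; linarith)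
    simpa using this
  e_pos := he
  e_le := he1
  d_nonneg := hd
  q_ge := hq
  bdd := h.bdd_line hα hα2 hz

end
end Anharmonic

namespace Anharmonic

lemma arg_add_real_mem {z : ℂ} (hz : 0 < z.re) {s : ℝ} (hs : 0 ≤ s) :
    (0 ≤ (z + s).arg ∧ (z + s).arg ≤ z.arg) ∨ (z.arg ≤ (z + s).arg ∧ (z + s).arg ≤ 0) := by
  have hn : ‖z‖ ≤ ‖z + s‖ := by
    rw [← sq_le_sq₀ (norm_nonneg _) (norm_nonneg _), ← Complex.normSq_eq_norm_sq,
      ← Complex.normSq_eq_norm_sq, Complex.normSq_apply, Complex.normSq_apply]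
    simp only [Complex.add_re, Complex.add_im, Complex.ofReal_re, Complex.ofReal_im, add_zero]
    nlinarith
  have hzp : 0 < ‖z‖ := norm_pos_iff.2 fun h => by simp [h] at hz
  have e1 : (z + s).arg = Real.arcsin (z.im / ‖z + s‖) := by
    rw [Complex.arg_of_re_nonneg (by simp; linarith)]; simp
  rw [e1, Complex.arg_of_re_nonneg hz.le]
  rcases le_total 0 z.im with h | h
  · exact Or.inl ⟨Real.arcsin_nonneg.2 (by positivity),
      Real.monotone_arcsin (div_le_div_of_nonneg_left h hzp hn)⟩
  · refine Or.inr ⟨Real.monotone_arcsin ?_, Real.arcsin_nonpos.2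
      (div_nonpos_of_nonpos_of_nonneg h (norm_nonneg _))⟩
    rw [div_le_div_iff₀ hzp (hzp.trans_le hn)]
    nlinarith

section
variable {α : ℝ}

/-- The domain on which the real part of `e^{iω} (z^α - μ)` is positive and increases to the
right. -/
def region (α ω : ℝ) (μ : ℂ) : Set ℂ :=
  {z | 0 < z.re ∧ |ω + (α - 1) * z.arg| < Real.pi / 2 ∧
    0 < (Complex.exp (ω * Complex.I) * (z ^ (α : ℂ) - μ)).re}

lemma isOpen_region (ω : ℝ) (μ : ℂ) : IsOpen (region α ω μ) := by
  have h1 : IsOpen {z : ℂ | 0 < z.re} := isOpen_lt continuous_const Complex.continuous_re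
  have hc : ContinuousOn (fun z : ℂ => |ω + (α - 1) * z.arg|) {z : ℂ | 0 < z.re} := fun z hz =>
    ((continuousAt_const.add (continuousAt_const.mul
      (Complex.continuousAt_arg (Or.inl hz)))).abs).continuousWithinAt
  have hc2 : ContinuousOn (fun z : ℂ => (Complex.exp (ω * Complex.I) * (z ^ (α : ℂ) - μ)).re)
      {z : ℂ | 0 < z.re} := fun z hz =>
    (Complex.continuous_re.continuousAt.comp (continuousAt_const.mul
      ((continuousAt_id.cpow continuousAt_const (Or.inl hz)).sub
        continuousAt_const))).continuousWithinAt
  have := (hc.isOpen_inter_preimage h1 (isOpen_Iio (a := Real.pi / 2))).inter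
    (hc2.isOpen_inter_preimage h1 (isOpen_Ioi (a := 0)))
  convert! this using 1
  ext z
  simp only [region, mem_ofPred_eq, mem_inter_iff, mem_preimage, mem_Iio, mem_Ioi]
  tauto

lemma re_exp_mul_cpow (ω : ℝ) {z : ℂ} (hz : z ≠ 0) (γ : ℝ) :
    (Complex.exp (ω * Complex.I) * z ^ (γ : ℂ)).re = ‖z‖ ^ γ * Real.cos (ω + γ * z.arg) := by
  rw [Complex.cpow_def_of_ne_zero hz, ← Complex.exp_add, Complex.exp_re]
  congr 1
  · rw [Real.rpow_def_of_pos (norm_pos_iff.2 hz)]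
    simp [Complex.log_re]
  · simp [Complex.log_im]; ring_nf

/-- Monotonicity to the right of `Re e^{iω} z^α`. -/
lemma re_line_mono {ω : ℝ} {z : ℂ} (μ : ℂ) (hα : 0 < α) (hz : 0 < z.re) (h1 : |ω| ≤ Real.pi / 2)
    (h2 : |ω + (α - 1) * z.arg| ≤ Real.pi / 2) {s : ℝ} (hs : 0 ≤ s) :
    (Complex.exp (ω * Complex.I) * (z ^ (α : ℂ) - μ)).re ≤
      (Complex.exp (ω * Complex.I) * ((z + s) ^ (α : ℂ) - μ)).re := by
  have hre : ∀ s : ℝ, 0 ≤ s → 0 < (z + s).re := fun s hs => by simp; linarith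
  have hder : ∀ s : ℝ, 0 ≤ s → HasDerivAt
      (fun s : ℝ => (Complex.exp (ω * Complex.I) * ((z + s) ^ (α : ℂ) - μ)).re)
      (Complex.exp (ω * Complex.I) * (α * (z + s) ^ ((α : ℂ) - 1) * 1)).re s := fun s hs => by
    refine hasDerivAt_re (HasDerivAt.const_mul _ (HasDerivAt.sub_const _ ?_))
    exact ((((hasDerivAt_id (s : ℂ)).const_add z).cpow_const (c := (α : ℂ))
      (Or.inl (hre s hs))).comp_ofReal)
  have hm : MonotoneOn (fun s : ℝ => (Complex.exp (ω * Complex.I) *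
      ((z + s) ^ (α : ℂ) - μ)).re) (Ici 0) := by
    refine monotoneOn_of_deriv_nonneg (convex_Ici 0)
      (fun s hs => (hder s hs).continuousAt.continuousWithinAt) ?_ ?_ <;>
    intro s hs <;> rw [interior_Ici] at hs
    · exact (hder s (le_of_lt hs)).differentiableAt.differentiableWithinAt
    · rw [(hder s (le_of_lt hs)).deriv]
      have hne : z + s ≠ 0 := fun h => by
        have := hre s (le_of_lt hs); rw [h] at this; simp at this
      have e := re_exp_mul_cpow ω hne (α - 1)
      rw [show Complex.exp (ω * Complex.I) * (α * (z + s) ^ ((α : ℂ) - 1) * 1)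
        = (α : ℂ) * (Complex.exp (ω * Complex.I) * (z + s) ^ (((α - 1 : ℝ)) : ℂ)) by
          push_cast; ring, Complex.re_ofReal_mul, e]
      refine mul_nonneg hα.le (mul_nonneg (by positivity) ?_)
      rw [abs_le] at h1 h2
      have harg := arg_add_real_mem hz (le_of_lt hs)
      refine Real.cos_nonneg_of_neg_pi_div_two_le_of_le ?_ ?_ <;>
      rcases harg with ⟨h3, h4⟩ | ⟨h3, h4⟩ <;> rcases le_total 0 (α - 1) with h5 | h5 <;>
      first
        | nlinarith [mul_le_mul_of_nonneg_left h4 h5, mul_le_mul_of_nonneg_left h3 h5]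
        | nlinarith [mul_le_mul_of_nonpos_left h4 h5, mul_le_mul_of_nonpos_left h3 h5]
  have := hm (self_mem_Ici) hs hs
  simpa using this

lemma exp_re_pos {ω : ℝ} (h1 : |ω| < Real.pi / 2) : 0 < (Complex.exp (ω * Complex.I)).re := by
  rw [Complex.exp_ofReal_mul_I_re]
  rw [abs_lt] at h1
  exact Real.cos_pos_of_mem_Ioo ⟨by linarith, h1.2⟩

variable (hα : 0 < α) (hα2 : α < 2)
include hα hα2

lemma sol_wronskian_re (a b μ : ℂ) {z : ℂ} (hz : 0 < z.re) (a' b' : ℂ) :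
    sol α a b μ z * sol1 α a' b' μ z - sol1 α a b μ z * sol α a' b' μ z = a * b' - b * a' := by
  have hl : ∀ s : ℝ, 0 < s → 0 < (0 + s * z : ℂ).re := fun s hs => by simp; positivity
  have := (isSol_line hα hα2 a b μ 0 z (by simp) hl).wronskian
    (isSol_line hα hα2 a' b' μ 0 z (by simp) hl) zero_le_one
  simp only [Complex.ofReal_one, one_mul, zero_add, Complex.ofReal_zero, zero_mul,
    sol_zero hα, sol1_zero hα] at this
  have hz0 : z ≠ 0 := fun h => by simp [h] at hz
  apply mul_left_cancel₀ hz0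
  linear_combination this

lemma exists_ne_zero_line {μ a b : ℂ} (h : a ≠ 0 ∨ b ≠ 0) {z : ℂ} (hz : 0 ≤ z.re) :
    ∃ t : ℝ, 0 < t ∧ sol α a b μ (z + t) ≠ 0 := by
  by_contra! hcon
  have h0 := hcon 1 one_pos
  have hre : 0 < (z + (1 : ℝ)).re := by simp; linarith
  have hd : HasDerivAt (fun s : ℝ => sol α a b μ (z + s)) (sol1 α a b μ (z + (1 : ℝ))) 1 := by
    exact ((hasDerivAt_sol hα hα2 a b μ (z := z + (1 : ℝ))
      (Or.inl hre)).comp_const_add z ((1 : ℝ) : ℂ)).comp_ofReal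
  have hd0 : HasDerivAt (fun s : ℝ => sol α a b μ (z + s)) 0 1 := by
    refine (hasDerivAt_const (1 : ℝ) (0 : ℂ)).congr_of_eventuallyEq ?_
    filter_upwards [Ioi_mem_nhds (show (0 : ℝ) < 1 by norm_num)] with t ht using hcon t ht
  have h1 := hd.unique hd0
  have e1 := sol_wronskian_re hα hα2 a b μ hre 0 1
  have e2 := sol_wronskian_re hα hα2 a b μ hre 1 0
  rw [h0, h1] at e1 e2
  rcases h with h | h
  · exact h (by simpa using e1.symm)
  · exact h (by simpa using e2.symm)

/-- Sign of the logarithmic derivative of the subdominant solution. -/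
lemma Sub.flux_pos_of_mem {μ a b : ℂ} (h : Sub α μ a b) {ω : ℝ} (hω : |ω| < Real.pi / 2) {z : ℂ}
    (hz : z ∈ region α ω μ) :
    (Complex.exp (ω * Complex.I) * (sol1 α a b μ z * conj (sol α a b μ z))).re < 0 := by
  obtain ⟨h1, h2, h3⟩ := hz
  have hd := h.isDecaying_line hα hα2 (z := z) (e := Complex.exp (ω * Complex.I)) h1.le
    (exp_re_pos hω) (Complex.norm_exp_ofReal_mul_I ω).le h3.le
    (fun s hs => re_line_mono μ hα h1 hω.le h2.le hs.le)
  have := hd.flux_pos h3 le_rfl (exists_ne_zero_line hα hα2 h.1 h1.le)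
  simp only [flux, Complex.ofReal_zero, add_zero] at this
  linarith

lemma Sub.sol_ne_zero_of_mem {μ a b : ℂ} (h : Sub α μ a b) {ω : ℝ} (hω : |ω| < Real.pi / 2) {z : ℂ}
    (hz : z ∈ region α ω μ) : sol α a b μ z ≠ 0 := fun h0 => by
  have := h.flux_pos_of_mem hα hα2 hω hz
  simp [h0] at this

lemma Sub.logDeriv_neg {μ a b : ℂ} (h : Sub α μ a b) {ω : ℝ} (hω : |ω| < Real.pi / 2) {z : ℂ}
    (hz : z ∈ region α ω μ) :
    (Complex.exp (ω * Complex.I) * (sol1 α a b μ z / sol α a b μ z)).re < 0 := by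
  have h1 := h.flux_pos_of_mem hα hα2 hω hz
  have h0 := h.sol_ne_zero_of_mem hα hα2 hω hz
  have hp : 0 < ‖sol α a b μ z‖ ^ 2 := by have := norm_pos_iff.2 h0; positivity
  have e : Complex.exp (ω * Complex.I) * (sol1 α a b μ z * conj (sol α a b μ z))
      = ((‖sol α a b μ z‖ ^ 2 : ℝ) : ℂ) *
        (Complex.exp (ω * Complex.I) * (sol1 α a b μ z / sol α a b μ z)) := by
    rw [← Complex.normSq_eq_norm_sq, ← Complex.mul_conj]; field_simp
  rw [e, Complex.re_ofReal_mul] at h1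
  by_contra! hcon
  nlinarith [mul_nonneg hp.le hcon]

/-- The logarithmic derivative almost solves the eikonal equation. -/
lemma Sub.eikonal {μ a b : ℂ} (h : Sub α μ a b) {ω : ℝ} (hω : |ω| < Real.pi / 2) {z : ℂ} {r : ℝ}
    (hr : 0 < r) (hball : Metric.ball z r ⊆ region α ω μ) :
    ‖(sol1 α a b μ z / sol α a b μ z) ^ 2 - (z ^ (α : ℂ) - μ)‖ ≤
      2 * ‖sol1 α a b μ z / sol α a b μ z‖ / r := by
  set e := Complex.exp (ω * Complex.I) with he
  have hen : ‖e‖ = 1 := Complex.norm_exp_ofReal_mul_I ω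
  set w : ℂ → ℂ := fun z => sol1 α a b μ z / sol α a b μ z with hw
  have hwd : ∀ x ∈ Metric.ball z r, HasDerivAt w ((x ^ (α : ℂ) - μ) - w x ^ 2) x := fun x hx => by
    have hx' := hball hx
    have h0 := h.sol_ne_zero_of_mem hα hα2 hω hx'
    have hs : x ∈ Complex.slitPlane := Or.inl hx'.1
    convert! (hasDerivAt_sol1 hα hα2 a b μ hs).div (hasDerivAt_sol hα hα2 a b μ hs) h0 using 1
    simp only [hw]
    field_simp
  have hneg : ∀ x ∈ Metric.ball z r, (e * w x).re < 0 := fun x hx =>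
    h.logDeriv_neg hα hα2 hω (hball hx)
  have hz : z ∈ Metric.ball z r := Metric.mem_ball_self hr
  set f0 := e * w z with hf0
  have hne : ∀ x ∈ Metric.ball z r, e * w x + conj f0 ≠ 0 := fun x hx h0 => by
    have := congrArg Complex.re h0
    simp only [Complex.add_re, Complex.conj_re, Complex.zero_re] at this
    linarith [hneg x hx, hneg z hz]
  set φ : ℂ → ℂ := fun x => (e * w x - f0) / (e * w x + conj f0) with hφ
  have hφd : ∀ x ∈ Metric.ball z r, HasDerivAt φ
      ((e * ((x ^ (α : ℂ) - μ) - w x ^ 2) * (e * w x + conj f0) -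
        (e * w x - f0) * (e * ((x ^ (α : ℂ) - μ) - w x ^ 2))) / (e * w x + conj f0) ^ 2) x :=
    fun x hx => (((hwd x hx).const_mul e).sub_const f0).div
      (((hwd x hx).const_mul e).add_const (conj f0)) (hne x hx)
  have hφ0 : φ z = 0 := by simp [hφ, hf0]
  have hb := Complex.norm_deriv_le_div_of_mapsTo_ball (f := φ) (c := z) (R₁ := r) (R₂ := 1)
    (fun x hx => (hφd x hx).differentiableAt.differentiableWithinAt) (fun x hx => by
      rw [hφ0, mem_closedBall_zero_iff]
      simp only [hφ]
      rw [norm_div, div_le_one (norm_pos_iff.2 (hne x hx)),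
        ← sq_le_sq₀ (norm_nonneg _) (norm_nonneg _), ← Complex.normSq_eq_norm_sq,
        ← Complex.normSq_eq_norm_sq, Complex.normSq_apply, Complex.normSq_apply]
      simp only [Complex.sub_re, Complex.sub_im, Complex.add_re, Complex.add_im, Complex.conj_re,
        Complex.conj_im]
      have h1 := hneg x hx
      have h2 : f0.re < 0 := hneg z hz
      nlinarith [mul_pos_of_neg_of_neg h1 h2]) hr
  rw [(hφd z hz).deriv] at hb
  have hsum : e * w z + conj f0 = ((2 * f0.re : ℝ) : ℂ) := by
    rw [← hf0, Complex.add_conj]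
  have h2 : f0.re < 0 := hneg z hz
  rw [← hf0, sub_self, zero_mul, sub_zero, hf0, hsum, sq ((2 * f0.re : ℝ) : ℂ), mul_div_mul_right _ _
    (by exact_mod_cast (by linarith : (2 * f0.re : ℝ) ≠ 0)), norm_div, norm_mul, hen, one_mul,
    Complex.norm_real, Real.norm_eq_abs, div_le_iff₀ (abs_pos.2 (by linarith)), abs_mul,
    abs_two] at hb
  have h3 : |f0.re| ≤ ‖w z‖ := by
    refine (Complex.abs_re_le_norm _).trans ?_
    rw [hf0, norm_mul, hen, one_mul]
  rw [norm_sub_rev]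
  calc _ ≤ 1 / r * (2 * |f0.re|) := hb
    _ ≤ 1 / r * (2 * ‖w z‖) := by gcongr
    _ = _ := by ring

end
end Anharmonic

namespace Anharmonic
section
variable {α : ℝ}

lemma real_mul_cpow {s : ℝ} (hs : 0 < s) (z : ℂ) (hα : 0 < α) :
    ((s : ℂ) * z) ^ (α : ℂ) = ((s ^ α : ℝ) : ℂ) * z ^ (α : ℂ) := by
  rcases eq_or_ne z 0 with rfl | hz
  · simp [Complex.zero_cpow (show (α : ℂ) ≠ 0 by exact_mod_cast hα.ne')]
  · have hs0 : (s : ℂ) ≠ 0 := by exact_mod_cast hs.ne'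
    rw [Complex.cpow_def_of_ne_zero (mul_ne_zero hs0 hz), Complex.cpow_def_of_ne_zero hz,
      Complex.log_ofReal_mul hs hz, Complex.ofReal_cpow hs.le, Complex.cpow_def_of_ne_zero hs0,
      ← Complex.ofReal_log hs.le, ← Complex.exp_add]
    congr 1; ring

lemma smul_mem_region {s ω : ℝ} (hα : 0 < α) (hs : 0 < s) {z μ : ℂ} (hz : z ∈ region α ω μ) :
    (s : ℂ) * z ∈ region α ω (((s ^ α : ℝ) : ℂ) * μ) := by
  obtain ⟨h1, h2, h3⟩ := hz
  refine ⟨by rw [Complex.re_ofReal_mul]; positivity, by rwa [Complex.arg_real_mul _ hs], ?_⟩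
  rw [real_mul_cpow hs z hα, ← mul_sub, mul_left_comm, Complex.re_ofReal_mul]
  have := Real.rpow_pos_of_pos hs α
  positivity

lemma ball_smul_subset {s r ω : ℝ} (hα : 0 < α) (hs : 0 < s) {z μ : ℂ}
    (hz : Metric.ball z r ⊆ region α ω μ) :
    Metric.ball ((s : ℂ) * z) (s * r) ⊆ region α ω (((s ^ α : ℝ) : ℂ) * μ) := by
  intro x hx
  have hs0 : (s : ℂ) ≠ 0 := by exact_mod_cast hs.ne'
  have hx' : x / s ∈ Metric.ball z r := by
    rw [mem_ball_iff_norm] at hx ⊢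
    have e : x / s - z = (x - s * z) / s := by field_simp
    rw [e, norm_div, Complex.norm_real, Real.norm_of_nonneg hs.le, div_lt_iff₀ hs]
    linarith
  have := smul_mem_region hα hs (hz hx')
  rwa [mul_div_cancel₀ _ hs0] at this

lemma region_anti {ω c : ℝ} {μ : ℂ} (hc : ‖μ‖ ≤ c) :
    region α ω (c * conj (Complex.exp (ω * Complex.I))) ⊆ region α ω μ := by
  rintro z ⟨h1, h2, h3⟩
  refine ⟨h1, h2, ?_⟩
  have e : Complex.exp (ω * Complex.I) * (c * conj (Complex.exp (ω * Complex.I))) = (c : ℂ) := by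
    rw [mul_left_comm, Complex.mul_conj, Complex.normSq_eq_norm_sq, Complex.norm_exp_ofReal_mul_I]
    simp
  rw [mul_sub, e, Complex.sub_re, Complex.ofReal_re] at h3
  rw [mul_sub, Complex.sub_re]
  have : (Complex.exp (ω * Complex.I) * μ).re ≤ ‖μ‖ := by
    refine (Complex.re_le_norm _).trans ?_
    rw [norm_mul, Complex.norm_exp_ofReal_mul_I, one_mul]
  linarith

lemma exp_cpow {ψ : ℝ} (h1 : |ψ| < Real.pi / 2) :
    Complex.exp (ψ * Complex.I) ^ (α : ℂ) = Complex.exp ((α * ψ : ℝ) * Complex.I) := by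
  rw [abs_lt] at h1
  rw [Complex.cpow_def_of_ne_zero (Complex.exp_ne_zero _), Complex.log_exp]
  · push_cast; congr 1; ring
  · simp; linarith [Real.pi_pos]
  · simp; linarith [Real.pi_pos]

lemma arg_exp {ψ : ℝ} (h1 : |ψ| < Real.pi / 2) : (Complex.exp (ψ * Complex.I)).arg = ψ := by
  rw [abs_lt] at h1
  rw [Complex.arg_exp_mul_I, toIocMod_eq_self]
  constructor <;> linarith [Real.pi_pos]

/-- Rotating by `ω = 2τ - π/2` turns real parts into imaginary parts along the ray of angle `τ`. -/
lemma exp_rot (τ : ℝ) : Complex.exp (((2 * τ - Real.pi / 2 : ℝ) : ℂ) * Complex.I)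
    = -Complex.I * Complex.exp (τ * Complex.I) ^ 2 := by
  rw [← Complex.exp_nat_mul]
  push_cast
  rw [show (2 * (τ : ℂ) - Real.pi / 2) * Complex.I = 2 * (τ * Complex.I) + -(Real.pi / 2 * Complex.I) by
    ring, Complex.exp_add, Complex.exp_neg, Complex.exp_pi_div_two_mul_I]
  simp; ring

variable (hα : 0 < α) (hα2 : α < 2)
include hα

lemma exists_ball_subset_region {τ : ℝ} (hτ : 0 < τ) (hτ1 : (α + 2) * τ < Real.pi)
    (hτ2 : τ < Real.pi / 2) : ∃ δ : ℝ, 0 < δ ∧ ∃ c : ℝ, 0 < c ∧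
      Metric.ball (Complex.exp (τ * Complex.I)) δ ⊆ region α (2 * τ - Real.pi / 2)
        (c * conj (Complex.exp ((2 * τ - Real.pi / 2 : ℝ) * Complex.I))) := by
  have hs : 0 < Real.sin ((α + 2) * τ) := Real.sin_pos_of_pos_of_lt_pi (by positivity) hτ1
  have hτa : |τ| < Real.pi / 2 := abs_lt.2 ⟨by linarith, hτ2⟩
  have hmem : Complex.exp (τ * Complex.I) ∈ region α (2 * τ - Real.pi / 2)
      ((Real.sin ((α + 2) * τ) / 2 : ℝ) *
        conj (Complex.exp ((2 * τ - Real.pi / 2 : ℝ) * Complex.I))) := by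
    refine ⟨exp_re_pos hτa, ?_, ?_⟩
    · rw [arg_exp hτa, abs_lt]
      constructor <;> nlinarith
    · rw [mul_sub, mul_left_comm, Complex.mul_conj, Complex.normSq_eq_norm_sq,
        Complex.norm_exp_ofReal_mul_I, exp_cpow hτa, ← Complex.exp_add, ← add_mul,
        ← Complex.ofReal_add, Complex.sub_re, Complex.exp_ofReal_mul_I_re]
      rw [show 2 * τ - Real.pi / 2 + α * τ = (α + 2) * τ - Real.pi / 2 by ring,
        Real.cos_sub_pi_div_two, ← Complex.ofReal_mul, Complex.ofReal_re]
      linarith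
  obtain ⟨δ, hδ, hsub⟩ := Metric.isOpen_iff.1 (isOpen_region _ _) _ hmem
  exact ⟨δ, hδ, _, by positivity, hsub⟩

include hα2

set_option maxHeartbeats 800000 in
/-- The subdominant solution is bounded on rays of small positive angle. -/
lemma Sub.bdd_ray {μ a b : ℂ} (h : Sub α μ a b) {τ : ℝ} (hτ : 0 < τ)
    (hτ1 : (α + 2) * τ < Real.pi) (hτ2 : τ < Real.pi / 2) :
    ∃ B : ℝ, ∀ s : ℝ, 0 ≤ s → ‖sol α a b μ (s * Complex.exp (τ * Complex.I))‖ ≤ B := by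
  obtain ⟨δ, hδ, c, hc, hball⟩ := exists_ball_subset_region hα hτ hτ1 hτ2
  set E := Complex.exp (τ * Complex.I) with hE
  have hEn : ‖E‖ = 1 := Complex.norm_exp_ofReal_mul_I τ
  have hτa : |τ| < Real.pi / 2 := abs_lt.2 ⟨by linarith, hτ2⟩
  have hω : |2 * τ - Real.pi / 2| < Real.pi / 2 := abs_lt.2 ⟨by linarith, by linarith⟩
  set S := Real.sin ((α + 2) * τ) with hS
  have hs : 0 < S := Real.sin_pos_of_pos_of_lt_pi (by positivity) hτ1
  have hS1 : S ≤ 1 := Real.sin_le_one _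
  have hr := tendsto_rpow_atTop hα
  obtain ⟨T, hT⟩ := Filter.eventually_atTop.1
    (((hr.eventually_ge_atTop (‖μ‖ / c)).and (hr.eventually_gt_atTop (6 * (‖μ‖ + 1) / S))).and
    ((Filter.eventually_ge_atTop (4 / (δ * S))).and (Filter.eventually_ge_atTop 1)))
  have hdec : ∀ s, T ≤ s → s * E ∈ Complex.slitPlane ∧
      (E * sol1 α a b μ (s * E) * conj (sol α a b μ (s * E))).re ≤ 0 := by
    intro s hsT
    obtain ⟨⟨h1, h2⟩, h3, h4⟩ := hT s hsT
    have hs0 : 0 < s := by linarith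
    have hb : Metric.ball (s * E) (s * δ) ⊆ region α (2 * τ - Real.pi / 2) μ := by
      refine (ball_smul_subset hα hs0 hball).trans ?_
      rw [← mul_assoc, ← Complex.ofReal_mul]
      exact region_anti (by rwa [div_le_iff₀ hc] at h1)
    have hmem := hb (Metric.mem_ball_self (by positivity))
    have hne := h.sol_ne_zero_of_mem hα hα2 hω hmem
    have hei := h.eikonal hα hα2 hω (by positivity) hb
    have hld := h.logDeriv_neg hα hα2 hω hmem
    refine ⟨Or.inl hmem.1, ?_⟩
    set u := sol α a b μ (s * E)
    set w := sol1 α a b μ (s * E) / u with hw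
    set W := E * w with hW
    have hwn : ‖w‖ = ‖W‖ := by rw [hW, norm_mul, hEn, one_mul]
    set Q := (s * E) ^ (α : ℂ) - μ with hQ
    have e1 : W ^ 2 - E ^ 2 * Q = E ^ 2 * (w ^ 2 - Q) := by rw [hW]; ring
    have hei' : ‖W ^ 2 - E ^ 2 * Q‖ ≤ 2 * ‖W‖ / (s * δ) := by
      rw [e1, norm_mul, norm_pow, hEn, one_pow, one_mul, ← hwn]; exact hei
    have hcs : 0 < Real.cos τ := Real.cos_pos_of_mem_Ioo ⟨by linarith, hτ2⟩
    have hsn : 0 < Real.sin τ := Real.sin_pos_of_pos_of_lt_pi hτ (by linarith)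
    have hWneg : Real.sin τ * W.re + Real.cos τ * W.im < 0 := by
      rw [exp_rot, ← hE] at hld
      have : -Complex.I * E ^ 2 * w = -Complex.I * (E * W) := by rw [hW]; ring
      rw [this] at hld
      have hre : E.re = Real.cos τ := Complex.exp_ofReal_mul_I_re τ
      have him : E.im = Real.sin τ := Complex.exp_ofReal_mul_I_im τ
      simp [hre, him] at hld
      linarith
    have hQn : ‖Q‖ ≤ s ^ α + ‖μ‖ := by
      refine (norm_sub_le _ _).trans ?_
      rw [Complex.norm_cpow_real, norm_mul, hEn, mul_one, Complex.norm_real,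
        Real.norm_of_nonneg hs0.le]
    have hQim : S * s ^ α - ‖μ‖ ≤ (E ^ 2 * Q).im := by
      rw [hQ, real_mul_cpow hs0 E hα, hE, exp_cpow hτa, mul_sub, Complex.sub_im, mul_left_comm,
        ← Complex.exp_nat_mul, ← Complex.exp_add, Complex.im_ofReal_mul,
        show ((2 : ℕ) : ℂ) * (τ * Complex.I) + ((α * τ : ℝ) : ℂ) * Complex.I
          = (((α + 2) * τ : ℝ) : ℂ) * Complex.I by push_cast; ring, Complex.exp_ofReal_mul_I_im]
      have : (Complex.exp (((2 : ℕ) : ℂ) * (τ * Complex.I)) * μ).im ≤ ‖μ‖ := by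
        refine (le_abs_self _).trans ((Complex.abs_im_le_norm _).trans ?_)
        rw [norm_mul, show ((2 : ℕ) : ℂ) * (τ * Complex.I) = ((2 * τ : ℝ) : ℂ) * Complex.I by
          push_cast; ring, Complex.norm_exp_ofReal_mul_I, one_mul]
      nlinarith
    have hWre : W.re < 0 := by
      by_contra! hcon
      have him : W.im < 0 := by
        by_contra! h5
        nlinarith [mul_nonneg hsn.le hcon, mul_nonneg hcs.le h5]
      have hsq : (W ^ 2).im ≤ 0 := by
        rw [sq, Complex.mul_im]; nlinarith
      have hsd : 4 / S ≤ s * δ := by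
        rw [div_le_iff₀ (by positivity)] at h3 ⊢; linarith
      have hsd' : 2 / (s * δ) ≤ S / 2 := by
        rw [div_le_div_iff₀ (by positivity) (by norm_num)]
        rw [div_le_iff₀ hs] at hsd; linarith
      have h6 : (E ^ 2 * Q).im ≤ S / 2 * ‖W‖ := by
        have h7 : (E ^ 2 * Q).im - (W ^ 2).im ≤ ‖W ^ 2 - E ^ 2 * Q‖ := by
          rw [← Complex.sub_im, norm_sub_rev]
          exact (le_abs_self _).trans (Complex.abs_im_le_norm _)
        have h8 : 2 * ‖W‖ / (s * δ) ≤ S / 2 * ‖W‖ := by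
          rw [mul_div_right_comm]; gcongr
        linarith
      have h9 : ‖W‖ ≤ ‖Q‖ + 1 := by
        have h10 : ‖W‖ ^ 2 ≤ ‖Q‖ + ‖W‖ := by
          have h11 : ‖W ^ 2‖ ≤ ‖E ^ 2 * Q‖ + ‖W ^ 2 - E ^ 2 * Q‖ := by
            have := norm_add_le (E ^ 2 * Q) (W ^ 2 - E ^ 2 * Q)
            rwa [add_sub_cancel] at this
          rw [norm_pow, norm_mul (E ^ 2), norm_pow, hEn, one_pow, one_mul] at h11
          have h8 : 2 * ‖W‖ / (s * δ) ≤ S / 2 * ‖W‖ := by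
            rw [mul_div_right_comm]; gcongr
          nlinarith [norm_nonneg W]
        by_contra! h12
        nlinarith [norm_nonneg W, norm_nonneg Q]
      rw [div_lt_iff₀ hs] at h2
      have h13 : S / 2 * ‖W‖ ≤ S / 2 * (s ^ α + ‖μ‖ + 1) := by gcongr; linarith
      have h14 : S * (‖μ‖ + 1) ≤ 1 * (‖μ‖ + 1) := by gcongr
      linarith [norm_nonneg μ]
    have e2 : E * sol1 α a b μ (s * E) * conj u = ((‖u‖ ^ 2 : ℝ) : ℂ) * W := by
      rw [← Complex.normSq_eq_norm_sq, ← Complex.mul_conj, hW, hw]; field_simp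
    rw [e2, Complex.re_ofReal_mul]
    exact mul_nonpos_of_nonneg_of_nonpos (sq_nonneg _) hWre.le
  have hder : ∀ s, T ≤ s → HasDerivAt (fun s : ℝ => ‖sol α a b μ (s * E)‖ ^ 2)
      (2 * (E * sol1 α a b μ (s * E) * conj (sol α a b μ (s * E))).re) s := fun s hsT => by
    refine hasDerivAt_norm_sq ?_
    have h1 := (hasDerivAt_sol hα hα2 a b μ (hdec s hsT).1).comp (s : ℂ)
      ((hasDerivAt_id (s : ℂ)).mul_const E)
    rw [one_mul, mul_comm] at h1
    exact h1.comp_ofReal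
  have hanti : AntitoneOn (fun s : ℝ => ‖sol α a b μ (s * E)‖ ^ 2) (Ici T) := by
    refine antitoneOn_of_deriv_nonpos (convex_Ici T)
      (fun s hs => (hder s hs).continuousAt.continuousWithinAt) ?_ ?_ <;>
    intro x hx <;> rw [interior_Ici] at hx
    · exact (hder x (le_of_lt hx)).differentiableAt.differentiableWithinAt
    · rw [(hder x (le_of_lt hx)).deriv]
      linarith [(hdec x (le_of_lt hx)).2]
  refine ⟨(‖a‖ + ‖b‖) * ((|T| + 1) * Real.exp (2 * growth α (|T| + 1) ‖μ‖)), fun s hs => ?_⟩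
  have hbd : ∀ s, 0 ≤ s → s ≤ |T| + 1 → ‖sol α a b μ (s * E)‖ ≤
      (‖a‖ + ‖b‖) * ((|T| + 1) * Real.exp (2 * growth α (|T| + 1) ‖μ‖)) := fun s hs hsT => by
    refine norm_sol_le hα hα2 a b μ (by linarith [abs_nonneg T]) ?_ le_rfl
    rwa [norm_mul, hEn, mul_one, Complex.norm_real, Real.norm_of_nonneg hs]
  rcases le_total s (|T| + 1) with h1 | h1
  · exact hbd s hs h1
  · refine le_trans ?_ (hbd (|T| + 1) (by positivity) le_rfl)
    have := hanti (show T ≤ |T| + 1 by linarith [le_abs_self T])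
      (show T ≤ s by linarith [le_abs_self T]) h1
    exact (sq_le_sq₀ (norm_nonneg _) (norm_nonneg _)).1 (by simpa using this)

end
end Anharmonic

namespace Anharmonic

lemma IsDecaying.norm_sq_one_le {q U U1 : ℝ → ℂ} {e : ℂ} {d : ℝ} (h : IsDecaying q U U1 e d)
    (hd : 0 < d) : ‖U 1‖ ^ 2 ≤ ((1 + 1 / √(e.re * d)) / d + 1 / √(e.re * d) / e.re) *
      flux e U U1 0 := by
  set r := √(e.re * d) with hr
  have he := h.e_pos
  have hr0 : 0 < r := Real.sqrt_pos.2 (mul_pos he hd)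
  have h1 : ∀ t ∈ Icc (0 : ℝ) 1, ‖U 1‖ ^ 2 ≤ (1 + 1 / r) * ‖U t‖ ^ 2 + 1 / r * ‖U1 t‖ ^ 2 := by
    intro t ht
    have h2 := (h.shift ht.1).norm_sq_le hd (T := 1 - t) (by linarith [ht.2])
    simp only [add_zero, add_sub_cancel] at h2
    have h3 : ‖U1 t‖ * ‖U t‖ / r ≤ (‖U t‖ ^ 2 + ‖U1 t‖ ^ 2) / r := by
      gcongr; nlinarith [sq_nonneg (‖U1 t‖ - ‖U t‖), sq_nonneg (‖U1 t‖), sq_nonneg (‖U t‖)]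
    have h4 : (‖U t‖ ^ 2 + ‖U1 t‖ ^ 2) / r = 1 / r * ‖U t‖ ^ 2 + 1 / r * ‖U1 t‖ ^ 2 := by ring
    linarith
  have i1 := h.intervalIntegrable_sq (T := 1) zero_le_one
  have i2 := h.intervalIntegrable_sq1 (T := 1) zero_le_one
  have h5 := intervalIntegral.integral_mono_on (μ := volume) (a := (0 : ℝ)) (b := 1) zero_le_one
    (f := fun _ => ‖U 1‖ ^ 2) (by simp)
    ((i1.const_mul (1 + 1 / r)).add (i2.const_mul (1 / r))) h1
  rw [intervalIntegral.integral_add (i1.const_mul _) (i2.const_mul _),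
    intervalIntegral.integral_const_mul, intervalIntegral.integral_const_mul] at h5
  simp only [intervalIntegral.integral_const, sub_zero, one_smul] at h5
  have h6 := h.integral_sq_le (T := 1) zero_le_one
  have h7 := h.integral_sq1_le (T := 1) zero_le_one
  have h6' : (∫ s in (0 : ℝ)..1, ‖U s‖ ^ 2) ≤ flux e U U1 0 / d := by
    rw [le_div_iff₀ hd]; linarith
  have h7' : (∫ s in (0 : ℝ)..1, ‖U1 s‖ ^ 2) ≤ flux e U U1 0 / e.re := by
    rw [le_div_iff₀ he]; linarith
  calc _ ≤ _ := h5
    _ ≤ (1 + 1 / r) * (flux e U U1 0 / d) + 1 / r * (flux e U U1 0 / e.re) := by gcongr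
    _ = _ := by ring

/-- Admissible exponents and angles: `τ` is the angle of the rotated half line. -/
structure Admissible (α τ : ℝ) : Prop where
  α_pos : 0 < α
  α_lt : α < 2
  τ_pos : 0 < τ
  lt_pi : (α + 2) * τ < Real.pi

noncomputable def dir (τ : ℝ) : ℂ := Complex.exp (τ * Complex.I)

noncomputable def pot (α τ : ℝ) (μ : ℂ) (s : ℝ) : ℂ :=
  dir τ ^ 2 * (((s : ℂ) * dir τ) ^ (α : ℂ) - μ)

noncomputable def raySol (α τ : ℝ) (a b μ : ℂ) (s : ℝ) : ℂ := sol α a b μ (s * dir τ)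

noncomputable def raySol1 (α τ : ℝ) (a b μ : ℂ) (s : ℝ) : ℂ := dir τ * sol1 α a b μ (s * dir τ)

lemma norm_dir (τ : ℝ) : ‖dir τ‖ = 1 := Complex.norm_exp_ofReal_mul_I τ

lemma dir_ne_zero (τ : ℝ) : dir τ ≠ 0 := Complex.exp_ne_zero _

lemma dir_add (s t : ℝ) : dir (s + t) = dir s * dir t := by
  rw [dir, dir, dir, ← Complex.exp_add]; push_cast; ring_nf

lemma dir_sq (τ : ℝ) : dir τ ^ 2 = dir (2 * τ) := by rw [sq, ← dir_add]; ring_nf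

lemma dir_re (τ : ℝ) : (dir τ).re = Real.cos τ := Complex.exp_ofReal_mul_I_re τ

lemma dir_im (τ : ℝ) : (dir τ).im = Real.sin τ := Complex.exp_ofReal_mul_I_im τ

namespace Admissible
variable {α τ : ℝ} (A : Admissible α τ)
include A

lemma τ_lt : τ < Real.pi / 2 := by
  nlinarith [A.lt_pi, mul_pos A.α_pos A.τ_pos]

lemma abs_τ : |τ| < Real.pi / 2 := abs_lt.2 ⟨by linarith [A.τ_pos, Real.pi_pos], A.τ_lt⟩

lemma pot_eq (μ : ℂ) {s : ℝ} (hs : 0 ≤ s) :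
    pot α τ μ s = ((s ^ α : ℝ) : ℂ) * dir ((α + 2) * τ) - dir (2 * τ) * μ := by
  rcases hs.eq_or_lt with rfl | hs
  · simp [pot, Complex.zero_cpow (show (α : ℂ) ≠ 0 by exact_mod_cast A.α_pos.ne'),
      Real.zero_rpow A.α_pos.ne', dir_sq]
  · rw [pot, real_mul_cpow hs _ A.α_pos, mul_sub, dir_sq, mul_left_comm]
    congr 2
    rw [show dir τ ^ (α : ℂ) = dir (α * τ) from exp_cpow A.abs_τ, ← dir_add]; ring_nf

lemma cos_pos : 0 < Real.cos ((α + 2) * τ / 2) :=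
  Real.cos_pos_of_mem_Ioo ⟨by nlinarith [A.τ_pos, A.α_pos, Real.pi_pos], by linarith [A.lt_pi]⟩

lemma isSol (a b μ : ℂ) {X : ℝ} (hX : 0 ≤ X) :
    IsSol (fun s => pot α τ μ (X + s)) (fun s => raySol α τ a b μ (X + s))
      (fun s => raySol1 α τ a b μ (X + s)) := by
  have hre : 0 < (dir τ).re := by
    rw [dir_re]; exact Real.cos_pos_of_mem_Ioo ⟨by linarith [A.τ_pos, Real.pi_pos], A.τ_lt⟩
  have := isSol_line A.α_pos A.α_lt a b μ (X * dir τ) (dir τ)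
    (by rw [Complex.re_ofReal_mul]; positivity)
    (fun s hs => by rw [Complex.add_re, Complex.re_ofReal_mul, Complex.re_ofReal_mul]; positivity)
  simp only [← add_mul, ← Complex.ofReal_add] at this
  exact this

lemma isSol_zero (a b μ : ℂ) :
    IsSol (pot α τ μ) (raySol α τ a b μ) (raySol1 α τ a b μ) := by
  simpa using A.isSol a b μ le_rfl

lemma isDecaying {a b μ e : ℂ} (h : Sub α μ a b) {X d : ℝ} (hX : 0 ≤ X) (he : 0 < e.re)
    (he1 : ‖e‖ ≤ 1) (hd : 0 ≤ d) (hq : ∀ s, X < s → d ≤ (e * pot α τ μ s).re) :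
    IsDecaying (fun s => pot α τ μ (X + s)) (fun s => raySol α τ a b μ (X + s))
      (fun s => raySol1 α τ a b μ (X + s)) e d where
  toIsSol := A.isSol a b μ hX
  e_pos := he
  e_le := he1
  d_nonneg := hd
  q_ge := fun s hs => hq _ (by linarith)
  bdd := by
    obtain ⟨B, hB⟩ := h.bdd_ray A.α_pos A.α_lt A.τ_pos A.lt_pi A.τ_lt
    exact ⟨B, fun s hs => hB _ (by positivity)⟩

lemma norm_raySol_le (a b μ : ℂ) {x R : ℝ} (hx : 0 ≤ x) (hR : 1 ≤ R) (hxR : x ≤ R) :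
    ‖raySol α τ a b μ x‖ ≤ (‖a‖ + ‖b‖) * (R * Real.exp (2 * growth α R ‖μ‖)) := by
  refine norm_sol_le A.α_pos A.α_lt a b μ hR ?_ le_rfl
  rwa [norm_mul, norm_dir, mul_one, Complex.norm_real, Real.norm_of_nonneg hx]

lemma norm_raySol1_le (a b μ : ℂ) {x R : ℝ} (hx : 0 ≤ x) (hR : 1 ≤ R) (hxR : x ≤ R) :
    ‖raySol1 α τ a b μ x‖ ≤ (‖a‖ + ‖b‖) * (R * Real.exp (2 * growth α R ‖μ‖)) := by
  rw [raySol1, norm_mul, norm_dir, one_mul]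
  refine norm_sol1_le A.α_pos A.α_lt a b μ hR ?_ le_rfl
  rwa [norm_mul, norm_dir, mul_one, Complex.norm_real, Real.norm_of_nonneg hx]

set_option maxHeartbeats 800000 in
/-- Uniform exponential bound for the subdominant solutions along the ray. -/
lemma exists_bound : ∃ C k : ℝ, 0 < C ∧ 0 < k ∧ ∀ μ a b : ℂ, Sub α μ a b → ∀ x : ℝ, 0 ≤ x →
    ‖raySol α τ a b μ x‖ ≤
      (‖a‖ + ‖b‖) * Real.exp (C * (1 + ‖μ‖) ^ (1 / 2 + 1 / α) - k * x) := by
  have hα := A.α_pos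
  set c := Real.cos ((α + 2) * τ / 2) with hc
  have hc0 : 0 < c := A.cos_pos
  have hc1 : c ≤ 1 := Real.cos_le_one _
  set k := √c with hk
  have hk0 : 0 < k := Real.sqrt_pos.2 hc0
  have hk1 : k ≤ 1 := Real.sqrt_le_one.2 hc1
  set c0 := (1 / c) ^ (1 / α) with hc0'
  have hc01 : 1 ≤ c0 := Real.one_le_rpow ((one_le_div hc0).2 hc1) (by positivity)
  set D := (1 + 1 / k) / 1 + 1 / k / c with hD
  have hD0 : 0 < D := by positivity
  set G := √(20 * (4 / c + 1)) * c0 with hG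
  have hG0 : 0 < G := by positivity
  set e := Complex.exp ((-((α + 2) * τ / 2) : ℝ) * Complex.I) with he
  have hee : e = dir (-((α + 2) * τ / 2)) := rfl
  have here : e.re = c := by rw [hee, dir_re, Real.cos_neg]
  have hen : ‖e‖ = 1 := norm_dir _
  refine ⟨2 * G + 4 * c0 + √D + 1, k, by positivity, hk0, fun μ a b h x hx => ?_⟩
  set M := ‖μ‖ with hM
  have hM0 : 0 ≤ M := norm_nonneg _
  set p := 1 / 2 + 1 / α with hp
  have hP1 : 1 ≤ (1 + M) ^ p := Real.one_le_rpow (by linarith) (by positivity)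
  set R := c0 * (1 + M) ^ (1 / α) with hR
  have hRa : R ^ α = (1 + M) / c := by
    rw [hR, hc0', Real.mul_rpow (by positivity) (by positivity), ← Real.rpow_mul (by positivity),
      ← Real.rpow_mul (by positivity), one_div_mul_cancel hα.ne', Real.rpow_one, Real.rpow_one]
    ring
  have hMa : 1 ≤ (1 + M) ^ (1 / α) := Real.one_le_rpow (by linarith) (by positivity)
  have hR1 : 1 ≤ R := by rw [hR]; nlinarith
  have hRp : R ≤ c0 * (1 + M) ^ p := by
    rw [hR]; gcongr
    · linarith
    · rw [hp]; linarith
  have hgr : growth α (2 * R) M ≤ G * (1 + M) ^ p := by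
    refine abs_le_of_sq_le_sq' ?_ (by positivity) |>.2
    rw [growth_sq (by positivity) hM0, hG, mul_pow (√_ * c0), mul_pow √_,
      Real.sq_sqrt (by positivity)]
    have e1 : ((1 + M) ^ p) ^ 2 = ((1 + M) ^ (1 / α)) ^ 2 * (1 + M) := by
      rw [← Real.rpow_natCast, ← Real.rpow_natCast, ← Real.rpow_mul (by positivity),
        ← Real.rpow_mul (by positivity), ← Real.rpow_add_one (by positivity)]
      congr 1; rw [hp]; push_cast; ring
    have e2 : (2 * R) ^ α ≤ 4 / c * (1 + M) := by
      rw [Real.mul_rpow (by norm_num) (by positivity), hRa]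
      have : (2 : ℝ) ^ α ≤ 2 ^ (2 : ℝ) := Real.rpow_le_rpow_of_exponent_le (by norm_num) A.α_lt.le
      have h4 : (2 : ℝ) ^ (2 : ℝ) = 4 := by norm_num
      calc _ ≤ 4 * ((1 + M) / c) := by gcongr; linarith
        _ = _ := by ring
    rw [e1]
    calc 5 * ((2 * R) ^ 2 * ((2 * R) ^ α + M))
        ≤ 5 * ((2 * R) ^ 2 * (4 / c * (1 + M) + (1 + M))) := by gcongr; linarith
      _ = _ := by rw [hR]; ring
  have hRe : 2 * R ≤ Real.exp (2 * R) := by linarith [Real.add_one_le_exp (2 * R)]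
  set N := ‖a‖ + ‖b‖ with hN
  have hN0 : 0 ≤ N := by positivity
  have hB : 2 * R * Real.exp (2 * growth α (2 * R) M)
      ≤ Real.exp ((2 * G + 2 * c0) * (1 + M) ^ p) := by
    calc _ ≤ Real.exp (2 * R) * Real.exp (2 * growth α (2 * R) M) := by gcongr
      _ = Real.exp (2 * R + 2 * growth α (2 * R) M) := by rw [Real.exp_add]
      _ ≤ _ := Real.exp_le_exp.2 (by linarith)
  rcases le_total x (R + 1) with h1 | h1
  · calc ‖raySol α τ a b μ x‖ ≤ N * (2 * R * Real.exp (2 * growth α (2 * R) M)) :=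
        A.norm_raySol_le a b μ hx (by linarith) (by linarith)
      _ ≤ N * Real.exp ((2 * G + 2 * c0) * (1 + M) ^ p) := by gcongr
      _ ≤ _ := by
        refine mul_le_mul_of_nonneg_left (Real.exp_le_exp.2 ?_) hN0
        have : k * x ≤ 1 * (2 * R) := by gcongr; linarith
        have h2 : 0 ≤ √D * (1 + M) ^ p := by positivity
        linarith
  · have hdec := A.isDecaying (e := e) h (X := R) (d := 1) (by positivity) (by rw [here]; exact hc0)
      hen.le zero_le_one (fun s hs => by
        have hs0 : 0 ≤ s := by linarith
        rw [A.pot_eq μ hs0, mul_sub, hee, mul_left_comm, ← dir_add, Complex.sub_re,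
          Complex.re_ofReal_mul, dir_re,
          show -((α + 2) * τ / 2) + (α + 2) * τ = (α + 2) * τ / 2 by ring, ← hc, ← hee]
        have h2 : (e * (dir (2 * τ) * μ)).re ≤ M := by
          refine (Complex.re_le_norm _).trans ?_
          rw [norm_mul, norm_mul, norm_dir, hen, one_mul, one_mul]
        have h3 : (1 + M) / c ≤ s ^ α := by rw [← hRa]; gcongr
        rw [div_le_iff₀ hc0] at h3
        linarith)
    have h2 := (hdec.shift (t := x - R - 1) (by linarith)).norm_sq_one_le one_pos
    have h3 := hdec.flux_exp_decay (s := x - R - 1) (by linarith)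
    have h4 := hdec.flux_zero_le
    simp only [add_zero, mul_one, here] at h2 h3 h4
    have e3 : R + (x - R - 1 + 1) = x := by ring
    rw [e3] at h2
    have hf : flux e (fun s => raySol α τ a b μ (R + s)) (fun s => raySol1 α τ a b μ (R + s)) 0
        ≤ (N * Real.exp ((2 * G + 2 * c0) * (1 + M) ^ p)) ^ 2 := by
      refine h4.trans ?_
      rw [sq]
      gcongr
      · exact (A.norm_raySol1_le a b μ (by positivity) (R := 2 * R) (by linarith)
          (by linarith)).trans (by gcongr)
      · exact (A.norm_raySol_le a b μ (by positivity) (R := 2 * R) (by linarith)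
          (by linarith)).trans (by gcongr)
    have h5 : ‖raySol α τ a b μ x‖ ^ 2 ≤
        D * ((N * Real.exp ((2 * G + 2 * c0) * (1 + M) ^ p)) ^ 2 *
          Real.exp (-(2 * k) * (x - R - 1))) := by
      refine h2.trans ?_
      gcongr
      · refine le_trans ?_ (h3.trans ?_)
        · simp only [flux, add_zero]; exact le_rfl
        · gcongr
    refine abs_le_of_sq_le_sq' ?_ (by positivity) |>.2
    refine h5.trans ?_
    have hDe : D ≤ Real.exp (√D * (1 + M) ^ p) ^ 2 := by
      have : √D ≤ Real.exp (√D * (1 + M) ^ p) := by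
        have := Real.add_one_le_exp (√D * (1 + M) ^ p)
        nlinarith [Real.sqrt_nonneg D]
      calc D = √D ^ 2 := (Real.sq_sqrt hD0.le).symm
        _ ≤ _ := by gcongr
    calc D * ((N * Real.exp ((2 * G + 2 * c0) * (1 + M) ^ p)) ^ 2 *
          Real.exp (-(2 * k) * (x - R - 1)))
        ≤ Real.exp (√D * (1 + M) ^ p) ^ 2 *
          ((N * Real.exp ((2 * G + 2 * c0) * (1 + M) ^ p)) ^ 2 *
          Real.exp (-(2 * k) * (x - R - 1))) := by gcongr
      _ = (N * Real.exp (√D * (1 + M) ^ p + (2 * G + 2 * c0) * (1 + M) ^ p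
            - k * (x - R - 1))) ^ 2 := by
        rw [mul_pow, mul_pow, ← Real.exp_nat_mul, ← Real.exp_nat_mul, ← Real.exp_nat_mul,
          mul_left_comm, mul_assoc, mul_left_comm, ← Real.exp_add, mul_left_comm,
          ← Real.exp_add]
        congr 2; push_cast; ring
      _ ≤ _ := by
        have h6 : k * (R + 1) ≤ 1 * (2 * R) := by gcongr; linarith
        refine pow_le_pow_left₀ (by positivity)
          (mul_le_mul_of_nonneg_left (Real.exp_le_exp.2 ?_) hN0) 2
        linarith

end Admissible
end Anharmonic

namespace Anharmonic

/-- The bilinear pairing of `f` with a solution along the ray. -/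
noncomputable def pairing (α τ : ℝ) (f : ℝ → ℂ) (a b μ : ℂ) : ℂ :=
  ∫ x in Ioi (0 : ℝ), f x * raySol α τ a b μ x

section
variable {α : ℝ} (hα : 0 < α) (hα2 : α < 2)
include hα hα2

lemma Sub.im_mul_norm_le {μ a b : ℂ} (h : Sub α μ a b) :
    |μ.im| * ‖b‖ ≤ 12 * (1 + ‖μ‖) ^ 2 * ‖a‖ := by
  rcases eq_or_ne μ.im 0 with h0 | h0
  · rw [h0, abs_zero, zero_mul]; positivity
  set m := 1 + ‖μ‖ with hm
  have hm1 : 1 ≤ m := by rw [hm]; linarith [norm_nonneg μ]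
  have hY : 0 < |μ.im| := abs_pos.2 h0
  have hYm : |μ.im| ≤ m := by rw [hm]; linarith [Complex.abs_im_le_norm μ]
  obtain ⟨σ, hσ, hσ1⟩ : ∃ σ : ℝ, σ * μ.im = |μ.im| ∧ |σ| = 1 := by
    rcases lt_or_gt_of_ne h0 with h1 | h1
    · exact ⟨-1, by rw [abs_of_neg h1]; ring, by simp⟩
    · exact ⟨1, by rw [abs_of_pos h1]; ring, by simp⟩
  set ε := |μ.im| / (4 * m) with hε
  have hε0 : 0 < ε := by positivity
  have hε4 : ε ≤ 1 / 4 := by rw [hε, div_le_iff₀ (by positivity)]; linarith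
  set e : ℂ := ⟨ε, σ / 2⟩ with he
  have hre : e.re = ε := rfl
  have him : e.im = σ / 2 := rfl
  have hd := h.isDecaying_line hα hα2 (z := 0) (e := e) (d := |μ.im| / 4) le_rfl hε0
    (by
      refine (Complex.norm_le_abs_re_add_abs_im e).trans ?_
      rw [hre, him, abs_of_pos hε0, abs_div, hσ1, abs_two]; linarith) (by positivity)
    (fun s hs => by
      rw [zero_add, ofReal_cpow_eq hs.le, Complex.mul_re, Complex.sub_re, Complex.sub_im,
        Complex.ofReal_re, Complex.ofReal_im, hre, him]
      have h1 : ε * μ.re ≤ |μ.im| / 4 := by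
        calc ε * μ.re ≤ ε * m := by
              gcongr; rw [hm]; linarith [Complex.re_le_norm μ]
          _ = _ := by rw [hε]; field_simp
      have h2 : 0 ≤ ε * s ^ α := by positivity
      have h3 : σ / 2 * μ.im = |μ.im| / 2 := by rw [← hσ]; ring
      linarith)
  have h1 := hd.norm_deriv_zero_le (by positivity) one_pos one_pos (B := m) (fun s hs => by
    rw [zero_add]
    refine (norm_sub_le _ _).trans ?_
    rw [Complex.norm_cpow_real, Complex.norm_real, Real.norm_of_nonneg hs.1.le, hm]
    have := Real.rpow_le_one hs.1.le hs.2.le hα.le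
    linarith)
  simp only [zero_add, Complex.ofReal_zero, sol_zero hα, sol1_zero hα, hre] at h1
  have h2 : (1 / (1 * ε) + m * 1 / (|μ.im| / 4) + m / (1 * ε)) * |μ.im| ≤ 12 * m ^ 2 := by
    have : (1 / (1 * ε) + m * 1 / (|μ.im| / 4) + m / (1 * ε)) * |μ.im| = 8 * m + 4 * m ^ 2 := by
      rw [hε]; field_simp; ring
    rw [this]; nlinarith
  calc |μ.im| * ‖b‖ ≤ |μ.im| * ((1 / (1 * ε) + m * 1 / (|μ.im| / 4) + m / (1 * ε)) * ‖a‖) := by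
        gcongr
    _ = ((1 / (1 * ε) + m * 1 / (|μ.im| / 4) + m / (1 * ε)) * |μ.im|) * ‖a‖ := by ring
    _ ≤ _ := by gcongr

lemma Sub.left_ne_zero {μ a b : ℂ} (h : Sub α μ a b) (hμ : μ.im ≠ 0) : a ≠ 0 := by
  rintro rfl
  have h1 := h.im_mul_norm_le hα hα2
  have hY : 0 < |μ.im| := abs_pos.2 hμ
  have hb : 0 < ‖b‖ := norm_pos_iff.2 (h.1.resolve_left (by simp))
  rw [norm_zero, mul_zero] at h1
  exact absurd h1 (not_le.2 (by positivity))

end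

lemma frequently_im_ne_zero (μ : ℂ) : ∃ᶠ w in nhds μ, w.im ≠ 0 := by
  rw [Filter.frequently_iff]
  intro U hU
  obtain ⟨r, hr, hU⟩ := Metric.mem_nhds_iff.1 hU
  by_cases h : μ.im = 0
  · exact ⟨μ + (r / 2 : ℝ) * Complex.I, hU (by simp [abs_of_pos hr, hr]), by
      simp [h, hr.ne']⟩
  · exact ⟨μ, hU (Metric.mem_ball_self hr), h⟩

lemma integrable_mul_exp {f : ℝ → ℂ} (hf : MemLp f 2 (volume.restrict (Ioi 0))) {k : ℝ}
    (hk : 0 < k) : IntegrableOn (fun x => ‖f x‖ * Real.exp (-k * x)) (Ioi 0) := by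
  have h1 : MemLp (fun x : ℝ => Real.exp (-k * x)) 2 (volume.restrict (Ioi 0)) := by
    rw [memLp_two_iff_integrable_sq (by fun_prop)]
    refine (exp_neg_integrableOn_Ioi 0 (b := 2 * k) (by positivity)).congr
      (ae_of_all _ fun x => ?_)
    simp only [← Real.exp_nat_mul]; push_cast; ring_nf
  exact hf.norm.integrable_mul h1

namespace Admissible
variable {α τ : ℝ} (A : Admissible α τ)
include A

lemma continuousOn_raySol (a b μ : ℂ) : ContinuousOn (raySol α τ a b μ) (Ici 0) :=
  (A.isSol_zero a b μ).cont

lemma aestronglyMeasurable_raySol (a b μ : ℂ) :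
    AEStronglyMeasurable (raySol α τ a b μ) (volume.restrict (Ioi 0)) :=
  ((A.continuousOn_raySol a b μ).mono Ioi_subset_Ici_self).aestronglyMeasurable measurableSet_Ioi

lemma pairing_bound {f : ℝ → ℂ} (hf : MemLp f 2 (volume.restrict (Ioi 0))) :
    ∃ C K : ℝ, 0 < C ∧ 0 < K ∧ ∀ μ a b : ℂ, Sub α μ a b →
      IntegrableOn (fun x => f x * raySol α τ a b μ x) (Ioi 0) ∧
      ‖pairing α τ f a b μ‖ ≤ K * (‖a‖ + ‖b‖) * Real.exp (C * (1 + ‖μ‖) ^ (1 / 2 + 1 / α)) := by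
  obtain ⟨C, k, hC, hk, hb⟩ := A.exists_bound
  have hi := integrable_mul_exp hf hk
  set K := ∫ x in Ioi (0 : ℝ), ‖f x‖ * Real.exp (-k * x) with hK
  have hK0 : 0 ≤ K := integral_nonneg fun x => by positivity
  refine ⟨C, K + 1, hC, by linarith, fun μ a b h => ?_⟩
  set E := (‖a‖ + ‖b‖) * Real.exp (C * (1 + ‖μ‖) ^ (1 / 2 + 1 / α)) with hE
  have hE0 : 0 ≤ E := by positivity
  have hbd : ∀ᵐ x ∂(volume.restrict (Ioi (0 : ℝ))), ‖f x * raySol α τ a b μ x‖ ≤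
      E * (‖f x‖ * Real.exp (-k * x)) := by
    refine (ae_restrict_iff' measurableSet_Ioi).2 (ae_of_all _ fun x hx => ?_)
    rw [norm_mul]
    calc ‖f x‖ * ‖raySol α τ a b μ x‖ ≤ ‖f x‖ * ((‖a‖ + ‖b‖) *
          Real.exp (C * (1 + ‖μ‖) ^ (1 / 2 + 1 / α) - k * x)) := by
          gcongr; exact hb μ a b h x (le_of_lt hx)
      _ = _ := by rw [sub_eq_add_neg, Real.exp_add, hE]; ring_nf
  have hinteg : IntegrableOn (fun x => f x * raySol α τ a b μ x) (Ioi 0) :=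
    (hi.const_mul E).mono' (hf.1.mul (A.aestronglyMeasurable_raySol a b μ)) hbd
  refine ⟨hinteg, ?_⟩
  have := norm_integral_le_of_norm_le (hi.const_mul E) hbd
  rw [integral_const_mul] at this
  refine this.trans ?_
  rw [mul_assoc (K + 1), ← hE, ← hK]; nlinarith

omit A in
lemma pairing_mul (f : ℝ → ℂ) (a b μ c : ℂ) :
    pairing α τ f (c * a) (c * b) μ = c * pairing α τ f a b μ := by
  rw [pairing, pairing, ← integral_const_mul]
  congr 1; ext x; simp only [raySol, sol]; ring

lemma differentiableOn_pairing {f : ℝ → ℂ} (hf : MemLp f 2 (volume.restrict (Ioi 0)))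
    {a b : ℂ → ℂ} {M : ℝ} (ha : DifferentiableOn ℂ a (Metric.ball 0 M))
    (hb : DifferentiableOn ℂ b (Metric.ball 0 M))
    (h : ∀ μ ∈ Metric.ball (0 : ℂ) M, Sub α μ (a μ) (b μ)) :
    DifferentiableOn ℂ (fun μ => pairing α τ f (a μ) (b μ) μ) (Metric.ball 0 M) := by
  obtain ⟨C, k, hC, hk, hB⟩ := A.exists_bound
  have hi := integrable_mul_exp hf hk
  intro μ hμ
  obtain ⟨r, hr, hr1⟩ : ∃ r > 0, Metric.closedBall μ r ⊆ Metric.ball 0 M :=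
    Metric.nhds_basis_closedBall.mem_iff.1 (Metric.isOpen_ball.mem_nhds hμ)
  have hcpt := isCompact_closedBall μ r
  obtain ⟨N, hN⟩ : ∃ N, ∀ w ∈ Metric.closedBall μ r, (‖a w‖ + ‖b w‖) *
      Real.exp (C * (1 + ‖w‖) ^ (1 / 2 + 1 / α)) ≤ N := by
    have hc : ContinuousOn (fun w => (‖a w‖ + ‖b w‖) *
        Real.exp (C * (1 + ‖w‖) ^ (1 / 2 + 1 / α))) (Metric.closedBall μ r) := by
      refine (((ha.continuousOn.mono hr1).norm).add (hb.continuousOn.mono hr1).norm).mul ?_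
      refine Continuous.continuousOn ?_
      have : ∀ x : ℂ, (1 + ‖x‖ ≠ 0 ∨ 0 ≤ (1 / 2 + 1 / α)) := fun x => Or.inl (by positivity)
      exact Real.continuous_exp.comp (continuous_const.mul
        ((continuous_const.add continuous_norm).rpow_const this))
    obtain ⟨N, hN⟩ := (hcpt.image_of_continuousOn hc).bddAbove
    exact ⟨N, fun w hw => hN (mem_image_of_mem _ hw)⟩
  have hsub : Metric.ball μ r ⊆ Metric.ball 0 M := Metric.ball_subset_closedBall.trans hr1
  refine ((differentiableOn_integral (ν := volume.restrict (Ioi 0)) (D := Metric.ball μ r)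
    (h := fun μ x => f x * raySol α τ (a μ) (b μ) μ x)
    (bound := fun x => N * (‖f x‖ * Real.exp (-k * x))) Metric.isOpen_ball
    (fun w hw => hf.1.mul (A.aestronglyMeasurable_raySol _ _ _)) (ae_of_all _ fun x => ?_) ?_
    (hi.const_mul N)).differentiableAt (Metric.ball_mem_nhds μ hr)).differentiableWithinAt
  · simp only [raySol, sol]
    exact (((ha.mono hsub).mul
      (differentiable_fund A.α_pos A.α_lt (Or.inl rfl) _).differentiableOn).add
      ((hb.mono hsub).mul
      (differentiable_fund A.α_pos A.α_lt (Or.inr rfl) _).differentiableOn)).const_mul _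
  · refine (ae_restrict_iff' measurableSet_Ioi).2 (ae_of_all _ fun x hx w hw => ?_)
    rw [norm_mul]
    calc ‖f x‖ * ‖raySol α τ (a w) (b w) w x‖ ≤ ‖f x‖ * ((‖a w‖ + ‖b w‖) *
          Real.exp (C * (1 + ‖w‖) ^ (1 / 2 + 1 / α) - k * x)) := by
          gcongr; exact hB w _ _ (h w (hsub hw)) x (le_of_lt hx)
      _ = (‖a w‖ + ‖b w‖) * Real.exp (C * (1 + ‖w‖) ^ (1 / 2 + 1 / α)) *
          (‖f x‖ * Real.exp (-k * x)) := by rw [sub_eq_add_neg, Real.exp_add]; ring_nf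
      _ ≤ _ := by gcongr; exact hN w (Metric.ball_subset_closedBall hw)

lemma exists_local_quotient {f : ℝ → ℂ} (hf : MemLp f 2 (volume.restrict (Ioi 0)))
    (h0 : ∀ μ b : ℂ, Sub α μ 0 b → pairing α τ f 0 b μ = 0) (μ₀ : ℂ) :
    ∃ g : ℂ → ℂ, ∃ r > 0, DifferentiableOn ℂ g (Metric.ball μ₀ r) ∧
      ∀ μ ∈ Metric.ball μ₀ r, ∀ a b, Sub α μ a b → g μ * a = pairing α τ f a b μ := by
  obtain ⟨a, b, ha, hb, hs⟩ := exists_local_sub A.α_pos A.α_lt (M := ‖μ₀‖ + 1) (by positivity)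
  set D := Metric.ball (0 : ℂ) (‖μ₀‖ + 1) with hD
  have hμ : μ₀ ∈ D := by simp [hD]
  have hDo : IsOpen D := Metric.isOpen_ball
  have hDn : D ∈ nhds μ₀ := hDo.mem_nhds hμ
  have hF := A.differentiableOn_pairing hf ha hb hs
  set F := fun μ => pairing α τ f (a μ) (b μ) μ with hFd
  have key : ∀ μ ∈ D, ∀ g : ℂ, g * a μ = F μ → ∀ a' b', Sub α μ a' b' →
      g * a' = pairing α τ f a' b' μ := by
    intro μ hμ g hg a' b' h'
    obtain ⟨c, -, rfl, rfl⟩ := (hs μ hμ).unique A.α_pos A.α_lt h'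
    rw [pairing_mul, mul_left_comm, hg]
  by_cases hz : a μ₀ = 0
  · have ha' := (Complex.differentiableOn_dslope hDn).2 ha
    have hF' := (Complex.differentiableOn_dslope hDn).2 hF
    have hb0 : b μ₀ ≠ 0 := (hs μ₀ hμ).1.resolve_left (by simp [hz])
    have hF0 : F μ₀ = 0 := by
      have h1 := hs μ₀ hμ
      simp only [hFd, hz] at h1 ⊢
      exact h0 μ₀ _ h1
    have hne : dslope a μ₀ μ₀ ≠ 0 := by
      intro hcon
      have hc : ContinuousAt (fun w => 12 * (1 + ‖w‖) ^ 2 * ‖dslope a μ₀ w‖ - ‖b w‖) μ₀ := by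
        have h1 := (ha'.differentiableAt hDn).continuousAt
        have h2 := (hb.differentiableAt hDn).continuousAt
        fun_prop
      have hlim : Filter.Tendsto (fun ε : ℝ => μ₀ + ε * Complex.I) (nhdsWithin 0 (Ioi 0))
          (nhds μ₀) := by
        have : ContinuousAt (fun ε : ℝ => μ₀ + ε * Complex.I) 0 := by fun_prop
        have := this.tendsto
        simp only [Complex.ofReal_zero, zero_mul, add_zero] at this
        exact this.mono_left nhdsWithin_le_nhds
      have h1 := ge_of_tendsto (hc.tendsto.comp hlim) (b := 0) (by
        filter_upwards [hlim hDn, self_mem_nhdsWithin] with ε h2 h3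
        have h3 : 0 < ε := h3
        simp only [Function.comp]
        have him0 : μ₀.im = 0 := by
          by_contra h4
          exact (hs μ₀ hμ).left_ne_zero A.α_pos A.α_lt h4 hz
        set w := μ₀ + ε * Complex.I with hw
        have hwi : w.im = ε := by simp [hw, him0]
        have h4 := (hs w h2).im_mul_norm_le A.α_pos A.α_lt
        have hwne : w ≠ μ₀ := by
          intro h5; rw [h5, him0] at hwi; exact h3.ne hwi
        have h5 : ‖a w‖ = ε * ‖dslope a μ₀ w‖ := by
          have := sub_smul_dslope a μ₀ w
          rw [hz, sub_zero] at this
          rw [← this, norm_smul, hw, add_sub_cancel_left, norm_mul, Complex.norm_I, mul_one,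
            Complex.norm_real, Real.norm_of_nonneg h3.le]
        rw [h5, hwi, abs_of_pos h3] at h4
        have : ε * ‖b w‖ ≤ ε * (12 * (1 + ‖w‖) ^ 2 * ‖dslope a μ₀ w‖) := by linarith
        have := le_of_mul_le_mul_left this h3
        linarith)
      rw [hcon, norm_zero, mul_zero, zero_sub] at h1
      have := norm_pos_iff.2 hb0
      linarith
    obtain ⟨r, hr, hrD⟩ := Metric.mem_nhds_iff.1 (Filter.inter_mem hDn
      ((ha'.differentiableAt hDn).continuousAt.eventually_ne hne))
    refine ⟨fun w => dslope F μ₀ w / dslope a μ₀ w, r, hr,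
      (hF'.mono fun w hw => (hrD hw).1).div (ha'.mono fun w hw => (hrD hw).1)
        fun w hw => (hrD hw).2, fun w hw => key w (hrD hw).1 _ ?_⟩
    have e1 := sub_smul_dslope F μ₀ w
    have e2 := sub_smul_dslope a μ₀ w
    rw [hF0, sub_zero] at e1
    rw [hz, sub_zero] at e2
    have h3 : dslope a μ₀ w ≠ 0 := (hrD hw).2
    rw [← e1, ← e2, smul_eq_mul, smul_eq_mul]
    field_simp
  · obtain ⟨r, hr, hrD⟩ := Metric.mem_nhds_iff.1 (Filter.inter_mem hDn
      ((ha.differentiableAt hDn).continuousAt.eventually_ne hz))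
    exact ⟨fun w => F w / a w, r, hr, (hF.mono fun w hw => (hrD hw).1).div
      (ha.mono fun w hw => (hrD hw).1) fun w hw => (hrD hw).2,
      fun w hw => key w (hrD hw).1 _ (div_mul_cancel₀ _ (hrD hw).2)⟩

lemma exists_quotient {f : ℝ → ℂ} (hf : MemLp f 2 (volume.restrict (Ioi 0)))
    (h0 : ∀ μ b : ℂ, Sub α μ 0 b → pairing α τ f 0 b μ = 0) :
    ∃ G : ℂ → ℂ, Differentiable ℂ G ∧
      ∀ μ a b, Sub α μ a b → G μ * a = pairing α τ f a b μ := by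
  choose g r hr hd hg using A.exists_local_quotient hf h0
  have hG : ∀ μ₀, ∀ μ ∈ Metric.ball μ₀ (r μ₀), g μ μ = g μ₀ μ := by
    intro μ₀ μ hμ
    have hfr := frequently_im_ne_zero μ
    have c1 := ((hd μ).differentiableAt (Metric.ball_mem_nhds μ (hr μ))).continuousAt
    have c2 := ((hd μ₀).differentiableAt (Metric.isOpen_ball.mem_nhds hμ)).continuousAt
    by_contra hne
    have hne' := (c1.sub c2).eventually_ne (sub_ne_zero.2 hne)
    obtain ⟨w, hw, ⟨hw1, hw2⟩, hw3⟩ := (hfr.and_eventually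
      (Filter.inter_mem (Filter.inter_mem (Metric.ball_mem_nhds μ (hr μ))
        (Metric.isOpen_ball.mem_nhds hμ)) hne')).exists
    obtain ⟨a, b, h⟩ := exists_sub A.α_pos A.α_lt w
    have e := (hg μ w hw1 a b h).trans (hg μ₀ w hw2 a b h).symm
    exact sub_ne_zero.1 hw3 (mul_right_cancel₀ (h.left_ne_zero A.α_pos A.α_lt hw) e)
  refine ⟨fun μ => g μ μ, fun μ₀ => ?_, fun μ a b h =>
    hg μ μ (Metric.mem_ball_self (hr μ)) a b h⟩
  refine ((hd μ₀).differentiableAt (Metric.ball_mem_nhds μ₀ (hr μ₀))).congr_of_eventuallyEq ?_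
  filter_upwards [Metric.ball_mem_nhds μ₀ (hr μ₀)] with μ hμ using hG μ₀ μ hμ

end Admissible
end Anharmonic

namespace Anharmonic

lemma norm_integral_mul_le {X : Type*} [MeasurableSpace X] {ν : Measure X} {f g : X → ℂ}
    (hf : MemLp f 2 ν) (hg : MemLp g 2 ν) :
    ‖∫ x, f x * g x ∂ν‖ ≤ √(∫ x, ‖f x‖ ^ 2 ∂ν) * √(∫ x, ‖g x‖ ^ 2 ∂ν) := by
  refine (norm_integral_le_integral_norm _).trans ?_
  simp only [norm_mul]
  have := integral_mul_le_Lp_mul_Lq_of_nonneg (μ := ν) (p := 2) (q := 2)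
    Real.HolderConjugate.two_two (f := fun x => ‖f x‖) (g := fun x => ‖g x‖)
    (ae_of_all _ fun x => norm_nonneg _) (ae_of_all _ fun x => norm_nonneg _)
    (by simpa using hf.norm) (by simpa using hg.norm)
  simpa [Real.sqrt_eq_rpow] using this

lemma exists_polar (μ : ℂ) (φ₀ : ℝ) : ∃ r φ : ℝ, 0 ≤ r ∧ φ ∈ Icc φ₀ (φ₀ + 2 * Real.pi) ∧
    μ = r * dir φ := by
  obtain ⟨φ, hφ, n, hn⟩ : ∃ φ ∈ Icc φ₀ (φ₀ + 2 * Real.pi), ∃ n : ℤ,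
      φ = μ.arg + n * (2 * Real.pi) := by
    have h2 : (0 : ℝ) < 2 * Real.pi := by positivity
    refine ⟨toIcoMod h2 φ₀ μ.arg, Ico_subset_Icc_self (toIcoMod_mem_Ico h2 φ₀ μ.arg),
      -toIcoDiv h2 φ₀ μ.arg, ?_⟩
    have := self_sub_toIcoDiv_zsmul h2 φ₀ μ.arg
    rw [← this]; push_cast; rw [zsmul_eq_mul]; ring
  refine ⟨‖μ‖, φ, norm_nonneg _, hφ, ?_⟩
  rw [dir, hn]
  push_cast
  rw [add_mul, Complex.exp_add,
    show (n : ℂ) * (2 * Real.pi) * Complex.I = n * (2 * Real.pi * Complex.I) by ring,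
    Complex.exp_int_mul_two_pi_mul_I, mul_one, Complex.norm_mul_exp_arg_mul_I]

/-- Phragmén-Lindelöf in a sector with vertex at the origin. -/
lemma bounded_sector {G : ℂ → ℂ} (hG : Differentiable ℂ G) {p C K : ℝ} (hp : 0 < p) (hC : 0 ≤ C)
    (hgr : ∀ μ, ‖G μ‖ ≤ K * Real.exp (C * (1 + ‖μ‖) ^ p)) {φ₁ φ₂ : ℝ} (h12 : φ₁ < φ₂)
    (hφ : p * (φ₂ - φ₁) < Real.pi) {K' : ℝ}
    (h1 : ∀ r : ℝ, 1 ≤ r → ‖G (r * dir φ₁)‖ ≤ K') (h2 : ∀ r : ℝ, 1 ≤ r → ‖G (r * dir φ₂)‖ ≤ K') :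
    ∃ B, ∀ r φ : ℝ, 0 ≤ r → φ ∈ Icc φ₁ φ₂ → ‖G (r * dir φ)‖ ≤ B := by
  obtain ⟨B0, hB0⟩ := (isCompact_closedBall (0 : ℂ) 1).exists_bound_of_continuousOn
    hG.continuous.continuousOn
  have hray : ∀ r φ : ℝ, 0 ≤ r → r ≤ 1 → ‖G (r * dir φ)‖ ≤ B0 := fun r φ hr hr1 =>
    hB0 _ (by simpa [norm_dir, abs_of_nonneg hr] using hr1)
  set B := max B0 K' with hB
  have hexp : ∀ z : ℂ, Complex.exp z = (Real.exp z.re : ℝ) * dir z.im := fun z => by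
    rw [dir, Complex.ofReal_exp, ← Complex.exp_add, Complex.re_add_im]
  have hline : ∀ φ, (∀ r : ℝ, 1 ≤ r → ‖G (r * dir φ)‖ ≤ K') → ∀ r : ℝ, 0 ≤ r →
      ‖G (r * dir φ)‖ ≤ B := fun φ h r hr => by
    rcases le_total r 1 with h3 | h3
    · exact (hray r φ hr h3).trans (le_max_left _ _)
    · exact (h r h3).trans (le_max_right _ _)
  refine ⟨B, fun r φ hr hφm => ?_⟩
  rcases hr.eq_or_lt with rfl | hr
  · exact (hray 0 φ le_rfl zero_le_one).trans (le_max_left _ _)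
  have e : (r : ℂ) * dir φ = Complex.exp (Real.log r + φ * Complex.I) := by
    rw [hexp]; simp [Real.exp_log hr]
  rw [e]
  refine PhragmenLindelof.horizontal_strip (f := fun z => G (Complex.exp z)) (a := φ₁) (b := φ₂)
    (hG.comp Complex.differentiable_exp).diffContOnCl ⟨p, ?_, C * 2 ^ p, ?_⟩ ?_ ?_ ?_ ?_
  · rw [lt_div_iff₀ (by linarith)]; exact hφ
  · refine Asymptotics.IsBigO.of_bound K (Filter.Eventually.of_forall fun z => ?_)
    refine (hgr _).trans ?_
    have hK : 0 ≤ K := by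
      by_contra! hK
      have := (norm_nonneg _).trans (hgr 0)
      exact absurd this (not_le.2 (mul_neg_of_neg_of_pos hK (Real.exp_pos _)))
    rw [Real.norm_of_nonneg (Real.exp_pos _).le, mul_assoc C]
    gcongr
    rw [Complex.norm_exp, mul_comm p, Real.exp_mul, ← Real.mul_rpow (by norm_num) (by positivity)]
    have h3 : Real.exp z.re ≤ Real.exp |z.re| := Real.exp_le_exp.2 (le_abs_self _)
    have h4 : 1 ≤ Real.exp |z.re| := Real.one_le_exp (abs_nonneg _)
    gcongr
    linarith
  · intro z hz; simp only [hexp, hz]; exact hline φ₁ h1 _ (Real.exp_pos _).le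
  · intro z hz; simp only [hexp, hz]; exact hline φ₂ h2 _ (Real.exp_pos _).le
  · simpa using hφm.1
  · simpa using hφm.2

namespace Admissible
variable {α τ : ℝ} (A : Admissible α τ)
include A

lemma quotient_growth {G : ℂ → ℂ} {f : ℝ → ℂ} (hf : MemLp f 2 (volume.restrict (Ioi 0)))
    (hG : Differentiable ℂ G) (hGp : ∀ μ a b, Sub α μ a b → G μ * a = pairing α τ f a b μ) :
    ∃ C K : ℝ, 0 ≤ C ∧ ∀ μ, ‖G μ‖ ≤ K * Real.exp (C * (1 + ‖μ‖) ^ (1 / 2 + 1 / α)) := by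
  obtain ⟨C, K, hC, hK, hb⟩ := A.pairing_bound hf
  set p := 1 / 2 + 1 / α with hp
  have hp1 : 1 ≤ p := by
    have : 1 / 2 ≤ 1 / α := one_div_le_one_div_of_le A.α_pos A.α_lt.le
    rw [hp]; linarith
  have hoff : ∀ μ, |μ.im| * ‖G μ‖ ≤ 13 * K * Real.exp ((C + 2) * (1 + ‖μ‖) ^ p) := by
    intro μ
    rcases eq_or_ne μ.im 0 with h0 | h0
    · rw [h0, abs_zero, zero_mul]; positivity
    obtain ⟨a, b, h⟩ := exists_sub A.α_pos A.α_lt μ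
    have ha := norm_pos_iff.2 (h.left_ne_zero A.α_pos A.α_lt h0)
    have h1 := (hb μ a b h).2
    rw [← hGp μ a b h, norm_mul] at h1
    have h2 := h.im_mul_norm_le A.α_pos A.α_lt
    set m := 1 + ‖μ‖ with hm
    have hm1 : 1 ≤ m := by rw [hm]; linarith [norm_nonneg μ]
    have hYm : |μ.im| ≤ m := by rw [hm]; linarith [Complex.abs_im_le_norm μ]
    have h3 : |μ.im| * (‖a‖ + ‖b‖) ≤ 13 * m ^ 2 * ‖a‖ := by
      have : |μ.im| * ‖a‖ ≤ m ^ 2 * ‖a‖ := by gcongr; nlinarith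
      linarith
    have h4 : m ^ 2 ≤ Real.exp (2 * m ^ p) := by
      have h5 : m ≤ m ^ p := by
        calc m = m ^ (1 : ℝ) := (Real.rpow_one m).symm
          _ ≤ _ := Real.rpow_le_rpow_of_exponent_le hm1 hp1
      have h6 : m ≤ Real.exp (m ^ p) := by linarith [Real.add_one_le_exp (m ^ p)]
      calc m ^ 2 ≤ Real.exp (m ^ p) ^ 2 := by gcongr
        _ = _ := by rw [← Real.exp_nat_mul]; norm_num
    refine le_of_mul_le_mul_right ?_ ha
    calc |μ.im| * ‖G μ‖ * ‖a‖ ≤ |μ.im| * (K * (‖a‖ + ‖b‖) * Real.exp (C * m ^ p)) := by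
          rw [mul_assoc]; gcongr
      _ = K * (|μ.im| * (‖a‖ + ‖b‖)) * Real.exp (C * m ^ p) := by ring
      _ ≤ K * (13 * m ^ 2 * ‖a‖) * Real.exp (C * m ^ p) := by gcongr
      _ ≤ K * (13 * Real.exp (2 * m ^ p) * ‖a‖) * Real.exp (C * m ^ p) := by gcongr
      _ = _ := by rw [add_mul, Real.exp_add]; ring
  refine ⟨(C + 2) * 2 ^ p, 2 * (13 * K), by positivity, fun μ => ?_⟩
  have h2p : (1 : ℝ) ≤ 2 ^ p := Real.one_le_rpow (by norm_num) (by linarith)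
  set x : ℂ := (μ.re : ℂ) with hx
  have hxn : ‖x‖ ≤ ‖μ‖ := by
    rw [hx, Complex.norm_real]; exact Complex.abs_re_le_norm μ
  rcases le_total 1 |μ.im| with h1 | h1
  · calc ‖G μ‖ ≤ |μ.im| * ‖G μ‖ := le_mul_of_one_le_left (norm_nonneg _) h1
      _ ≤ _ := hoff μ
      _ ≤ _ := by
        have h3 : C + 2 ≤ (C + 2) * 2 ^ p := le_mul_of_one_le_right (by positivity) h2p
        have h4 : 13 * K ≤ 2 * (13 * K) := by linarith
        exact mul_le_mul h4 (Real.exp_le_exp.2 (by gcongr)) (by positivity) (by positivity)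
  · set H := fun z => G z * ((z - x) ^ 2 - 1) with hH
    have hHd : Differentiable ℂ H := hG.mul (by fun_prop)
    have h2 := Complex.norm_le_of_forall_mem_frontier_norm_le (f := H) (U := Metric.ball x 1)
      Metric.isBounded_ball hHd.diffContOnCl
      (C := 2 * (13 * K) * Real.exp ((C + 2) * 2 ^ p * (1 + ‖μ‖) ^ p)) (fun z hz => ?_)
      (z := μ) (by
        rw [closure_ball _ one_ne_zero, mem_closedBall_iff_norm]
        have : μ - x = μ.im * Complex.I := by
          apply Complex.ext <;> simp [hx]
        rw [this]; simpa using h1)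
    · refine le_trans ?_ h2
      simp only [hH, norm_mul]
      refine le_mul_of_one_le_right (norm_nonneg _) ?_
      have e : (μ - x) ^ 2 - 1 = ((-(1 + μ.im ^ 2) : ℝ) : ℂ) := by
        have : μ - x = μ.im * Complex.I := by
          apply Complex.ext <;> simp [hx]
        rw [this, mul_pow, Complex.I_sq]; push_cast; ring
      rw [e, Complex.norm_real, Real.norm_eq_abs, abs_neg, abs_of_pos (by positivity)]
      nlinarith [sq_nonneg μ.im]
    · rw [frontier_ball _ one_ne_zero, mem_sphere_iff_norm] at hz
      have hz1 : ‖(z - x) ^ 2 - 1‖ = 2 * |z.im| := by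
        have e1 : (1 : ℂ) = (z - x) * conj (z - x) := by
          rw [Complex.mul_conj, Complex.normSq_eq_norm_sq, hz]; simp
        have e2 : (z - x) ^ 2 - 1 = (z - x) * ((2 * z.im : ℝ) * Complex.I) := by
          rw [show (z - x) ^ 2 - 1 = (z - x) ^ 2 - (z - x) * conj (z - x) by rw [← e1], sq,
            ← mul_sub, Complex.sub_conj]
          simp [hx]
        rw [e2, norm_mul, hz, norm_mul, Complex.norm_I, Complex.norm_real, Real.norm_eq_abs,
          abs_mul, abs_two]; ring
      simp only [hH, norm_mul, hz1]
      have h3 : 1 + ‖z‖ ≤ 2 * (1 + ‖μ‖) := by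
        have : ‖z‖ ≤ ‖z - x‖ + ‖x‖ := by simpa using norm_add_le (z - x) x
        linarith [norm_nonneg μ]
      calc ‖G z‖ * (2 * |z.im|) = 2 * (|z.im| * ‖G z‖) := by ring
        _ ≤ 2 * (13 * K * Real.exp ((C + 2) * (1 + ‖z‖) ^ p)) :=
          mul_le_mul_of_nonneg_left (hoff z) zero_le_two
        _ ≤ 2 * (13 * K * Real.exp ((C + 2) * (2 * (1 + ‖μ‖)) ^ p)) := by gcongr
        _ = _ := by rw [Real.mul_rpow (by norm_num) (by positivity)]; ring_nf

lemma raySol_zero (a b μ : ℂ) : raySol α τ a b μ 0 = a := by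
  simp [raySol, sol_zero A.α_pos]

lemma raySol1_zero (a b μ : ℂ) : raySol1 α τ a b μ 0 = dir τ * b := by
  simp [raySol1, sol1_zero A.α_pos]

lemma dir_re_pos : 0 < (dir τ).re := by
  rw [dir_re]; exact Real.cos_pos_of_mem_Ioo ⟨by linarith [A.τ_pos, Real.pi_pos], A.τ_lt⟩

lemma eq_zero_of_data {μ a b : ℂ} {x : ℝ} (hx : 0 ≤ x) (h0 : raySol α τ a b μ x = 0)
    (h1 : raySol1 α τ a b μ x = 0) : a = 0 ∧ b = 0 := by
  have h1 : sol1 α a b μ (x * dir τ) = 0 := (mul_eq_zero.1 h1).resolve_left (dir_ne_zero τ)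
  rw [raySol] at h0
  rcases hx.eq_or_lt with rfl | hx
  · simpa [sol_zero A.α_pos, sol1_zero A.α_pos] using And.intro h0 h1
  have hz : 0 < ((x : ℂ) * dir τ).re := by
    rw [Complex.re_ofReal_mul]; exact mul_pos hx A.dir_re_pos
  have e1 := sol_wronskian_re A.α_pos A.α_lt a b μ hz 0 1
  have e2 := sol_wronskian_re A.α_pos A.α_lt a b μ hz 1 0
  rw [h0, h1] at e1 e2
  constructor
  · simpa using e1.symm
  · simpa using e2.symm

lemma norm_pot_le (μ : ℂ) {s : ℝ} (hs : 0 ≤ s) : ‖pot α τ μ s‖ ≤ s ^ α + ‖μ‖ := by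
  rw [A.pot_eq μ hs]
  refine (norm_sub_le _ _).trans ?_
  rw [norm_mul, norm_mul, norm_dir, norm_dir, mul_one, one_mul, Complex.norm_real,
    Real.norm_of_nonneg (by positivity)]

lemma isDecaying_good {e : ℂ} {c : ℝ} (he0 : 0 < e.re) (he1 : ‖e‖ ≤ 1) (hc : 0 ≤ c)
    (hθ : 0 ≤ (e * dir ((α + 2) * τ)).re) {μ a b : ℂ} (h : Sub α μ a b)
    (hμ : c * ‖μ‖ ≤ -(e * (dir (2 * τ) * μ)).re) {X : ℝ} (hX : 0 ≤ X) :
    IsDecaying (fun s => pot α τ μ (X + s)) (fun s => raySol α τ a b μ (X + s))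
      (fun s => raySol1 α τ a b μ (X + s)) e (c * ‖μ‖) := by
  refine A.isDecaying h hX he0 he1 (by positivity) fun s hs => ?_
  have hs0 : 0 ≤ s := by linarith
  rw [A.pot_eq μ hs0, mul_sub, mul_left_comm, Complex.sub_re, Complex.re_ofReal_mul]
  have : 0 ≤ s ^ α * (e * dir ((α + 2) * τ)).re := by positivity
  linarith

/-- Estimates for subdominant solutions when the spectral parameter lies in a direction where
the rotated energy is coercive. -/
lemma good_direction {e : ℂ} {c : ℝ} (he0 : 0 < e.re) (he1 : ‖e‖ ≤ 1) (hc : 0 < c)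
    (hθ : 0 ≤ (e * dir ((α + 2) * τ)).re) (X₀ : ℝ) :
    ∃ K > 0, ∀ μ a b : ℂ, Sub α μ a b → 1 ≤ ‖μ‖ → c * ‖μ‖ ≤ -(e * (dir (2 * τ) * μ)).re →
      ∀ X ∈ Icc 0 X₀, raySol α τ a b μ X ≠ 0 ∧
        ‖raySol1 α τ a b μ X‖ ≤ K * √‖μ‖ * ‖raySol α τ a b μ X‖ ∧
        IntegrableOn (fun s => ‖raySol α τ a b μ (X + s)‖ ^ 2) (Ioi 0) ∧
        ∫ s in Ioi (0 : ℝ), ‖raySol α τ a b μ (X + s)‖ ^ 2 ≤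
          K / √‖μ‖ * ‖raySol α τ a b μ X‖ ^ 2 ∧
        ∀ T, 0 ≤ T → ‖raySol α τ a b μ (X + T)‖ ^ 2 ≤ K * ‖raySol α τ a b μ X‖ ^ 2 := by
  set N := (|X₀| + 1) ^ α + 1 with hN
  have hN0 : 0 < N := by positivity
  set D := 1 / e.re + N / c + N / e.re with hD
  have hD0 : 0 < D := by positivity
  have hDc : 0 < 1 + D / √(e.re * c) := by positivity
  refine ⟨D + D / c + (1 + D / √(e.re * c)), by positivity, fun μ a b h hμ1 hμ X hX => ?_⟩
  set K := D + D / c + (1 + D / √(e.re * c)) with hK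
  have hDK : D ≤ K := by rw [hK]; linarith [div_pos hD0 hc]
  set r := √‖μ‖ with hr
  have hr1 : 1 ≤ r := Real.one_le_sqrt.2 hμ1
  have hrr : ‖μ‖ = r ^ 2 := (Real.sq_sqrt (norm_nonneg _)).symm
  have hdec := A.isDecaying_good he0 he1 hc.le hθ h hμ hX.1
  have hd0 : 0 < c * ‖μ‖ := by positivity
  have h1 := hdec.norm_deriv_zero_le hd0 (ℓ := 1 / r) (B := N * r ^ 2) (k := r) (by positivity)
    (by positivity) (fun s hs => by
      have hs1 : s ≤ 1 := hs.2.le.trans ((div_le_one (by positivity)).2 hr1)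
      refine (A.norm_pot_le μ (by linarith [hX.1, hs.1])).trans ?_
      rw [hrr, hN]
      have h2 : (X + s) ^ α ≤ (|X₀| + 1) ^ α :=
        Real.rpow_le_rpow (by linarith [hX.1, hs.1])
          (by linarith [hX.2, le_abs_self X₀]) A.α_pos.le
      have h3 : 1 ≤ r ^ 2 := by nlinarith
      have h4 : (|X₀| + 1) ^ α ≤ (|X₀| + 1) ^ α * r ^ 2 := le_mul_of_one_le_right (by positivity) h3
      linarith)
  simp only [add_zero] at h1
  have e1 : 1 / (1 / r * e.re) + N * r ^ 2 * r / (c * ‖μ‖) + N * r ^ 2 / (r * e.re) = D * r := by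
    rw [hrr, hD]; field_simp
  rw [e1] at h1
  have hfl := hdec.flux_zero_le
  simp only [add_zero] at hfl
  have hfl2 : flux e (fun s => raySol α τ a b μ (X + s)) (fun s => raySol1 α τ a b μ (X + s)) 0
      ≤ D * r * ‖raySol α τ a b μ X‖ ^ 2 := by
    refine hfl.trans ?_
    rw [sq, ← mul_assoc]; gcongr
  refine ⟨fun h0 => ?_, h1.trans (by gcongr), hdec.integrableOn_sq hd0, ?_, fun T hT => ?_⟩
  · rw [h0, norm_zero, mul_zero] at h1
    have := A.eq_zero_of_data hX.1 h0 (norm_le_zero_iff.1 h1)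
    exact h.1.elim (fun h => h this.1) fun h => h this.2
  · have h2 := (hdec.integral_Ioi_sq_le hd0).trans hfl2
    have h3 : (∫ s in Ioi (0 : ℝ), ‖raySol α τ a b μ (X + s)‖ ^ 2) ≤
        D / c / r * ‖raySol α τ a b μ X‖ ^ 2 := by
      refine le_of_mul_le_mul_left (h2.trans (le_of_eq ?_)) hd0
      rw [hrr]; field_simp
    refine h3.trans ?_
    gcongr
    rw [hK]; linarith
  · have h2 := hdec.norm_sq_le hd0 hT
    simp only [add_zero] at h2
    have e2 : √(e.re * (c * ‖μ‖)) = √(e.re * c) * r := by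
      rw [← mul_assoc, Real.sqrt_mul (by positivity)]
    have h3 : ‖raySol1 α τ a b μ X‖ * ‖raySol α τ a b μ X‖ / √(e.re * (c * ‖μ‖)) ≤
        D / √(e.re * c) * ‖raySol α τ a b μ X‖ ^ 2 := by
      have : 0 < √(e.re * c) := by positivity
      rw [e2, div_le_iff₀ (by positivity)]
      calc _ ≤ D * r * ‖raySol α τ a b μ X‖ * ‖raySol α τ a b μ X‖ := by gcongr
        _ = _ := by field_simp
    refine h2.trans ?_
    calc _ ≤ (1 + D / √(e.re * c)) * ‖raySol α τ a b μ X‖ ^ 2 := by linarith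
      _ ≤ _ := by gcongr; rw [hK]; linarith [div_pos hD0 hc]

lemma exists_good {ε : ℝ} (hε : 0 < ε) (hε1 : (α + 2) * τ + ε < Real.pi) :
    ∃ e₁ e₂ : ℂ, ∃ c > 0, (∀ e, e = e₁ ∨ e = e₂ → 0 < e.re ∧ ‖e‖ ≤ 1 ∧
      0 ≤ (e * dir ((α + 2) * τ)).re) ∧
      ∀ r φ : ℝ, 0 ≤ r → φ ∈ Icc ((α + 2) * τ + ε) (2 * Real.pi - ε) →
        (c * r ≤ -(e₁ * (r * dir φ)).re ∨ c * r ≤ -(e₂ * (r * dir φ)).re) := by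
  set θ := (α + 2) * τ with hθ
  have hθ0 : 0 < θ := by have := A.τ_pos; have := A.α_pos; positivity
  have hpi := Real.pi_pos
  have hs1 : 0 < Real.sin ε := Real.sin_pos_of_pos_of_lt_pi hε (by linarith)
  have hs2 : 0 < Real.sin θ := Real.sin_pos_of_pos_of_lt_pi hθ0 (by linarith)
  have hs3 : 0 < Real.sin (ε / 2) := Real.sin_pos_of_pos_of_lt_pi (by linarith) (by linarith)
  have key : ∀ x y t : ℝ, 0 ≤ x → y ≤ Real.pi → t ∈ Icc x y →
      min (Real.sin x) (Real.sin y) ≤ Real.sin t := fun x y t hx hy ht => by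
    have hc := strictConcaveOn_sin_Icc.concaveOn
    exact hc.min_le_of_mem_Icc ⟨hx, by linarith [ht.1, ht.2]⟩ ⟨by linarith [ht.1, ht.2], hy⟩ ht
  refine ⟨dir (Real.pi / 2 - θ), dir (-(Real.pi / 2) + ε / 2),
    min (min (Real.sin ε) (Real.sin θ)) (Real.sin (ε / 2)), by positivity, ?_, ?_⟩
  · rintro e (rfl | rfl)
    · refine ⟨?_, (norm_dir _).le, ?_⟩
      · rw [dir_re]; exact Real.cos_pos_of_mem_Ioo ⟨by linarith, by linarith⟩
      · rw [← dir_add, dir_re]; simp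
    · refine ⟨?_, (norm_dir _).le, ?_⟩
      · rw [dir_re]; exact Real.cos_pos_of_mem_Ioo ⟨by linarith, by linarith⟩
      · rw [← dir_add, dir_re]
        exact Real.cos_nonneg_of_mem_Icc ⟨by linarith, by linarith⟩
  · intro r φ hr hφ
    have e0 : ∀ ω, -(dir ω * (r * dir φ)).re = -Real.cos (ω + φ) * r := fun ω => by
      rw [mul_left_comm, ← dir_add, Complex.re_ofReal_mul, dir_re]; ring
    rw [e0, e0]
    rcases le_total φ Real.pi with h1 | h1
    · left
      gcongr
      have e1 : -Real.cos (Real.pi / 2 - θ + φ) = Real.sin (φ - θ) := by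
        rw [show Real.pi / 2 - θ + φ = (φ - θ) + Real.pi / 2 by ring, Real.cos_add_pi_div_two,
          neg_neg]
      rw [e1]
      refine (min_le_left _ _).trans ?_
      rw [← Real.sin_pi_sub θ]
      exact key _ _ _ hε.le (by linarith) ⟨by linarith [hφ.1], by linarith⟩
    · right
      gcongr
      have e1 : -Real.cos (-(Real.pi / 2) + ε / 2 + φ) = Real.sin (φ + ε / 2 - Real.pi) := by
        rw [Real.sin_sub_pi, show -(Real.pi / 2) + ε / 2 + φ = (φ + ε / 2) - Real.pi / 2 by ring,
          Real.cos_sub_pi_div_two]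
      rw [e1]
      refine (min_le_right _ _).trans ?_
      have := key (ε / 2) (Real.pi - ε / 2) (φ + ε / 2 - Real.pi) (by linarith) (by linarith)
        ⟨by linarith, by linarith [hφ.2]⟩
      rwa [Real.sin_pi_sub, min_self] at this

lemma quotient_good {G : ℂ → ℂ} {f : ℝ → ℂ} (hf : MemLp f 2 (volume.restrict (Ioi 0)))
    (hGp : ∀ μ a b, Sub α μ a b → G μ * a = pairing α τ f a b μ) {ε : ℝ} (hε : 0 < ε)
    (hε1 : (α + 2) * τ + ε < Real.pi) :
    ∃ K > 0, ∀ r φ : ℝ, 1 ≤ r → φ ∈ Icc ((α + 2) * τ + ε) (2 * Real.pi - ε) →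
      ‖G (r * dir (φ - 2 * τ))‖ ≤ K * √(1 / √r) := by
  obtain ⟨e₁, e₂, c, hc, he, hcov⟩ := A.exists_good hε hε1
  obtain ⟨a1, a2, a3⟩ := he e₁ (Or.inl rfl)
  obtain ⟨b1, b2, b3⟩ := he e₂ (Or.inr rfl)
  obtain ⟨K₁, hK₁, h1⟩ := A.good_direction a1 a2 hc a3 0
  obtain ⟨K₂, hK₂, h2⟩ := A.good_direction b1 b2 hc b3 0
  set F := √(∫ x in Ioi (0 : ℝ), ‖f x‖ ^ 2) with hF
  have key : ∀ K, 0 < K → ∀ μ a b : ℂ, Sub α μ a b → 1 ≤ ‖μ‖ →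
      (raySol α τ a b μ 0 ≠ 0 ∧
        IntegrableOn (fun s => ‖raySol α τ a b μ s‖ ^ 2) (Ioi 0) ∧
        ∫ s in Ioi (0 : ℝ), ‖raySol α τ a b μ s‖ ^ 2 ≤
          K / √‖μ‖ * ‖raySol α τ a b μ 0‖ ^ 2) → ‖G μ‖ ≤ F * √K * √(1 / √‖μ‖) := by
    intro K hK μ a b h hμ ⟨h1, h2, h3⟩
    rw [A.raySol_zero] at h1 h3
    refine le_of_mul_le_mul_right ?_ (norm_pos_iff.2 h1)
    rw [← norm_mul, hGp μ a b h]
    have hg : MemLp (raySol α τ a b μ) 2 (volume.restrict (Ioi 0)) :=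
      (memLp_two_iff_integrable_sq_norm (A.aestronglyMeasurable_raySol a b μ)).2 h2
    refine (norm_integral_mul_le hf hg).trans ?_
    rw [← hF]
    calc F * √(∫ s in Ioi (0 : ℝ), ‖raySol α τ a b μ s‖ ^ 2)
        ≤ F * √(K / √‖μ‖ * ‖a‖ ^ 2) := by gcongr
      _ = _ := by
        rw [Real.sqrt_mul (by positivity), Real.sqrt_sq (norm_nonneg _), div_eq_mul_one_div,
          Real.sqrt_mul hK.le]; ring
  refine ⟨F * √K₁ + F * √K₂ + 1, by positivity, fun r φ hr hφ => ?_⟩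
  set μ := (r : ℂ) * dir (φ - 2 * τ) with hμ
  have hμn : ‖μ‖ = r := by
    rw [hμ, norm_mul, norm_dir, mul_one, Complex.norm_real, Real.norm_of_nonneg (by linarith)]
  have hμe : dir (2 * τ) * μ = r * dir φ := by
    rw [hμ, mul_left_comm, ← dir_add]; ring_nf
  obtain ⟨a, b, h⟩ := exists_sub A.α_pos A.α_lt μ
  have hpos : 0 ≤ F * √K₁ ∧ 0 ≤ F * √K₂ := ⟨by positivity, by positivity⟩
  rcases hcov r φ (by linarith) hφ with h3 | h3
  · obtain ⟨g1, -, g2, g3, -⟩ := h1 μ a b h (by rw [hμn]; exact hr) (by rw [hμn, hμe]; exact h3) 0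
      (by simp)
    simp only [zero_add] at g2 g3
    have := key K₁ hK₁ μ a b h (by rw [hμn]; exact hr) ⟨g1, g2, g3⟩
    rw [hμn] at this
    refine this.trans ?_
    gcongr; linarith
  · obtain ⟨g1, -, g2, g3, -⟩ := h2 μ a b h (by rw [hμn]; exact hr) (by rw [hμn, hμe]; exact h3) 0
      (by simp)
    simp only [zero_add] at g2 g3
    have := key K₂ hK₂ μ a b h (by rw [hμn]; exact hr) ⟨g1, g2, g3⟩
    rw [hμn] at this
    refine this.trans ?_
    gcongr; linarith

end Admissible
end Anharmonic

namespace Anharmonic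

/-- The principal square root. -/
noncomputable def csqrt (z : ℂ) : ℂ := z ^ ((1 / 2 : ℝ) : ℂ)

lemma csqrt_sq (z : ℂ) : csqrt z ^ 2 = z := by
  have := Complex.cpow_nat_inv_pow z (n := 2) two_ne_zero
  rw [csqrt]
  convert! this using 3
  push_cast; norm_num

lemma csqrt_zero : csqrt 0 = 0 := by
  rw [csqrt, Complex.zero_cpow (by norm_num)]

lemma continuousOn_csqrt_slitPlane : ContinuousOn csqrt Complex.slitPlane := fun _ hz =>
  (continuousAt_id.cpow continuousAt_const hz).continuousWithinAt

lemma continuousOn_csqrt_re : ContinuousOn csqrt {z : ℂ | 0 ≤ z.re} :=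
  continuousOn_cpow_re (by norm_num)

lemma arg_of_re_exp_pos {ω : ℝ} (hω : |ω| < Real.pi / 2) {z : ℂ}
    (hz : 0 < (Complex.exp (ω * Complex.I) * z).re) :
    z ≠ 0 ∧ |ω + z.arg| < Real.pi / 2 := by
  have hz0 : z ≠ 0 := fun h => by simp [h] at hz
  refine ⟨hz0, ?_⟩
  have h1 := re_exp_mul_cpow ω hz0 1
  rw [Complex.ofReal_one, Complex.cpow_one, Real.rpow_one, one_mul] at h1
  rw [h1] at hz
  have hc : 0 < Real.cos (ω + z.arg) := pos_of_mul_pos_right hz (norm_nonneg _)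
  have ha := Complex.neg_pi_lt_arg z
  have hb := Complex.arg_le_pi z
  rw [abs_lt] at hω ⊢
  constructor
  · by_contra! hcon
    have : Real.cos (ω + z.arg) ≤ 0 := by
      rw [← Real.cos_neg]
      exact Real.cos_nonpos_of_pi_div_two_le_of_le (by linarith) (by linarith)
    linarith
  · by_contra! hcon
    have : Real.cos (ω + z.arg) ≤ 0 :=
      Real.cos_nonpos_of_pi_div_two_le_of_le (by linarith) (by linarith)
    linarith

lemma mem_slitPlane_of_re_exp_pos {ω : ℝ} (hω : |ω| < Real.pi / 2) {z : ℂ}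
    (hz : 0 < (Complex.exp (ω * Complex.I) * z).re) : z ∈ Complex.slitPlane := by
  obtain ⟨h0, h1⟩ := arg_of_re_exp_pos hω hz
  rw [Complex.mem_slitPlane_iff_arg]
  refine ⟨fun h => ?_, h0⟩
  rw [h, abs_lt] at h1
  rw [abs_lt] at hω
  linarith

lemma csqrt_re_pos {ω : ℝ} (hω : |ω| < Real.pi / 2) {z : ℂ}
    (hz : 0 < (Complex.exp (ω * Complex.I) * z).re) :
    0 < (Complex.exp (ω * Complex.I) * csqrt z).re := by
  obtain ⟨h0, h1⟩ := arg_of_re_exp_pos hω hz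
  rw [csqrt, re_exp_mul_cpow ω h0]
  rw [abs_lt] at h1 hω
  exact mul_pos (Real.rpow_pos_of_pos (norm_pos_iff.2 h0) _)
    (Real.cos_pos_of_mem_Ioo ⟨by linarith, by linarith⟩)

variable {α : ℝ}

lemma continuousOn_symbol (ω : ℝ) (μ : ℂ) :
    ContinuousOn (fun z : ℂ => z ^ (α : ℂ) - μ) (region α ω μ) := fun _ hz =>
  ((continuousAt_id.cpow continuousAt_const (Or.inl hz.1)).sub continuousAt_const).continuousWithinAt

lemma continuousOn_csqrt_symbol {ω : ℝ} (hω : |ω| < Real.pi / 2) (μ : ℂ) :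
    ContinuousOn (fun z : ℂ => csqrt (z ^ (α : ℂ) - μ)) (region α ω μ) :=
  continuousOn_csqrt_slitPlane.comp (continuousOn_symbol ω μ) fun _ hz =>
    mem_slitPlane_of_re_exp_pos hω hz.2.2

/-- The WKB approximation of the logarithmic derivative of a subdominant solution. -/
lemma wkb (hα : 0 < α) (hα2 : α < 2) {ω : ℝ} (hω : |ω| < Real.pi / 2) {μ : ℂ} {K : Set ℂ}
    (hK : IsCompact K) (hKr : K ⊆ region α ω μ) :
    ∃ M : ℝ, 0 < M ∧ ∀ N : ℝ, 1 ≤ N → ∀ a b, Sub α (((N ^ α : ℝ) : ℂ) * μ) a b → ∀ z ∈ K,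
      sol α a b (((N ^ α : ℝ) : ℂ) * μ) (N * z) ≠ 0 ∧
      ‖sol1 α a b (((N ^ α : ℝ) : ℂ) * μ) (N * z) / sol α a b (((N ^ α : ℝ) : ℂ) * μ) (N * z)‖
        ≤ M * N ^ (α / 2) ∧
      ‖N * (sol1 α a b (((N ^ α : ℝ) : ℂ) * μ) (N * z) /
          sol α a b (((N ^ α : ℝ) : ℂ) * μ) (N * z))
        + ((N ^ (1 + α / 2) : ℝ) : ℂ) * csqrt (z ^ (α : ℂ) - μ)‖ ≤ M := by
  rcases K.eq_empty_or_nonempty with rfl | hne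
  · exact ⟨1, one_pos, by simp⟩
  obtain ⟨r, hr, hth⟩ := hK.exists_thickening_subset_open (isOpen_region ω μ) hKr
  obtain ⟨B, hB⟩ := hK.exists_bound_of_continuousOn ((continuousOn_symbol ω μ).mono hKr)
  obtain ⟨z₁, hz₁, hmin⟩ := hK.exists_isMinOn hne
    (f := fun z : ℂ => (Complex.exp (ω * Complex.I) * csqrt (z ^ (α : ℂ) - μ)).re)
    (Complex.continuous_re.comp_continuousOn (continuousOn_const.mul
      ((continuousOn_csqrt_symbol hω μ).mono hKr)))
  set m := (Complex.exp (ω * Complex.I) * csqrt (z₁ ^ (α : ℂ) - μ)).re with hm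
  have hmp : 0 < m := csqrt_re_pos hω (hKr hz₁).2.2
  have hB0 : 0 ≤ B := (norm_nonneg _).trans (hB z₁ hz₁)
  set M1 := B + 1 + 2 / r with hM1
  have hM1p : 0 < M1 := by positivity
  refine ⟨max M1 (2 * M1 / (r * m)), lt_max_of_lt_left hM1p, fun N hN a b h z hz => ?_⟩
  have hN0 : 0 < N := by linarith
  have hball := ball_smul_subset hα hN0 (z := z) (r := r) (μ := μ) (ω := ω)
    ((Metric.ball_subset_thickening hz r).trans hth)
  have hmem := smul_mem_region hα hN0 (hKr hz)
  have hn0 := h.sol_ne_zero_of_mem hα hα2 hω hmem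
  have heik := h.eikonal hα hα2 hω (mul_pos hN0 hr) hball
  have hneg := h.logDeriv_neg hα hα2 hω hmem
  set v := sol1 α a b (((N ^ α : ℝ) : ℂ) * μ) (N * z) / sol α a b (((N ^ α : ℝ) : ℂ) * μ) (N * z)
    with hv
  rw [real_mul_cpow hN0 z hα, ← mul_sub] at heik
  set Q := z ^ (α : ℂ) - μ with hQ
  have hQB : ‖Q‖ ≤ B := hB z hz
  set s := csqrt Q with hs
  have hsQ : s ^ 2 = Q := csqrt_sq Q
  set k : ℝ := N ^ (α / 2) with hk
  have hk1 : 1 ≤ k := Real.one_le_rpow hN (by linarith)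
  have hk2 : N ^ α = k ^ 2 := by
    rw [hk, ← Real.rpow_natCast, ← Real.rpow_mul hN0.le]; congr 1; push_cast; ring
  have hk3 : N ^ (1 + α / 2) = N * k := by
    rw [Real.rpow_add hN0, Real.rpow_one]
  have hX0 := norm_nonneg v
  have hle : ‖v‖ ≤ M1 * k := by
    by_contra! hcon
    have h1 : ‖v‖ ^ 2 ≤ k ^ 2 * B + 2 * ‖v‖ / r := by
      have e1 : ‖v ^ 2‖ ≤ ‖((N ^ α : ℝ) : ℂ) * Q‖ + 2 * ‖v‖ / (N * r) := by
        have := norm_le_insert' (v ^ 2) (((N ^ α : ℝ) : ℂ) * Q)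
        linarith
      rw [norm_pow, norm_mul, hk2, Complex.norm_real, Real.norm_of_nonneg (by positivity)] at e1
      have e2 : 2 * ‖v‖ / (N * r) ≤ 2 * ‖v‖ / r :=
        div_le_div_of_nonneg_left (by positivity) hr (by nlinarith)
      have e3 : k ^ 2 * ‖Q‖ ≤ k ^ 2 * B := mul_le_mul_of_nonneg_left hQB (by positivity)
      linarith
    have h2 : 2 * ‖v‖ / r ≤ (2 / r) * k * ‖v‖ := by
      have : 0 ≤ 2 * ‖v‖ / r := by positivity
      calc 2 * ‖v‖ / r ≤ 2 * ‖v‖ / r * k := le_mul_of_one_le_right this hk1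
        _ = _ := by ring
    have h3 : M1 * k * ‖v‖ ≤ ‖v‖ ^ 2 := by nlinarith
    have h4 : (B + 1) * k * ‖v‖ ≤ k ^ 2 * B := by
      have : M1 * k * ‖v‖ = (B + 1) * k * ‖v‖ + (2 / r) * k * ‖v‖ := by rw [hM1]; ring
      linarith
    have h5 : k ≤ ‖v‖ := by
      have : 1 ≤ M1 := by rw [hM1]; have : 0 < 2 / r := by positivity
                          linarith
      nlinarith
    have h6 : (B + 1) * k * k ≤ (B + 1) * k * ‖v‖ := mul_le_mul_of_nonneg_left h5 (by positivity)
    nlinarith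
  refine ⟨hn0, hle.trans (mul_le_mul_of_nonneg_right (le_max_left _ _) (by positivity)), ?_⟩
  have hprod : (v - k * s) * (v + k * s) = v ^ 2 - ((N ^ α : ℝ) : ℂ) * Q := by
    rw [hk2, ← hsQ]; push_cast; ring
  have hms : m ≤ (Complex.exp (ω * Complex.I) * s).re := hmin hz
  have hlow : k * m ≤ ‖v - k * s‖ := by
    have e1 : (Complex.exp (ω * Complex.I) * (k * s - v)).re ≤ ‖v - k * s‖ := by
      refine (Complex.re_le_norm _).trans ?_
      rw [norm_mul, Complex.norm_exp_ofReal_mul_I, one_mul, norm_sub_rev]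
    have e2 : (Complex.exp (ω * Complex.I) * (k * s - v)).re
        = k * (Complex.exp (ω * Complex.I) * s).re - (Complex.exp (ω * Complex.I) * v).re := by
      rw [← Complex.re_ofReal_mul, ← Complex.sub_re]; congr 1; ring
    have e3 : k * m ≤ k * (Complex.exp (ω * Complex.I) * s).re :=
      mul_le_mul_of_nonneg_left hms (by linarith)
    linarith
  have hup : k * m * ‖v + k * s‖ ≤ 2 * (M1 * k) / (N * r) := by
    calc k * m * ‖v + k * s‖ ≤ ‖v - k * s‖ * ‖v + k * s‖ :=
          mul_le_mul_of_nonneg_right hlow (norm_nonneg _)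
      _ = ‖v ^ 2 - ((N ^ α : ℝ) : ℂ) * Q‖ := by rw [← norm_mul, hprod]
      _ ≤ 2 * ‖v‖ / (N * r) := heik
      _ ≤ _ := by gcongr
  have e : (N : ℂ) * v + ((N ^ (1 + α / 2) : ℝ) : ℂ) * s = N * (v + k * s) := by
    rw [hk3]; push_cast; ring
  rw [e, norm_mul, Complex.norm_real, Real.norm_of_nonneg hN0.le]
  refine le_trans ?_ (le_max_right _ _)
  rw [le_div_iff₀ (by positivity)]
  rw [le_div_iff₀ (by positivity)] at hup
  have hkp : 0 < k := by linarith
  have : k * (N * ‖v + k * s‖ * (r * m)) ≤ k * (2 * M1) := by nlinarith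
  exact le_of_mul_le_mul_left this hkp

/-- The WKB estimate of a subdominant solution along a path. -/
lemma wkb_path (hα : 0 < α) (hα2 : α < 2) {ω : ℝ} (hω : |ω| < Real.pi / 2) {μ : ℂ}
    {γ γ' : ℝ → ℂ} (hγ : ∀ s, HasDerivAt γ (γ' s) s) (hγ' : Continuous γ') {s₀ s₁ : ℝ}
    (hs : s₀ ≤ s₁) (hmem : ∀ s ∈ Icc s₀ s₁, γ s ∈ region α ω μ) :
    ∃ M : ℝ, 0 < M ∧ ∀ N : ℝ, 1 ≤ N → ∀ a b, Sub α (((N ^ α : ℝ) : ℂ) * μ) a b →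
      ‖sol α a b (((N ^ α : ℝ) : ℂ) * μ) (N * γ s₁)‖ ≤
        M * ‖sol α a b (((N ^ α : ℝ) : ℂ) * μ) (N * γ s₀)‖ *
          Real.exp (-(N ^ (1 + α / 2) *
            (∫ s in s₀..s₁, csqrt (γ s ^ (α : ℂ) - μ) * γ' s).re)) := by
  have hγc : Continuous γ := continuous_iff_continuousAt.2 fun s => (hγ s).continuousAt
  have hKc : IsCompact (γ '' Icc s₀ s₁) := isCompact_Icc.image hγc
  obtain ⟨M, hM, hwkb⟩ := wkb hα hα2 hω hKc (by rintro _ ⟨s, hs, rfl⟩; exact hmem s hs)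
  obtain ⟨L, hL⟩ := isCompact_Icc.exists_bound_of_continuousOn (hγ'.continuousOn (s := Icc s₀ s₁))
  have hL0 : 0 ≤ L := (norm_nonneg _).trans (hL s₀ ⟨le_rfl, hs⟩)
  refine ⟨Real.exp (M * L * (s₁ - s₀)), Real.exp_pos _, fun N hN a b h => ?_⟩
  have hN0 : 0 < N := by linarith
  set ν := ((N ^ α : ℝ) : ℂ) * μ with hν
  set P : ℝ := N ^ (1 + α / 2) with hP
  set σ : ℝ → ℂ := fun s => csqrt (γ s ^ (α : ℂ) - μ) * γ' s with hσ
  have hσc : ContinuousOn σ (Icc s₀ s₁) :=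
    ((continuousOn_csqrt_symbol hω μ).comp hγc.continuousOn hmem).mul hγ'.continuousOn
  set J : ℝ → ℂ := fun s => ∫ x in s₀..s, σ x with hJ
  have hJc : ContinuousOn J (Icc s₀ s₁) := by
    have := intervalIntegral.continuousOn_primitive_interval (μ := volume) (f := σ) (a := s₀) (b := s₁)
      (by rw [uIcc_of_le hs]; exact hσc.integrableOn_Icc)
    rwa [uIcc_of_le hs] at this
  have hJd : ∀ s ∈ Ico s₀ s₁, HasDerivWithinAt J (σ s) (Ici s) s := fun s hs' => by
    have hmem' : s ∈ Icc s₀ s₁ := ⟨hs'.1, hs'.2.le⟩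
    have := Fact.mk hmem'
    refine (intervalIntegral.integral_hasDerivWithinAt_right
      ((hσc.mono (Icc_subset_Icc_right hs'.2.le)).intervalIntegrable_of_Icc hs'.1)
      (s := Icc s₀ s₁) (t := Icc s₀ s₁)
      (hσc.stronglyMeasurableAtFilter_nhdsWithin measurableSet_Icc s)
      (hσc s hmem')).mono_of_mem_nhdsWithin (Icc_mem_nhdsGE_of_mem hs')
  set F : ℝ → ℂ := fun s => sol α a b ν (N * γ s) * Complex.exp (P * J s) with hF
  have hre : ∀ s ∈ Icc s₀ s₁, 0 < ((N : ℂ) * γ s).re := fun s hs' => by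
    rw [Complex.re_ofReal_mul]; exact mul_pos hN0 (hmem s hs').1
  have hsd : ∀ s ∈ Icc s₀ s₁, HasDerivAt (fun s => sol α a b ν (N * γ s))
      (sol1 α a b ν (N * γ s) * (N * γ' s)) s := fun s hs' =>
    HasDerivAt.comp (h₂ := sol α a b ν) (h := fun s => (N : ℂ) * γ s) s
      (hasDerivAt_sol hα hα2 a b ν (Or.inl (hre s hs'))) ((hγ s).const_mul _)
  have hFc : ContinuousOn F (Icc s₀ s₁) := by
    refine ContinuousOn.mul (fun s hs' => (hsd s hs').continuousAt.continuousWithinAt) ?_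
    exact Complex.continuous_exp.comp_continuousOn (continuousOn_const.mul hJc)
  have hFd : ∀ s ∈ Ico s₀ s₁, HasDerivWithinAt F
      (sol1 α a b ν (N * γ s) * (N * γ' s) * Complex.exp (P * J s) +
        sol α a b ν (N * γ s) * (Complex.exp (P * J s) * (P * σ s))) (Ici s) s := fun s hs' =>
    (hsd s ⟨hs'.1, hs'.2.le⟩).hasDerivWithinAt.mul (((hJd s hs').const_mul _).cexp)
  have hFb : ∀ s ∈ Ico s₀ s₁, ‖sol1 α a b ν (N * γ s) * (N * γ' s) * Complex.exp (P * J s) +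
        sol α a b ν (N * γ s) * (Complex.exp (P * J s) * (P * σ s))‖ ≤ M * L * ‖F s‖ + 0 :=
    fun s hs' => by
    have hs'' : s ∈ Icc s₀ s₁ := ⟨hs'.1, hs'.2.le⟩
    obtain ⟨h1, -, h3⟩ := hwkb N hN a b h (γ s) (mem_image_of_mem _ hs'')
    have e : sol1 α a b ν (N * γ s) * (N * γ' s) * Complex.exp (P * J s) +
        sol α a b ν (N * γ s) * (Complex.exp (P * J s) * (P * σ s))
        = (N * (sol1 α a b ν (N * γ s) / sol α a b ν (N * γ s)) +
          P * csqrt (γ s ^ (α : ℂ) - μ)) * γ' s * F s := by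
      have h1 : sol α a b ν (N * γ s) ≠ 0 := h1
      simp only [hF, hσ]; field_simp
    rw [e, norm_mul, norm_mul, add_zero]
    exact mul_le_mul_of_nonneg_right (mul_le_mul h3 (hL s hs'') (norm_nonneg _) hM.le)
      (norm_nonneg _)
  have hgr := norm_le_gronwallBound_of_norm_deriv_right_le hFc hFd (le_refl _) hFb s₁
    ⟨hs, le_rfl⟩
  rw [gronwallBound_ε0] at hgr
  have e0 : F s₀ = sol α a b ν (N * γ s₀) := by simp [hF, hJ]
  have e1 : ‖F s₁‖ = ‖sol α a b ν (N * γ s₁)‖ * Real.exp (P * (J s₁).re) := by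
    rw [hF, norm_mul, Complex.norm_exp, Complex.re_ofReal_mul]
  rw [e0, e1] at hgr
  rw [Real.exp_neg, ← div_eq_mul_inv, le_div_iff₀ (Real.exp_pos _)]
  linarith

end Anharmonic

namespace Anharmonic

lemma continuous_dir : Continuous dir := by unfold dir; fun_prop

lemma hasDerivAt_dir (s : ℝ) : HasDerivAt dir (dir s * Complex.I) s := by
  have h : HasDerivAt (fun z : ℂ => Complex.exp (z * Complex.I))
      (Complex.exp (s * Complex.I) * (1 * Complex.I)) s :=
    ((hasDerivAt_id' (s : ℂ)).mul_const _).cexp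
  rw [one_mul] at h
  exact h.comp_ofReal

lemma dir_zero : dir 0 = 1 := by simp [dir]

lemma dir_neg_mul (s : ℝ) : dir (-s) * dir s = 1 := by rw [← dir_add]; simp [dir_zero]

lemma dir_pi_div_two : dir (Real.pi / 2) = Complex.I := by
  rw [dir]; push_cast; exact Complex.exp_pi_div_two_mul_I

/-- The square root with a branch cut in the direction opposite to `φ`. -/
noncomputable def rsqrt (φ : ℝ) (z : ℂ) : ℂ := dir (φ / 2) * csqrt (dir (-φ) * z)

lemma rsqrt_sq (φ : ℝ) (z : ℂ) : rsqrt φ z ^ 2 = z := by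
  rw [rsqrt, mul_pow, csqrt_sq, dir_sq, show 2 * (φ / 2) = φ by ring, ← mul_assoc, mul_comm (dir φ),
    dir_neg_mul, one_mul]

lemma norm_rsqrt_sq (φ : ℝ) (z : ℂ) : ‖rsqrt φ z‖ ^ 2 = ‖z‖ := by rw [← norm_pow, rsqrt_sq]

lemma csqrt_ofReal_mul_dir {x φ : ℝ} (hx : 0 ≤ x) (h1 : -Real.pi < φ) (h2 : φ ≤ Real.pi) :
    csqrt (x * dir φ) = (√x : ℝ) * dir (φ / 2) := by
  rcases hx.eq_or_lt with rfl | hx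
  · simp [csqrt_zero]
  · have hl : Complex.log (dir φ) = φ * Complex.I := by
      rw [dir, Complex.log_exp] <;> simp <;> linarith
    rw [csqrt, real_mul_cpow hx _ (by norm_num), Real.sqrt_eq_rpow,
      Complex.cpow_def_of_ne_zero (dir_ne_zero _), hl, dir]
    push_cast; ring_nf

lemma eq_norm_mul_dir (z : ℂ) : z = (‖z‖ : ℝ) * dir z.arg := (Complex.norm_mul_exp_arg_mul_I z).symm

lemma rsqrt_eq_csqrt {φ : ℝ} {z : ℂ} (h1 : -Real.pi < z.arg - φ) (h2 : z.arg - φ ≤ Real.pi) :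
    rsqrt φ z = csqrt z := by
  have e : dir (-φ) * z = (‖z‖ : ℝ) * dir (z.arg - φ) := by
    conv_lhs => rw [eq_norm_mul_dir z, mul_left_comm, ← dir_add]
    ring_nf
  rw [rsqrt, e, csqrt_ofReal_mul_dir (norm_nonneg z) h1 h2, mul_left_comm, ← dir_add]
  conv_rhs => rw [eq_norm_mul_dir z, csqrt_ofReal_mul_dir (norm_nonneg z)
    (Complex.neg_pi_lt_arg z) (Complex.arg_le_pi z)]
  ring_nf

lemma continuousOn_rsqrt (φ : ℝ) : ContinuousOn (rsqrt φ) {z | 0 ≤ (dir (-φ) * z).re} := by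
  refine continuousOn_const.mul (continuousOn_csqrt_re.comp (by fun_prop) fun z hz => hz)

/-- Cauchy's theorem on an annular sector, in logarithmic coordinates. -/
lemma sector_cauchy {F : ℂ → ℂ} {ε C φ₁ φ₂ B : ℝ} (hε : 0 < ε) (hC : ε ≤ C) (hφ : φ₁ ≤ φ₂)
    (hc : ContinuousOn F {w | w.im ∈ Icc φ₁ φ₂})
    (hd : DifferentiableOn ℂ F {w | w.im ∈ Ioo φ₁ φ₂})
    (hB : ∀ ψ ∈ Icc φ₁ φ₂, ‖F (Real.log ε + ψ * Complex.I)‖ ≤ B) :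
    ‖(∫ r in ε..C, F (Real.log r + φ₁ * Complex.I) * dir φ₁)
      + (∫ ψ in φ₁..φ₂, F (Real.log C + ψ * Complex.I) * (C * (dir ψ * Complex.I)))
      - ∫ r in ε..C, F (Real.log r + φ₂ * Complex.I) * dir φ₂‖ ≤ B * ε * (φ₂ - φ₁) := by
  have hC0 : 0 < C := by linarith
  have hl : Real.log ε ≤ Real.log C := Real.log_le_log hε hC
  set G : ℂ → ℂ := fun w => F w * Complex.exp w with hG
  have hrect := Complex.integral_boundary_rect_eq_zero_of_continuousOn_of_differentiableOn G
    ⟨Real.log ε, φ₁⟩ ⟨Real.log C, φ₂⟩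
    ((hc.mul Complex.continuous_exp.continuousOn).mono fun w hw => by
      have := hw.2; simpa [uIcc_of_le hφ] using this)
    ((hd.mul Complex.differentiable_exp.differentiableOn).mono fun w hw => by
      have := hw.2; simpa [hφ] using this)
  dsimp only at hrect
  have hsub : ∀ φ ∈ Icc φ₁ φ₂, (∫ x : ℝ in Real.log ε..Real.log C, G (x + φ * Complex.I))
      = ∫ r in ε..C, F (Real.log r + φ * Complex.I) * dir φ := fun φ hφ' => by
    have h1 := intervalIntegral.integral_deriv_smul_comp' (a := Real.log ε) (b := Real.log C)
      (f := Real.exp) (f' := Real.exp) (g := fun r : ℝ => F (Real.log r + φ * Complex.I) * dir φ)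
      (fun x _ => Real.hasDerivAt_exp x) Real.continuous_exp.continuousOn
      (by
        refine ContinuousOn.mul (hc.comp ?_ fun r _ => by simpa using hφ') continuousOn_const
        refine ContinuousOn.add (Complex.continuous_ofReal.comp_continuousOn
          (Real.continuousOn_log.mono ?_)) continuousOn_const
        rintro _ ⟨x, -, rfl⟩
        exact (Real.exp_pos x).ne')
    rw [Real.exp_log hε, Real.exp_log hC0] at h1
    rw [← h1]
    refine intervalIntegral.integral_congr fun x _ => ?_
    simp only [hG, Function.comp, Real.log_exp, Complex.exp_add, dir, Complex.real_smul,
      Complex.ofReal_exp]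
    ring
  rw [hsub φ₁ ⟨le_rfl, hφ⟩, hsub φ₂ ⟨hφ, le_rfl⟩] at hrect
  have hout : ∀ r : ℝ, 0 < r → Complex.I • (∫ y : ℝ in φ₁..φ₂, G (Real.log r + y * Complex.I))
      = ∫ ψ in φ₁..φ₂, F (Real.log r + ψ * Complex.I) * (r * (dir ψ * Complex.I)) := fun r hr => by
    rw [← intervalIntegral.integral_smul]
    refine intervalIntegral.integral_congr fun x _ => ?_
    simp only [hG, Complex.exp_add, dir, ← Complex.ofReal_exp, Real.exp_log hr, smul_eq_mul]
    ring
  rw [hout ε hε, hout C hC0] at hrect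
  have hin : ‖∫ ψ in φ₁..φ₂, F (Real.log ε + ψ * Complex.I) * (ε * (dir ψ * Complex.I))‖
      ≤ B * ε * (φ₂ - φ₁) := by
    have := intervalIntegral.norm_integral_le_of_norm_le_const (a := φ₁) (b := φ₂) (C := B * ε)
      (f := fun ψ : ℝ => F (Real.log ε + ψ * Complex.I) * (ε * (dir ψ * Complex.I)))
      (fun ψ hψ => by
        rw [uIoc_of_le hφ] at hψ
        rw [norm_mul, norm_mul, norm_mul, norm_dir, Complex.norm_I, Complex.norm_real,
          Real.norm_of_nonneg hε.le, mul_one, mul_one]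
        exact mul_le_mul_of_nonneg_right (hB ψ ⟨hψ.1.le, hψ.2⟩) hε.le)
    rwa [abs_of_nonneg (by linarith)] at this
  refine le_trans (le_of_eq ?_) hin
  congr 1
  linear_combination hrect

variable {α : ℝ}

/-- The branch of `√(z^α - e^{iβ})` with cut opposite to `φ`, in polar coordinates. -/
noncomputable def phase (α β φ r ψ : ℝ) : ℂ :=
  rsqrt φ (((r ^ α : ℝ) : ℂ) * dir (α * ψ) - dir β)

lemma norm_phase_sq_le (β φ ψ : ℝ) {r : ℝ} (hr : 0 ≤ r) : ‖phase α β φ r ψ‖ ^ 2 ≤ r ^ α + 1 := by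
  rw [phase, norm_rsqrt_sq]
  refine (norm_sub_le _ _).trans ?_
  rw [norm_mul, norm_dir, norm_dir, Complex.norm_real, mul_one,
    Real.norm_of_nonneg (Real.rpow_nonneg hr α)]

lemma norm_phase_le (hα : 0 < α) (β φ ψ : ℝ) {r : ℝ} (hr : 0 ≤ r) (hr1 : r ≤ 1) :
    ‖phase α β φ r ψ‖ ≤ 2 := by
  have h1 := norm_phase_sq_le (α := α) β φ ψ hr
  have h2 := Real.rpow_le_one hr hr1 hα.le
  nlinarith [norm_nonneg (phase α β φ r ψ)]

lemma phase_cauchy (hα : 0 < α) {β φ ε C φ₁ φ₂ : ℝ} (hε : 0 < ε) (hε1 : ε ≤ 1) (hC : ε ≤ C)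
    (hφ : φ₁ ≤ φ₂) (h0 : Real.cos (β - φ) = 0)
    (h1 : ∀ ψ ∈ Icc φ₁ φ₂, 0 ≤ Real.cos (α * ψ - φ))
    (h2 : ∀ ψ ∈ Ioo φ₁ φ₂, 0 < Real.cos (α * ψ - φ)) :
    ‖(∫ r in ε..C, phase α β φ r φ₁ * dir φ₁)
      + (∫ ψ in φ₁..φ₂, phase α β φ C ψ * (C * (dir ψ * Complex.I)))
      - ∫ r in ε..C, phase α β φ r φ₂ * dir φ₂‖ ≤ 2 * ε * (φ₂ - φ₁) := by
  set q : ℂ → ℂ := fun w => Complex.exp (α * w) - dir β with hq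
  have hqre : ∀ w : ℂ, (dir (-φ) * q w).re = Real.exp (α * w.re) * Real.cos (α * w.im - φ) :=
    fun w => by
    have e : Complex.exp (α * w) = ((Real.exp (α * w.re) : ℝ) : ℂ) * dir (α * w.im) := by
      rw [dir, Complex.ofReal_exp, ← Complex.exp_add]
      congr 1
      apply Complex.ext <;> simp
    rw [hq]
    simp only
    rw [mul_sub, ← dir_add, e, mul_left_comm, ← dir_add, Complex.sub_re, Complex.re_ofReal_mul,
      dir_re, dir_re, show -φ + β = β - φ by ring, h0, sub_zero]
    ring_nf
  have hval : ∀ r ψ : ℝ, 0 < r → rsqrt φ (q (Real.log r + ψ * Complex.I)) = phase α β φ r ψ :=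
    fun r ψ hr => by
    rw [phase]
    congr 1
    simp only [hq]
    congr 1
    rw [dir, Real.rpow_def_of_pos hr, Complex.ofReal_exp, ← Complex.exp_add]
    push_cast; ring_nf
  have hC0 : 0 < C := by linarith
  have hqd : Differentiable ℂ q := by rw [hq]; fun_prop
  have key := sector_cauchy (F := fun w => rsqrt φ (q w)) (B := 2) hε hC hφ
    ((continuousOn_rsqrt φ).comp hqd.continuous.continuousOn fun w hw => by
      rw [mem_ofPred_eq, hqre]
      exact mul_nonneg (Real.exp_pos _).le (h1 _ hw))
    (by
      refine DifferentiableOn.const_mul (fun w hw => ?_) _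
      have : DifferentiableAt ℂ (fun w => dir (-φ) * q w) w := (hqd w).const_mul _
      refine (this.cpow (differentiableAt_const _) ?_).differentiableWithinAt
      left
      rw [hqre]
      exact mul_pos (Real.exp_pos _) (h2 _ hw))
    (fun ψ hψ => by
      rw [hval ε ψ hε]
      exact norm_phase_le hα β φ ψ hε.le hε1)
  simp only [hval C _ hC0] at key
  have hr : ∀ ψ : ℝ, ∫ r in ε..C, rsqrt φ (q (Real.log r + ψ * Complex.I)) * dir ψ
      = ∫ r in ε..C, phase α β φ r ψ * dir ψ := fun ψ => by
    refine intervalIntegral.integral_congr fun r hr => ?_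
    rw [uIcc_of_le hC] at hr
    simp only [hval r ψ (by linarith [hr.1])]
  rwa [hr, hr] at key

end Anharmonic

namespace Anharmonic

variable {α : ℝ}

lemma real_mul_dir_cpow (hα : 0 < α) {r ψ : ℝ} (hr : 0 < r) (hψ : |ψ| < Real.pi / 2) :
    ((r : ℂ) * dir ψ) ^ (α : ℂ) = ((r ^ α : ℝ) : ℂ) * dir (α * ψ) := by
  rw [real_mul_cpow hr _ hα]; congr 1; exact exp_cpow hψ

lemma arg_real_mul_dir {r ψ : ℝ} (hr : 0 < r) (hψ : |ψ| < Real.pi / 2) :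
    ((r : ℂ) * dir ψ).arg = ψ := by
  rw [Complex.arg_real_mul _ hr]; exact arg_exp hψ

lemma real_mem_region {β : ℝ} (hβ : 0 < β) (hβ1 : β < Real.pi) {x : ℝ} (hx : 0 < x) :
    (x : ℂ) ∈ region α ((Real.pi - β) / 2) (dir β) := by
  have hs : 0 < Real.sin (β / 2) := Real.sin_pos_of_pos_of_lt_pi (by linarith) (by linarith)
  refine ⟨by simpa using hx, ?_, ?_⟩
  · rw [Complex.arg_ofReal_of_nonneg hx.le, mul_zero, add_zero, abs_of_nonneg] <;> linarith
  · rw [ofReal_cpow_eq hx.le, mul_sub, Complex.sub_re]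
    change 0 < (dir ((Real.pi - β) / 2) * _).re - (dir ((Real.pi - β) / 2) * dir β).re
    rw [← dir_add, mul_comm, Complex.re_ofReal_mul, dir_re, dir_re,
      show (Real.pi - β) / 2 = Real.pi / 2 - β / 2 by ring, Real.cos_pi_div_two_sub,
      show Real.pi / 2 - β / 2 + β = β / 2 + Real.pi / 2 by ring, Real.cos_add_pi_div_two]
    have := Real.rpow_pos_of_pos hx α
    nlinarith

lemma real_start (hα : 0 < α) (hα2 : α < 2) {β : ℝ} (hβ : 0 < β) (hβ1 : β < Real.pi) :
    ∃ D : ℝ, 0 < D ∧ ∀ N : ℝ, 1 ≤ N → ∀ a b, Sub α (((N ^ α : ℝ) : ℂ) * dir β) a b →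
      ‖b‖ ≤ D * N ^ (α / 2) * ‖a‖ ∧
      ∀ x : ℝ, 0 ≤ x → ‖sol α a b (((N ^ α : ℝ) : ℂ) * dir β) x‖ ≤ D * ‖a‖ := by
  set σ := Real.sin (β / 2) with hσ
  have hs : 0 < σ := Real.sin_pos_of_pos_of_lt_pi (by linarith) (by linarith)
  refine ⟨5 / σ + √(1 + 5 / σ / σ), by positivity, fun N hN a b h => ?_⟩
  have hN0 : 0 < N := by linarith
  set k : ℝ := N ^ (α / 2) with hk
  have hk1 : 1 ≤ k := Real.one_le_rpow hN (by linarith)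
  have hkp : 0 < k := by linarith
  have hk2 : N ^ α = k ^ 2 := by
    rw [hk, ← Real.rpow_natCast, ← Real.rpow_mul hN0.le]; congr 1; push_cast; ring
  set e := dir ((Real.pi - β) / 2) with he
  have here : e.re = σ := by
    rw [he, dir_re, show (Real.pi - β) / 2 = Real.pi / 2 - β / 2 by ring, Real.cos_pi_div_two_sub]
  have hdec := h.isDecaying_line hα hα2 (z := 0) (e := e) (d := σ * k ^ 2) (by simp)
    (by rw [here]; exact hs) (norm_dir _).le (by positivity) (fun s hs' => by
      rw [zero_add, ofReal_cpow_eq hs'.le, mul_sub, Complex.sub_re, mul_left_comm,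
        Complex.re_ofReal_mul, he, ← dir_add, mul_comm (dir _) ((s ^ α : ℝ) : ℂ), Complex.re_ofReal_mul, dir_re,
        dir_re,
      show (Real.pi - β) / 2 = Real.pi / 2 - β / 2 by ring, Real.cos_pi_div_two_sub,
      show Real.pi / 2 - β / 2 + β = β / 2 + Real.pi / 2 by ring, Real.cos_add_pi_div_two, ← hσ,
      hk2]
      have := Real.rpow_pos_of_pos hs' α
      nlinarith)
  have hd0 : 0 < σ * k ^ 2 := by positivity
  have h1 := hdec.norm_deriv_zero_le hd0 (ℓ := 1 / k) (B := 2 * k ^ 2) (k := k) (by positivity) hkp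
    (fun s hs' => by
      have hs1 : s ≤ 1 := hs'.2.le.trans ((div_le_one hkp).2 hk1)
      refine (norm_sub_le _ _).trans ?_
      rw [zero_add, ofReal_cpow_eq hs'.1.le, norm_mul, norm_dir, Complex.norm_real, mul_one,
        Complex.norm_real, hk2, Real.norm_of_nonneg (Real.rpow_nonneg hs'.1.le _),
        Real.norm_of_nonneg (by positivity)]
      have := Real.rpow_le_one hs'.1.le hs1 hα.le
      nlinarith)
  simp only [Complex.ofReal_zero, add_zero, sol_zero hα, sol1_zero hα] at h1
  have e1 : 1 / (1 / k * e.re) + 2 * k ^ 2 * k / (σ * k ^ 2) + 2 * k ^ 2 / (k * e.re)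
      = 5 / σ * k := by
    rw [here]; field_simp; norm_num
  rw [e1] at h1
  refine ⟨h1.trans ?_, fun x hx => ?_⟩
  · gcongr
    exact le_add_of_nonneg_right (Real.sqrt_nonneg _)
  · have h2 := hdec.norm_sq_le hd0 hx
    simp only [Complex.ofReal_zero, add_zero, sol_zero hα, sol1_zero hα, zero_add] at h2
    have e2 : √(e.re * (σ * k ^ 2)) = σ * k := by
      rw [here, show σ * (σ * k ^ 2) = (σ * k) ^ 2 by ring, Real.sqrt_sq (by positivity)]
    rw [e2] at h2
    have h3 : ‖b‖ * ‖a‖ / (σ * k) ≤ 5 / σ / σ * ‖a‖ ^ 2 := by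
      rw [div_le_iff₀ (by positivity)]
      calc ‖b‖ * ‖a‖ ≤ 5 / σ * k * ‖a‖ * ‖a‖ := by gcongr
        _ = _ := by field_simp
    have h4 : ‖sol α a b (((N ^ α : ℝ) : ℂ) * dir β) x‖ ≤ √(1 + 5 / σ / σ) * ‖a‖ := by
      refine (pow_le_pow_iff_left₀ (norm_nonneg _) (by positivity) two_ne_zero).1 ?_
      rw [mul_pow, Real.sq_sqrt (by positivity)]
      linarith
    refine h4.trans ?_
    gcongr
    exact le_add_of_nonneg_left (by positivity)

lemma re_rot_mul (τ : ℝ) (z : ℂ) :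
    (Complex.exp (((2 * τ - Real.pi / 2 : ℝ) : ℂ) * Complex.I) * z).re = (dir (2 * τ) * z).im := by
  rw [exp_rot]
  change (-Complex.I * dir τ ^ 2 * z).re = _
  rw [dir_sq, mul_assoc]
  simp

namespace Admissible
variable {τ : ℝ} (A : Admissible α τ)
include A

lemma abs_rot : |2 * τ - Real.pi / 2| < Real.pi / 2 := by
  have := A.τ_pos; have := A.lt_pi; have := A.α_pos
  rw [abs_lt]; constructor <;> nlinarith

lemma abs_le_of_mem {ψ : ℝ} (hψ : ψ ∈ Icc 0 τ) : |ψ| < Real.pi / 2 := by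
  rw [abs_of_nonneg hψ.1]; exact lt_of_le_of_lt hψ.2 A.τ_lt

lemma mem_region_of {r ψ β : ℝ} (hr : 0 < r) (hψ : ψ ∈ Icc 0 τ)
    (h : Real.sin (β + 2 * τ) < r ^ α * Real.sin (2 * τ + α * ψ)) :
    (r : ℂ) * dir ψ ∈ region α (2 * τ - Real.pi / 2) (dir β) := by
  have hp := A.abs_le_of_mem hψ
  have hτ := A.τ_pos
  have hα := A.α_pos
  have hpi := A.lt_pi
  have hψ0 := hψ.1
  have hψ1 := hψ.2
  refine ⟨?_, ?_, ?_⟩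
  · rw [Complex.re_ofReal_mul, dir_re]
    rw [abs_lt] at hp
    exact mul_pos hr (Real.cos_pos_of_mem_Ioo ⟨hp.1, hp.2⟩)
  · rw [arg_real_mul_dir hr hp, abs_lt]
    constructor <;> nlinarith
  · rw [re_rot_mul, real_mul_dir_cpow hα hr hp, mul_sub, mul_left_comm, ← dir_add, ← dir_add,
      Complex.sub_im, Complex.im_ofReal_mul, dir_im, dir_im, add_comm (2 * τ) β]
    linarith

lemma exists_arc (β : ℝ) : ∃ C₀ : ℝ, 1 ≤ C₀ ∧ ∀ C, C₀ ≤ C → ∀ ψ ∈ Icc 0 τ,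
    (C : ℂ) * dir ψ ∈ region α (2 * τ - Real.pi / 2) (dir β) := by
  have hτ := A.τ_pos
  have hα := A.α_pos
  have hpi := A.lt_pi
  set m := min (Real.sin (2 * τ)) (Real.sin ((α + 2) * τ)) with hm
  have hm0 : 0 < m := lt_min (Real.sin_pos_of_pos_of_lt_pi (by linarith) (by nlinarith))
    (Real.sin_pos_of_pos_of_lt_pi (by positivity) hpi)
  refine ⟨max 1 ((2 / m) ^ (1 / α)), le_max_left _ _, fun C hC ψ hψ => ?_⟩
  have hC1 : 1 ≤ C := (le_max_left _ _).trans hC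
  refine A.mem_region_of (by linarith) hψ ?_
  have h1 : m ≤ Real.sin (2 * τ + α * ψ) := by
    have := hψ.1
    have := hψ.2
    exact strictConcaveOn_sin_Icc.concaveOn.min_le_of_mem_Icc (x := 2 * τ) (y := (α + 2) * τ)
      ⟨by linarith, by nlinarith⟩ ⟨by positivity, hpi.le⟩ ⟨by nlinarith, by nlinarith⟩
  have h2 : 2 / m ≤ C ^ α := by
    have h3 : ((2 / m) ^ (1 / α)) ^ α ≤ C ^ α :=
      Real.rpow_le_rpow (by positivity) ((le_max_right _ _).trans hC) hα.le
    rwa [← Real.rpow_mul (by positivity), one_div_mul_cancel hα.ne', Real.rpow_one] at h3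
  have h4 : 2 ≤ C ^ α * m := (div_le_iff₀ hm0).1 h2
  have h5 : C ^ α * m ≤ C ^ α * Real.sin (2 * τ + α * ψ) :=
    mul_le_mul_of_nonneg_left h1 (by positivity)
  linarith [Real.sin_le_one (β + 2 * τ)]

end Admissible

end Anharmonic

namespace Anharmonic

variable {α : ℝ}

/-- The branch of `√(e^{iθ} r^α - e^{iη})` equal to `-i e^{iη/2}` at the origin. -/
noncomputable def gfun (α θ η r : ℝ) : ℂ :=
  -(dir (η / 2 + Real.pi / 4) *
    csqrt (dir (-(Real.pi / 2)) * (((r ^ α : ℝ) : ℂ) * dir (θ - η) - 1)))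

lemma phase_ray (β τ r : ℝ) : phase α β (β + Real.pi / 2) r τ * dir τ
    = -gfun α ((α + 2) * τ) (β + 2 * τ) r := by
  have e : dir (-(β + Real.pi / 2)) * (((r ^ α : ℝ) : ℂ) * dir (α * τ) - dir β)
      = dir (-(Real.pi / 2)) * (((r ^ α : ℝ) : ℂ) * dir ((α + 2) * τ - (β + 2 * τ)) - 1) := by
    rw [show -(β + Real.pi / 2) = -(Real.pi / 2) + -β by ring, dir_add,
      show (α + 2) * τ - (β + 2 * τ) = -β + α * τ by ring, dir_add (-β)]
    linear_combination -dir (-(Real.pi / 2)) * dir_neg_mul β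
  rw [phase, rsqrt, gfun, e, neg_neg, mul_right_comm, ← dir_add]
  congr 2; ring

lemma rsqrt_real_mul_dir {x χ φ : ℝ} (hx : 0 ≤ x) (h1 : -Real.pi < χ - φ) (h2 : χ - φ ≤ Real.pi) :
    rsqrt φ (x * dir χ) = (√x : ℝ) * dir (χ / 2) := by
  rw [rsqrt, mul_left_comm, ← dir_add, show -φ + χ = χ - φ by ring,
    csqrt_ofReal_mul_dir hx h1 h2, mul_left_comm, ← dir_add]
  congr 2; ring

lemma dir_add_pi (s : ℝ) : dir (s + Real.pi) = -dir s := by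
  rw [dir_add, dir, dir, Complex.exp_pi_mul_I]; ring

lemma dir_sub_pi (s : ℝ) : dir (s - Real.pi) = -dir s := by
  have := dir_add_pi (s - Real.pi)
  rw [sub_add_cancel] at this
  rw [this, neg_neg]

lemma phase_sub_phase (hα : 0 < α) (β r : ℝ) :
    phase α β (β - Real.pi / 2) r (β / α) - phase α β (β + Real.pi / 2) r (β / α)
      = ((2 * √(1 - r ^ α) : ℝ) : ℂ) * dir (β / 2 - Real.pi / 2) := by
  have hpi := Real.pi_pos
  have e : α * (β / α) = β := by field_simp
  rw [phase, phase, e]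
  rcases le_total 1 (r ^ α) with h | h
  · have e1 : ((r ^ α : ℝ) : ℂ) * dir β - dir β = ((r ^ α - 1 : ℝ) : ℂ) * dir β := by
      push_cast; ring
    rw [e1, rsqrt_real_mul_dir (by linarith) (by linarith) (by linarith),
      rsqrt_real_mul_dir (by linarith) (by linarith) (by linarith),
      Real.sqrt_eq_zero_of_nonpos (show 1 - r ^ α ≤ 0 by linarith)]
    simp
  · have e1 : ((r ^ α : ℝ) : ℂ) * dir β - dir β = ((1 - r ^ α : ℝ) : ℂ) * dir (β - Real.pi) := by
      rw [dir_sub_pi]; push_cast; ring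
    have e2 : ((r ^ α : ℝ) : ℂ) * dir β - dir β = ((1 - r ^ α : ℝ) : ℂ) * dir (β + Real.pi) := by
      rw [dir_add_pi]; push_cast; ring
    rw [e1, rsqrt_real_mul_dir (by linarith) (by linarith) (by linarith), ← e1, e2,
      rsqrt_real_mul_dir (by linarith) (by linarith) (by linarith),
      show (β + Real.pi) / 2 = (β / 2 - Real.pi / 2) + Real.pi by ring, dir_add_pi,
      show (β - Real.pi) / 2 = β / 2 - Real.pi / 2 by ring]
    push_cast; ring

lemma re_dir_mul_symbol (β φ ψ r : ℝ) :
    (dir (-φ) * (((r ^ α : ℝ) : ℂ) * dir (α * ψ) - dir β)).re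
      = r ^ α * Real.cos (α * ψ - φ) - Real.cos (β - φ) := by
  rw [mul_sub, mul_left_comm, ← dir_add, ← dir_add, Complex.sub_re, Complex.re_ofReal_mul, dir_re,
    dir_re]
  ring_nf

lemma phase_eq (hα : 0 < α) {β φ ω r ψ : ℝ} (hr : 0 < r) (hψ : |ψ| < Real.pi / 2)
    (hω : |ω| < Real.pi / 2) (hz : (r : ℂ) * dir ψ ∈ region α ω (dir β)) (hφ : |ω + φ| < Real.pi)
    (h0 : Real.cos (β - φ) = 0) (h1 : 0 ≤ Real.cos (α * ψ - φ)) :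
    csqrt (((r : ℂ) * dir ψ) ^ (α : ℂ) - dir β) = phase α β φ r ψ := by
  have hz3 := hz.2.2
  rw [real_mul_dir_cpow hα hr hψ] at hz3 ⊢
  obtain ⟨hne, harg⟩ := arg_of_re_exp_pos hω hz3
  have hre := re_dir_mul_symbol (α := α) β φ ψ r
  rw [h0, sub_zero] at hre
  have hre0 := mul_nonneg (Real.rpow_nonneg hr.le α) h1
  rw [← hre] at hre0
  rw [phase]
  set z := ((r ^ α : ℝ) : ℂ) * dir (α * ψ) - dir β with hzdef
  have e : (dir (-φ) * z).re = ‖z‖ * Real.cos (z.arg - φ) := by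
    conv_lhs => rw [eq_norm_mul_dir z, mul_left_comm, ← dir_add, Complex.re_ofReal_mul, dir_re]
    ring_nf
  rw [e] at hre0
  have hcos : 0 ≤ Real.cos (z.arg - φ) := by
    have := norm_pos_iff.2 hne
    by_contra! hcon
    nlinarith
  rw [abs_lt] at harg hφ
  refine (rsqrt_eq_csqrt ?_ ?_).symm
  · by_contra! hcon
    have : Real.cos (z.arg - φ) < 0 := by
      rw [← Real.cos_neg]
      exact Real.cos_neg_of_pi_div_two_lt_of_lt (by linarith) (by linarith)
    linarith
  · by_contra! hcon
    have : Real.cos (z.arg - φ) < 0 :=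
      Real.cos_neg_of_pi_div_two_lt_of_lt (by linarith) (by linarith)
    linarith

lemma continuousOn_phase (hα : 0 < α) {β φ ψ : ℝ} (h0 : Real.cos (β - φ) = 0)
    (h1 : 0 ≤ Real.cos (α * ψ - φ)) : ContinuousOn (fun r => phase α β φ r ψ) (Ici 0) := by
  refine (continuousOn_rsqrt φ).comp (ContinuousOn.sub (ContinuousOn.mul
    (Complex.continuous_ofReal.comp_continuousOn (Real.continuous_rpow_const hα.le).continuousOn)
    continuousOn_const) continuousOn_const) fun r hr => ?_
  rw [mem_ofPred_eq, re_dir_mul_symbol, h0, sub_zero]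
  exact mul_nonneg (Real.rpow_nonneg hr α) h1

/-- The limit exponent of the subdominant solution, relative to its value at the origin. -/
noncomputable def exponent (α θ η Z : ℝ) : ℝ :=
  (∫ r in (0 : ℝ)..Z, gfun α θ η r).re -
    2 * Real.sin ((η - 2 * (θ / (α + 2))) * (1 / 2 + 1 / α)) *
      ∫ ξ in (0 : ℝ)..1, √(1 - ξ ^ α)

end Anharmonic

namespace Anharmonic

variable {α : ℝ}

lemma continuous_sqrt_one_sub (hα : 0 < α) : Continuous fun r : ℝ => √(1 - r ^ α) :=
  (continuous_const.sub (Real.continuous_rpow_const hα.le)).sqrt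

lemma integral_sqrt_ge (hα : 0 < α) {κ C : ℝ} (hκ : 0 < κ) (hC : 1 ≤ C) :
    |(∫ r in κ..C, √(1 - r ^ α)) - ∫ r in (0 : ℝ)..1, √(1 - r ^ α)| ≤ κ := by
  have hi : ∀ a b : ℝ, IntervalIntegrable (fun r : ℝ => √(1 - r ^ α)) volume a b := fun a b =>
    (continuous_sqrt_one_sub hα).intervalIntegrable a b
  have h1 : ∫ r in (1 : ℝ)..C, √(1 - r ^ α) = 0 := by
    rw [intervalIntegral.integral_congr (g := fun _ => (0 : ℝ))]
    · simp
    · intro r hr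
      rw [uIcc_of_le hC] at hr
      exact Real.sqrt_eq_zero_of_nonpos (by linarith [Real.one_le_rpow hr.1 hα.le])
  have h2 : (∫ r in κ..C, √(1 - r ^ α)) - ∫ r in (0 : ℝ)..1, √(1 - r ^ α)
      = -∫ r in (0 : ℝ)..κ, √(1 - r ^ α) := by
    rw [← intervalIntegral.integral_add_adjacent_intervals (hi κ 1) (hi 1 C), h1,
      ← intervalIntegral.integral_add_adjacent_intervals (hi 0 κ) (hi κ 1)]
    ring
  rw [h2, abs_neg, ← Real.norm_eq_abs]
  have := intervalIntegral.norm_integral_le_of_norm_le_const (a := 0) (b := κ) (C := 1)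
    (f := fun r : ℝ => √(1 - r ^ α)) (fun r hr => by
      rw [uIoc_of_le hκ.le] at hr
      rw [Real.norm_of_nonneg (Real.sqrt_nonneg _)]
      exact Real.sqrt_le_one.2 (by linarith [Real.rpow_nonneg hr.1.le α]))
  simpa [abs_of_pos hκ] using this

namespace Admissible
variable {τ : ℝ} (A : Admissible α τ)
include A

lemma cos_low {β ψ : ℝ} (hβ : β < Real.pi) (hψ : ψ ∈ Icc 0 (β / α)) :
    0 ≤ Real.cos (α * ψ - (β - Real.pi / 2)) := by
  have hα := A.α_pos
  have h1 : α * ψ ≤ β := by have := (le_div_iff₀ hα).1 hψ.2; linarith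
  have h2 : 0 ≤ α * ψ := mul_nonneg hα.le hψ.1
  rw [show α * ψ - (β - Real.pi / 2) = Real.pi / 2 - (β - α * ψ) by ring, Real.cos_pi_div_two_sub]
  exact Real.sin_nonneg_of_nonneg_of_le_pi (by linarith) (by linarith)

lemma cos_low' {β ψ : ℝ} (hβ : β < Real.pi) (hψ : ψ ∈ Ioo 0 (β / α)) :
    0 < Real.cos (α * ψ - (β - Real.pi / 2)) := by
  have hα := A.α_pos
  have h1 : α * ψ < β := by have := (lt_div_iff₀ hα).1 hψ.2; linarith
  have h2 : 0 ≤ α * ψ := mul_nonneg hα.le hψ.1.le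
  rw [show α * ψ - (β - Real.pi / 2) = Real.pi / 2 - (β - α * ψ) by ring, Real.cos_pi_div_two_sub]
  exact Real.sin_pos_of_pos_of_lt_pi (by linarith) (by linarith)

lemma cos_up {β ψ : ℝ} (hβ : 0 < β) (hψ : ψ ∈ Icc (β / α) τ) :
    0 ≤ Real.cos (α * ψ - (β + Real.pi / 2)) := by
  have hα := A.α_pos
  have hτ := A.τ_pos
  have hpi := A.lt_pi
  have h1 : β ≤ α * ψ := by have := (div_le_iff₀ hα).1 hψ.1; linarith
  have h2 : α * ψ ≤ α * τ := mul_le_mul_of_nonneg_left hψ.2 hα.le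
  rw [show α * ψ - (β + Real.pi / 2) = (α * ψ - β) - Real.pi / 2 by ring, Real.cos_sub_pi_div_two]
  exact Real.sin_nonneg_of_nonneg_of_le_pi (by linarith) (by linarith)

lemma cos_up' {β ψ : ℝ} (hβ : 0 < β) (hψ : ψ ∈ Ioo (β / α) τ) :
    0 < Real.cos (α * ψ - (β + Real.pi / 2)) := by
  have hα := A.α_pos
  have hτ := A.τ_pos
  have hpi := A.lt_pi
  have h1 : β < α * ψ := by have := (div_lt_iff₀ hα).1 hψ.1; linarith
  have h2 : α * ψ ≤ α * τ := mul_le_mul_of_nonneg_left hψ.2.le hα.le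
  rw [show α * ψ - (β + Real.pi / 2) = (α * ψ - β) - Real.pi / 2 by ring, Real.cos_sub_pi_div_two]
  exact Real.sin_pos_of_pos_of_lt_pi (by linarith) (by linarith)

lemma contour {β κ C Z : ℝ} (hβ : 0 < β) (hβ1 : β < Real.pi) (hβτ : β ≤ α * τ) (hκ : 0 < κ)
    (hκ1 : κ ≤ 1) (hκZ : κ ≤ Z) (hZC : Z ≤ C) (hC : 1 ≤ C) :
    -exponent α ((α + 2) * τ) (β + 2 * τ) Z - κ * (2 * τ + 4) ≤
      ((∫ r in κ..C, phase α β (β - Real.pi / 2) r 0 * dir 0) +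
        ((∫ ψ in (0 : ℝ)..β / α, phase α β (β - Real.pi / 2) C ψ * (C * (dir ψ * Complex.I))) +
        ∫ ψ in β / α..τ, phase α β (β + Real.pi / 2) C ψ * (C * (dir ψ * Complex.I))) -
        ∫ r in Z..C, phase α β (β + Real.pi / 2) r τ * dir τ).re := by
  have hα := A.α_pos
  have hτ := A.τ_pos
  have hκC : κ ≤ C := by linarith
  have hb0 : 0 ≤ β / α := by positivity
  have hbτ : β / α ≤ τ := by rw [div_le_iff₀ hα]; linarith
  have z1 : Real.cos (β - (β - Real.pi / 2)) = 0 := by simp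
  have z2 : Real.cos (β - (β + Real.pi / 2)) = 0 := by simp
  have hL := phase_cauchy hα hκ hκ1 hκC hb0 z1 (fun ψ hψ => A.cos_low hβ1 hψ)
    (fun ψ hψ => A.cos_low' hβ1 hψ)
  have hU := phase_cauchy hα hκ hκ1 hκC hbτ z2 (fun ψ hψ => A.cos_up hβ hψ)
    (fun ψ hψ => A.cos_up' hβ hψ)
  have hinteg : ∀ {φ ψ : ℝ}, Real.cos (β - φ) = 0 → 0 ≤ Real.cos (α * ψ - φ) → ∀ x y : ℝ, 0 ≤ x →
      x ≤ y → IntervalIntegrable (fun r => phase α β φ r ψ * dir ψ) volume x y :=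
    fun h0 h1 x y hx hxy => (((continuousOn_phase hα h0 h1).mul continuousOn_const).mono
      fun r hr => hx.trans hr.1).intervalIntegrable_of_Icc hxy
  have hPQ : (∫ r in κ..C, phase α β (β - Real.pi / 2) r (β / α) * dir (β / α))
      - (∫ r in κ..C, phase α β (β + Real.pi / 2) r (β / α) * dir (β / α))
      = ((2 * ∫ r in κ..C, √(1 - r ^ α) : ℝ) : ℂ) *
        dir (β / 2 - Real.pi / 2 + β / α) := by
    rw [← intervalIntegral.integral_sub (hinteg z1 (A.cos_low hβ1 ⟨hb0, le_rfl⟩) κ C hκ.le hκC)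
      (hinteg z2 (A.cos_up hβ ⟨le_rfl, hbτ⟩) κ C hκ.le hκC), dir_add,
      ← intervalIntegral.integral_const_mul, ← intervalIntegral.integral_ofReal,
      ← intervalIntegral.integral_mul_const]
    refine intervalIntegral.integral_congr fun r _ => ?_
    rw [← sub_mul, phase_sub_phase hα]
    push_cast; ring
  have hX0 := fun x y => hinteg z2 (A.cos_up hβ (ψ := τ) ⟨hbτ, le_rfl⟩) x y
  have hX : (∫ r in κ..C, phase α β (β + Real.pi / 2) r τ * dir τ)
      - (∫ r in Z..C, phase α β (β + Real.pi / 2) r τ * dir τ)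
      = (∫ r in (0 : ℝ)..Z, phase α β (β + Real.pi / 2) r τ * dir τ) -
        ∫ r in (0 : ℝ)..κ, phase α β (β + Real.pi / 2) r τ * dir τ := by
    rw [← intervalIntegral.integral_add_adjacent_intervals (hX0 κ Z hκ.le hκZ)
      (hX0 Z C (by linarith) hZC), ← intervalIntegral.integral_add_adjacent_intervals
      (hX0 0 κ le_rfl hκ.le) (hX0 κ Z hκ.le hκZ)]
    ring
  have hg : (∫ r in (0 : ℝ)..Z, phase α β (β + Real.pi / 2) r τ * dir τ)
      = -∫ r in (0 : ℝ)..Z, gfun α ((α + 2) * τ) (β + 2 * τ) r := by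
    rw [← intervalIntegral.integral_neg]
    exact intervalIntegral.integral_congr fun r _ => phase_ray β τ r
  have hsmall : ‖∫ r in (0 : ℝ)..κ, phase α β (β + Real.pi / 2) r τ * dir τ‖ ≤ 2 * κ := by
    have := intervalIntegral.norm_integral_le_of_norm_le_const (a := 0) (b := κ) (C := 2)
      (f := fun r : ℝ => phase α β (β + Real.pi / 2) r τ * dir τ) (fun r hr => by
        rw [uIoc_of_le hκ.le] at hr
        rw [norm_mul, norm_dir, mul_one]
        exact norm_phase_le hα _ _ _ hr.1.le (hr.2.trans hκ1))
    simpa [abs_of_pos hκ] using this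
  have hK := integral_sqrt_ge hα hκ hC
  set I1 := ∫ r in κ..C, phase α β (β - Real.pi / 2) r 0 * dir 0
  set aL := ∫ ψ in (0 : ℝ)..β / α, phase α β (β - Real.pi / 2) C ψ * (C * (dir ψ * Complex.I))
  set aU := ∫ ψ in β / α..τ, phase α β (β + Real.pi / 2) C ψ * (C * (dir ψ * Complex.I))
  set P := ∫ r in κ..C, phase α β (β - Real.pi / 2) r (β / α) * dir (β / α)
  set Q := ∫ r in κ..C, phase α β (β + Real.pi / 2) r (β / α) * dir (β / α)
  set X := ∫ r in κ..C, phase α β (β + Real.pi / 2) r τ * dir τ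
  set Y := ∫ r in Z..C, phase α β (β + Real.pi / 2) r τ * dir τ
  set S := ∫ r in (0 : ℝ)..κ, phase α β (β + Real.pi / 2) r τ * dir τ
  set W := ∫ r in (0 : ℝ)..Z, gfun α ((α + 2) * τ) (β + 2 * τ) r with hW
  set K := ∫ r in (0 : ℝ)..1, √(1 - r ^ α) with hKdef
  set K' := ∫ r in κ..C, √(1 - r ^ α)
  have key : I1 + (aL + aU) - Y = (I1 + aL - P) + (Q + aU - X) + (P - Q) + (X - Y) := by ring
  rw [hg] at hX
  rw [key, hPQ, hX]
  have b1 := (abs_le.1 ((Complex.abs_re_le_norm _).trans hL)).1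
  have b2 := (abs_le.1 ((Complex.abs_re_le_norm _).trans hU)).1
  have b3 := (abs_le.1 ((Complex.abs_re_le_norm _).trans hsmall)).2
  have hγ : (dir (β / 2 - Real.pi / 2 + β / α)).re = Real.sin (β * (1 / 2 + 1 / α)) := by
    rw [dir_re, show β / 2 - Real.pi / 2 + β / α = β * (1 / 2 + 1 / α) - Real.pi / 2 by
      field_simp; ring, Real.cos_sub_pi_div_two]
  have hE : exponent α ((α + 2) * τ) (β + 2 * τ) Z
      = W.re - 2 * Real.sin (β * (1 / 2 + 1 / α)) * K := by
    rw [exponent, ← hW, ← hKdef, show β + 2 * τ - 2 * ((α + 2) * τ / (α + 2)) = β by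
      field_simp; ring]
  rw [hE, Complex.add_re, Complex.add_re, Complex.add_re, Complex.sub_re (-W) S, Complex.neg_re W,
    Complex.re_ofReal_mul, hγ]
  set sγ := Real.sin (β * (1 / 2 + 1 / α)) with hsγ
  have b4 : |2 * sγ * (K' - K)| ≤ 2 * κ := by
    rw [abs_mul, abs_mul, abs_two]
    have : |sγ| ≤ 1 := Real.abs_sin_le_one _
    nlinarith [abs_nonneg sγ, abs_nonneg (K' - K)]
  have b5 := (abs_le.1 b4).1
  nlinarith

end Admissible

end Anharmonic

namespace Anharmonic

variable {α : ℝ}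

namespace Admissible
variable {τ : ℝ} (A : Admissible α τ)
include A

lemma real_axis_decay {β κ C : ℝ} (hβ : 0 < β) (hβ1 : β < Real.pi) (hκ : 0 < κ) (hκC : κ ≤ C) :
    ∃ M : ℝ, 0 < M ∧ ∀ N : ℝ, 1 ≤ N → ∀ a b, Sub α (((N ^ α : ℝ) : ℂ) * dir β) a b →
      ‖sol α a b (((N ^ α : ℝ) : ℂ) * dir β) (N * C)‖ ≤ M * ‖a‖ *
        Real.exp (-(N ^ (1 + α / 2) *
          (∫ r in κ..C, phase α β (β - Real.pi / 2) r 0 * dir 0).re)) := by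
  have hα := A.α_pos
  have hω : |(Real.pi - β) / 2| < Real.pi / 2 := by rw [abs_of_nonneg] <;> linarith
  obtain ⟨D, hD, hstart⟩ := real_start hα A.α_lt hβ hβ1
  obtain ⟨M, hM, hpath⟩ := wkb_path hα A.α_lt hω (μ := dir β) (γ := fun s => (s : ℂ))
    (γ' := fun _ => 1) (fun s => (hasDerivAt_id' (s : ℂ)).comp_ofReal) continuous_const hκC
    (fun s hs => real_mem_region hβ hβ1 (hκ.trans_le hs.1))
  refine ⟨M * D, by positivity, fun N hN a b h => ?_⟩
  have h1 := hpath N hN a b h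
  have h2 := (hstart N hN a b h).2 (N * κ) (by positivity)
  have e : (∫ s in κ..C, csqrt ((s : ℂ) ^ (α : ℂ) - dir β) * 1)
      = ∫ r in κ..C, phase α β (β - Real.pi / 2) r 0 * dir 0 := by
    refine intervalIntegral.integral_congr fun r hr => ?_
    rw [uIcc_of_le hκC] at hr
    have hr0 : 0 < r := hκ.trans_le hr.1
    have := phase_eq hα (β := β) (φ := β - Real.pi / 2) (ω := (Real.pi - β) / 2) (ψ := 0) hr0
      (by simp [Real.pi_pos]) hω
      (by rw [dir_zero, mul_one]; exact real_mem_region hβ hβ1 hr0)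
      (by rw [abs_lt]; constructor <;> linarith) (by simp)
      (A.cos_low hβ1 ⟨le_rfl, by positivity⟩)
    rw [dir_zero, mul_one] at this
    simp only [this, dir_zero]
  rw [e] at h1
  push_cast at h2
  refine h1.trans ?_
  rw [mul_assoc M D]
  gcongr

lemma arc_decay {β C : ℝ} (hβ : 0 < β) (hβ1 : β + 2 * τ < Real.pi) (hβτ : β ≤ α * τ) (hC : 0 < C)
    (hreg : ∀ ψ ∈ Icc 0 τ, (C : ℂ) * dir ψ ∈ region α (2 * τ - Real.pi / 2) (dir β)) :
    ∃ M : ℝ, 0 < M ∧ ∀ N : ℝ, 1 ≤ N → ∀ a b, Sub α (((N ^ α : ℝ) : ℂ) * dir β) a b →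
      ‖sol α a b (((N ^ α : ℝ) : ℂ) * dir β) (N * (C * dir τ))‖ ≤
        M * ‖sol α a b (((N ^ α : ℝ) : ℂ) * dir β) (N * C)‖ * Real.exp (-(N ^ (1 + α / 2) *
          ((∫ ψ in (0 : ℝ)..β / α, phase α β (β - Real.pi / 2) C ψ * (C * (dir ψ * Complex.I))) +
        ∫ ψ in β / α..τ, phase α β (β + Real.pi / 2) C ψ * (C * (dir ψ * Complex.I))).re)) := by
  have hα := A.α_pos
  have hτ := A.τ_pos
  have hb0 : 0 ≤ β / α := by positivity
  have hbτ : β / α ≤ τ := by rw [div_le_iff₀ hα]; linarith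
  obtain ⟨M, hM, hpath⟩ := wkb_path hα A.α_lt A.abs_rot (μ := dir β) (γ := fun s => (C : ℂ) * dir s)
    (γ' := fun s => C * (dir s * Complex.I)) (fun s => (hasDerivAt_dir s).const_mul _)
    (continuous_const.mul (continuous_dir.mul continuous_const)) hτ.le hreg
  refine ⟨M, hM, fun N hN a b h => ?_⟩
  have h1 := hpath N hN a b h
  simp only [dir_zero, mul_one] at h1
  have hcont : ContinuousOn (fun s : ℝ => csqrt (((C : ℂ) * dir s) ^ (α : ℂ) - dir β) *
      (C * (dir s * Complex.I))) (Icc 0 τ) := by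
    refine ContinuousOn.mul ?_
      (continuous_const.mul (continuous_dir.mul continuous_const)).continuousOn
    exact (continuousOn_csqrt_symbol A.abs_rot (dir β)).comp
      (continuous_const.mul continuous_dir).continuousOn hreg
  have e : (∫ s in (0 : ℝ)..τ, csqrt (((C : ℂ) * dir s) ^ (α : ℂ) - dir β) *
      (C * (dir s * Complex.I)))
      = (∫ ψ in (0 : ℝ)..β / α, phase α β (β - Real.pi / 2) C ψ * (C * (dir ψ * Complex.I))) +
        ∫ ψ in β / α..τ, phase α β (β + Real.pi / 2) C ψ * (C * (dir ψ * Complex.I)) := by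
    rw [← intervalIntegral.integral_add_adjacent_intervals (b := β / α)
      ((hcont.mono (Icc_subset_Icc_right hbτ)).intervalIntegrable_of_Icc hb0)
      ((hcont.mono (Icc_subset_Icc_left hb0)).intervalIntegrable_of_Icc hbτ)]
    congr 1
    · refine intervalIntegral.integral_congr fun ψ hψ => ?_
      rw [uIcc_of_le hb0] at hψ
      have hψ' : ψ ∈ Icc 0 τ := ⟨hψ.1, hψ.2.trans hbτ⟩
      rw [phase_eq hα hC (A.abs_le_of_mem hψ') A.abs_rot (hreg ψ hψ')
        (φ := β - Real.pi / 2) (by rw [abs_lt]; constructor <;> linarith) (by simp)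
        (A.cos_low (by linarith) hψ)]
    · refine intervalIntegral.integral_congr fun ψ hψ => ?_
      rw [uIcc_of_le hbτ] at hψ
      have hψ' : ψ ∈ Icc 0 τ := ⟨hb0.trans hψ.1, hψ.2⟩
      rw [phase_eq hα hC (A.abs_le_of_mem hψ') A.abs_rot (hreg ψ hψ')
        (φ := β + Real.pi / 2) (by rw [abs_lt]; constructor <;> linarith) (by simp)
        (A.cos_up hβ hψ)]
  rwa [e] at h1

lemma ray_mem_region {β Z : ℝ} (hZ : 0 < Z)
    (hsin : Real.sin (β + 2 * τ) < Z ^ α * Real.sin ((α + 2) * τ)) {r : ℝ} (hr : Z ≤ r) :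
    (r : ℂ) * dir τ ∈ region α (2 * τ - Real.pi / 2) (dir β) := by
  refine A.mem_region_of (hZ.trans_le hr) ⟨A.τ_pos.le, le_rfl⟩ (hsin.trans_le ?_)
  have hα := A.α_pos
  have hτ := A.τ_pos
  rw [show 2 * τ + α * τ = (α + 2) * τ by ring]
  exact mul_le_mul_of_nonneg_right (Real.rpow_le_rpow hZ.le hr hα.le)
    (Real.sin_pos_of_pos_of_lt_pi (by positivity) A.lt_pi).le

lemma ray_decay {β Z C : ℝ} (hβ : 0 < β) (hβ1 : β + 2 * τ < Real.pi) (hβτ : β ≤ α * τ) (hZ : 0 < Z)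
    (hZC : Z ≤ C) (hsin : Real.sin (β + 2 * τ) < Z ^ α * Real.sin ((α + 2) * τ)) :
    ∃ M : ℝ, 0 < M ∧ ∀ N : ℝ, 1 ≤ N → ∀ a b, Sub α (((N ^ α : ℝ) : ℂ) * dir β) a b →
      ‖sol α a b (((N ^ α : ℝ) : ℂ) * dir β) (N * (Z * dir τ))‖ ≤
        M * ‖sol α a b (((N ^ α : ℝ) : ℂ) * dir β) (N * (C * dir τ))‖ *
          Real.exp (-(N ^ (1 + α / 2) *
          (-∫ r in Z..C, phase α β (β + Real.pi / 2) r τ * dir τ).re)) := by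
  have hα := A.α_pos
  have hτ := A.τ_pos
  have hbτ : β / α ≤ τ := by rw [div_le_iff₀ hα]; linarith
  obtain ⟨M, hM, hpath⟩ := wkb_path hα A.α_lt A.abs_rot (μ := dir β)
    (γ := fun s => ((-s : ℝ) : ℂ) * dir τ) (γ' := fun s => -1 * dir τ)
    (fun s => by
      have : HasDerivAt (fun z : ℂ => -z * dir τ) (-1 * dir τ) (s : ℂ) :=
        (hasDerivAt_id' (s : ℂ)).neg.mul_const _
      simpa using this.comp_ofReal) continuous_const
    (neg_le_neg hZC) (fun s hs => A.ray_mem_region hZ hsin (by linarith [hs.2]))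
  refine ⟨M, hM, fun N hN a b h => ?_⟩
  have h1 := hpath N hN a b h
  simp only [neg_neg] at h1
  have e : (∫ s in -C..-Z, csqrt ((((-s : ℝ) : ℂ) * dir τ) ^ (α : ℂ) - dir β) * (-1 * dir τ))
      = -∫ r in Z..C, phase α β (β + Real.pi / 2) r τ * dir τ := by
    rw [← intervalIntegral.integral_neg, ← intervalIntegral.integral_comp_neg]
    refine intervalIntegral.integral_congr fun s hs => ?_
    rw [uIcc_of_le hZC] at hs
    rw [neg_neg, phase_eq hα (r := s) (by linarith [hs.1]) (A.abs_le_of_mem ⟨hτ.le, le_rfl⟩)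
      A.abs_rot (A.ray_mem_region hZ hsin hs.1)
      (φ := β + Real.pi / 2) (by rw [abs_lt]; constructor <;> linarith) (by simp)
        (A.cos_up hβ ⟨hbτ, le_rfl⟩)]
    ring
  rwa [e] at h1

lemma tunnel {β Z δ : ℝ} (hβ : 0 < β) (hβ1 : β + 2 * τ < Real.pi) (hβτ : β ≤ α * τ) (hZ : 0 < Z)
    (hsin : Real.sin (β + 2 * τ) < Z ^ α * Real.sin ((α + 2) * τ))
    (hexp : exponent α ((α + 2) * τ) (β + 2 * τ) Z < -δ) :
    ∃ M : ℝ, 0 < M ∧ ∀ N : ℝ, 1 ≤ N → ∀ a b, Sub α (((N ^ α : ℝ) : ℂ) * dir β) a b →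
      ‖sol α a b (((N ^ α : ℝ) : ℂ) * dir β) (N * (Z * dir τ))‖ ≤
        M * ‖a‖ * Real.exp (-(δ * N ^ (1 + α / 2))) ∧
      ‖sol1 α a b (((N ^ α : ℝ) : ℂ) * dir β) (N * (Z * dir τ))‖ ≤
        M * N ^ (α / 2) * ‖sol α a b (((N ^ α : ℝ) : ℂ) * dir β) (N * (Z * dir τ))‖ := by
  have hα := A.α_pos
  have hτ := A.τ_pos
  set E := exponent α ((α + 2) * τ) (β + 2 * τ) Z
  obtain ⟨C₀, hC₀, harc⟩ := A.exists_arc β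
  set C := max C₀ Z with hC
  have hC1 : 1 ≤ C := hC₀.trans (le_max_left _ _)
  set κ := min (min 1 Z) ((-δ - E) / (2 * τ + 4)) with hκdef
  have hκ : 0 < κ := lt_min (lt_min one_pos hZ) (div_pos (by linarith) (by positivity))
  have hκ1 : κ ≤ 1 := (min_le_left _ _).trans (min_le_left _ _)
  have hκZ : κ ≤ Z := (min_le_left _ _).trans (min_le_right _ _)
  have hκE : κ * (2 * τ + 4) ≤ -δ - E :=
    (le_div_iff₀ (by positivity)).1 (min_le_right _ _)
  have hZC : Z ≤ C := le_max_right _ _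
  obtain ⟨M1, hM1, H1⟩ := A.real_axis_decay hβ (by linarith) hκ (hκZ.trans hZC)
  obtain ⟨M2, hM2, H2⟩ := A.arc_decay hβ hβ1 hβτ (by linarith) (harc C (le_max_left _ _))
  obtain ⟨M3, hM3, H3⟩ := A.ray_decay hβ hβ1 hβτ hZ hZC hsin
  obtain ⟨M4, hM4, H4⟩ := wkb hα A.α_lt A.abs_rot (μ := dir β)
    (isCompact_singleton (x := (Z : ℂ) * dir τ))
    (singleton_subset_iff.2 (A.ray_mem_region hZ hsin le_rfl))
  have hcont := A.contour hβ (by linarith) hβτ hκ hκ1 hκZ hZC hC1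
  set P := ∫ r in κ..C, phase α β (β - Real.pi / 2) r 0 * dir 0
  set Q := (∫ ψ in (0 : ℝ)..β / α, phase α β (β - Real.pi / 2) C ψ * (C * (dir ψ * Complex.I))) +
        ∫ ψ in β / α..τ, phase α β (β + Real.pi / 2) C ψ * (C * (dir ψ * Complex.I))
  set Y := ∫ r in Z..C, phase α β (β + Real.pi / 2) r τ * dir τ
  rw [Complex.sub_re, Complex.add_re] at hcont
  refine ⟨max (M3 * (M2 * M1)) M4, lt_max_of_lt_right hM4, fun N hN a b h => ⟨?_, ?_⟩⟩
  · have h1 := H1 N hN a b h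
    have h2 := H2 N hN a b h
    have h3 := H3 N hN a b h
    set k := N ^ (1 + α / 2) with hk
    have hk0 : 0 ≤ k := Real.rpow_nonneg (by linarith) _
    refine h3.trans ?_
    calc _ ≤ M3 * (M2 * (M1 * ‖a‖ * Real.exp (-(k * P.re))) * Real.exp (-(k * Q.re)))
          * Real.exp (-(k * (-Y).re)) := by
          gcongr
          refine h2.trans ?_
          gcongr
      _ = M3 * (M2 * M1) * ‖a‖ * Real.exp (-(k * (P.re + Q.re - Y.re))) := by
          rw [show -(k * (P.re + Q.re - Y.re)) = -(k * P.re) + -(k * Q.re) + -(k * (-Y).re) by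
            rw [Complex.neg_re]; ring, Real.exp_add, Real.exp_add]
          ring
      _ ≤ _ := by
          have : -(k * (P.re + Q.re - Y.re)) ≤ -(δ * k) := by nlinarith
          have := Real.exp_le_exp.2 this
          have := le_max_left (M3 * (M2 * M1)) M4
          gcongr
  · obtain ⟨hne, h1, -⟩ := H4 N hN a b h _ rfl
    rw [norm_div, div_le_iff₀ (norm_pos_iff.2 hne)] at h1
    refine h1.trans ?_
    have := le_max_right (M3 * (M2 * M1)) M4
    have : 0 ≤ N := by linarith
    gcongr

end Admissible

end Anharmonic

namespace Anharmonic

variable {α : ℝ}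

namespace Admissible
variable {τ : ℝ} (A : Admissible α τ)
include A

lemma re_dir_mul_pot (x N β : ℝ) {s : ℝ} (hs : 0 ≤ s) :
    (dir x * pot α τ (((N ^ α : ℝ) : ℂ) * dir β) s).re
      = s ^ α * Real.cos ((α + 2) * τ + x) - N ^ α * Real.cos (β + 2 * τ + x) := by
  rw [A.pot_eq _ hs, mul_sub, mul_left_comm, ← dir_add, mul_left_comm (dir (2 * τ)),
    mul_left_comm (dir x), ← dir_add, ← dir_add, Complex.sub_re, Complex.re_ofReal_mul,
    Complex.re_ofReal_mul, dir_re, dir_re]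
  ring_nf

lemma outer_energy {β Z : ℝ} (hZ : 0 < Z)
    (hsin : Real.sin (β + 2 * τ) < Z ^ α * Real.sin ((α + 2) * τ)) :
    ∃ c : ℝ, 0 < c ∧ ∀ N : ℝ, 1 ≤ N → ∀ a b, Sub α (((N ^ α : ℝ) : ℂ) * dir β) a b →
      IntegrableOn (fun s => ‖raySol α τ a b (((N ^ α : ℝ) : ℂ) * dir β) (N * Z + s)‖ ^ 2) (Ioi 0) ∧
      c * N ^ α * ∫ s in Ioi (0 : ℝ), ‖raySol α τ a b (((N ^ α : ℝ) : ℂ) * dir β) (N * Z + s)‖ ^ 2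
        ≤ ‖raySol1 α τ a b (((N ^ α : ℝ) : ℂ) * dir β) (N * Z)‖ *
          ‖raySol α τ a b (((N ^ α : ℝ) : ℂ) * dir β) (N * Z)‖ := by
  have hα := A.α_pos
  have hτ := A.τ_pos
  have hpi := A.lt_pi
  obtain ⟨ς, ⟨hς1, hς2⟩, hς0⟩ : ∃ ς : ℝ, (0 < Z ^ α * Real.sin ((α + 2) * τ + ς) -
      Real.sin (β + 2 * τ + ς) ∧ ς < Real.pi - (α + 2) * τ) ∧ 0 < ς := by
    have h1 : ∀ᶠ ς in nhds (0 : ℝ), 0 < Z ^ α * Real.sin ((α + 2) * τ + ς) -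
        Real.sin (β + 2 * τ + ς) := by
      have : Continuous fun ς : ℝ => Z ^ α * Real.sin ((α + 2) * τ + ς) -
        Real.sin (β + 2 * τ + ς) := by fun_prop
      exact this.continuousAt.eventually_const_lt (by simpa using hsin)
    have h2 : ∀ᶠ ς in nhds (0 : ℝ), ς < Real.pi - (α + 2) * τ := gt_mem_nhds (by linarith)
    exact (((h1.and h2).filter_mono nhdsWithin_le_nhds).and
      (self_mem_nhdsWithin (s := Ioi (0 : ℝ)))).exists
  have hθ : 0 < (α + 2) * τ := by positivity
  refine ⟨_, hς1, fun N hN a b h => ?_⟩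
  have hN0 : 0 < N := by linarith
  have hNα : 0 < N ^ α := Real.rpow_pos_of_pos hN0 α
  have hd := mul_pos hς1 hNα
  have hdec := A.isDecaying h (X := N * Z) (e := dir (ς - Real.pi / 2)) (by positivity)
    (by rw [dir_re, Real.cos_sub_pi_div_two]
        exact Real.sin_pos_of_pos_of_lt_pi hς0 (by linarith)) (norm_dir _).le hd.le
    (fun s hs => by
      have hs0 : 0 ≤ s := by nlinarith
      rw [A.re_dir_mul_pot _ _ _ hs0, ← add_sub_assoc, ← add_sub_assoc, Real.cos_sub_pi_div_two,
        Real.cos_sub_pi_div_two]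
      have h1 : (N * Z) ^ α ≤ s ^ α := Real.rpow_le_rpow (by positivity) hs.le hα.le
      rw [Real.mul_rpow hN0.le hZ.le] at h1
      have h2 : 0 ≤ Real.sin ((α + 2) * τ + ς) :=
        Real.sin_nonneg_of_nonneg_of_le_pi (by linarith) (by linarith)
      nlinarith)
  refine ⟨hdec.integrableOn_sq hd, (hdec.integral_Ioi_sq_le hd).trans ?_⟩
  simpa using hdec.flux_zero_le

lemma inner_energy {β Z : ℝ} (hZ : 0 < Z)
    (hsin : Z ^ α * Real.sin ((α + 2) * τ) < Real.sin (β + 2 * τ)) :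
    ∃ c : ℝ, 0 < c ∧ ∀ N : ℝ, 1 ≤ N → ∀ a b : ℂ,
      c * N ^ α * ∫ s in (0 : ℝ)..N * Z, ‖raySol α τ a b (((N ^ α : ℝ) : ℂ) * dir β) s‖ ^ 2
        ≤ ‖b‖ * ‖a‖ + ‖raySol1 α τ a b (((N ^ α : ℝ) : ℂ) * dir β) (N * Z)‖ *
          ‖raySol α τ a b (((N ^ α : ℝ) : ℂ) * dir β) (N * Z)‖ := by
  have hα := A.α_pos
  have hτ := A.τ_pos
  have hpi := A.lt_pi
  have hθ : 0 < Real.sin ((α + 2) * τ) := Real.sin_pos_of_pos_of_lt_pi (by positivity) hpi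
  refine ⟨_, sub_pos.2 hsin, fun N hN a b => ?_⟩
  have hN0 : 0 < N := by linarith
  have hT : 0 ≤ N * Z := by positivity
  have hsol := A.isSol_zero a b (((N ^ α : ℝ) : ℂ) * dir β)
  set U := raySol α τ a b (((N ^ α : ℝ) : ℂ) * dir β) with hU
  set U1 := raySol1 α τ a b (((N ^ α : ℝ) : ℂ) * dir β) with hU1
  have hsub : Icc 0 (N * Z) ⊆ Ici (0 : ℝ) := fun s hs => hs.1
  have hen := hsol.flux_energy (dir (Real.pi / 2)) hT
  have hf0 := (abs_le.1 (flux_le (norm_dir (Real.pi / 2)).le U U1 0)).2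
  have hfT := (abs_le.1 (flux_le (norm_dir (Real.pi / 2)).le U U1 (N * Z))).1
  have h0 : ‖U1 0‖ * ‖U 0‖ = ‖b‖ * ‖a‖ := by
    rw [hU, hU1, A.raySol_zero, A.raySol1_zero, norm_mul, norm_dir, one_mul]
  have hmono : (Real.sin (β + 2 * τ) - Z ^ α * Real.sin ((α + 2) * τ)) * N ^ α *
      ∫ s in (0 : ℝ)..N * Z, ‖U s‖ ^ 2 ≤ ∫ s in (0 : ℝ)..N * Z,
        ((dir (Real.pi / 2)).re * ‖U1 s‖ ^ 2 +
          (dir (Real.pi / 2) * pot α τ (((N ^ α : ℝ) : ℂ) * dir β) s).re * ‖U s‖ ^ 2) := by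
    rw [← intervalIntegral.integral_const_mul]
    refine intervalIntegral.integral_mono_on hT
      ((continuousOn_const.mul ((hsol.cont.mono hsub).norm.pow 2)).intervalIntegrable_of_Icc hT)
      (ContinuousOn.intervalIntegrable_of_Icc hT ?_) fun s hs => ?_
    · have h1 := hsol.cont1.mono hsub
      have h2 := hsol.cont.mono hsub
      have h3 := Complex.continuous_re.comp_continuousOn
        (continuousOn_const (c := dir (Real.pi / 2)).mul (hsol.contq.mono hsub))
      exact (continuousOn_const.mul (h1.norm.pow 2)).add (h3.mul (h2.norm.pow 2))
    · rw [A.re_dir_mul_pot _ _ _ hs.1, dir_re, Real.cos_pi_div_two, zero_mul, zero_add,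
        Real.cos_add_pi_div_two, Real.cos_add_pi_div_two]
      have h1 : s ^ α ≤ (N * Z) ^ α := Real.rpow_le_rpow hs.1 hs.2 hα.le
      rw [Real.mul_rpow hN0.le hZ.le] at h1
      refine mul_le_mul_of_nonneg_right ?_ (by positivity)
      nlinarith
  linarith

set_option maxHeartbeats 1000000 in
lemma ray_energy {β Z₁ Z₂ δ : ℝ} (hβ : 0 < β) (hβ1 : β + 2 * τ < Real.pi) (hβτ : β ≤ α * τ)
    (hZ₂ : 0 < Z₂) (hZ : Z₂ ≤ Z₁)
    (hsin₁ : Real.sin (β + 2 * τ) < Z₁ ^ α * Real.sin ((α + 2) * τ))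
    (hsin₂ : Z₂ ^ α * Real.sin ((α + 2) * τ) < Real.sin (β + 2 * τ))
    (hexp : exponent α ((α + 2) * τ) (β + 2 * τ) Z₁ < -δ)
    (hδ : √(Z₁ ^ α + 1) * (Z₁ - Z₂) < δ) :
    ∃ K : ℝ, 0 < K ∧ ∀ N : ℝ, 1 ≤ N → ∀ a b, Sub α (((N ^ α : ℝ) : ℂ) * dir β) a b →
      IntegrableOn (fun s => ‖raySol α τ a b (((N ^ α : ℝ) : ℂ) * dir β) s‖ ^ 2) (Ioi 0) ∧
      ∫ s in Ioi (0 : ℝ), ‖raySol α τ a b (((N ^ α : ℝ) : ℂ) * dir β) s‖ ^ 2 ≤ K * ‖a‖ ^ 2 := by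
  have hα := A.α_pos
  have hτ := A.τ_pos
  have hZ₁ : 0 < Z₁ := hZ₂.trans_le hZ
  obtain ⟨M, hM, htun⟩ := A.tunnel hβ hβ1 hβτ hZ₁ hsin₁ hexp
  obtain ⟨D, hD, hstart⟩ := real_start hα A.α_lt hβ (by linarith)
  obtain ⟨c₁, hc₁, hout⟩ := A.outer_energy hZ₁ hsin₁
  obtain ⟨c₂, hc₂, hinn⟩ := A.inner_energy hZ₂ hsin₂
  set κ := √(Z₁ ^ α + 1) with hκ
  have hκ0 : 0 < κ := by positivity
  have hκ2 : κ ^ 2 = Z₁ ^ α + 1 := Real.sq_sqrt (by positivity)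
  set ε := δ - κ * (Z₁ - Z₂) with hε
  have hε0 : 0 < ε := by linarith
  set L := (κ ^ 2 + M ^ 2) * M ^ 2 with hL
  have hL0 : 0 < L := by positivity
  refine ⟨(D + L / κ) / c₂ + L / κ ^ 2 * (Z₁ / ε) + L / κ / c₁, by positivity,
    fun N hN a b h => ?_⟩
  have hN0 : 0 < N := by linarith
  obtain ⟨hb, -⟩ := hstart N hN a b h
  obtain ⟨ht0, ht1⟩ := htun N hN a b h
  obtain ⟨ho1, ho2⟩ := hout N hN a b h
  have hi := hinn N hN a b
  have hsol := A.isSol_zero a b (((N ^ α : ℝ) : ℂ) * dir β)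
  set n := N ^ (α / 2) with hn
  have hn0 : 0 < n := Real.rpow_pos_of_pos hN0 _
  have hn1 : 1 ≤ n := Real.one_le_rpow hN (by linarith)
  have hn2 : N ^ α = n ^ 2 := by
    rw [hn, ← Real.rpow_natCast, ← Real.rpow_mul hN0.le]; congr 1; push_cast; ring
  have hk : N ^ (1 + α / 2) = N * n := by rw [Real.rpow_add hN0, Real.rpow_one]
  rw [hk] at ht0
  have hU1eq : ‖raySol1 α τ a b (((N ^ α : ℝ) : ℂ) * dir β) (N * Z₁)‖
      = ‖sol1 α a b (((N ^ α : ℝ) : ℂ) * dir β) (N * (Z₁ * dir τ))‖ := by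
    rw [raySol1, norm_mul, norm_dir, one_mul]; push_cast; rw [mul_assoc]
  have hUeq : ‖raySol α τ a b (((N ^ α : ℝ) : ℂ) * dir β) (N * Z₁)‖
      = ‖sol α a b (((N ^ α : ℝ) : ℂ) * dir β) (N * (Z₁ * dir τ))‖ := by
    rw [raySol]; push_cast; rw [mul_assoc]
  rw [← hUeq] at ht0 ht1
  rw [← hU1eq] at ht1
  set U := raySol α τ a b (((N ^ α : ℝ) : ℂ) * dir β) with hU
  set U1 := raySol1 α τ a b (((N ^ α : ℝ) : ℂ) * dir β) with hU1
  have hmid : ∀ s ∈ Icc (N * Z₂) (N * Z₁), κ ^ 2 * n ^ 2 * ‖U s‖ ^ 2 + ‖U1 s‖ ^ 2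
      ≤ L * n ^ 2 * ‖a‖ ^ 2 * Real.exp (-(2 * ε * (N * n))) := by
    intro s hs
    have hs0 : 0 ≤ s := le_trans (by positivity) hs.1
    have hg := hsol.gronwall (K := κ * n) (T := N * Z₁) (by positivity) (fun t ht => by
      refine (A.norm_pot_le _ ht.1.le).trans ?_
      have : t ^ α ≤ (N * Z₁) ^ α := Real.rpow_le_rpow ht.1.le ht.2.le hα.le
      rw [Real.mul_rpow hN0.le hZ₁.le, hn2] at this
      rw [norm_mul, norm_dir, mul_one, Complex.norm_real, hn2, Real.norm_of_nonneg (by positivity),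
        mul_pow, hκ2]
      linarith) (s := s) (t := N * Z₁) ⟨hs0, hs.2⟩ ⟨by positivity, le_rfl⟩
    rw [mul_pow] at hg
    refine hg.trans ?_
    have e1 : |s - N * Z₁| ≤ N * (Z₁ - Z₂) := by
      have h1 := hs.1
      have h2 := hs.2
      rw [abs_le, mul_sub]; constructor <;> linarith
    have e2 : 2 * (κ * n) * |s - N * Z₁| ≤ 2 * (κ * n) * (N * (Z₁ - Z₂)) :=
      mul_le_mul_of_nonneg_left e1 (by positivity)
    have e3 : ‖U1 (N * Z₁)‖ ^ 2 ≤ M ^ 2 * n ^ 2 * ‖U (N * Z₁)‖ ^ 2 := by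
      rw [← mul_pow, ← mul_pow]; exact pow_le_pow_left₀ (norm_nonneg _) ht1 2
    have e4 : ‖U (N * Z₁)‖ ^ 2 ≤ M ^ 2 * ‖a‖ ^ 2 * Real.exp (-(2 * δ * (N * n))) := by
      refine (pow_le_pow_left₀ (norm_nonneg _) ht0 2).trans_eq ?_
      rw [mul_pow, mul_pow, ← Real.exp_nat_mul]
      congr 2; push_cast; ring
    calc (κ ^ 2 * n ^ 2 * ‖U (N * Z₁)‖ ^ 2 + ‖U1 (N * Z₁)‖ ^ 2) *
          Real.exp (2 * (κ * n) * |s - N * Z₁|)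
        ≤ ((κ ^ 2 + M ^ 2) * n ^ 2 * (M ^ 2 * ‖a‖ ^ 2 * Real.exp (-(2 * δ * (N * n))))) *
          Real.exp (2 * (κ * n) * (N * (Z₁ - Z₂))) := by
          refine mul_le_mul ?_ (Real.exp_le_exp.2 e2) (Real.exp_pos _).le (by positivity)
          calc _ ≤ (κ ^ 2 + M ^ 2) * n ^ 2 * ‖U (N * Z₁)‖ ^ 2 := by linarith
            _ ≤ _ := mul_le_mul_of_nonneg_left e4 (by positivity)
      _ = L * n ^ 2 * ‖a‖ ^ 2 * (Real.exp (-(2 * δ * (N * n))) *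
          Real.exp (2 * (κ * n) * (N * (Z₁ - Z₂)))) := by rw [hL]; ring
      _ = _ := by rw [← Real.exp_add]; congr 2; rw [hε]; ring
  have hexp1 : Real.exp (-(2 * ε * (N * n))) ≤ 1 := Real.exp_le_one_iff.2 (by
    have : 0 ≤ 2 * ε * (N * n) := by positivity
    linarith)
  have hprod : ∀ s ∈ Icc (N * Z₂) (N * Z₁), ‖U1 s‖ * ‖U s‖ ≤ L / κ * n * ‖a‖ ^ 2 := by
    intro s hs
    have h1 := hmid s hs
    have h2 : L * n ^ 2 * ‖a‖ ^ 2 * Real.exp (-(2 * ε * (N * n))) ≤ L * n ^ 2 * ‖a‖ ^ 2 :=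
      mul_le_of_le_one_right (by positivity) hexp1
    have h3 : 2 * (κ * n * (‖U1 s‖ * ‖U s‖)) ≤ L * n ^ 2 * ‖a‖ ^ 2 := by
      nlinarith [sq_nonneg (κ * n * ‖U s‖ - ‖U1 s‖)]
    have h5 : 0 ≤ ‖U1 s‖ * ‖U s‖ := by positivity
    have h4 : κ * n * (‖U1 s‖ * ‖U s‖) ≤ κ * n * (L / κ * n * ‖a‖ ^ 2) := by
      rw [show κ * n * (L / κ * n * ‖a‖ ^ 2) = L * n ^ 2 * ‖a‖ ^ 2 by field_simp]
      have : 0 ≤ κ * n * (‖U1 s‖ * ‖U s‖) := by positivity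
      linarith
    exact le_of_mul_le_mul_left h4 (by positivity)
  have hz12 : N * Z₂ ≤ N * Z₁ := by gcongr
  have hNZ₂ : 0 ≤ N * Z₂ := by positivity
  have hii : ∀ x y : ℝ, 0 ≤ x → x ≤ y → IntervalIntegrable (fun s => ‖U s‖ ^ 2) volume x y :=
    fun x y hx hxy => ((hsol.cont.mono fun s hs => hx.trans hs.1).norm.pow 2).intervalIntegrable_of_Icc
      hxy
  have I1 : ∫ s in (0 : ℝ)..N * Z₂, ‖U s‖ ^ 2 ≤ (D + L / κ) / c₂ * ‖a‖ ^ 2 := by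
    have h1 := hprod (N * Z₂) ⟨le_rfl, hz12⟩
    have h2 : ‖b‖ * ‖a‖ ≤ D * n * ‖a‖ * ‖a‖ := by gcongr
    have h3 : c₂ * N ^ α * (∫ s in (0 : ℝ)..N * Z₂, ‖U s‖ ^ 2)
        ≤ c₂ * N ^ α * ((D + L / κ) / c₂ * ‖a‖ ^ 2) := by
      refine hi.trans ?_
      rw [hn2, show c₂ * n ^ 2 * ((D + L / κ) / c₂ * ‖a‖ ^ 2) = n ^ 2 * ((D + L / κ) * ‖a‖ ^ 2) by
        field_simp]
      have h4 : n * ((D + L / κ) * ‖a‖ ^ 2) ≤ n ^ 2 * ((D + L / κ) * ‖a‖ ^ 2) :=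
        mul_le_mul_of_nonneg_right (by nlinarith) (by positivity)
      linarith
    exact le_of_mul_le_mul_left h3 (by positivity)
  have I2 : ∫ s in N * Z₂..N * Z₁, ‖U s‖ ^ 2 ≤ L / κ ^ 2 * (Z₁ / ε) * ‖a‖ ^ 2 := by
    have hpt : ∀ s ∈ Icc (N * Z₂) (N * Z₁), ‖U s‖ ^ 2 ≤ L / κ ^ 2 * ‖a‖ ^ 2 * (1 / (ε * N)) := by
      intro s hs
      have h1 := hmid s hs
      have h2 : Real.exp (-(2 * ε * (N * n))) ≤ 1 / (ε * N) := by
        rw [Real.exp_neg, ← one_div]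
        refine one_div_le_one_div_of_le (by positivity) ?_
        have h3 := Real.add_one_le_exp (2 * ε * (N * n))
        have h4 : ε * N ≤ ε * N * n := le_mul_of_one_le_right (by positivity) hn1
        have h5 : 0 ≤ ε * N := by positivity
        nlinarith
      have h3 : κ ^ 2 * n ^ 2 * ‖U s‖ ^ 2 ≤ κ ^ 2 * n ^ 2 *
          (L / κ ^ 2 * ‖a‖ ^ 2 * (1 / (ε * N))) := by
        rw [show κ ^ 2 * n ^ 2 * (L / κ ^ 2 * ‖a‖ ^ 2 * (1 / (ε * N)))
          = L * n ^ 2 * ‖a‖ ^ 2 * (1 / (ε * N)) by field_simp]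
        have h4 := mul_le_mul_of_nonneg_left h2 (show 0 ≤ L * n ^ 2 * ‖a‖ ^ 2 by positivity)
        have := sq_nonneg ‖U1 s‖
        linarith
      exact le_of_mul_le_mul_left h3 (by positivity)
    have h1 := intervalIntegral.integral_mono_on hz12 (hii _ _ hNZ₂ hz12)
      intervalIntegrable_const hpt
    rw [intervalIntegral.integral_const, smul_eq_mul] at h1
    refine h1.trans ?_
    rw [show L / κ ^ 2 * (Z₁ / ε) * ‖a‖ ^ 2
      = (N * Z₁) * (L / κ ^ 2 * ‖a‖ ^ 2 * (1 / (ε * N))) by field_simp]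
    exact mul_le_mul_of_nonneg_right (by linarith) (by positivity)
  have I3 : ∫ s in Ioi (0 : ℝ), ‖U (N * Z₁ + s)‖ ^ 2 ≤ L / κ / c₁ * ‖a‖ ^ 2 := by
    have h1 := hprod (N * Z₁) ⟨hz12, le_rfl⟩
    have h3 : c₁ * N ^ α * (∫ s in Ioi (0 : ℝ), ‖U (N * Z₁ + s)‖ ^ 2)
        ≤ c₁ * N ^ α * (L / κ / c₁ * ‖a‖ ^ 2) := by
      refine ho2.trans (h1.trans ?_)
      rw [hn2, show c₁ * n ^ 2 * (L / κ / c₁ * ‖a‖ ^ 2) = n ^ 2 * (L / κ * ‖a‖ ^ 2) by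
        field_simp]
      have h4 : n * (L / κ * ‖a‖ ^ 2) ≤ n ^ 2 * (L / κ * ‖a‖ ^ 2) :=
        mul_le_mul_of_nonneg_right (by nlinarith) (by positivity)
      linarith
    exact le_of_mul_le_mul_left h3 (by positivity)
  have hpre : (fun s => N * Z₁ + s) ⁻¹' Ioi (N * Z₁) = Ioi 0 := by ext s; simp
  have hmp := measurePreserving_add_left volume (N * Z₁)
  have hemb := (MeasurableEquiv.addLeft (N * Z₁)).measurableEmbedding
  have hI : IntegrableOn (fun s => ‖U s‖ ^ 2) (Ioi (N * Z₁)) := by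
    rw [← hmp.integrableOn_comp_preimage hemb, hpre]; exact ho1
  have hIeq : ∫ s in Ioi (N * Z₁), ‖U s‖ ^ 2 = ∫ s in Ioi (0 : ℝ), ‖U (N * Z₁ + s)‖ ^ 2 := by
    rw [← hmp.setIntegral_preimage_emb hemb, hpre]
  have hNZ₁ : 0 ≤ N * Z₁ := hNZ₂.trans hz12
  have hI0 : IntegrableOn (fun s => ‖U s‖ ^ 2) (Ioi 0) := by
    rw [← Ioc_union_Ioi_eq_Ioi hNZ₁]
    exact ((intervalIntegrable_iff_integrableOn_Ioc_of_le hNZ₁).1 (hii 0 _ le_rfl hNZ₁)).union hI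
  refine ⟨hI0, ?_⟩
  rw [← intervalIntegral.integral_interval_add_Ioi hI0 hI, hIeq,
    ← intervalIntegral.integral_add_adjacent_intervals (hii 0 _ le_rfl hNZ₂) (hii _ _ hNZ₂ hz12)]
  rw [add_mul, add_mul]
  gcongr

end Admissible

end Anharmonic

namespace Anharmonic

variable {α : ℝ}

namespace Admissible
variable {τ : ℝ} (A : Admissible α τ)
include A

lemma quotient_ray {G : ℂ → ℂ} {f : ℝ → ℂ} (hf : MemLp f 2 (volume.restrict (Ioi 0)))
    (hGp : ∀ μ a b, Sub α μ a b → G μ * a = pairing α τ f a b μ)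
    {β Z₁ Z₂ δ : ℝ} (hβ : 0 < β) (hβ1 : β + 2 * τ < Real.pi) (hβτ : β ≤ α * τ)
    (hZ₂ : 0 < Z₂) (hZ : Z₂ ≤ Z₁)
    (hsin₁ : Real.sin (β + 2 * τ) < Z₁ ^ α * Real.sin ((α + 2) * τ))
    (hsin₂ : Z₂ ^ α * Real.sin ((α + 2) * τ) < Real.sin (β + 2 * τ))
    (hexp : exponent α ((α + 2) * τ) (β + 2 * τ) Z₁ < -δ)
    (hδ : √(Z₁ ^ α + 1) * (Z₁ - Z₂) < δ) :
    ∃ K : ℝ, ∀ r : ℝ, 1 ≤ r → ‖G (r * dir β)‖ ≤ K := by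
  have hα := A.α_pos
  have hτ := A.τ_pos
  obtain ⟨K, hK, hen⟩ := A.ray_energy hβ hβ1 hβτ hZ₂ hZ hsin₁ hsin₂ hexp hδ
  refine ⟨√(∫ x in Ioi (0 : ℝ), ‖f x‖ ^ 2) * √K, fun r hr => ?_⟩
  have hr0 : 0 < r := by linarith
  set N := r ^ (1 / α) with hN
  have hN1 : 1 ≤ N := Real.one_le_rpow hr (by positivity)
  have hNr : N ^ α = r := by
    rw [hN, ← Real.rpow_mul hr0.le, one_div_mul_cancel hα.ne', Real.rpow_one]
  obtain ⟨a, b, h⟩ := exists_sub hα A.α_lt (r * dir β)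
  have hen' := hen N hN1 a b
  rw [hNr] at hen'
  obtain ⟨h1, h2⟩ := hen' h
  have hsinβ : 0 < Real.sin β := Real.sin_pos_of_pos_of_lt_pi hβ (by linarith)
  have ha : a ≠ 0 := h.left_ne_zero hα A.α_lt (by
    rw [Complex.im_ofReal_mul, dir_im]; positivity)
  have hg : MemLp (raySol α τ a b (r * dir β)) 2 (volume.restrict (Ioi 0)) :=
    (memLp_two_iff_integrable_sq_norm (A.aestronglyMeasurable_raySol a b _)).2 h1
  have h3 : ‖G (r * dir β)‖ * ‖a‖ ≤ √(∫ x in Ioi (0 : ℝ), ‖f x‖ ^ 2) * √K * ‖a‖ := by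
    rw [← norm_mul, hGp _ a b h, pairing]
    refine (norm_integral_mul_le hf hg).trans ?_
    rw [mul_assoc]
    refine mul_le_mul_of_nonneg_left ?_ (Real.sqrt_nonneg _)
    rw [← Real.sqrt_sq (norm_nonneg a), ← Real.sqrt_mul hK.le]
    exact Real.sqrt_le_sqrt h2
  exact le_of_mul_le_mul_right h3 (norm_pos_iff.2 ha)

end Admissible

end Anharmonic

namespace Anharmonic

variable {α : ℝ}

lemma gfun_sq (α θ η r : ℝ) : gfun α θ η r ^ 2 = ((r ^ α : ℝ) : ℂ) * dir θ - dir η := by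
  rw [gfun, neg_sq, mul_pow, csqrt_sq, dir_sq, ← mul_assoc, ← dir_add, mul_sub, mul_one,
    mul_left_comm, ← dir_add]
  congr 3 <;> ring

lemma gfun_zero (hα : 0 < α) (θ η : ℝ) : gfun α θ η 0 = -Complex.I * dir (η / 2) := by
  have e : dir (-(Real.pi / 2)) * ((((0 : ℝ) ^ α : ℝ) : ℂ) * dir (θ - η) - 1)
      = ((1 : ℝ) : ℂ) * dir (Real.pi / 2) := by
    rw [Real.zero_rpow hα.ne', show Real.pi / 2 = -(Real.pi / 2) + Real.pi by ring, dir_add_pi]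
    push_cast; ring_nf
  rw [gfun, e, csqrt_ofReal_mul_dir zero_le_one (by linarith [Real.pi_pos])
    (by linarith [Real.pi_pos]), Real.sqrt_one, Complex.ofReal_one, one_mul, ← dir_add,
    show η / 2 + Real.pi / 4 + Real.pi / 2 / 2 = η / 2 + Real.pi / 2 by ring, dir_add,
    dir_pi_div_two]
  ring

lemma re_gfun_symbol (α θ η r : ℝ) :
    (dir (-(Real.pi / 2)) * (((r ^ α : ℝ) : ℂ) * dir (θ - η) - 1)).re
      = r ^ α * Real.sin (θ - η) := by
  rw [mul_sub, mul_one, mul_left_comm, ← dir_add, Complex.sub_re, Complex.re_ofReal_mul, dir_re,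
    dir_re, Real.cos_neg, Real.cos_pi_div_two, sub_zero,
    show -(Real.pi / 2) + (θ - η) = θ - η - Real.pi / 2 by ring, Real.cos_sub_pi_div_two]

lemma continuousOn_gfun (hα : 0 < α) (θ : ℝ) : ContinuousOn (fun p : ℝ × ℝ => gfun α θ p.1 p.2)
    {p | 0 ≤ Real.sin (θ - p.1) ∧ 0 ≤ p.2} := by
  refine ContinuousOn.neg (ContinuousOn.mul
    (continuous_dir.comp (by fun_prop)).continuousOn
    (continuousOn_csqrt_re.comp (Continuous.continuousOn ?_) fun p hp => ?_))
  · refine continuous_const.mul (((Complex.continuous_ofReal.comp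
      ((Real.continuous_rpow_const hα.le).comp continuous_snd)).mul
      (continuous_dir.comp (by fun_prop))).sub continuous_const)
  · rw [mem_ofPred_eq, re_gfun_symbol]
    exact mul_nonneg (Real.rpow_nonneg hp.2 α) hp.1

lemma norm_gfun_le (α θ η : ℝ) {r : ℝ} (hr : 0 ≤ r) : ‖gfun α θ η r‖ ≤ r ^ α + 1 := by
  have h1 : ‖gfun α θ η r‖ ^ 2 ≤ r ^ α + 1 := by
    rw [← norm_pow, gfun_sq]
    refine (norm_sub_le _ _).trans ?_
    rw [norm_mul, norm_dir, norm_dir, mul_one, Complex.norm_real,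
      Real.norm_of_nonneg (Real.rpow_nonneg hr α)]
  nlinarith [Real.rpow_nonneg hr α, norm_nonneg (gfun α θ η r)]

lemma continuousWithinAt_exponent (hα : 0 < α) {θ : ℝ} {η Z : ℝ → ℝ}
    (hη : ContinuousWithinAt η (Ici 0) 0) (hZ : ContinuousWithinAt Z (Ici 0) 0)
    (hsin : ∀ᶠ ν in nhdsWithin 0 (Ici (0 : ℝ)), 0 ≤ Real.sin (θ - η ν))
    (hZ0 : ∀ᶠ ν in nhdsWithin 0 (Ici (0 : ℝ)), 0 ≤ Z ν) :
    ContinuousWithinAt (fun ν => exponent α θ (η ν) (Z ν)) (Ici 0) 0 := by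
  have hscale : ∀ ν, (∫ r in (0 : ℝ)..Z ν, gfun α θ (η ν) r)
      = (Z ν : ℂ) * ∫ x in (0 : ℝ)..1, gfun α θ (η ν) (x * Z ν) := by
    intro ν
    have := intervalIntegral.smul_integral_comp_mul_right (a := 0) (b := 1)
      (gfun α θ (η ν)) (Z ν)
    rw [zero_mul, one_mul] at this
    rw [← this, Complex.real_smul]
  have hmem : (0 : ℝ) ∈ Ici (0 : ℝ) := self_mem_Ici
  unfold exponent
  refine ContinuousWithinAt.sub ?_ (ContinuousWithinAt.mul (ContinuousWithinAt.mul
    continuousWithinAt_const (Real.continuous_sin.continuousAt.comp_continuousWithinAt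
      ((hη.sub continuousWithinAt_const).mul continuousWithinAt_const))) continuousWithinAt_const)
  simp only [hscale]
  refine Complex.continuous_re.continuousAt.comp_continuousWithinAt
    ((Complex.continuous_ofReal.continuousAt.comp_continuousWithinAt hZ).mul ?_)
  refine intervalIntegral.continuousWithinAt_of_dominated_interval
    (bound := fun _ => (Z 0 + 1) ^ α + 1) ?_ ?_ intervalIntegrable_const ?_
  · filter_upwards [hsin, hZ0] with ν h1 h2
    refine ContinuousOn.aestronglyMeasurable ?_ measurableSet_uIoc
    refine (continuousOn_gfun hα θ).comp (f := fun x : ℝ => (η ν, x * Z ν)) (by fun_prop) ?_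
    intro x hx
    rw [uIoc_of_le zero_le_one] at hx
    exact ⟨h1, mul_nonneg hx.1.le h2⟩
  · have h3 : ∀ᶠ ν in nhdsWithin 0 (Ici (0 : ℝ)), Z ν < Z 0 + 1 :=
      hZ.eventually_lt_const (by linarith)
    filter_upwards [hZ0, h3] with ν h2 h3
    refine Filter.Eventually.of_forall fun x hx => ?_
    rw [uIoc_of_le zero_le_one] at hx
    refine (norm_gfun_le α θ _ (mul_nonneg hx.1.le h2)).trans ?_
    have : x * Z ν ≤ Z 0 + 1 := (mul_le_of_le_one_left h2 hx.2).trans h3.le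
    have := Real.rpow_le_rpow (mul_nonneg hx.1.le h2) this hα.le
    linarith
  · refine Filter.Eventually.of_forall fun x hx => ?_
    rw [uIoc_of_le zero_le_one] at hx
    have hc := (continuousOn_gfun hα θ) (η 0, x * Z 0) ⟨hsin.self_of_nhdsWithin hmem,
      mul_nonneg hx.1.le (hZ0.self_of_nhdsWithin hmem)⟩
    have hp : Filter.Tendsto (fun ν => (η ν, x * Z ν)) (nhdsWithin 0 (Ici (0 : ℝ)))
        (nhdsWithin (η 0, x * Z 0) {p : ℝ × ℝ | 0 ≤ Real.sin (θ - p.1) ∧ 0 ≤ p.2}) := by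
      refine tendsto_nhdsWithin_iff.2 ⟨hη.prodMk_nhds (hZ.const_mul x), ?_⟩
      filter_upwards [hsin, hZ0] with ν h1 h2 using ⟨h1, mul_nonneg hx.1.le h2⟩
    have hcomp := Filter.Tendsto.comp (f := fun ν => (η ν, x * Z ν))
      (g := fun p : ℝ × ℝ => gfun α θ p.1 p.2) hc hp
    simpa only [ContinuousWithinAt, Function.comp_def] using hcomp

lemma exists_parameters (hα : 0 < α) {θ t s : ℝ} (ht : 0 < t) (htθ : t ≤ θ) (hθ : θ < Real.pi)
    (hst : s < t) (hexp : exponent α θ t ((Real.sin t / Real.sin θ) ^ (1 / α)) < 0) :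
    ∃ η Z₁ Z₂ δ : ℝ, s < η ∧ η < t ∧ 0 < Z₂ ∧ Z₂ ≤ Z₁ ∧ Real.sin η < Z₁ ^ α * Real.sin θ ∧
      Z₂ ^ α * Real.sin θ < Real.sin η ∧ exponent α θ η Z₁ < -δ ∧
      √(Z₁ ^ α + 1) * (Z₁ - Z₂) < δ := by
  have hsθ : 0 < Real.sin θ := Real.sin_pos_of_pos_of_lt_pi (by linarith) hθ
  have hst0 : 0 < Real.sin t := Real.sin_pos_of_pos_of_lt_pi ht (by linarith)
  set z : ℝ → ℝ := fun ν => (Real.sin (t - ν) / Real.sin θ) ^ (1 / α) with hz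
  have hzc : Continuous z := by
    refine (Real.continuous_rpow_const (by positivity)).comp ?_
    fun_prop
  have hz0 : z 0 = (Real.sin t / Real.sin θ) ^ (1 / α) := by simp [hz]
  have hz0p : 0 < z 0 := by rw [hz0]; positivity
  have hmem : (0 : ℝ) ∈ Ici (0 : ℝ) := self_mem_Ici
  have hηc : Continuous fun ν : ℝ => t - ν := by fun_prop
  have hZc : Continuous fun ν : ℝ => z ν + ν := hzc.add continuous_id
  have e1 : ∀ᶠ ν in nhds (0 : ℝ), 0 < t - ν := by
    refine hηc.continuousAt.eventually_const_lt ?_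
    simpa using ht
  have e2 : ∀ᶠ ν in nhds (0 : ℝ), s < t - ν := by
    refine hηc.continuousAt.eventually_const_lt ?_
    simpa using hst
  have e3 : ∀ᶠ ν in nhds (0 : ℝ), 0 < z ν - ν :=
    (hzc.sub continuous_id).continuousAt.eventually_const_lt (by simpa using hz0p)
  have hsin : ∀ᶠ ν in nhdsWithin 0 (Ici (0 : ℝ)), 0 ≤ Real.sin (θ - (t - ν)) := by
    filter_upwards [e1.filter_mono nhdsWithin_le_nhds, self_mem_nhdsWithin] with ν h1 h2
    have h2' : (0 : ℝ) ≤ ν := h2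
    exact Real.sin_nonneg_of_nonneg_of_le_pi (by linarith) (by linarith)
  have hZ0 : ∀ᶠ ν in nhdsWithin 0 (Ici (0 : ℝ)), 0 ≤ z ν + ν := by
    filter_upwards [e3.filter_mono nhdsWithin_le_nhds, self_mem_nhdsWithin] with ν h1 h2
    have h2' : (0 : ℝ) ≤ ν := h2
    linarith
  have hE := continuousWithinAt_exponent hα hηc.continuousWithinAt hZc.continuousWithinAt hsin hZ0
  set E := exponent α θ t ((Real.sin t / Real.sin θ) ^ (1 / α)) with hEdef
  have e4 : ∀ᶠ ν in nhdsWithin 0 (Ici (0 : ℝ)), exponent α θ (t - ν) (z ν + ν) < -(-E / 2) := by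
    refine hE.eventually_lt_const ?_
    simp only [sub_zero, add_zero, hz0]
    rw [← hEdef]; linarith
  have e5 : ∀ᶠ ν in nhds (0 : ℝ), √((z ν + ν) ^ α + 1) * ((z ν + ν) - (z ν - ν)) < -E / 2 := by
    have : Continuous fun ν : ℝ => √((z ν + ν) ^ α + 1) * ((z ν + ν) - (z ν - ν)) :=
      (Real.continuous_sqrt.comp (((Real.continuous_rpow_const hα.le).comp hZc).add
        continuous_const)).mul (hZc.sub (hzc.sub continuous_id))
    refine this.continuousAt.eventually_lt_const ?_
    simp only [add_zero, sub_zero, sub_self, mul_zero]; linarith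
  have hev := ((((e1.and e2).and e3).and e5).filter_mono
    (nhdsWithin_le_nhds (s := Ioi (0 : ℝ)))).and
    ((e4.filter_mono (nhdsWithin_mono _ Ioi_subset_Ici_self)).and
      (self_mem_nhdsWithin (s := Ioi (0 : ℝ))))
  obtain ⟨ν, ⟨⟨⟨h1, h2⟩, h3⟩, h5⟩, h4, h6⟩ := hev.exists
  have h6' : 0 < ν := h6
  have hzα : z ν ^ α * Real.sin θ = Real.sin (t - ν) := by
    have : 0 < Real.sin (t - ν) := Real.sin_pos_of_pos_of_lt_pi h1 (by linarith)
    rw [hz]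
    beta_reduce
    rw [← Real.rpow_mul (by positivity), one_div_mul_cancel hα.ne', Real.rpow_one]
    field_simp
  refine ⟨t - ν, z ν + ν, z ν - ν, -E / 2, h2, by linarith, h3, by linarith, ?_, ?_, h4, h5⟩
  · rw [← hzα]
    exact mul_lt_mul_of_pos_right (Real.rpow_lt_rpow (by linarith) (by linarith) hα) hsθ
  · rw [← hzα]
    exact mul_lt_mul_of_pos_right (Real.rpow_lt_rpow (by linarith) (by linarith) hα) hsθ

end Anharmonic

namespace Anharmonic

variable {α : ℝ}

lemma dir_add_two_pi (s : ℝ) : dir (s + 2 * Real.pi) = dir s := by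
  rw [show s + 2 * Real.pi = s + Real.pi + Real.pi by ring, dir_add_pi, dir_add_pi, neg_neg]

lemma tendsto_sqrt_one_div_sqrt :
    Filter.Tendsto (fun r : ℝ => √(1 / √r)) Filter.atTop (nhds 0) := by
  have h1 : Filter.Tendsto (fun r : ℝ => 1 / √r) Filter.atTop (nhds 0) := by
    simp only [one_div]
    exact Filter.Tendsto.comp tendsto_inv_atTop_zero Real.tendsto_sqrt_atTop
  simpa [Function.comp_def] using (Real.continuous_sqrt.tendsto 0).comp h1

/-- An entire function which is bounded on a sector and decays outside it vanishes. -/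
lemma eq_zero_of_bounded_sector {G : ℂ → ℂ} (hG : Differentiable ℂ G) {φ₁ φ₃ : ℝ}
    (h31 : φ₃ < φ₁ + 2 * Real.pi) {K : ℝ}
    (hbad : ∃ B, ∀ r φ : ℝ, 0 ≤ r → φ ∈ Icc φ₁ φ₃ → ‖G (r * dir φ)‖ ≤ B)
    (hgood : ∀ r φ : ℝ, 1 ≤ r → φ ∈ Icc φ₃ (φ₁ + 2 * Real.pi) →
      ‖G (r * dir φ)‖ ≤ K * √(1 / √r)) (μ : ℂ) : G μ = 0 := by
  have hK : 0 ≤ K := by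
    have := (norm_nonneg _).trans (hgood 1 φ₃ le_rfl ⟨le_rfl, h31.le⟩)
    simpa using this
  obtain ⟨B₁, hB₁⟩ := hbad
  obtain ⟨B₃, hB₃⟩ := (isCompact_closedBall (0 : ℂ) 1).exists_bound_of_continuousOn
    hG.continuous.continuousOn
  have hb : ∀ μ, ‖G μ‖ ≤ max B₁ (max B₃ K) := by
    intro μ
    obtain ⟨r, φ, hr, hφ, rfl⟩ := exists_polar μ φ₁
    rcases le_total φ φ₃ with h' | h'
    · exact (hB₁ r φ hr ⟨hφ.1, h'⟩).trans (by simp)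
    rcases le_total r 1 with h'' | h''
    · exact (hB₃ _ (by simpa [norm_dir, abs_of_nonneg hr] using h'')).trans (by simp)
    · refine ((hgood r φ h'' ⟨h', hφ.2⟩).trans (mul_le_of_le_one_right hK ?_)).trans (by simp)
      rw [Real.sqrt_le_one, div_le_one (by positivity), Real.one_le_sqrt]
      exact h''
  have hconst : ∀ z w, G z = G w := fun z w =>
    hG.apply_eq_apply_of_bounded (isBounded_iff_forall_norm_le.2 ⟨_, by
      rintro _ ⟨μ, rfl⟩; exact hb μ⟩) z w
  have hlim : Filter.Tendsto (fun r : ℝ => K * √(1 / √r)) Filter.atTop (nhds 0) := by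
    simpa using tendsto_sqrt_one_div_sqrt.const_mul K
  have : ‖G μ‖ ≤ 0 := by
    refine ge_of_tendsto hlim ?_
    filter_upwards [Filter.eventually_ge_atTop 1] with r hr
    rw [hconst μ (r * dir φ₃)]
    exact hgood r φ₃ hr ⟨le_rfl, h31.le⟩
  exact norm_le_zero_iff.1 this

/-- An entire function of order less than `π` over the opening of a sector, which decays outside
the sector, vanishes. -/
lemma eq_zero_of_sector {G : ℂ → ℂ} (hG : Differentiable ℂ G) {p C K₀ : ℝ} (hp : 0 < p)
    (hC : 0 ≤ C) (hgr : ∀ μ, ‖G μ‖ ≤ K₀ * Real.exp (C * (1 + ‖μ‖) ^ p)) {φ₁ φ₃ : ℝ}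
    (h13 : φ₁ < φ₃) (h31 : φ₃ < φ₁ + 2 * Real.pi) (hp13 : p * (φ₃ - φ₁) < Real.pi) {K : ℝ}
    (hgood : ∀ r φ : ℝ, 1 ≤ r → φ ∈ Icc φ₃ (φ₁ + 2 * Real.pi) →
      ‖G (r * dir φ)‖ ≤ K * √(1 / √r)) (μ : ℂ) : G μ = 0 := by
  have hK : 0 ≤ K := by
    have := (norm_nonneg _).trans (hgood 1 φ₃ le_rfl ⟨le_rfl, h31.le⟩)
    simpa using this
  have hgood' : ∀ r φ : ℝ, 1 ≤ r → φ ∈ Icc φ₃ (φ₁ + 2 * Real.pi) → ‖G (r * dir φ)‖ ≤ K :=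
    fun r φ hr hφ => by
      refine (hgood r φ hr hφ).trans (mul_le_of_le_one_right hK ?_)
      rw [Real.sqrt_le_one, div_le_one (by positivity), Real.one_le_sqrt]
      exact hr
  exact eq_zero_of_bounded_sector hG h31 (bounded_sector hG hp hC hgr h13 hp13 (fun r hr => by
    rw [← dir_add_two_pi]; exact hgood' r _ hr ⟨h31.le, le_rfl⟩)
    fun r hr => hgood' r _ hr ⟨le_rfl, h31.le⟩) hgood μ

/-- A version of `eq_zero_of_sector` where a ray splits the sector in two admissible pieces. -/
lemma eq_zero_of_sectors {G : ℂ → ℂ} (hG : Differentiable ℂ G) {p C K₀ : ℝ} (hp : 0 < p)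
    (hC : 0 ≤ C) (hgr : ∀ μ, ‖G μ‖ ≤ K₀ * Real.exp (C * (1 + ‖μ‖) ^ p)) {φ₁ φ₂ φ₃ : ℝ}
    (h12 : φ₁ < φ₂) (h23 : φ₂ < φ₃) (h31 : φ₃ < φ₁ + 2 * Real.pi)
    (hp12 : p * (φ₂ - φ₁) < Real.pi) (hp23 : p * (φ₃ - φ₂) < Real.pi) {K K' : ℝ}
    (hray : ∀ r : ℝ, 1 ≤ r → ‖G (r * dir φ₂)‖ ≤ K')
    (hgood : ∀ r φ : ℝ, 1 ≤ r → φ ∈ Icc φ₃ (φ₁ + 2 * Real.pi) →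
      ‖G (r * dir φ)‖ ≤ K * √(1 / √r)) (μ : ℂ) : G μ = 0 := by
  have hK : 0 ≤ K := by
    have := (norm_nonneg _).trans (hgood 1 φ₃ le_rfl ⟨le_rfl, h31.le⟩)
    simpa using this
  have hgood' : ∀ r φ : ℝ, 1 ≤ r → φ ∈ Icc φ₃ (φ₁ + 2 * Real.pi) →
      ‖G (r * dir φ)‖ ≤ max K K' := fun r φ hr hφ => by
    refine ((hgood r φ hr hφ).trans (mul_le_of_le_one_right hK ?_)).trans (le_max_left _ _)
    rw [Real.sqrt_le_one, div_le_one (by positivity), Real.one_le_sqrt]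
    exact hr
  have hray' : ∀ r : ℝ, 1 ≤ r → ‖G (r * dir φ₂)‖ ≤ max K K' :=
    fun r hr => (hray r hr).trans (le_max_right _ _)
  obtain ⟨B₁, hB₁⟩ := bounded_sector hG hp hC hgr h12 hp12 (K' := max K K') (fun r hr => by
    rw [← dir_add_two_pi]; exact hgood' r _ hr ⟨h31.le, le_rfl⟩) hray'
  obtain ⟨B₂, hB₂⟩ := bounded_sector hG hp hC hgr h23 hp23 (K' := max K K') hray'
    (fun r hr => hgood' r _ hr ⟨le_rfl, h31.le⟩)
  refine eq_zero_of_bounded_sector hG h31 ⟨max B₁ B₂, fun r φ hr hφ => ?_⟩ hgood μ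
  rcases le_total φ φ₂ with h | h
  · exact (hB₁ r φ hr ⟨hφ.1, h⟩).trans (le_max_left _ _)
  · exact (hB₂ r φ hr ⟨h, hφ.2⟩).trans (le_max_right _ _)

namespace Admissible
variable {τ : ℝ} (A : Admissible α τ)
include A

lemma quotient_eq_zero {G : ℂ → ℂ} {f : ℝ → ℂ} (hf : MemLp f 2 (volume.restrict (Ioi 0)))
    (hG : Differentiable ℂ G) (hGp : ∀ μ a b, Sub α μ a b → G μ * a = pairing α τ f a b μ)
    {t : ℝ} (ht : (1 / 2 + 1 / α) * t = Real.pi) (htθ : t ≤ (α + 2) * τ) (hτt : 2 * τ < t)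
    (hθt : (α + 2) * τ < 2 * t)
    (hexp : exponent α ((α + 2) * τ) t
      ((Real.sin t / Real.sin ((α + 2) * τ)) ^ (1 / α)) < 0) (μ : ℂ) : G μ = 0 := by
  have hα := A.α_pos
  have hτ := A.τ_pos
  have hpi := A.lt_pi
  obtain ⟨η, Z₁, Z₂, δ, hs, hηt, hZ₂, hZ, hs1, hs2, he, hδ⟩ := exists_parameters hα
    (s := max (2 * τ) ((α + 2) * τ - t)) (by linarith) htθ hpi
    (max_lt hτt (by linarith)) hexp
  have hη1 := (le_max_left _ _).trans_lt hs
  have hη2 := (le_max_right _ _).trans_lt hs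
  have e : η - 2 * τ + 2 * τ = η := by ring
  obtain ⟨K', hK'⟩ := A.quotient_ray hf hGp (β := η - 2 * τ) (Z₁ := Z₁) (Z₂ := Z₂) (δ := δ)
    (by linarith) (by linarith) (by linarith) hZ₂ hZ (by rwa [e]) (by rwa [e])
    (by rwa [e]) hδ
  set θ := (α + 2) * τ with hθ
  set ε := min ((t - η) / 2) (min ((t - (θ - η)) / 2) ((Real.pi - θ) / 2)) with hε
  have hε0 : 0 < ε := lt_min (by linarith) (lt_min (by linarith) (by linarith))
  have hε1 : ε ≤ (t - η) / 2 := min_le_left _ _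
  have hε2 : ε ≤ (t - (θ - η)) / 2 := (min_le_right _ _).trans (min_le_left _ _)
  have hε3 : ε ≤ (Real.pi - θ) / 2 := (min_le_right _ _).trans (min_le_right _ _)
  obtain ⟨K, hK, hgood⟩ := A.quotient_good hf hGp hε0 (by linarith)
  obtain ⟨C, K₀, hC, hgr⟩ := A.quotient_growth hf hG hGp
  have hp : 0 < 1 / 2 + 1 / α := by positivity
  refine eq_zero_of_sectors hG hp hC hgr (φ₁ := -ε - 2 * τ) (φ₂ := η - 2 * τ)
    (φ₃ := θ + ε - 2 * τ) (K := K) (by linarith) (by linarith) (by linarith) ?_ ?_ hK'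
    (fun r φ hr hφ => ?_) μ
  · rw [← ht]; exact mul_lt_mul_of_pos_left (by linarith) hp
  · rw [← ht]; exact mul_lt_mul_of_pos_left (by linarith) hp
  · have := hgood r (φ + 2 * τ) hr ⟨by linarith [hφ.1], by linarith [hφ.2]⟩
    rwa [add_sub_cancel_right] at this

end Admissible

end Anharmonic

namespace Anharmonic

variable {α : ℝ}

namespace IsSol
variable {q U U1 : ℝ → ℂ} (h : IsSol q U U1) {e : ℂ} {d : ℝ}
include h

/-- Energy estimate up to `T` for a solution vanishing at the origin. -/
lemma integral_sq_le_neg_flux (he : 0 ≤ e.re) (hq : ∀ s, 0 < s → d ≤ (e * q s).re)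
    (h0 : U 0 = 0) {T : ℝ} (hT : 0 ≤ T) :
    d * ∫ s in (0 : ℝ)..T, ‖U s‖ ^ 2 ≤ -flux e U U1 T := by
  have hsub : Icc 0 T ⊆ Ici (0 : ℝ) := fun s hs => hs.1
  have h1 := h.cont1.mono hsub
  have h2 := h.cont.mono hsub
  have h3 := Complex.continuous_re.comp_continuousOn
    ((continuousOn_const (c := e)).mul (h.contq.mono hsub))
  have h4 := h.flux_energy e hT
  have h5 : flux e U U1 0 = 0 := by simp [flux, h0]
  rw [h5, zero_sub] at h4
  rw [← h4, ← intervalIntegral.integral_const_mul]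
  refine intervalIntegral.integral_mono_on_of_le_Ioo hT
    ((continuousOn_const.mul (h2.norm.pow 2)).intervalIntegrable_of_Icc hT)
    ((((continuousOn_const (c := e.re)).mul (h1.norm.pow 2)).add
      (h3.mul (h2.norm.pow 2))).intervalIntegrable_of_Icc hT) fun s hs => ?_
  have := mul_le_mul_of_nonneg_right (hq s hs.1) (sq_nonneg ‖U s‖)
  have := mul_nonneg he (sq_nonneg ‖U1 s‖)
  linarith

/-- Pointwise estimate for a solution vanishing at the origin. -/
lemma norm_sq_le_neg_flux (he : 0 ≤ e.re) (hd : 0 ≤ d) (hq : ∀ s, 0 < s → d ≤ (e * q s).re)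
    (h0 : U 0 = 0) {T : ℝ} (hT : 0 ≤ T) :
    √(e.re * d) * ‖U T‖ ^ 2 ≤ -flux e U U1 T := by
  set k := √(e.re * d) with hk
  have hk2 : k ^ 2 = e.re * d := Real.sq_sqrt (mul_nonneg he hd)
  have hk0 : 0 ≤ k := Real.sqrt_nonneg _
  have hder : ∀ t, 0 < t → HasDerivAt (fun t => k * ‖U t‖ ^ 2 + flux e U U1 t)
      (k * (2 * (U1 t * conj (U t)).re) +
        -(e.re * ‖U1 t‖ ^ 2 + (e * q t).re * ‖U t‖ ^ 2)) t := fun t ht =>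
    ((hasDerivAt_norm_sq (h.deriv t ht)).const_mul k).add (h.hasDerivAt_flux e ht)
  have hanti : AntitoneOn (fun t => k * ‖U t‖ ^ 2 + flux e U U1 t) (Ici 0) := by
    refine antitoneOn_of_deriv_nonpos (convex_Ici 0)
      ((continuousOn_const.mul (h.cont.norm.pow 2)).add (h.continuousOn_flux e)) ?_ ?_
    · intro x hx
      rw [interior_Ici] at hx
      exact (hder x hx).differentiableAt.differentiableWithinAt
    · intro x hx
      rw [interior_Ici] at hx
      rw [(hder x hx).deriv]
      have h1 : (U1 x * conj (U x)).re ≤ ‖U1 x‖ * ‖U x‖ := by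
        refine (Complex.re_le_norm _).trans ?_
        rw [norm_mul, RCLike.norm_conj]
      have h2 := mul_le_mul_of_nonneg_right (hq x hx) (sq_nonneg ‖U x‖)
      have h3 : 2 * k * (‖U1 x‖ * ‖U x‖) ≤ e.re * ‖U1 x‖ ^ 2 + d * ‖U x‖ ^ 2 := by
        have hs : (2 * k * (‖U1 x‖ * ‖U x‖)) ^ 2 ≤ (e.re * ‖U1 x‖ ^ 2 + d * ‖U x‖ ^ 2) ^ 2 := by
          have : (2 * k * (‖U1 x‖ * ‖U x‖)) ^ 2
              = 4 * ((e.re * ‖U1 x‖ ^ 2) * (d * ‖U x‖ ^ 2)) := by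
            rw [mul_pow, mul_pow, hk2]; ring
          rw [this]
          nlinarith [sq_nonneg (e.re * ‖U1 x‖ ^ 2 - d * ‖U x‖ ^ 2)]
        exact le_of_sq_le_sq hs (by positivity)
      have h4 := mul_le_mul_of_nonneg_left h1 hk0
      linarith
  have := hanti (self_mem_Ici) (mem_Ici.2 hT) hT
  simp only [h0, norm_zero, flux, map_zero, mul_zero, Complex.zero_re, neg_zero] at this
  simp only [flux]
  norm_num at this ⊢
  linarith

end IsSol

end Anharmonic

namespace Anharmonic

variable {α : ℝ}

/-- The value at `x` of the solution of the inhomogeneous equation with zero initial data. -/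
noncomputable def volterra (α τ : ℝ) (f : ℝ → ℂ) (x : ℝ) (μ : ℂ) : ℂ :=
  raySol α τ 0 1 μ x * (∫ t in (0 : ℝ)..x, f t * raySol α τ 1 0 μ t) -
    raySol α τ 1 0 μ x * ∫ t in (0 : ℝ)..x, f t * raySol α τ 0 1 μ t

lemma raySol_eq (α τ : ℝ) (a b μ : ℂ) (s : ℝ) :
    raySol α τ a b μ s = a * raySol α τ 1 0 μ s + b * raySol α τ 0 1 μ s := by
  simp [raySol, sol]

lemma raySol1_eq (α τ : ℝ) (a b μ : ℂ) (s : ℝ) :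
    raySol1 α τ a b μ s = a * raySol1 α τ 1 0 μ s + b * raySol1 α τ 0 1 μ s := by
  simp only [raySol1, sol1]; ring

namespace Admissible
variable {τ : ℝ} (A : Admissible α τ)
include A

lemma ray_wronskian (μ : ℂ) {x : ℝ} (hx : 0 ≤ x) :
    raySol α τ 1 0 μ x * raySol1 α τ 0 1 μ x - raySol1 α τ 1 0 μ x * raySol α τ 0 1 μ x
      = dir τ := by
  rw [(A.isSol_zero 1 0 μ).wronskian (A.isSol_zero 0 1 μ) hx]
  simp [A.raySol_zero, A.raySol1_zero]

lemma intervalIntegrable_mul_raySol {f : ℝ → ℂ} (hf : MemLp f 2 (volume.restrict (Ioi 0)))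
    (a b μ : ℂ) {x : ℝ} (hx : 0 ≤ x) :
    IntervalIntegrable (fun t => f t * raySol α τ a b μ t) volume 0 x := by
  rw [intervalIntegrable_iff_integrableOn_Ioc_of_le hx]
  have hf' : MemLp f 2 (volume.restrict (Ioc 0 x)) :=
    hf.mono_measure (Measure.restrict_mono (fun s hs => hs.1) le_rfl)
  have hc := ((A.isSol_zero a b μ).cont.mono (fun s (hs : s ∈ Icc 0 x) => hs.1))
  obtain ⟨B, hB⟩ := isCompact_Icc.exists_bound_of_continuousOn hc
  refine (hf'.integrable (by norm_num)).mul_bdd (c := B) ?_ ?_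
  · exact (hc.mono Ioc_subset_Icc_self).aestronglyMeasurable measurableSet_Ioc
  · exact (ae_restrict_iff' measurableSet_Ioc).2 (ae_of_all _ fun t ht =>
      hB t (Ioc_subset_Icc_self ht))

/-- In a good direction the inhomogeneous solution is represented by the decaying Green
function. -/
lemma volterra_good {e : ℂ} {c : ℝ} (he0 : 0 < e.re) (he1 : ‖e‖ ≤ 1) (hc : 0 < c)
    (hθ : 0 ≤ (e * dir ((α + 2) * τ)).re) {f : ℝ → ℂ}
    (hf : MemLp f 2 (volume.restrict (Ioi 0)))
    (hp : ∀ μ a b, Sub α μ a b → pairing α τ f a b μ = 0) {x : ℝ} (hx : 0 ≤ x) :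
    ∃ K > 0, ∀ μ : ℂ, 1 ≤ ‖μ‖ → c * ‖μ‖ ≤ -(e * (dir (2 * τ) * μ)).re →
      ‖volterra α τ f x μ‖ ≤ K * √(1 / √‖μ‖) := by
  obtain ⟨K, hK, hgood⟩ := A.good_direction he0 he1 hc hθ x
  obtain ⟨_, _, -, -, hpb⟩ := A.pairing_bound hf
  set F := √(∫ t in Ioi (0 : ℝ), ‖f t‖ ^ 2) with hF
  set k := √(e.re * c) with hk
  have hk0 : 0 < k := Real.sqrt_pos.2 (by positivity)
  refine ⟨F * √(1 / (k * c)) + F * √(K / k ^ 2) + 1, by positivity, fun μ hμ hμc => ?_⟩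
  obtain ⟨a, b, h⟩ := exists_sub A.α_pos A.α_lt μ
  have ha : a ≠ 0 := by simpa [A.raySol_zero] using (hgood μ a b h hμ hμc 0 ⟨le_rfl, hx⟩).1
  obtain ⟨-, -, hI, hI1, -⟩ := hgood μ a b h hμ hμc x ⟨hx, le_rfl⟩
  set y := raySol α τ a b μ with hy
  set κ := raySol α τ 0 1 μ x / a with hκ
  set b' := -(y x) / a with hb'
  set ψ := raySol α τ 0 b' μ with hψ
  set w := ψ x with hw
  have hyx : y x = a * raySol α τ 1 0 μ x + b * raySol α τ 0 1 μ x := raySol_eq ..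
  have hψy : ∀ t, ψ t + κ * y t =
      raySol α τ 0 1 μ x * raySol α τ 1 0 μ t - raySol α τ 1 0 μ x * raySol α τ 0 1 μ t := by
    intro t
    rw [hψ, hy, raySol_eq, raySol_eq α τ a b μ t, hb', hκ, hyx]
    field_simp
    ring
  have hψy1 : raySol1 α τ 0 b' μ x = -dir τ - κ * raySol1 α τ a b μ x := by
    rw [← A.ray_wronskian μ hx, raySol1_eq, raySol1_eq α τ a b μ x, hb', hκ, hyx]
    field_simp
    ring
  have hwκ : w = -(κ * y x) := by
    have := hψy x
    linear_combination this
  have hψ0 : ψ 0 = 0 := A.raySol_zero ..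
  -- the flux of the Green function
  have hsol := A.isSol_zero 0 b' μ
  have hdec := A.isDecaying_good he0 he1 hc.le hθ h hμc le_rfl
  simp only [zero_add] at hdec
  have hq := hdec.q_ge
  have hfl := hdec.flux_nonneg hx
  have hflux : -flux e ψ (raySol1 α τ 0 b' μ) x ≤ ‖w‖ := by
    have e1 : e * (raySol1 α τ 0 b' μ x * conj w) =
        -(e * (dir τ * conj w)) + ((‖κ‖ ^ 2 : ℝ) : ℂ) * (e * (raySol1 α τ a b μ x * conj (y x))) := by
      rw [hψy1, hwκ, Complex.ofReal_pow, ← Complex.mul_conj', map_neg, map_mul]; ring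
    have e2 : -flux e ψ (raySol1 α τ 0 b' μ) x =
        (-(e * (dir τ * conj w))).re - ‖κ‖ ^ 2 * flux e y (raySol1 α τ a b μ) x := by
      simp only [flux]
      rw [← hw, e1, Complex.add_re, Complex.re_ofReal_mul]; ring
    rw [e2]
    have e3 : (-(e * (dir τ * conj w))).re ≤ ‖w‖ := by
      refine (Complex.re_le_norm _).trans ?_
      rw [norm_neg, norm_mul, norm_mul, norm_dir, one_mul, RCLike.norm_conj]
      exact mul_le_of_le_one_left (norm_nonneg _) he1
    have : 0 ≤ ‖κ‖ ^ 2 * flux e y (raySol1 α τ a b μ) x := by positivity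
    linarith
  have hkμ : k ≤ √(e.re * (c * ‖μ‖)) := by
    refine Real.sqrt_le_sqrt ?_
    rw [← mul_assoc]
    exact le_mul_of_one_le_right (by positivity) hμ
  have hwk : ‖w‖ ≤ 1 / k := by
    have h1 := (hsol.norm_sq_le_neg_flux he0.le (by positivity) hq hψ0 hx).trans hflux
    have h2 : k * ‖w‖ ^ 2 ≤ ‖w‖ :=
      (mul_le_mul_of_nonneg_right hkμ (sq_nonneg _)).trans h1
    rw [le_div_iff₀ hk0]
    rcases (norm_nonneg w).eq_or_lt with h0 | h0
    · rw [← h0]; simp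
    · refine le_of_mul_le_mul_right (a := ‖w‖) ?_ h0
      linarith [show k * ‖w‖ ^ 2 = ‖w‖ * k * ‖w‖ by ring]
  have hμ0 : 0 < ‖μ‖ := by linarith
  have hsμ : √‖μ‖ ≤ ‖μ‖ := Real.sqrt_le_left (by linarith) |>.2 (by nlinarith)
  have hψI : ∫ s in (0 : ℝ)..x, ‖ψ s‖ ^ 2 ≤ 1 / (k * c) * (1 / √‖μ‖) := by
    have h1 := ((hsol.integral_sq_le_neg_flux he0.le hq hψ0 hx).trans hflux).trans hwk
    have h2 : ∫ s in (0 : ℝ)..x, ‖ψ s‖ ^ 2 ≤ 1 / k / (c * ‖μ‖) := by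
      rw [le_div_iff₀ (by positivity), mul_comm]; exact h1
    refine h2.trans ?_
    rw [div_div, ← mul_assoc, one_div_mul_one_div]
    exact one_div_le_one_div_of_le (by positivity) (by gcongr)
  -- the representation
  have hi : IntegrableOn (fun t => f t * y t) (Ioi 0) := (hpb μ a b h).1
  have hpy : (∫ t in (0 : ℝ)..x, f t * y t) + ∫ t in Ioi x, f t * y t = 0 := by
    rw [intervalIntegral.integral_interval_add_Ioi hi (hi.mono_set (Ioi_subset_Ioi hx))]
    exact hp μ a b h
  have hv : volterra α τ f x μ =
      (∫ t in (0 : ℝ)..x, f t * ψ t) - κ * ∫ t in Ioi x, f t * y t := by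
    have h1 := A.intervalIntegrable_mul_raySol hf 1 0 μ hx
    have h2 := A.intervalIntegrable_mul_raySol hf 0 1 μ hx
    have h3 := A.intervalIntegrable_mul_raySol hf 0 b' μ hx
    have h4 := A.intervalIntegrable_mul_raySol hf a b μ hx
    have e1 : volterra α τ f x μ =
        (∫ t in (0 : ℝ)..x, f t * ψ t) + κ * ∫ t in (0 : ℝ)..x, f t * y t := by
      rw [volterra, ← intervalIntegral.integral_const_mul, ← intervalIntegral.integral_const_mul,
        ← intervalIntegral.integral_const_mul, ← intervalIntegral.integral_sub (h1.const_mul _)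
          (h2.const_mul _), ← intervalIntegral.integral_add h3 (h4.const_mul _)]
      congr 1
      funext t
      linear_combination -(f t) * hψy t
    rw [e1]
    linear_combination κ * hpy
  have hmf : ∀ {s : Set ℝ}, s ⊆ Ioi 0 → MemLp f 2 (volume.restrict s) := fun hs =>
    hf.mono_measure (Measure.restrict_mono hs le_rfl)
  have hF2 : ∀ {s : Set ℝ}, s ⊆ Ioi 0 → √(∫ t in s, ‖f t‖ ^ 2) ≤ F := fun hs =>
    Real.sqrt_le_sqrt (setIntegral_mono_set
      ((memLp_two_iff_integrable_sq_norm hf.1).1 hf) (ae_of_all _ fun _ => sq_nonneg _)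
      (Filter.Eventually.of_forall hs))
  have hs1 : Ioc 0 x ⊆ Ioi (0 : ℝ) := fun s hs => hs.1
  have hs2 : Ioi x ⊆ Ioi (0 : ℝ) := Ioi_subset_Ioi hx
  have hb1 : ‖∫ t in (0 : ℝ)..x, f t * ψ t‖ ≤ F * √(1 / (k * c) * (1 / √‖μ‖)) := by
    rw [intervalIntegral.integral_of_le hx] at hψI ⊢
    have hg : MemLp ψ 2 (volume.restrict (Ioc 0 x)) := by
      refine (memLp_two_iff_integrable_sq_norm
        ((hsol.cont.mono fun s hs => mem_Ici.2 (le_of_lt (mem_Ioc.1 hs).1)).aestronglyMeasurable measurableSet_Ioc)).2 ?_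
      exact ((hsol.cont.mono fun s (hs : s ∈ Icc 0 x) => hs.1).norm.pow 2).integrableOn_Icc.mono_set
        Ioc_subset_Icc_self
    refine (norm_integral_mul_le (hmf hs1) hg).trans ?_
    exact mul_le_mul (hF2 hs1) (Real.sqrt_le_sqrt hψI) (Real.sqrt_nonneg _) (Real.sqrt_nonneg _)
  have hpre : (fun s => x + s) ⁻¹' Ioi x = Ioi 0 := by ext s; simp
  have hmp := measurePreserving_add_left volume x
  have hemb := (MeasurableEquiv.addLeft x).measurableEmbedding
  have hIx : IntegrableOn (fun s => ‖y s‖ ^ 2) (Ioi x) := by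
    rw [← hmp.integrableOn_comp_preimage hemb, hpre]; exact hI
  have hIeq : ∫ s in Ioi x, ‖y s‖ ^ 2 = ∫ s in Ioi (0 : ℝ), ‖y (x + s)‖ ^ 2 := by
    rw [← hmp.setIntegral_preimage_emb hemb, hpre]
  have hb2 : ‖κ * ∫ t in Ioi x, f t * y t‖ ≤ F * √(K / k ^ 2 * (1 / √‖μ‖)) := by
    have hg : MemLp y 2 (volume.restrict (Ioi x)) :=
      (memLp_two_iff_integrable_sq_norm
        ((A.aestronglyMeasurable_raySol a b μ).mono_measure
          (Measure.restrict_mono hs2 le_rfl))).2 hIx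
    have h1 := norm_integral_mul_le (hmf hs2) hg
    rw [norm_mul]
    calc ‖κ‖ * ‖∫ t in Ioi x, f t * y t‖
        ≤ ‖κ‖ * (F * √(K / √‖μ‖ * ‖y x‖ ^ 2)) := by
          refine mul_le_mul_of_nonneg_left (h1.trans ?_) (norm_nonneg _)
          exact mul_le_mul (hF2 hs2) (Real.sqrt_le_sqrt (hIeq ▸ hI1)) (Real.sqrt_nonneg _)
            (Real.sqrt_nonneg _)
      _ = F * √(K * (1 / √‖μ‖) * ‖w‖ ^ 2) := by
          rw [hwκ, norm_neg, norm_mul, mul_pow, Real.sqrt_mul (by positivity),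
            Real.sqrt_mul (by positivity), ← mul_pow, Real.sqrt_sq (by positivity),
            Real.sqrt_sq (by positivity), ← div_eq_mul_one_div]
          ring
      _ ≤ F * √(K / k ^ 2 * (1 / √‖μ‖)) := by
          refine mul_le_mul_of_nonneg_left (Real.sqrt_le_sqrt ?_) (Real.sqrt_nonneg _)
          have : ‖w‖ ^ 2 ≤ 1 / k ^ 2 := by
            rw [← one_div_pow]; exact pow_le_pow_left₀ (norm_nonneg _) hwk 2
          calc _ ≤ K * (1 / √‖μ‖) * (1 / k ^ 2) := by gcongr
            _ = _ := by ring
  rw [hv]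
  refine (norm_sub_le _ _).trans ((add_le_add hb1 hb2).trans ?_)
  rw [Real.sqrt_mul (by positivity), Real.sqrt_mul (by positivity)]
  have := Real.sqrt_nonneg (1 / √‖μ‖)
  linarith

end Admissible

end Anharmonic

namespace Anharmonic

variable {α : ℝ}

namespace Admissible
variable {τ : ℝ} (A : Admissible α τ)
include A

lemma differentiable_integral_raySol {f : ℝ → ℂ} (hf : MemLp f 2 (volume.restrict (Ioi 0)))
    (a b : ℂ) {x : ℝ} (hx : 0 ≤ x) :
    Differentiable ℂ fun μ => ∫ t in (0 : ℝ)..x, f t * raySol α τ a b μ t := by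
  intro μ
  simp only [intervalIntegral.integral_of_le hx]
  have hf' : MemLp f 2 (volume.restrict (Ioc 0 x)) :=
    hf.mono_measure (Measure.restrict_mono (fun s hs => hs.1) le_rfl)
  set M := ‖μ‖ + 1 with hM
  refine (differentiableOn_integral (ν := volume.restrict (Ioc 0 x)) (D := Metric.ball 0 M)
    (h := fun μ t => f t * raySol α τ a b μ t)
    (bound := fun t => ‖f t‖ * ((‖a‖ + ‖b‖) * ((1 + x) * Real.exp (2 * growth α (1 + x) M))))
    Metric.isOpen_ball (fun w hw => hf'.1.mul ((A.aestronglyMeasurable_raySol a b w).mono_measure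
      (Measure.restrict_mono (fun s hs => hs.1) le_rfl))) (ae_of_all _ fun t => ?_) ?_
    ((hf'.integrable (by norm_num)).norm.mul_const _)).differentiableAt
    (Metric.isOpen_ball.mem_nhds (by simp [hM]))
  · simp only [raySol, sol]
    exact (((differentiable_const _).mul
      (differentiable_fund A.α_pos A.α_lt (Or.inl rfl) _)).add ((differentiable_const _).mul
      (differentiable_fund A.α_pos A.α_lt (Or.inr rfl) _))).differentiableOn.const_mul _
  · refine (ae_restrict_iff' measurableSet_Ioc).2 (ae_of_all _ fun t ht w hw => ?_)
    rw [norm_mul]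
    refine mul_le_mul_of_nonneg_left ?_ (norm_nonneg _)
    refine norm_sol_le A.α_pos A.α_lt a b w (by linarith) ?_ (mem_ball_zero_iff.1 hw).le
    rw [norm_mul, norm_dir, mul_one, Complex.norm_real, Real.norm_of_nonneg ht.1.le]
    linarith [ht.2]

lemma differentiable_raySol (a b : ℂ) (x : ℝ) :
    Differentiable ℂ fun μ => raySol α τ a b μ x := by
  simp only [raySol, sol]
  exact (((differentiable_const _).mul
    (differentiable_fund A.α_pos A.α_lt (Or.inl rfl) _)).add ((differentiable_const _).mul
    (differentiable_fund A.α_pos A.α_lt (Or.inr rfl) _)))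

lemma differentiable_volterra {f : ℝ → ℂ} (hf : MemLp f 2 (volume.restrict (Ioi 0)))
    {x : ℝ} (hx : 0 ≤ x) : Differentiable ℂ (volterra α τ f x) :=
  ((A.differentiable_raySol 0 1 x).mul (A.differentiable_integral_raySol hf 1 0 hx)).sub
    ((A.differentiable_raySol 1 0 x).mul (A.differentiable_integral_raySol hf 0 1 hx))

lemma volterra_growth {f : ℝ → ℂ} (hf : MemLp f 2 (volume.restrict (Ioi 0)))
    {x : ℝ} (hx : 0 ≤ x) : ∃ C K : ℝ, 0 ≤ C ∧ ∀ μ,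
      ‖volterra α τ f x μ‖ ≤ K * Real.exp (C * (1 + ‖μ‖) ^ (1 / 2 : ℝ)) := by
  have hf' : MemLp f 2 (volume.restrict (Ioc 0 x)) :=
    hf.mono_measure (Measure.restrict_mono (fun s hs => hs.1) le_rfl)
  have hfi := (hf'.integrable (by norm_num)).norm
  set R := 1 + x with hR
  have hR1 : 1 ≤ R := by linarith
  set N := ∫ t in Ioc 0 x, ‖f t‖ with hN
  have hN0 : 0 ≤ N := integral_nonneg fun _ => norm_nonneg _
  have hα := A.α_pos
  refine ⟨4 * √(5 * (R ^ 2 * R ^ α)), 2 * R ^ 2 * N, by positivity, fun μ => ?_⟩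
  set E := Real.exp (2 * growth α R ‖μ‖) with hE
  have hs : ∀ a b : ℂ, ‖a‖ + ‖b‖ = 1 → ∀ t, 0 ≤ t → t ≤ x → ‖raySol α τ a b μ t‖ ≤ R * E :=
    fun a b hab t ht htx => by
      have := A.norm_raySol_le a b μ ht hR1 (by linarith)
      rwa [hab, one_mul] at this
  have hi : ∀ a b : ℂ, ‖a‖ + ‖b‖ = 1 →
      ‖∫ t in (0 : ℝ)..x, f t * raySol α τ a b μ t‖ ≤ N * (R * E) := fun a b hab => by
    rw [intervalIntegral.integral_of_le hx, hN, ← integral_mul_const]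
    refine norm_integral_le_of_norm_le (hfi.mul_const _) ?_
    refine (ae_restrict_iff' measurableSet_Ioc).2 (ae_of_all _ fun t ht => ?_)
    rw [norm_mul]
    exact mul_le_mul_of_nonneg_left (hs a b hab t ht.1.le ht.2) (norm_nonneg _)
  have e1 : ‖volterra α τ f x μ‖ ≤ 2 * R ^ 2 * N * (E * E) := by
    refine (norm_sub_le _ _).trans ?_
    rw [norm_mul, norm_mul]
    have h1 := mul_le_mul (hs 0 1 (by simp) x hx le_rfl) (hi 1 0 (by simp)) (norm_nonneg _)
      (by positivity)
    have h2 := mul_le_mul (hs 1 0 (by simp) x hx le_rfl) (hi 0 1 (by simp)) (norm_nonneg _)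
      (by positivity)
    linarith
  refine e1.trans (mul_le_mul_of_nonneg_left ?_ (by positivity))
  rw [hE, ← Real.exp_add]
  refine Real.exp_le_exp.2 ?_
  have e2 : growth α R ‖μ‖ ≤ √(5 * (R ^ 2 * R ^ α)) * (1 + ‖μ‖) ^ (1 / 2 : ℝ) := by
    rw [← Real.sqrt_eq_rpow, ← Real.sqrt_mul (by positivity), growth]
    refine Real.sqrt_le_sqrt ?_
    have h1 : 1 ≤ R ^ α := Real.one_le_rpow hR1 hα.le
    have h2 : R ^ α + ‖μ‖ ≤ R ^ α * (1 + ‖μ‖) := by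
      nlinarith [norm_nonneg μ]
    have := mul_le_mul_of_nonneg_left h2 (show 0 ≤ 5 * R ^ 2 by positivity)
    linarith
  linarith

lemma volterra_eq_zero {f : ℝ → ℂ} (hf : MemLp f 2 (volume.restrict (Ioi 0)))
    (hp : ∀ μ a b, Sub α μ a b → pairing α τ f a b μ = 0) {x : ℝ} (hx : 0 ≤ x) (μ : ℂ) :
    volterra α τ f x μ = 0 := by
  have hpi := A.lt_pi
  set θ := (α + 2) * τ with hθ
  have hθ0 : 0 < θ := mul_pos (by linarith [A.α_pos]) A.τ_pos
  set ε := (Real.pi - θ) / 2 with hε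
  have hε0 : 0 < ε := by linarith
  obtain ⟨e₁, e₂, c, hc, he, hcov⟩ := A.exists_good hε0 (by linarith)
  obtain ⟨a1, a2, a3⟩ := he e₁ (Or.inl rfl)
  obtain ⟨b1, b2, b3⟩ := he e₂ (Or.inr rfl)
  obtain ⟨K₁, hK₁, h1⟩ := A.volterra_good a1 a2 hc a3 hf hp hx
  obtain ⟨K₂, hK₂, h2⟩ := A.volterra_good b1 b2 hc b3 hf hp hx
  obtain ⟨C, K₀, hC, hgr⟩ := A.volterra_growth hf hx
  refine eq_zero_of_sector (A.differentiable_volterra hf hx) (p := 1 / 2) (by norm_num) hC hgr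
    (φ₁ := -ε - 2 * τ) (φ₃ := θ + ε - 2 * τ) (K := K₁ + K₂) (by linarith) (by linarith)
    (by linarith) (fun r φ hr hφ => ?_) μ
  have hμn : ‖(r : ℂ) * dir φ‖ = r := by
    rw [norm_mul, norm_dir, mul_one, Complex.norm_real, Real.norm_of_nonneg (by linarith)]
  have hμe : dir (2 * τ) * (r * dir φ) = r * dir (φ + 2 * τ) := by
    rw [mul_left_comm, ← dir_add, add_comm]
  rcases hcov r (φ + 2 * τ) (by linarith) ⟨by linarith [hφ.1], by linarith [hφ.2]⟩ with h3 | h3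
  · have := h1 (r * dir φ) (by rwa [hμn]) (by rwa [hμn, hμe])
    rw [hμn] at this
    exact this.trans (mul_le_mul_of_nonneg_right (by linarith) (Real.sqrt_nonneg _))
  · have := h2 (r * dir φ) (by rwa [hμn]) (by rwa [hμn, hμe])
    rw [hμn] at this
    exact this.trans (mul_le_mul_of_nonneg_right (by linarith) (Real.sqrt_nonneg _))

lemma ae_hasDerivAt_integral_raySol {f : ℝ → ℂ} (hf : MemLp f 2 (volume.restrict (Ioi 0)))
    (a b μ : ℂ) : ∀ᵐ x : ℝ, 0 < x →
      HasDerivAt (fun x => ∫ t in (0 : ℝ)..x, f t * raySol α τ a b μ t)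
        (f x * raySol α τ a b μ x) x := by
  have : ∀ n : ℕ, ∀ᵐ x : ℝ, x ∈ uIcc 0 (n : ℝ) → ∀ c ∈ uIcc 0 (n : ℝ),
      HasDerivAt (fun x => ∫ t in c..x, f t * raySol α τ a b μ t)
        (f x * raySol α τ a b μ x) x := fun n =>
    (A.intervalIntegrable_mul_raySol hf a b μ n.cast_nonneg).ae_hasDerivAt_integral
  filter_upwards [ae_all_iff.2 this] with x hx hx0
  obtain ⟨n, hn⟩ := exists_nat_ge x
  exact hx n (by rw [uIcc_of_le n.cast_nonneg]; exact ⟨hx0.le, hn⟩) 0 left_mem_uIcc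

/-- A square integrable function orthogonal to all subdominant solutions vanishes. -/
lemma ae_eq_zero_of_pairing {f : ℝ → ℂ} (hf : MemLp f 2 (volume.restrict (Ioi 0)))
    (hp : ∀ μ a b, Sub α μ a b → pairing α τ f a b μ = 0) :
    ∀ᵐ x ∂volume.restrict (Ioi (0 : ℝ)), f x = 0 := by
  have hC := A.ae_hasDerivAt_integral_raySol hf 1 0 0
  have hS := A.ae_hasDerivAt_integral_raySol hf 0 1 0
  set C := raySol α τ 1 0 0 with hCd
  set S := raySol α τ 0 1 0 with hSd
  set p : ℝ → ℂ := fun x => ∫ t in (0 : ℝ)..x, f t * C t with hpd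
  set r : ℝ → ℂ := fun x => ∫ t in (0 : ℝ)..x, f t * S t with hrd
  have hv : ∀ x, 0 ≤ x → S x * p x - C x * r x = 0 := fun x hx => A.volterra_eq_zero hf hp hx 0
  have hz : ∀ᵐ x : ℝ, 0 < x → p x = 0 ∧ r x = 0 := by
    filter_upwards [hC, hS] with x h1 h2 hx
    have d1 := ((A.isSol_zero 0 1 0).deriv x hx).mul (h1 hx)
    have d2 := ((A.isSol_zero 1 0 0).deriv x hx).mul (h2 hx)
    have d3 := d1.sub d2
    have d4 : HasDerivAt (S * p - C * r) 0 x := by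
      refine (hasDerivAt_const x (0 : ℂ)).congr_of_eventuallyEq ?_
      filter_upwards [Ioi_mem_nhds hx] with s hs
      exact hv s (le_of_lt hs)
    have e := d3.unique d4
    have hW := A.ray_wronskian 0 hx.le
    have h0 := hv x hx.le
    have hd := dir_ne_zero τ
    simp only [← hCd, ← hSd] at e hW
    constructor
    · have : dir τ * p x = 0 := by
        rw [← hW]
        linear_combination C x * e - raySol1 α τ 1 0 0 x * h0
      exact (mul_eq_zero.1 this).resolve_left hd
    · have : dir τ * r x = 0 := by
        rw [← hW]
        linear_combination S x * e - raySol1 α τ 0 1 0 x * h0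
      exact (mul_eq_zero.1 this).resolve_left hd
  have hcont : ∀ a b : ℂ, ContinuousOn (fun x => ∫ t in (0 : ℝ)..x, f t * raySol α τ a b 0 t)
      (Ioi 0) := fun a b x hx => by
    have hx1 : (0 : ℝ) ≤ x + 1 := by linarith [hx.out]
    have h1 := intervalIntegral.continuousOn_primitive_interval'
      (A.intervalIntegrable_mul_raySol hf a b 0 hx1) left_mem_uIcc
    rw [uIcc_of_le hx1] at h1
    exact (h1.continuousAt (Icc_mem_nhds hx (by linarith))).continuousWithinAt
  have hz' : ∀ᵐ x ∂volume.restrict (Ioi (0 : ℝ)), p x = 0 ∧ r x = 0 :=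
    (ae_restrict_iff' measurableSet_Ioi).2 hz
  have hp0 := Measure.eqOn_open_of_ae_eq (g := fun _ => (0 : ℂ)) (hz'.mono fun x h => h.1)
    isOpen_Ioi (hcont 1 0) continuousOn_const
  have hr0 := Measure.eqOn_open_of_ae_eq (g := fun _ => (0 : ℂ)) (hz'.mono fun x h => h.2)
    isOpen_Ioi (hcont 0 1) continuousOn_const
  rw [ae_restrict_iff' measurableSet_Ioi]
  filter_upwards [hC, hS] with x h1 h2 hx
  have d1 : f x * C x = 0 := (h1 hx).unique ((hasDerivAt_const x (0 : ℂ)).congr_of_eventuallyEq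
    (hp0.eventuallyEq_of_mem (Ioi_mem_nhds hx)))
  have d2 : f x * S x = 0 := (h2 hx).unique ((hasDerivAt_const x (0 : ℂ)).congr_of_eventuallyEq
    (hr0.eventuallyEq_of_mem (Ioi_mem_nhds hx)))
  have hW := A.ray_wronskian 0 (le_of_lt hx)
  have : f x * dir τ = 0 := by
    rw [← hW]
    linear_combination raySol1 α τ 0 1 0 x * d1 - raySol1 α τ 1 0 0 x * d2
  exact (mul_eq_zero.1 this).resolve_right (dir_ne_zero τ)

end Admissible

end Anharmonic

namespace Anharmonic

variable {α : ℝ}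

lemma quasiMeasurePreserving_mul_left {k : ℝ} (hk : 0 < k) :
    Measure.QuasiMeasurePreserving (fun x : ℝ => k * x) (volume.restrict (Ioi 0))
      (volume.restrict (Ioi 0)) := by
  refine Measure.QuasiMeasurePreserving.restrict ⟨measurable_const_mul k, ?_⟩
    fun x hx => mul_pos hk hx
  rw [Real.map_volume_mul_left hk.ne']
  exact Measure.smul_absolutelyContinuous

namespace Admissible
variable {τ : ℝ} (A : Admissible α τ)
include A

lemma integrableOn_sq_raySol {μ a b : ℂ} (h : Sub α μ a b) :
    IntegrableOn (fun s => ‖raySol α τ a b μ s‖ ^ 2) (Ioi 0) := by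
  obtain ⟨C, k, hC, hk, hB⟩ := A.exists_bound
  set N := (‖a‖ + ‖b‖) * Real.exp (C * (1 + ‖μ‖) ^ (1 / 2 + 1 / α)) with hN
  have hi : IntegrableOn (fun x => N ^ 2 * Real.exp (-(2 * k) * x)) (Ioi 0) :=
    (integrableOn_exp_mul_Ioi (by linarith) 0).const_mul _
  refine hi.mono' (((A.aestronglyMeasurable_raySol a b μ).norm).pow 2) ?_
  refine (ae_restrict_iff' measurableSet_Ioi).2 (ae_of_all _ fun x hx => ?_)
  rw [Real.norm_of_nonneg (sq_nonneg _)]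
  refine (pow_le_pow_left₀ (norm_nonneg _) (hB μ a b h x (le_of_lt hx)) 2).trans (le_of_eq ?_)
  rw [sub_eq_add_neg, Real.exp_add, ← mul_assoc, ← hN, mul_pow, ← Real.exp_nat_mul]
  congr 2
  push_cast
  ring

/-- Dilated subdominant solutions on the ray which vanish at the origin are eigenfunctions. -/
lemma isEigenfunction_raySol {μ b : ℂ} (h : Sub α μ 0 b) {k : ℝ} (hk : 0 < k) :
    IsEigenfunction α (((k ^ (α + 2) : ℝ) : ℂ) * dir ((α + 2) * τ)) (k ^ 2 * (dir (2 * τ) * μ))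
      fun x => raySol α τ 0 b μ (k * x) := by
  have hs := A.isSol_zero 0 b μ
  have hb : b ≠ 0 := h.1.resolve_left (by simp)
  refine ⟨?_, ?_, ?_, ⟨fun x => k * raySol1 α τ 0 b μ (k * x), ?_, ?_⟩, ?_⟩
  · exact hs.cont.comp (by fun_prop) fun x hx => mul_nonneg hk.le hx
  · simp [A.raySol_zero]
  · by_contra! hz
    have hz' : ∀ s, 0 ≤ s → raySol α τ 0 b μ s = 0 := fun s hs => by
      have := hz (s / k) (by positivity)
      rwa [mul_div_cancel₀ s hk.ne'] at this
    have hd := hs.deriv 1 one_pos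
    have hd0 : HasDerivAt (raySol α τ 0 b μ) 0 1 :=
      (hasDerivAt_const (1 : ℝ) (0 : ℂ)).congr_of_eventuallyEq (by
        filter_upwards [Ioi_mem_nhds one_pos] with s hs using hz' s (le_of_lt hs))
    exact hb (A.eq_zero_of_data zero_le_one (hz' 1 zero_le_one) (hd.unique hd0)).2
  · intro x hx
    have := (hs.deriv (k * x) (mul_pos hk hx)).scomp x ((hasDerivAt_id x).const_mul k)
    simpa [Function.comp_def] using this
  · intro x hx
    have h1 := ((hs.deriv1 (k * x) (mul_pos hk hx)).scomp x
      ((hasDerivAt_id x).const_mul k)).const_mul (k : ℂ)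
    have hx0 : 0 < x := hx
    convert! h1 using 1
    rw [A.pot_eq μ (by positivity), Real.mul_rpow hk.le hx0.le, Real.rpow_add hk]
    simp only [mul_one, Complex.real_smul, Complex.ofReal_mul]
    rw [show ((k ^ (2 : ℝ) : ℝ) : ℂ) = (k : ℂ) ^ 2 by rw [Real.rpow_two]; push_cast; rfl]
    ring
  · have := (integrableOn_Ioi_comp_mul_left_iff (fun s => ‖raySol α τ 0 b μ s‖ ^ 2) 0 hk).2
    rw [mul_zero] at this
    exact this (A.integrableOn_sq_raySol h)

/-- A function orthogonal to all Dirichlet eigenfunctions on the ray vanishes. -/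
lemma ae_eq_zero_of_eigen {t : ℝ} (ht : (1 / 2 + 1 / α) * t = Real.pi) (htθ : t ≤ (α + 2) * τ)
    (hτt : 2 * τ < t) (hθt : (α + 2) * τ < 2 * t)
    (hexp : exponent α ((α + 2) * τ) t
      ((Real.sin t / Real.sin ((α + 2) * τ)) ^ (1 / α)) < 0)
    {f : ℝ → ℂ} (hf : MemLp f 2 (volume.restrict (Ioi 0)))
    (h0 : ∀ μ b : ℂ, Sub α μ 0 b → pairing α τ f 0 b μ = 0) :
    ∀ᵐ x ∂volume.restrict (Ioi (0 : ℝ)), f x = 0 := by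
  obtain ⟨G, hG, hGp⟩ := A.exists_quotient hf h0
  refine A.ae_eq_zero_of_pairing hf fun μ a b h => ?_
  rw [← hGp μ a b h, A.quotient_eq_zero hf hG hGp ht htθ hτt hθt hexp, zero_mul]

lemma ae_eq_zero_of_dilated {t : ℝ} (ht : (1 / 2 + 1 / α) * t = Real.pi)
    (htθ : t ≤ (α + 2) * τ) (hτt : 2 * τ < t) (hθt : (α + 2) * τ < 2 * t)
    (hexp : exponent α ((α + 2) * τ) t
      ((Real.sin t / Real.sin ((α + 2) * τ)) ^ (1 / α)) < 0) {k : ℝ} (hk : 0 < k)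
    {f : ℝ → ℂ} (hf : MemLp f 2 (volume.restrict (Ioi 0)))
    (h0 : ∀ lam y, IsEigenfunction α (((k ^ (α + 2) : ℝ) : ℂ) * dir ((α + 2) * τ)) lam y →
      ∫ x in Ioi (0 : ℝ), f x * y x = 0) :
    ∀ᵐ x ∂volume.restrict (Ioi (0 : ℝ)), f x = 0 := by
  have hk' : 0 < k⁻¹ := inv_pos.2 hk
  have hm := hf.1.comp_quasiMeasurePreserving (quasiMeasurePreserving_mul_left hk')
  have hg : MemLp (fun x => f (k⁻¹ * x)) 2 (volume.restrict (Ioi 0)) := by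
    refine (memLp_two_iff_integrable_sq_norm hm).2 ?_
    have := (integrableOn_Ioi_comp_mul_left_iff (fun s => ‖f s‖ ^ 2) 0 hk').2
    rw [mul_zero] at this
    exact this ((memLp_two_iff_integrable_sq_norm hf.1).1 hf)
  have := A.ae_eq_zero_of_eigen ht htθ hτt hθt hexp hg fun μ b h => by
    have h1 := h0 _ _ (A.isEigenfunction_raySol h hk)
    have h2 := integral_comp_mul_left_Ioi
      (fun x => f (k⁻¹ * x) * raySol α τ 0 b μ x) 0 hk
    simp only [mul_zero, inv_mul_cancel_left₀ hk.ne', h1] at h2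
    exact (smul_eq_zero.1 h2.symm).resolve_left hk'.ne'
  have h3 := (quasiMeasurePreserving_mul_left hk).ae this
  simpa only [inv_mul_cancel_left₀ hk.ne'] using h3

end Admissible

lemma isEigenfunction_conj {c lam : ℂ} {y : ℝ → ℂ} (h : IsEigenfunction α c lam y) :
    IsEigenfunction α (conj c) (conj lam) fun x => conj (y x) := by
  obtain ⟨h1, h2, ⟨x, hx, hyx⟩, ⟨y', h3, h4⟩, h5⟩ := h
  refine ⟨Complex.continuous_conj.comp_continuousOn h1, by simp [h2], ⟨x, hx, by simpa using hyx⟩,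
    ⟨fun x => conj (y' x), fun x hx => hasDerivAt_conj (h3 x hx), fun x hx => ?_⟩, by simpa using h5⟩
  convert! hasDerivAt_conj (h4 x hx) using 1
  simp

/-- The eigenfunctions are complete if only the zero function is orthogonal to them. -/
lemma eigenfunctionsComplete_of_forall {c : ℂ}
    (H : ∀ f : ℝ → ℂ, MemLp f 2 (volume.restrict (Ioi (0 : ℝ))) →
      (∀ lam y, IsEigenfunction α c lam y → ∫ x in Ioi (0 : ℝ), f x * y x = 0) →
      ∀ᵐ x ∂volume.restrict (Ioi (0 : ℝ)), f x = 0) : EigenfunctionsComplete α c := by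
  rw [EigenfunctionsComplete, ← dense_iff_closure_eq,
    Submodule.dense_iff_topologicalClosure_eq_top, Submodule.topologicalClosure_eq_top_iff,
    Submodule.eq_bot_iff]
  intro h hh
  rw [Submodule.mem_orthogonal] at hh
  have := H (fun x => conj (h x)) (Lp.memLp h).star fun lam y hy => by
    have hm : AEStronglyMeasurable y (volume.restrict (Ioi (0 : ℝ))) :=
      (hy.1.mono Ioi_subset_Ici_self).aestronglyMeasurable measurableSet_Ioi
    have hL : MemLp y 2 (volume.restrict (Ioi (0 : ℝ))) :=
      (memLp_two_iff_integrable_sq_norm hm).2 hy.2.2.2.2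
    have h1 := hh (hL.toLp y) (Submodule.subset_span ⟨lam, y, hy, hL.coeFn_toLp⟩)
    rw [L2.inner_def] at h1
    have h2 : ∫ x in Ioi (0 : ℝ), conj (conj (h x) * y x) = 0 := by
      rw [← h1]
      refine integral_congr_ae ?_
      filter_upwards [hL.coeFn_toLp] with x hx
      rw [hx, RCLike.inner_apply, map_mul, Complex.conj_conj]
    rw [integral_conj] at h2
    simpa using h2
  rw [Lp.eq_zero_iff_ae_eq_zero]
  filter_upwards [this] with x hx
  simpa using hx

lemma eigenfunctionsComplete_conj_of_forall {c : ℂ}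
    (H : ∀ f : ℝ → ℂ, MemLp f 2 (volume.restrict (Ioi (0 : ℝ))) →
      (∀ lam y, IsEigenfunction α c lam y → ∫ x in Ioi (0 : ℝ), f x * y x = 0) →
      ∀ᵐ x ∂volume.restrict (Ioi (0 : ℝ)), f x = 0) : EigenfunctionsComplete α (conj c) := by
  refine eigenfunctionsComplete_of_forall fun f hf h => ?_
  have := H (fun x => conj (f x)) hf.star fun lam y hy => by
    have h1 := h _ _ (isEigenfunction_conj hy)
    have h2 : ∫ x in Ioi (0 : ℝ), conj (conj (f x) * y x) = 0 := by
      simpa only [map_mul, Complex.conj_conj] using h1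
    rw [integral_conj] at h2
    simpa using h2
  filter_upwards [this] with x hx
  simpa using hx

end Anharmonic

/-- if `α ∈ (0,2)`, `c ≠ 0`, `|arg c| ∈ [t₀(α), min(π, πα))` and
`ρ_α(|arg c|) < 0`, then the system of eigenfunctions of `𝓛_{c,α}` is complete. -/
theorem stmt15 (α : ℝ) (hα0 : 0 < α) (hα2 : α < 2) (ρ : ℝ → ℝ)
    (hρ : ∀ θ ∈ Set.Ico (t0 α) (min Real.pi (Real.pi * α)), ∀ g : ℝ → ℂ,
      ContinuousOn g (Set.Icc 0 (Z0 α θ)) →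
      (∀ t ∈ Set.Icc (0 : ℝ) (Z0 α θ),
        g t ^ 2 = Complex.exp (Complex.I * (θ : ℂ)) * ((t ^ α : ℝ) : ℂ)
          - Complex.exp (Complex.I * ((t0 α : ℝ) : ℂ))) →
      g 0 = -Complex.I * Complex.exp (Complex.I * ((t0 α / 2 : ℝ) : ℂ)) →
      ρ θ = (∫ t in (0 : ℝ)..(Z0 α θ), g t).re
        - 2 * Real.sin (θ / α) * ∫ ξ in (0 : ℝ)..1, Real.sqrt (1 - ξ ^ α))
    (c : ℂ) (hc : c ≠ 0)
    (harg : |c.arg| ∈ Set.Ico (t0 α) (min Real.pi (Real.pi * α)))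
    (hneg : ρ |c.arg| < 0) :
    EigenfunctionsComplete α c := by
  have hpi := Real.pi_pos
  set θ := |c.arg| with hθ
  have hα2' : 0 < α + 2 := by linarith
  have ht0 : 0 < t0 α := by unfold t0; positivity
  have hθt := harg.1
  have hθπ : θ < Real.pi := harg.2.trans_le (min_le_left _ _)
  have hθα : θ < Real.pi * α := harg.2.trans_le (min_le_right _ _)
  have hτ : (α + 2) * (θ / (α + 2)) = θ := mul_div_cancel₀ θ hα2'.ne'
  have A : Anharmonic.Admissible α (θ / (α + 2)) :=
    ⟨hα0, hα2, div_pos (ht0.trans_le hθt) hα2', by rwa [hτ]⟩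
  have hdir : ∀ s : ℝ, Complex.exp (Complex.I * (s : ℂ)) = Anharmonic.dir s := fun s => by
    rw [Anharmonic.dir, mul_comm]
  have hexp : Anharmonic.exponent α θ (t0 α) (Z0 α θ) < 0 := by
    rw [hρ θ harg (Anharmonic.gfun α θ (t0 α)) ?_ ?_ ?_] at hneg
    · convert hneg using 4
      rw [Anharmonic.exponent, ← Real.sin_pi_sub (θ / α)]
      congr 4
      unfold t0
      field_simp
    · refine (Anharmonic.continuousOn_gfun hα0 θ).comp (f := fun r => (t0 α, r))
        (by fun_prop) fun r hr => ?_
      exact ⟨Real.sin_nonneg_of_nonneg_of_le_pi (by simpa using hθt) (by simp; linarith), hr.1⟩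
    · intro r _
      rw [Anharmonic.gfun_sq, hdir, hdir, mul_comm]
    · rw [Anharmonic.gfun_zero hα0, hdir]
  set k := ‖c‖ ^ (1 / (α + 2)) with hk
  have hcn : 0 < ‖c‖ := norm_pos_iff.2 hc
  have hk0 : 0 < k := Real.rpow_pos_of_pos hcn _
  have hkc : k ^ (α + 2) = ‖c‖ := by
    rw [hk, ← Real.rpow_mul hcn.le, one_div_mul_cancel hα2'.ne', Real.rpow_one]
  have H := fun (f : ℝ → ℂ) (hf : MemLp f 2 (volume.restrict (Ioi (0 : ℝ)))) =>
    A.ae_eq_zero_of_dilated (t := t0 α) (by unfold t0; field_simp) (by rwa [hτ])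
    (by
      unfold t0
      rw [← mul_div_assoc, div_lt_div_iff_of_pos_right hα2']
      linarith)
    (by
      rw [hτ]
      unfold t0
      rw [← mul_div_assoc, lt_div_iff₀ hα2']
      nlinarith)
    (by rw [hτ]; exact hexp) hk0 (f := f) hf
  rw [hkc, hτ] at H
  have hcarg : (‖c‖ : ℂ) * Anharmonic.dir c.arg = c := Complex.norm_mul_exp_arg_mul_I c
  rcases abs_choice c.arg with h | h
  · rw [hθ, h, hcarg] at H
    exact Anharmonic.eigenfunctionsComplete_of_forall H
  · have hconj : (‖c‖ : ℂ) * Anharmonic.dir θ = conj c := by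
      conv_rhs => rw [← hcarg]
      rw [hθ, h, map_mul, Complex.conj_ofReal, Anharmonic.dir, Anharmonic.dir, ← Complex.exp_conj]
      simp
    rw [hconj] at H
    have := Anharmonic.eigenfunctionsComplete_conj_of_forall H
    rwa [Complex.conj_conj] at this
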